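/- Let θ be a formula in the first-order language of rings with free variables x₁,…,x_n, y₁,…,y_m. Then there exist a finite index set I and, for each i ∈ I, a formula θᵢ in the variables y₁,…,y_m, positive rational numbers μᵢ and εᵢ, and a natural number rᵢ ≤ n, such that: for every finite field K with q elements and every tuple b ∈ K^m, there is a unique i ∈ I with K ⊨ θᵢ(b), and for this i the number N_q(b) of tuples a ∈ K^n with K ⊨ θ(a,b) is either zero or satisfies |N_q(b) − μᵢ·q^{rᵢ}| ≤ εᵢ·q^{rᵢ}/√q (as real numbers). -/

import Mathlib

set_option linter.unusedSectionVars false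
section
open PowerSeries Polynomial IntermediateField
open Fintype (card)

namespace CDM

section den
variable {L : Type} [Field L]

/-- power series with coefficients in a subring -/
def psub (O : Subring L) : Subring (PowerSeries L) where
  carrier := {A | ∀ i, PowerSeries.coeff i A ∈ O}
  mul_mem' := by
    intro a b ha hb i
    rw [PowerSeries.coeff_mul]
    exact Subring.sum_mem _ fun p _ => O.mul_mem (ha _) (hb _)
  one_mem' := by
    intro i; rw [PowerSeries.coeff_one]; split_ifs
    · exact O.one_mem
    · exact O.zero_mem
  add_mem' := by
    intro a b ha hb i; rw [map_add]; exact O.add_mem (ha i) (hb i)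
  zero_mem' := by intro i; rw [map_zero]; exact O.zero_mem
  neg_mem' := by intro a ha i; rw [map_neg]; exact O.neg_mem (ha i)

theorem C_mem_psub {O : Subring L} {a : L} (h : a ∈ O) : PowerSeries.C a ∈ psub O := by
  intro i; rw [PowerSeries.coeff_C]; split_ifs
  · exact h
  · exact O.zero_mem

theorem X_mem_psub {O : Subring L} : (PowerSeries.X : PowerSeries L) ∈ psub O := by
  intro i; rw [PowerSeries.coeff_X]; split_ifs
  · exact O.one_mem
  · exact O.zero_mem

theorem exists_X_mul {O : Subring L} {A : PowerSeries L} (hA : A ∈ psub O)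
    (h0 : PowerSeries.constantCoeff A = 0) : ∃ e ∈ psub O, A = PowerSeries.X * e := by
  obtain ⟨e, he⟩ := PowerSeries.X_dvd_iff.2 h0
  refine ⟨e, fun i => ?_, he⟩
  have := hA (i+1)
  rwa [he, coeff_succ_X_mul] at this

theorem rescale_mem_psub {O : Subring L} {A : PowerSeries L} (hA : A ∈ psub O) {d : L}
    (hd : d ∈ O) : rescale d A ∈ psub O := by
  intro i; rw [coeff_rescale]; exact O.mul_mem (O.pow_mem hd i) (hA i)

theorem aeval_mem_sub {R : Type} [CommRing R] (S : Subring R) (p : Polynomial S) {a : R}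
    (ha : a ∈ S) : aeval a p ∈ S := by
  have : aeval a p = ((p.eval ⟨a, ha⟩ : S) : R) := by
    have := aeval_algebraMap_apply R (⟨a, ha⟩ : S) p
    exact this
  rw [this]; exact SetLike.coe_mem _

theorem fixpoint {O : Subring L} {c0 c1 w : PowerSeries L} (h0 : c0 ∈ psub O) (h1 : c1 ∈ psub O)
    (h : Polynomial (psub O)) (hw : (PowerSeries.X : PowerSeries L) ∣ w)
    (hc : (PowerSeries.X : PowerSeries L) ∣ c1)
    (eq : w = c0 + c1 * w + w ^ 2 * aeval w h) : w ∈ psub O := by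
  have key : ∀ N : ℕ, ∃ w' ∈ psub O, (PowerSeries.X : PowerSeries L) ^ (N+1) ∣ w - w' := by
    intro N
    induction N with
    | zero => exact ⟨0, (psub O).zero_mem, by simpa using hw⟩
    | succ N ih =>
      obtain ⟨w', hw', r, hr⟩ := ih
      refine ⟨c0 + c1 * w' + w' ^ 2 * aeval w' h, ?_, ?_⟩
      · exact add_mem (add_mem h0 (mul_mem h1 hw')) (mul_mem (pow_mem hw' 2) (aeval_mem_sub _ _ hw'))
      · have hxw' : (PowerSeries.X : PowerSeries L) ∣ w' := by
          have : w' = w - PowerSeries.X ^ (N+1) * r := by rw [← hr]; ring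
          rw [this]
          exact dvd_sub hw (Dvd.dvd.mul_right (dvd_pow_self _ (by omega)) _)
        have hev : w - w' ∣ aeval w h - aeval w' h := by
          have := sub_dvd_eval_sub w w' (h.map (algebraMap (psub O) (PowerSeries L)))
          simpa [eval_map_algebraMap] using this
        obtain ⟨s, hs⟩ := hev
        obtain ⟨a, ha⟩ := hxw'
        obtain ⟨b, hb⟩ := hw
        obtain ⟨c, hc⟩ := hc
        have e1 : w - (c0 + c1 * w' + w' ^ 2 * aeval w' h) =
          c1 * (w - w') + (w - w') * (w + w') * aeval w h + w'^2 * (aeval w h - aeval w' h) := by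
          nth_rewrite 1 [eq]; ring
        rw [e1, hs, hr]
        refine dvd_add (dvd_add ?_ ?_) ?_
        · rw [hc]; exact ⟨c * r, by ring⟩
        · have : w + w' = PowerSeries.X * (a + b) := by rw [mul_add, ← ha, ← hb]; ring
          rw [this]; exact ⟨r * (a+b) * aeval w h, by ring⟩
        · nth_rewrite 1 [ha]; exact ⟨PowerSeries.X * a^2 * r * s, by ring⟩
  intro i
  obtain ⟨w', hw', hd⟩ := key i
  have := PowerSeries.X_pow_dvd_iff.1 hd i (by omega)
  rw [map_sub, sub_eq_zero] at this
  rw [this]; exact hw' i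

theorem den {O : Subring L} (M : Polynomial (psub O)) (A : PowerSeries L) (hA : aeval A M = 0)
    (v d : L) (hv : v ∈ O) (hAv : PowerSeries.constantCoeff A = v)
    (hd : PowerSeries.constantCoeff (aeval (PowerSeries.C v) (derivative M)) = d) (hd0 : d ≠ 0) :
    rescale (d^2) A ∈ psub O := by
  have hCv : PowerSeries.C v ∈ psub O := C_mem_psub hv
  have hdO : d ∈ O := by
    rw [← hd, ← coeff_zero_eq_constantCoeff_apply]
    exact aeval_mem_sub (psub O) (derivative M) hCv 0
  -- values at C v
  have hM0 : PowerSeries.constantCoeff (aeval (PowerSeries.C v) M) = 0 := by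
    have h2 : A - PowerSeries.C v ∣ aeval A M - aeval (PowerSeries.C v) M := by
      have := sub_dvd_eval_sub A (PowerSeries.C v)
        (M.map (algebraMap (psub O) (PowerSeries L)))
      simpa [eval_map_algebraMap] using this
    obtain ⟨s, hs⟩ := h2
    have := congrArg PowerSeries.constantCoeff hs
    rw [hA] at this
    simpa [hAv] using this
  obtain ⟨e0, he0, hE0⟩ := exists_X_mul (aeval_mem_sub (psub O) M hCv) hM0
  obtain ⟨e1, he1, hE1⟩ := exists_X_mul (A := aeval (PowerSeries.C v) (derivative M) - PowerSeries.C d)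
    (sub_mem (aeval_mem_sub (psub O) (derivative M) hCv) (C_mem_psub hdO)) (by simp [hd])
  let ρ : psub O →+* psub O := ((rescale (d^2)).comp (psub O).subtype).codRestrict (psub O)
    (fun x => rescale_mem_psub x.2 (O.pow_mem hdO 2))
  have hρ : ∀ (p : Polynomial (psub O)) (a : PowerSeries L),
      rescale (d^2) (aeval a p) = aeval (rescale (d^2) a) (p.map ρ) := by
    intro p a
    rw [aeval_def, hom_eval₂, aeval_def, eval₂_map]
    rfl
  set B := rescale (d^2) A with hB
  set N : Polynomial (psub O) := taylor ⟨_, hCv⟩ (M.map ρ) with hN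
  have hresC : rescale (d^2) (PowerSeries.C v) = PowerSeries.C v := by
    ext i; rw [coeff_rescale, PowerSeries.coeff_C]; split_ifs with h
    · simp [h]
    · simp
  have hNT : aeval (B - PowerSeries.C v) N = 0 := by
    rw [hN, taylor_apply, aeval_comp]
    have : aeval (B - PowerSeries.C v) (Polynomial.X + Polynomial.C (⟨_, hCv⟩ : psub O)) = B := by
      rw [map_add, aeval_X, aeval_C]
      exact sub_add_cancel _ _
    rw [this, hB, ← hρ, hA, map_zero]
  have hn0 : ((N.coeff 0 : psub O) : PowerSeries L) = PowerSeries.C (d^2) * (PowerSeries.X * rescale (d^2) e0) := by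
    rw [hN, taylor_coeff_zero]
    have : (((M.map ρ).eval ⟨_, hCv⟩ : psub O) : PowerSeries L) = aeval (PowerSeries.C v) (M.map ρ) := by
      have := aeval_algebraMap_apply (PowerSeries L) (⟨_, hCv⟩ : psub O) (M.map ρ)
      exact this.symm
    rw [this]
    nth_rewrite 1 [← hresC]
    rw [← hρ, hE0, map_mul, rescale_X]
    ring
  have hn1 : ((N.coeff 1 : psub O) : PowerSeries L) = PowerSeries.C d + PowerSeries.C (d^2) * (PowerSeries.X * rescale (d^2) e1) := by
    rw [hN, taylor_coeff_one, derivative_map]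
    have : (((M.derivative.map ρ).eval ⟨_, hCv⟩ : psub O) : PowerSeries L) = aeval (PowerSeries.C v) (M.derivative.map ρ) := by
      have := aeval_algebraMap_apply (PowerSeries L) (⟨_, hCv⟩ : psub O) (M.derivative.map ρ)
      exact this.symm
    rw [this]
    nth_rewrite 1 [← hresC]
    rw [← hρ]
    have h3 : aeval (PowerSeries.C v) (derivative M) = PowerSeries.C d + PowerSeries.X * e1 := by
      rw [← hE1]; ring
    have hresD : rescale (d^2) (PowerSeries.C d) = PowerSeries.C d := by
      ext i; rw [coeff_rescale, PowerSeries.coeff_C]; split_ifs with h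
      · simp [h]
      · simp
    rw [h3, map_add, map_mul, rescale_X, hresD]
    ring
  set h := N.divX.divX with hh
  have hNexp : N = Polynomial.C (N.coeff 0) + Polynomial.X * (Polynomial.C (N.coeff 1) + Polynomial.X * h) := by
    have a1 := X_mul_divX_add N
    have a2 := X_mul_divX_add N.divX
    rw [coeff_divX] at a2
    rw [hh, add_comm (Polynomial.C (N.coeff 1)), a2, add_comm, a1]
  let dS : psub O := ⟨PowerSeries.C d, C_mem_psub hdO⟩
  set W := PowerSeries.C d⁻¹ * (B - PowerSeries.C v) with hW
  have hCd : PowerSeries.C d * PowerSeries.C d⁻¹ = (1 : PowerSeries L) := by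
    rw [← map_mul, mul_inv_cancel₀ hd0, map_one]
  have hBW : B - PowerSeries.C v = PowerSeries.C d * W := by
    rw [hW, ← mul_assoc, hCd, one_mul]
  have hB0 : PowerSeries.constantCoeff (B - PowerSeries.C v) = 0 := by
    rw [map_sub, hB, ← coeff_zero_eq_constantCoeff_apply, coeff_rescale]
    simp [hAv]
  have hWmem : W ∈ psub O := by
    refine fixpoint (c0 := -(PowerSeries.X * rescale (d^2) e0))
      (c1 := -(PowerSeries.C d * (PowerSeries.X * rescale (d^2) e1)))
      (h := -(h.comp (Polynomial.C dS * Polynomial.X))) ?_ ?_ ?_ ?_ ?_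
    · exact neg_mem (mul_mem X_mem_psub (rescale_mem_psub he0 (O.pow_mem hdO 2)))
    · exact neg_mem (mul_mem (C_mem_psub hdO) (mul_mem X_mem_psub (rescale_mem_psub he1 (O.pow_mem hdO 2))))
    · rw [PowerSeries.X_dvd_iff, hW, map_mul, hB0, mul_zero]
    · rw [dvd_neg]; exact ⟨PowerSeries.C d * rescale (d^2) e1, by ring⟩
    · have h4 : aeval W (-(h.comp (Polynomial.C dS * Polynomial.X))) = - aeval (PowerSeries.C d * W) h := by
        rw [map_neg, aeval_comp, map_mul, aeval_X, aeval_C]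
        rfl
      rw [h4]
      have h5 := hNT
      rw [hNexp, map_add, map_mul, map_add, map_mul, aeval_X, aeval_C, aeval_C, hBW] at h5
      change ((N.coeff 0 : psub O) : PowerSeries L) + PowerSeries.C d * W * (((N.coeff 1 : psub O) : PowerSeries L) + _) = 0 at h5
      rw [hn0, hn1] at h5
      have hCd2 : (PowerSeries.C (d^2) : PowerSeries L) = PowerSeries.C d ^ 2 := map_pow _ _ _
      rw [hCd2] at h5
      have hne : (PowerSeries.C d : PowerSeries L) ^ 2 ≠ 0 := by
        apply pow_ne_zero
        intro h6
        rw [h6, zero_mul] at hCd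
        exact zero_ne_one hCd
      apply mul_left_cancel₀ hne
      linear_combination h5
  have : B = PowerSeries.C v + PowerSeries.C d * W := by rw [← hBW]; ring
  rw [this]
  exact add_mem hCv (mul_mem (C_mem_psub hdO) hWmem)

end den
end CDM

namespace CDM

section gal
variable {k L ι : Type} [Field k] [Field L] [Algebra k L] [Fintype ι]

/-- evaluation of polynomials at an element, as ring hom -/
noncomputable abbrev evz (k : Type) {L : Type} [Field k] [Field L] [Algebra k L] (z : L) : k[X] →+* L :=
  (aeval z : k[X] →ₐ[k] L).toRingHom

/-- A Galois covering of the line, given as splitting field of a monic polynomial -/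
structure IsCov (f : k[X][X]) (z : L) (y : ι → L) : Prop where
  tr : Transcendental k z
  fac : f.map (evz k z) = ∏ i, (Polynomial.X - Polynomial.C (y i))
  gen : adjoin k (insert z (Set.range y)) = ⊤
  sep : ∀ i, IsSeparable k⟮z⟯ (y i)

open IntermediateField.algebraAdjoinAdjoin in
theorem mem_adjoin_of_integral {w : L} (hw : Transcendental k w) {a : L} (ha : a ∈ k⟮w⟯)
    (hi : IsIntegral (Algebra.adjoin k {w}) a) : a ∈ Algebra.adjoin k {w} := by
  have e := algEquivOfTranscendental k w hw
  have hic : IsIntegrallyClosed (Algebra.adjoin k {w}) := IsIntegrallyClosed.of_equiv e.toRingEquiv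
  have h2 : IsIntegral (Algebra.adjoin k {w}) (⟨a, ha⟩ : k⟮w⟯) := by
    have : a = algebraMap k⟮w⟯ L ⟨a, ha⟩ := rfl
    rw [this] at hi
    exact (isIntegral_algebraMap_iff (algebraMap k⟮w⟯ L).injective).1 hi
  obtain ⟨b, hb⟩ := (IsIntegrallyClosed.isIntegral_iff (K := k⟮w⟯)).1 h2
  have := congrArg (algebraMap k⟮w⟯ L) hb
  have h3 : (b : L) = a := this
  rw [← h3]; exact b.2

theorem mem_range_of_integral {w : L} (hw : Transcendental k w) {a : L} (ha : a ∈ k⟮w⟯)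
    (hi : (evz k w).IsIntegralElem a) : a ∈ (evz k w).range := by
  have h1 : a ∈ Algebra.adjoin k {w} := by
    apply mem_adjoin_of_integral hw ha
    obtain ⟨p, hp, hpa⟩ := hi
    have hmem : ∀ g : k[X], evz k w g ∈ Algebra.adjoin k {w} := by
      intro g; rw [Algebra.adjoin_singleton_eq_range_aeval]; exact ⟨g, rfl⟩
    let r : k[X] →+* Algebra.adjoin k {w} := (evz k w).codRestrict _ hmem
    refine ⟨p.map r, hp.map r, ?_⟩
    rw [eval₂_map]; exact hpa
  rw [Algebra.adjoin_singleton_eq_range_aeval] at h1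
  obtain ⟨g, hg⟩ := h1
  exact ⟨g, hg⟩

variable {f : k[X][X]} {z : L} {y : ι → L}

theorem evz_mem_adjoin (z : L) (g : k[X]) : evz k z g ∈ k⟮z⟯ := by
  have h1 : evz k z g ∈ Algebra.adjoin k {z} := by
    rw [Algebra.adjoin_singleton_eq_range_aeval]; exact ⟨g, rfl⟩
  exact algebra_adjoin_le_adjoin k {z} h1

theorem IsCov.splitting (hc : IsCov f z y) : ∃ F : (k⟮z⟯)[X],
    F.map (algebraMap k⟮z⟯ L) = ∏ i, (Polynomial.X - Polynomial.C (y i)) ∧ F.IsSplittingField k⟮z⟯ L := by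
  let r : k[X] →+* k⟮z⟯ := (evz k z).codRestrict _ (evz_mem_adjoin z)
  have hF : (f.map r).map (algebraMap k⟮z⟯ L) = ∏ i, (Polynomial.X - Polynomial.C (y i)) := by
    rw [Polynomial.map_map, ← hc.fac]; rfl
  refine ⟨f.map r, hF, ?_, ?_⟩
  · rw [hF]; exact Splits.prod fun i _ => Splits.X_sub_C _
  · have hroots : (f.map r).rootSet L = Set.range y := by
      ext a
      rw [mem_rootSet', aeval_def, ← eval_map, hF, eval_prod,
        Finset.prod_eq_zero_iff]
      constructor
      · rintro ⟨_, i, _, hi⟩; exact ⟨i, by simpa [sub_eq_zero, eq_comm] using hi⟩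
      · rintro ⟨i, rfl⟩
        exact ⟨(monic_prod_of_monic _ _ fun i _ => monic_X_sub_C _).ne_zero,
          i, Finset.mem_univ i, by simp⟩
    rw [hroots]
    have h1 : adjoin k⟮z⟯ (Set.range y) = ⊤ := by
      apply restrictScalars_injective k
      rw [restrictScalars_top, ← hc.gen, adjoin_adjoin_left]
      rfl
    have halg : ∀ a ∈ Set.range y, IsAlgebraic k⟮z⟯ a := by
      rintro _ ⟨i, rfl⟩; exact (hc.sep i).isIntegral.isAlgebraic
    have := adjoin_toSubalgebra_of_isAlgebraic halg
    rw [← this, h1]; rfl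

theorem IsCov.fin (hc : IsCov f z y) : FiniteDimensional k⟮z⟯ L := by
  obtain ⟨F, _, h⟩ := hc.splitting
  exact IsSplittingField.finiteDimensional L F

theorem IsCov.gal (hc : IsCov f z y) : IsGalois k⟮z⟯ L := by
  obtain ⟨F, _, h⟩ := hc.splitting
  have hn : Normal k⟮z⟯ L := Normal.of_isSplittingField F
  have h1 : adjoin k⟮z⟯ (Set.range y) = ⊤ := by
    apply restrictScalars_injective k
    rw [restrictScalars_top, ← hc.gen, adjoin_adjoin_left]
    rfl
  have hs : Algebra.IsSeparable k⟮z⟯ L := by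
    rw [← isSeparable_top, ← h1]
    rw [isSeparable_adjoin_iff_isSeparable]
    rintro _ ⟨i, rfl⟩; exact hc.sep i
  exact ⟨⟩

theorem fix_evz (h : L ≃ₐ[k⟮z⟯] L) {w : L} (hw : w ∈ k⟮z⟯) (g : k[X]) : h (evz k w g) = evz k w g := by
  have h1 : evz k w g ∈ k⟮z⟯ := by
    have : k⟮w⟯ ≤ k⟮z⟯ := by
      rw [adjoin_simple_le_iff]; exact hw
    exact this (evz_mem_adjoin w g)
  exact h.commutes ⟨_, h1⟩

theorem IsCov.perm (hc : IsCov f z y) (h : L ≃ₐ[k⟮z⟯] L) (i : ι) : ∃ j, h (y i) = y j := by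
  have h1 : (f.map (evz k z)).eval (h (y i)) = 0 := by
    have h2 : (f.map (evz k z)).eval (y i) = 0 := by
      rw [hc.fac, eval_prod]; exact Finset.prod_eq_zero (Finset.mem_univ i) (by simp)
    rw [eval_map] at h2 ⊢
    have h3 := congrArg (h : L →+* L) h2
    rw [hom_eval₂] at h3
    have h4 : (h : L →+* L).comp (evz k z) = evz k z := by
      ext g
      · simpa using fix_evz h (mem_adjoin_simple_self k z) (Polynomial.C g)
      · simpa using fix_evz h (mem_adjoin_simple_self k z) (Polynomial.X)
    rw [h4] at h3
    simpa using h3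
  rw [hc.fac, eval_prod, Finset.prod_eq_zero_iff] at h1
  obtain ⟨j, _, hj⟩ := h1
  exact ⟨j, by simpa [sub_eq_zero] using hj⟩

theorem IsCov.ext (hc : IsCov f z y) {h h' : L ≃ₐ[k⟮z⟯] L} (e : ∀ i, h (y i) = h' (y i)) : h = h' := by
  have h1 : adjoin k⟮z⟯ (Set.range y) = ⊤ := by
    apply restrictScalars_injective k
    rw [restrictScalars_top, ← hc.gen, adjoin_adjoin_left]
    rfl
  have h2 : (h : L →ₐ[k⟮z⟯] L) = h' := by
    apply AlgHom.ext_of_adjoin_eq_top (s := Set.range y)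
    · have halg : ∀ a ∈ Set.range y, IsAlgebraic k⟮z⟯ a := by
        rintro _ ⟨i, rfl⟩; exact (hc.sep i).isIntegral.isAlgebraic
      rw [← adjoin_toSubalgebra_of_isAlgebraic halg, h1]; rfl
    · rintro _ ⟨i, rfl⟩
      exact e i
  ext a
  exact DFunLike.congr_fun h2 a

theorem IsCov.finrank_le (hc : IsCov f z y) : Module.finrank k⟮z⟯ L ≤ card ι ^ card ι := by
  classical
  have := hc.fin
  have := hc.gal
  rw [← IsGalois.card_aut_eq_finrank]
  choose s hs using hc.perm
  have : Function.Injective s := by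
    intro h h' e
    apply hc.ext
    intro i; rw [hs, hs, e]
  have h2 := Nat.card_le_card_of_injective s this
  simpa using h2

open Classical in
/-- the orbit of an element under the Galois group -/
noncomputable def orb (hc : IsCov f z y) (b : L) : Finset L :=
  haveI := hc.fin
  Finset.univ.image (fun h : L ≃ₐ[k⟮z⟯] L => h b)

theorem mem_orb (hc : IsCov f z y) {b a : L} : a ∈ orb hc b ↔ ∃ h : L ≃ₐ[k⟮z⟯] L, h b = a := by
  simp [orb]

theorem self_mem_orb (hc : IsCov f z y) (b : L) : b ∈ orb hc b := (mem_orb hc).2 ⟨1, rfl⟩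

theorem orb_poly_fixed (hc : IsCov f z y) (b : L) (h : L ≃ₐ[k⟮z⟯] L) :
    (∏ a ∈ orb hc b, (Polynomial.X - Polynomial.C a)).map (h : L →+* L) =
      ∏ a ∈ orb hc b, (Polynomial.X - Polynomial.C a) := by
  rw [Polynomial.map_prod]
  apply Finset.prod_bij (fun a _ => h a)
  · intro a ha
    obtain ⟨g, rfl⟩ := (mem_orb hc).1 ha
    exact (mem_orb hc).2 ⟨h * g, rfl⟩
  · intro a _ a' _ e; exact h.injective e
  · intro a ha
    obtain ⟨g, rfl⟩ := (mem_orb hc).1 ha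
    refine ⟨(h⁻¹ * g) b, (mem_orb hc).2 ⟨_, rfl⟩, ?_⟩
    change (h * (h⁻¹ * g)) b = _
    rw [mul_inv_cancel_left]
  · intro a _; simp

theorem integral_conj {w : L} (hw : w ∈ k⟮z⟯) {b : L} (hb : (evz k w).IsIntegralElem b)
    (h : L ≃ₐ[k⟮z⟯] L) : (evz k w).IsIntegralElem (h b) := by
  obtain ⟨p, hp, hpb⟩ := hb
  refine ⟨p, hp, ?_⟩
  have h3 := congrArg (h : L →+* L) hpb
  rw [hom_eval₂] at h3
  have h4 : (h : L →+* L).comp (evz k w) = evz k w := by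
    ext g
    · simpa using fix_evz h hw (Polynomial.C g)
    · simpa using fix_evz h hw (Polynomial.X)
  rw [h4] at h3
  simpa using h3

theorem coeff_prod_mem (S : Subring L) (s : Finset L) (hs : ∀ a ∈ s, a ∈ S) (n : ℕ) :
    (∏ a ∈ s, (Polynomial.X - Polynomial.C a)).coeff n ∈ S := by
  have : (∏ a ∈ s, (Polynomial.X - Polynomial.C a)) ∈ lifts S.subtype := by
    apply Subsemiring.prod_mem
    intro a ha
    have h1 : Polynomial.X - Polynomial.C a =
      mapRingHom S.subtype (Polynomial.X - Polynomial.C ⟨a, hs a ha⟩) := by simp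
    rw [h1]
    exact ⟨_, rfl⟩
  obtain ⟨p, hp⟩ := (mem_lifts _).1 this
  rw [← hp, Polynomial.coeff_map]
  exact (p.coeff n).2

theorem orbit_poly (hc : IsCov f z y) {w : L} (hw : Transcendental k w) (hkw : k⟮w⟯ = k⟮z⟯) {b : L}
    (hb : (evz k w).IsIntegralElem b) :
    ∃ m : k[X][X], m.map (evz k w) = ∏ a ∈ orb hc b, (Polynomial.X - Polynomial.C a) := by
  have hfin := hc.fin
  have hgal := hc.gal
  have hwz : w ∈ k⟮z⟯ := hkw ▸ mem_adjoin_simple_self k w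
  suffices h : (∏ a ∈ orb hc b, (Polynomial.X - Polynomial.C a)) ∈ lifts (evz k w) from
    (mem_lifts _).1 h
  rw [lifts_iff_coeff_lifts]
  intro n
  apply mem_range_of_integral hw
  · rw [hkw]
    have : (∏ a ∈ orb hc b, (Polynomial.X - Polynomial.C a)).coeff n ∈ Set.range (algebraMap k⟮z⟯ L) := by
      rw [IsGalois.mem_range_algebraMap_iff_fixed]
      intro h
      have := orb_poly_fixed hc b h
      have h2 := congrArg (fun p => p.coeff n) this
      simpa using h2
    obtain ⟨c, hc⟩ := this
    rw [← hc]; exact c.2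
  · let _ : Algebra k[X] L := (evz k w).toAlgebra
    have := coeff_prod_mem (integralClosure k[X] L).toSubring (orb hc b) (by
      intro a ha
      obtain ⟨h, rfl⟩ := (mem_orb hc).1 ha
      exact integral_conj hwz hb h) n
    exact this

end gal
end CDM

namespace CDM

theorem lift_hensel {F L R : Type} [Field F] [Field L] [Algebra F L] [FiniteDimensional F L]
    [Algebra.IsSeparable F L] [CommRing R] [Algebra F R] (ρ : R →ₐ[F] L)
    (hρ : Function.Surjective ρ) (hH : HenselianRing R (RingHom.ker ρ)) :
    ∃ E : L →ₐ[F] R, ∀ a, ρ (E a) = a := by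
  let pb := Field.powerBasisOfFiniteOfSeparable F L
  obtain ⟨a0, ha0⟩ := hρ pb.gen
  have hev : ∀ g : F[X], ρ ((g.map (algebraMap F R)).eval a0) = aeval pb.gen g := by
    intro g
    rw [eval_map_algebraMap, ← ha0, aeval_algHom_apply]
  have hm : ((minpoly F pb.gen).map (algebraMap F R)).Monic :=
    (minpoly.monic (Algebra.IsIntegral.isIntegral _)).map _
  obtain ⟨a, ha, haI⟩ := hH.is_henselian _ hm a0 (by
      rw [RingHom.mem_ker]; exact (hev _).trans (minpoly.aeval _ _)) (by
      rw [derivative_map]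
      have h1 : ρ (((derivative (minpoly F pb.gen)).map (algebraMap F R)).eval a0) ≠ 0 := by
        rw [hev]
        have hs : (minpoly F pb.gen).Separable := Algebra.IsSeparable.isSeparable F pb.gen
        exact hs.aeval_derivative_ne_zero (minpoly.aeval _ _)
      have e := Ideal.quotientKerAlgEquivOfSurjective hρ
      obtain ⟨b, hb⟩ := hρ (ρ (((derivative (minpoly F pb.gen)).map (algebraMap F R)).eval a0))⁻¹
      refine IsUnit.of_mul_eq_one (Ideal.Quotient.mk _ b) ?_
      rw [← map_mul, ← (Ideal.Quotient.mk _).map_one, Ideal.Quotient.eq, RingHom.mem_ker, map_sub, map_mul, map_one, sub_eq_zero]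
      change ρ _ * ρ b = 1
      rw [hb, mul_inv_cancel₀ h1])
  have ha' : aeval a (minpoly F pb.gen) = 0 := by
    rw [← eval_map_algebraMap]; exact ha
  refine ⟨pb.lift a ha', ?_⟩
  have h2 : ρ.comp (pb.lift a ha') = AlgHom.id F L := by
    apply pb.algHom_ext
    rw [AlgHom.comp_apply, pb.lift_gen, AlgHom.id_apply, ← ha0, ← sub_eq_zero, ← map_sub]
    exact haI
  intro a; exact DFunLike.congr_fun h2 a

variable {k L ι : Type} [Field k] [Field L] [Algebra k L] [Fintype ι]
variable {f : k[X][X]} {z : L} {y : ι → L}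

open IntermediateField.algebraAdjoinAdjoin in
theorem exists_E (hc : IsCov f z y) : ∃ E : L →+* PowerSeries L,
    (∀ c : k, E (algebraMap k L c) = PowerSeries.C (algebraMap k L c)) ∧
    E z = PowerSeries.C z + PowerSeries.X ∧ ∀ a, PowerSeries.constantCoeff (E a) = a := by
  have hfin := hc.fin
  have hgal := hc.gal
  let e := algEquivOfTranscendental k z hc.tr
  let g0 : k[X] →ₐ[k] PowerSeries L := aeval (PowerSeries.C z + PowerSeries.X)
  let g1 : Algebra.adjoin k {z} →+* PowerSeries L := (g0.comp e.symm.toAlgHom).toRingHom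
  have hg1 : ∀ a, PowerSeries.constantCoeff (g1 a) = a := by
    intro a
    obtain ⟨p, rfl⟩ := e.surjective a
    have h0 : g1 (e p) = g0 p := by
      change g0 (e.symm (e p)) = _
      rw [e.symm_apply_apply]
    rw [h0]
    have h1 : ((e p : Algebra.adjoin k {z}) : L) = aeval z p := by
      simp [e, algEquivOfTranscendental]
    rw [h1]
    have h2 : ((PowerSeries.constantCoeff (R := L)).comp g0.toRingHom) = (aeval z : k[X] →ₐ[k] L).toRingHom := by
      ext c
      · simp [g0, PowerSeries.algebraMap_apply]
      · simp [g0]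
    exact DFunLike.congr_fun h2 p
  have hinv : ∀ s : nonZeroDivisors (Algebra.adjoin k {z}), IsUnit (g1 s) := by
    intro s
    rw [isUnit_iff_constantCoeff, hg1, isUnit_iff_ne_zero]
    intro h
    exact nonZeroDivisors.ne_zero s.2 (Subtype.ext h)
  let g2 : k⟮z⟯ →+* PowerSeries L := IsLocalization.lift (M := nonZeroDivisors (Algebra.adjoin k {z})) hinv
  have hg2 : ∀ a, PowerSeries.constantCoeff (g2 a) = a := by
    have : (PowerSeries.constantCoeff (R := L)).comp g2 = algebraMap k⟮z⟯ L := by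
      apply IsLocalization.ringHom_ext (nonZeroDivisors (Algebra.adjoin k {z}))
      ext a
      change PowerSeries.constantCoeff (g2 (algebraMap _ _ a)) = _
      rw [IsLocalization.lift_eq, hg1]; rfl
    intro a; exact DFunLike.congr_fun this a
  have key : ∃ E : L →+* PowerSeries L, (∀ a : k⟮z⟯, E a = g2 a) ∧ ∀ a, PowerSeries.constantCoeff (E a) = a := by
    let inst : Algebra k⟮z⟯ (PowerSeries L) := g2.toAlgebra
    let ρ : @AlgHom k⟮z⟯ (PowerSeries L) L _ _ _ inst _ :=
      @AlgHom.mk _ _ _ _ _ _ inst _ (PowerSeries.constantCoeff (R := L)) hg2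
    have hker : RingHom.ker ρ = Ideal.span {(PowerSeries.X : PowerSeries L)} := by
      ext a
      rw [RingHom.mem_ker, Ideal.mem_span_singleton, PowerSeries.X_dvd_iff]; rfl
    have hH : HenselianRing (PowerSeries L) (RingHom.ker ρ) := by
      rw [hker]; infer_instance
    obtain ⟨E, hE⟩ := @lift_hensel k⟮z⟯ L (PowerSeries L) _ _ _ _ _ _ inst ρ
      (fun a => ⟨PowerSeries.C a, constantCoeff_C a⟩) hH
    exact ⟨E.toRingHom, fun a => E.commutes a, hE⟩
  obtain ⟨E, hE1, hE2⟩ := key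
  have hE3 : ∀ p : k[X], E (aeval z p) = g0 p := by
    intro p
    have h1 : ((e p : Algebra.adjoin k {z}) : L) = aeval z p := by
      simp [e, algEquivOfTranscendental]
    have h2 : (algebraMap (Algebra.adjoin k {z}) k⟮z⟯ (e p) : L) = aeval z p := h1
    rw [← h2, hE1, IsLocalization.lift_eq]
    change g0 (e.symm (e p)) = _
    rw [e.symm_apply_apply]
  refine ⟨E, ?_, ?_, hE2⟩
  · intro c
    have := hE3 (Polynomial.C c)
    simpa [g0, PowerSeries.algebraMap_apply] using this
  · have := hE3 Polynomial.X
    simpa [g0] using this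

end CDM

namespace CDM

variable {k L ι : Type} [Field k] [Field L] [Algebra k L] [Fintype ι]

/-- the affine coordinate ring -/
def O0 (k : Type) {L ι : Type} [Field k] [Field L] [Algebra k L] (z : L) (y : ι → L) : Subalgebra k L :=
  Algebra.adjoin k (insert z (Set.range y))

theorem z_mem_O0 (z : L) (y : ι → L) : z ∈ O0 k z y := Algebra.subset_adjoin (Set.mem_insert _ _)
theorem y_mem_O0 (z : L) (y : ι → L) (i : ι) : y i ∈ O0 k z y :=
  Algebra.subset_adjoin (Set.mem_insert_of_mem _ ⟨i, rfl⟩)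

section local_ring
variable {O : Subalgebra k L} (P : O →ₐ[k] k)

/-- local ring of a point -/
def V : Subalgebra k L where
  carrier := {a | ∃ b s : O, P s ≠ 0 ∧ a * s = b}
  mul_mem' := by
    rintro a a' ⟨b, s, hs, e⟩ ⟨b', s', hs', e'⟩
    refine ⟨b * b', s * s', by rw [map_mul]; exact mul_ne_zero hs hs', ?_⟩
    push_cast; rw [← e, ← e']; ring
  add_mem' := by
    rintro a a' ⟨b, s, hs, e⟩ ⟨b', s', hs', e'⟩
    refine ⟨b * s' + b' * s, s * s', by rw [map_mul]; exact mul_ne_zero hs hs', ?_⟩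
    push_cast; rw [← e, ← e']; ring
  algebraMap_mem' := by
    intro c
    refine ⟨algebraMap k O c, 1, by simp, ?_⟩
    simp

open Classical in
/-- residue value at a point (junk value outside of the local ring) -/
noncomputable def rv (a : L) : k :=
  if h : ∃ b s : O, P s ≠ 0 ∧ a * s = b then P h.choose / P h.choose_spec.choose else 0

variable {P}

theorem rv_eq {a : L} {b s : O} (hs : P s ≠ 0) (e : a * s = b) : rv P a = P b / P s := by
  have h : ∃ b s : O, P s ≠ 0 ∧ a * s = b := ⟨b, s, hs, e⟩
  rw [rv, dif_pos h]
  obtain ⟨hs', e'⟩ := h.choose_spec.choose_spec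
  rw [div_eq_div_iff hs' hs, ← map_mul, ← map_mul]
  congr 1
  apply Subtype.ext
  push_cast
  linear_combination (h.choose_spec.choose : L) * e - (s : L) * e'

theorem mem_V_of_mem {a : L} (ha : a ∈ O) : a ∈ V P := ⟨⟨a, ha⟩, 1, by simp, by simp⟩

theorem rv_of_mem {a : L} (ha : a ∈ O) : rv P a = P ⟨a, ha⟩ := by
  rw [rv_eq (P := P) (a := a) (b := ⟨a, ha⟩) (s := 1) (by simp) (by simp)]; simp

theorem rv_add {a a' : L} (ha : a ∈ V P) (ha' : a' ∈ V P) : rv P (a + a') = rv P a + rv P a' := by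
  obtain ⟨b, s, hs, e⟩ := ha
  obtain ⟨b', s', hs', e'⟩ := ha'
  rw [rv_eq hs e, rv_eq hs' e', rv_eq (b := b * s' + b' * s) (s := s * s')
    (by rw [map_mul]; exact mul_ne_zero hs hs') (by push_cast; rw [← e, ← e']; ring)]
  simp only [map_add, map_mul]; field_simp

theorem rv_mul {a a' : L} (ha : a ∈ V P) (ha' : a' ∈ V P) : rv P (a * a') = rv P a * rv P a' := by
  obtain ⟨b, s, hs, e⟩ := ha
  obtain ⟨b', s', hs', e'⟩ := ha'
  rw [rv_eq hs e, rv_eq hs' e', rv_eq (b := b * b') (s := s * s')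
    (by rw [map_mul]; exact mul_ne_zero hs hs') (by push_cast; rw [← e, ← e']; ring)]
  simp only [map_mul]; field_simp

theorem rv_alg (c : k) : rv P (algebraMap k L c) = c := by
  rw [rv_of_mem (O.algebraMap_mem c)]
  exact P.commutes c

variable (P) in
/-- residue as an algebra hom -/
noncomputable def res : V P →ₐ[k] k where
  toFun a := rv P a
  map_one' := by simpa using rv_alg (P := P) 1
  map_mul' a b := rv_mul a.2 b.2
  map_zero' := by simpa using rv_alg (P := P) 0
  map_add' a b := rv_add a.2 b.2
  commutes' c := rv_alg c

theorem rv_one : rv P (1 : L) = 1 := by simpa using rv_alg (P := P) 1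
theorem rv_zero : rv P (0 : L) = 0 := by simpa using rv_alg (P := P) 0
theorem rv_neg {a : L} (ha : a ∈ V P) : rv P (-a) = - rv P a := map_neg (res P) ⟨a, ha⟩
theorem rv_sub {a b : L} (ha : a ∈ V P) (hb : b ∈ V P) : rv P (a - b) = rv P a - rv P b :=
  map_sub (res P) ⟨a, ha⟩ ⟨b, hb⟩
theorem rv_pow {a : L} (ha : a ∈ V P) (n : ℕ) : rv P (a ^ n) = rv P a ^ n :=
  map_pow (res P) ⟨a, ha⟩ n
theorem rv_smul (c : k) {a : L} (ha : a ∈ V P) : rv P (c • a) = c * rv P a :=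
  map_smul (res P) c ⟨a, ha⟩
theorem rv_sum {J : Type} (s : Finset J) {a : J → L} (ha : ∀ j ∈ s, a j ∈ V P) :
    rv P (∑ j ∈ s, a j) = ∑ j ∈ s, rv P (a j) := by
  classical
  induction s using Finset.induction_on with
  | empty => simp [rv_zero]
  | insert j s hj ih =>
    rw [Finset.sum_insert hj, Finset.sum_insert hj, rv_add (ha j (by simp))
      (sum_mem fun i hi => ha i (by simp [hi])), ih fun i hi => ha i (by simp [hi])]
theorem rv_prod {J : Type} (s : Finset J) {a : J → L} (ha : ∀ j ∈ s, a j ∈ V P) :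
    rv P (∏ j ∈ s, a j) = ∏ j ∈ s, rv P (a j) := by
  classical
  induction s using Finset.induction_on with
  | empty => simp [rv_one]
  | insert j s hj ih =>
    rw [Finset.prod_insert hj, Finset.prod_insert hj, rv_mul (ha j (by simp))
      (prod_mem fun i hi => ha i (by simp [hi])), ih fun i hi => ha i (by simp [hi])]

theorem inv_mem_V {a : L} (ha : a ∈ V P) (h : rv P a ≠ 0) : a⁻¹ ∈ V P := by
  obtain ⟨b, s, hs, e⟩ := ha
  rw [rv_eq hs e] at h
  have hb : P b ≠ 0 := fun h' => h (by rw [h', zero_div])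
  have ha0 : a ≠ 0 := by
    rintro rfl
    apply hb
    have : b = 0 := Subtype.ext (by rw [← e, zero_mul]; rfl)
    rw [this, map_zero]
  exact ⟨s, b, hb, by rw [← e, inv_mul_cancel_left₀ ha0]⟩

/-- pullback of a point -/
noncomputable def pcomp (P : O →ₐ[k] k) (ψ : L →ₐ[k] L) (hψ : ∀ a ∈ O, ψ a ∈ O) : O →ₐ[k] k :=
  P.comp ((ψ.comp O.val).codRestrict O (fun a => hψ a a.2))

theorem pcomp_spec {ψ : L →ₐ[k] L} (hψ : ∀ a ∈ O, ψ a ∈ O) {a : L} (ha : a ∈ V (pcomp P ψ hψ)) :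
    ψ a ∈ V P ∧ rv P (ψ a) = rv (pcomp P ψ hψ) a := by
  obtain ⟨b, s, hs, e⟩ := ha
  have e2 : ψ a * ψ s = ψ b := by rw [← map_mul, e]
  exact ⟨⟨⟨ψ b, hψ _ b.2⟩, ⟨ψ s, hψ _ s.2⟩, hs, e2⟩,
    (rv_eq (b := ⟨ψ b, hψ _ b.2⟩) (s := ⟨ψ s, hψ _ s.2⟩) hs e2).trans (rv_eq hs e).symm⟩

end local_ring

variable {f : k[X][X]} {z : L} {y : ι → L}

/-- good points: distinct roots stay distinct -/
def Good (P : O0 k z y →ₐ[k] k) : Prop := ∀ i j, y i ≠ y j → rv P (y i) ≠ rv P (y j)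

theorem O0_induction {p : L → Prop} (h0 : ∀ c : k, p (algebraMap k L c)) (hz : p z) (hy : ∀ i, p (y i))
    (ha : ∀ a ∈ O0 k z y, ∀ b ∈ O0 k z y, p a → p b → p (a + b))
    (hm : ∀ a ∈ O0 k z y, ∀ b ∈ O0 k z y, p a → p b → p (a * b)) {a : L} (h : a ∈ O0 k z y) : p a := by
  unfold O0 at h ha hm
  induction h using Algebra.adjoin_induction with
  | mem x hx =>
    rcases hx with rfl | ⟨i, rfl⟩
    · exact hz
    · exact hy i
  | algebraMap c => exact h0 c
  | add a b h1 h2 h3 h4 => exact ha a h1 b h2 h3 h4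
  | mul a b h1 h2 h3 h4 => exact hm a h1 b h2 h3 h4

theorem IsCov.y_integral (hc : IsCov f z y) (i : ι) : (evz k z).IsIntegralElem (y i) := by
  refine ⟨f, ?_, ?_⟩
  · have h1 : (f.map (evz k z)).Monic := by
      rw [hc.fac]; exact monic_prod_of_monic _ _ fun i _ => monic_X_sub_C _
    have hinj : Function.Injective (evz k z) := transcendental_iff_injective.1 hc.tr
    exact monic_of_injective hinj h1
  · rw [← eval_map, hc.fac, eval_prod]
    exact Finset.prod_eq_zero (Finset.mem_univ i) (by simp)

theorem IsCov.orb_y (hc : IsCov f z y) {i : ι} {a : L} (ha : a ∈ orb hc (y i)) : ∃ j, a = y j := by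
  obtain ⟨h, rfl⟩ := (mem_orb hc).1 ha
  exact hc.perm h i

theorem evz_mem_V {P : O0 k z y →ₐ[k] k} (g : k[X]) : evz k z g ∈ V P ∧ rv P (evz k z g) = g.eval (rv P z) := by
  have hz := mem_V_of_mem (P := P) (z_mem_O0 z y)
  have h1 : evz k z g ∈ V P := by
    have : aeval (⟨z, hz⟩ : V P) g = evz k z g := by
      exact (aeval_algHom_apply (V P).val ⟨z, hz⟩ g).symm
    rw [← this]; exact SetLike.coe_mem _
  refine ⟨h1, ?_⟩
  have h2 : res P (aeval (⟨z, hz⟩ : V P) g) = g.eval (rv P z) := by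
    rw [← aeval_algHom_apply, coe_aeval_eq_eval]; rfl
  rw [← h2]
  change rv P _ = rv P _
  congr 1
  exact (aeval_algHom_apply (V P).val ⟨z, hz⟩ g)

theorem sub_rv_mem (hc : IsCov f z y) {P : O0 k z y →ₐ[k] k} (hP : Good P) (i : ι) :
    (y i - algebraMap k L (rv P (y i))) * (z - algebraMap k L (rv P z))⁻¹ ∈ V P := by
  classical
  set η := rv P (y i) with hη
  set t := z - algebraMap k L (rv P z) with ht
  have ht0 : t ≠ 0 := by
    intro h
    rw [ht, sub_eq_zero] at h
    apply hc.tr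
    rw [h]; exact isAlgebraic_algebraMap _
  obtain ⟨m, hm⟩ := orbit_poly hc hc.tr rfl (hc.y_integral i)
  have hyV : ∀ a ∈ orb hc (y i), a ∈ V P := by
    intro a ha; obtain ⟨j, rfl⟩ := hc.orb_y ha; exact mem_V_of_mem (y_mem_O0 z y j)
  let G : k[X] := m.eval (Polynomial.C η)
  have hG : evz k z G = ∏ a ∈ orb hc (y i), (algebraMap k L η - a) := by
    have h1 : evz k z G = (m.map (evz k z)).eval (evz k z (Polynomial.C η)) := by
      rw [eval_map_apply]
    rw [h1, hm, eval_prod]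
    simp
  have hGc : G.eval (rv P z) = 0 := by
    rw [← (evz_mem_V (P := P) G).2, hG, rv_prod _ fun a ha => sub_mem ((V P).algebraMap_mem _) (hyV a ha)]
    apply Finset.prod_eq_zero (self_mem_orb hc (y i))
    rw [rv_sub ((V P).algebraMap_mem _) (hyV _ (self_mem_orb hc _)), rv_alg, sub_self]
  obtain ⟨G', hG'⟩ := dvd_iff_isRoot.2 hGc
  have hGt : evz k z G = t * evz k z G' := by
    rw [hG', map_mul]; congr 1; simp [ht]
  set U := ∏ a ∈ (orb hc (y i)).erase (y i), (algebraMap k L η - a) with hU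
  have hUV : U ∈ V P := prod_mem fun a ha =>
    sub_mem ((V P).algebraMap_mem _) (hyV a (Finset.mem_of_mem_erase ha))
  have hU0 : rv P U ≠ 0 := by
    rw [hU, rv_prod _ fun a ha => sub_mem ((V P).algebraMap_mem _) (hyV a (Finset.mem_of_mem_erase ha)),
      Finset.prod_ne_zero_iff]
    intro a ha
    have ha' := Finset.mem_of_mem_erase ha
    rw [rv_sub ((V P).algebraMap_mem _) (hyV a ha'), rv_alg, sub_ne_zero]
    obtain ⟨j, rfl⟩ := hc.orb_y ha'
    exact hP i j (Finset.ne_of_mem_erase ha).symm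
  have hUne : U ≠ 0 := by
    intro h; apply hU0; rw [h, rv_zero]
  have hfin : (algebraMap k L η - y i) * U = t * evz k z G' := by
    rw [← hGt, hG, hU, Finset.mul_prod_erase _ (fun a => algebraMap k L η - a) (self_mem_orb hc (y i))]
  have : (y i - algebraMap k L η) * t⁻¹ = - (evz k z G' * U⁻¹) := by
    field_simp
    linear_combination -hfin
  rw [this]
  exact neg_mem (mul_mem (evz_mem_V G').1 (inv_mem_V hUV hU0))

theorem div_t_mem (hc : IsCov f z y) {P : O0 k z y →ₐ[k] k} (hP : Good P) {a : L} (ha : a ∈ V P)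
    (h0 : rv P a = 0) : a * (z - algebraMap k L (rv P z))⁻¹ ∈ V P := by
  set t := z - algebraMap k L (rv P z) with ht
  have ht0 : t ≠ 0 := by
    intro h
    rw [ht, sub_eq_zero] at h
    apply hc.tr
    rw [h]; exact isAlgebraic_algebraMap _
  have key : ∀ b ∈ O0 k z y, (b - algebraMap k L (rv P b)) * t⁻¹ ∈ V P := by
    intro b hb
    refine O0_induction (p := fun b => (b - algebraMap k L (rv P b)) * t⁻¹ ∈ V P) ?_ ?_ ?_ ?_ ?_ hb
    · intro c; rw [rv_alg, sub_self, zero_mul]; exact zero_mem _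
    · rw [← ht, mul_inv_cancel₀ ht0]; exact one_mem _
    · exact sub_rv_mem hc hP
    · intro a ha b hb h1 h2
      have e : (a + b - algebraMap k L (rv P (a + b))) * t⁻¹ = (a - algebraMap k L (rv P a)) * t⁻¹ +
        (b - algebraMap k L (rv P b)) * t⁻¹ := by
        rw [rv_add (mem_V_of_mem ha) (mem_V_of_mem hb), map_add]; ring
      rw [e]; exact add_mem h1 h2
    · intro a ha b hb h1 h2
      have e : (a * b - algebraMap k L (rv P (a * b))) * t⁻¹ = (a - algebraMap k L (rv P a)) * t⁻¹ * b +
        algebraMap k L (rv P a) * ((b - algebraMap k L (rv P b)) * t⁻¹) := by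
        rw [rv_mul (mem_V_of_mem ha) (mem_V_of_mem hb), map_mul]; ring
      rw [e]; exact add_mem (mul_mem h1 (mem_V_of_mem hb)) (mul_mem ((V P).algebraMap_mem _) h2)
  obtain ⟨b, s, hs, e⟩ := ha
  have hsV : (s : L) ∈ V P := mem_V_of_mem s.2
  have hs0 : rv P (s : L) ≠ 0 := by rw [rv_of_mem s.2]; exact hs
  have hsne : (s : L) ≠ 0 := by intro h; apply hs0; rw [h, rv_zero]
  have hb0 : rv P (b : L) = 0 := by
    rw [← e, rv_mul ⟨b, s, hs, e⟩ hsV, h0, zero_mul]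
  have h1 := key b b.2
  rw [hb0, map_zero, sub_zero] at h1
  have : a * t⁻¹ = b * t⁻¹ * (s : L)⁻¹ := by rw [← e]; field_simp
  rw [this]
  exact mul_mem h1 (inv_mem_V hsV hs0)

end CDM

namespace CDM

variable {k L ι : Type} [Field k] [Field L] [Algebra k L] [Fintype ι]
variable {f : k[X][X]} {z : L} {y : ι → L}

/-- Taylor expansion map -/
structure IsE (k : Type) {L : Type} [Field k] [Field L] [Algebra k L] (z : L) (E : L →+* PowerSeries L) : Prop where
  const : ∀ c : k, E (algebraMap k L c) = PowerSeries.C (algebraMap k L c)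
  ez : E z = PowerSeries.C z + PowerSeries.X
  id : ∀ a, PowerSeries.constantCoeff (E a) = a

variable {E : L →+* PowerSeries L}

open Classical in
theorem den_app (hc : IsCov f z y) (hE : IsE k z E) {w : L} (hw : Transcendental k w)
    (hkw : k⟮w⟯ = k⟮z⟯) {b : L} (hb : (evz k w).IsIntegralElem b) (O : Subalgebra k L)
    (hEw : E w ∈ psub O.toSubring) (hbO : b ∈ O) (d : L)
    (hd : d = ∏ a ∈ (orb hc b).filter (· ≠ b), (b - a)) :
    rescale (d ^ 2) (E b) ∈ psub O.toSubring := by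
  obtain ⟨m, hm⟩ := orbit_poly hc hw hkw hb
  have hmem : ∀ g : k[X], (E.comp (evz k w)) g ∈ psub O.toSubring := by
    intro g
    induction g using Polynomial.induction_on' with
    | add p q hp hq => rw [map_add]; exact add_mem hp hq
    | monomial n c =>
      rw [← C_mul_X_pow_eq_monomial, map_mul, map_pow]
      refine mul_mem ?_ (pow_mem ?_ n)
      · simp only [RingHom.comp_apply]
        have : evz k w (Polynomial.C c) = algebraMap k L c := by simp
        rw [this, hE.const]
        exact C_mem_psub (O.algebraMap_mem c)
      · simpa using hEw
  let r : k[X] →+* psub O.toSubring := (E.comp (evz k w)).codRestrict _ hmem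
  have hd0 : d ≠ 0 := by
    rw [hd, Finset.prod_ne_zero_iff]
    intro a ha; rw [Finset.mem_filter] at ha; exact sub_ne_zero.2 ha.2.symm
  refine den (m.map r) (E b) ?_ b d hbO (hE.id b) ?_ hd0
  · rw [aeval_def, eval₂_map]
    change Polynomial.eval₂ (E.comp (evz k w)) (E b) m = 0
    rw [← hom_eval₂, ← eval_map, hm, eval_prod,
      Finset.prod_eq_zero (self_mem_orb hc b) (by simp), map_zero]
  · rw [derivative_map, aeval_def, eval₂_map]
    change PowerSeries.constantCoeff (Polynomial.eval₂ (E.comp (evz k w)) (PowerSeries.C b) (derivative m)) = d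
    rw [hom_eval₂]
    have h1 : (PowerSeries.constantCoeff (R := L)).comp (E.comp (evz k w)) = evz k w := by
      ext c <;> simp [hE.id]
    rw [h1, constantCoeff_C, ← eval_map, ← derivative_map, hm,
      ← Finset.mul_prod_erase _ _ (self_mem_orb hc b), derivative_mul]
    simp [eval_prod, hd, Finset.filter_ne']

theorem psub_inv {O : Subring L} {A B : PowerSeries L} (hA : A ∈ psub O) (h : A * B = 1)
    (h0 : (PowerSeries.constantCoeff A)⁻¹ ∈ O) : B ∈ psub O := by
  have hA0 : PowerSeries.constantCoeff A ≠ 0 := by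
    intro h1
    have := congrArg PowerSeries.constantCoeff h
    rw [map_mul, h1, zero_mul, map_one] at this
    exact zero_ne_one this
  intro n
  induction n using Nat.strong_induction_on with
  | _ n ih =>
    have h2 := congrArg (PowerSeries.coeff n) h
    rw [PowerSeries.coeff_mul, Finset.Nat.sum_antidiagonal_eq_sum_range_succ
      (f := fun i j => PowerSeries.coeff i A * PowerSeries.coeff j B), Finset.sum_range_succ'] at h2
    have h3 : PowerSeries.coeff n B = (PowerSeries.constantCoeff A)⁻¹ * (PowerSeries.coeff n (1 : PowerSeries L) -
      ∑ i ∈ Finset.range n, PowerSeries.coeff (i+1) A * PowerSeries.coeff (n - (i+1)) B) := by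
      rw [← h2]
      simp only [coeff_zero_eq_constantCoeff, Nat.sub_zero]
      field_simp
      ring
    rw [h3]
    refine mul_mem h0 (sub_mem ((psub O).one_mem n) (sum_mem fun i hi => mul_mem (hA _) (ih _ ?_)))
    rw [Finset.mem_range] at hi; omega

theorem E_mem_V (hc : IsCov f z y) (hE : IsE k z E) {P : O0 k z y →ₐ[k] k} (hP : Good P) {a : L}
    (ha : a ∈ V P) : E a ∈ psub (V P).toSubring := by
  classical
  have hz : E z ∈ psub (V P).toSubring := by
    rw [hE.ez]; exact add_mem (C_mem_psub (mem_V_of_mem (z_mem_O0 z y))) X_mem_psub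
  have hy : ∀ i, E (y i) ∈ psub (V P).toSubring := by
    intro i
    set d := ∏ a ∈ (orb hc (y i)).filter (· ≠ y i), (y i - a) with hd
    have h1 := den_app hc hE hc.tr rfl (hc.y_integral i) (V P) hz (mem_V_of_mem (y_mem_O0 z y i)) d hd
    have hm : ∀ a ∈ (orb hc (y i)).filter (· ≠ y i), y i - a ∈ V P ∧ rv P (y i - a) ≠ 0 := by
      intro a ha
      rw [Finset.mem_filter] at ha
      obtain ⟨j, rfl⟩ := hc.orb_y ha.1
      refine ⟨sub_mem (mem_V_of_mem (y_mem_O0 z y i)) (mem_V_of_mem (y_mem_O0 z y j)), ?_⟩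
      rw [rv_sub (mem_V_of_mem (y_mem_O0 z y i)) (mem_V_of_mem (y_mem_O0 z y j)), sub_ne_zero]
      exact hP i j ha.2.symm
    have hdV : d ∈ V P := prod_mem fun a ha => (hm a ha).1
    have hd0 : rv P d ≠ 0 := by
      rw [hd, rv_prod _ fun a ha => (hm a ha).1, Finset.prod_ne_zero_iff]
      exact fun a ha => (hm a ha).2
    have hdne : d ≠ 0 := by intro h; apply hd0; rw [h, rv_zero]
    have hdi := inv_mem_V hdV hd0
    intro n
    have h2 := h1 n
    rw [coeff_rescale] at h2
    have : PowerSeries.coeff n (E (y i)) = (d⁻¹ ^ 2) ^ n * ((d ^ 2) ^ n * PowerSeries.coeff n (E (y i))) := by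
      rw [← mul_assoc, ← mul_pow, ← mul_pow, inv_mul_cancel₀ hdne]; simp
    rw [this]
    exact mul_mem (pow_mem (pow_mem hdi 2) n) h2
  have hO : ∀ b ∈ O0 k z y, E b ∈ psub (V P).toSubring := by
    intro b hb
    refine O0_induction (p := fun b => E b ∈ psub (V P).toSubring) ?_ hz hy ?_ ?_ hb
    · intro c; rw [hE.const]; exact C_mem_psub ((V P).algebraMap_mem c)
    · intro a _ b _ h1 h2; rw [map_add]; exact add_mem h1 h2
    · intro a _ b _ h1 h2; rw [map_mul]; exact mul_mem h1 h2
  obtain ⟨b, s, hs, e⟩ := ha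
  have hsV : (s : L) ∈ V P := mem_V_of_mem s.2
  have hs0 : rv P (s : L) ≠ 0 := by rw [rv_of_mem s.2]; exact hs
  have hsne : (s : L) ≠ 0 := by intro h; apply hs0; rw [h, rv_zero]
  have h3 : E (s : L)⁻¹ ∈ psub (V P).toSubring := by
    apply psub_inv (hO s s.2)
    · rw [← map_mul, mul_inv_cancel₀ hsne, map_one]
    · rw [hE.id]; exact inv_mem_V hsV hs0
  have : a = b * (s : L)⁻¹ := by rw [← e]; field_simp
  rw [this, map_mul]
  exact mul_mem (hO b b.2) h3

theorem IsE.sub (hE : IsE k z E) (c : k) : E (z - algebraMap k L c) = PowerSeries.C (z - algebraMap k L c) + PowerSeries.X := by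
  rw [map_sub, hE.ez, hE.const, map_sub]; ring

theorem rescale_C' (a b : L) : rescale a (PowerSeries.C b) = PowerSeries.C b := by
  ext i; rw [coeff_rescale, PowerSeries.coeff_C]; split_ifs with h
  · simp [h]
  · simp

theorem E_pole (hc : IsCov f z y) (hE : IsE k z E) {P : O0 k z y →ₐ[k] k} (hP : Good P) {a : L} {t : L}
    (ht : t = z - algebraMap k L (rv P z)) {N : ℕ}
    (ha : t ^ N * a ∈ V P) (i : ℕ) : t ^ (N + i) * PowerSeries.coeff i (E a) ∈ V P := by
  have ht0 : t ≠ 0 := by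
    intro h
    rw [ht, sub_eq_zero] at h
    apply hc.tr
    rw [h]; exact isAlgebraic_algebraMap _
  have htV : t ∈ V P := by
    rw [ht]; exact sub_mem (mem_V_of_mem (z_mem_O0 z y)) ((V P).algebraMap_mem _)
  have hEt : E t = PowerSeries.C t + PowerSeries.X := by rw [ht, hE.sub]
  set b := t ^ N * a with hb
  have hEb := rescale_mem_psub (E_mem_V hc hE hP ha) htV
  set w := rescale t (E t⁻¹) * PowerSeries.C t with hw
  have hw1 : (1 + PowerSeries.X) * w = 1 := by
    have h1 : rescale t (E t) = PowerSeries.C t * (1 + PowerSeries.X) := by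
      rw [hEt, map_add, rescale_X, rescale_C']; ring
    calc (1 + PowerSeries.X) * w = rescale t (E t) * rescale t (E t⁻¹) := by
          rw [h1, hw]; ring
      _ = 1 := by rw [← map_mul, ← map_mul, mul_inv_cancel₀ ht0, map_one, map_one]
  have hwV : w ∈ psub (V P).toSubring := by
    refine psub_inv (add_mem (one_mem _) X_mem_psub) hw1 ?_
    simp
  have h4 : rescale t (E a) * PowerSeries.C t ^ N = w ^ N * rescale t (E b) := by
    have : a = t⁻¹ ^ N * b := by rw [hb, ← mul_assoc, ← mul_pow, inv_mul_cancel₀ ht0, one_pow, one_mul]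
    rw [this, map_mul, map_mul, map_pow, map_pow, hw]; ring
  have h5 : rescale t (E a) * PowerSeries.C t ^ N ∈ psub (V P).toSubring := by
    rw [h4]; exact mul_mem (pow_mem hwV N) hEb
  have h6 := h5 i
  rw [← map_pow, PowerSeries.coeff_mul_C, coeff_rescale] at h6
  have : t ^ (N + i) * PowerSeries.coeff i (E a) = t ^ i * PowerSeries.coeff i (E a) * t ^ N := by ring
  rw [this]; exact h6

/-! ### the second chart -/

section chart
variable {z0 : k} {x : L} {κ : ℕ} {v : ι → L}

theorem x_tr (hc : IsCov f z y) (hx : x = (z - algebraMap k L z0)⁻¹) : Transcendental k x := by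
  intro h
  apply hc.tr
  have h1 : IsAlgebraic k (x⁻¹ + algebraMap k L z0) := (IsAlgebraic.inv h).add (isAlgebraic_algebraMap _)
  rw [hx, inv_inv, sub_add_cancel] at h1
  exact h1

theorem x_ne (hc : IsCov f z y) (hx : x = (z - algebraMap k L z0)⁻¹) : x ≠ 0 := by
  intro h; apply x_tr hc hx; rw [h]; exact isAlgebraic_zero

theorem x_adj (hx : x = (z - algebraMap k L z0)⁻¹) : k⟮x⟯ = k⟮z⟯ := by
  apply le_antisymm
  · rw [adjoin_simple_le_iff, hx]
    exact inv_mem (sub_mem (mem_adjoin_simple_self k z) (IntermediateField.algebraMap_mem _ _))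
  · rw [adjoin_simple_le_iff]
    have : z = x⁻¹ + algebraMap k L z0 := by rw [hx, inv_inv, sub_add_cancel]
    have h2 : x⁻¹ + algebraMap k L z0 ∈ k⟮x⟯ :=
      add_mem (inv_mem (mem_adjoin_simple_self k x)) (IntermediateField.algebraMap_mem _ _)
    rwa [← this] at h2

theorem evz_mul_pow (hc : IsCov f z y) (hx : x = (z - algebraMap k L z0)⁻¹) (g : k[X]) (N : ℕ)
    (hg : g.natDegree ≤ N) : evz k z g * x ^ N ∈ (evz k x).range := by
  have hxz : z * x = algebraMap k L z0 * x + 1 := by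
    have h1 : (z - algebraMap k L z0) * x = 1 := by
      have := x_ne hc hx
      rw [hx, mul_inv_cancel₀]
      intro h; apply this; rw [hx, h, inv_zero]
    linear_combination h1
  have hC : ∀ c : k, algebraMap k L c ∈ (evz k x).range := fun c => ⟨Polynomial.C c, by simp⟩
  have hX : x ∈ (evz k x).range := ⟨Polynomial.X, by simp⟩
  have : evz k z g * x ^ N = ∑ l ∈ Finset.range (N+1), algebraMap k L (g.coeff l) * (algebraMap k L z0 * x + 1) ^ l * x ^ (N - l) := by
    rw [show evz k z g = aeval z g from rfl, aeval_eq_sum_range' (Nat.lt_succ_of_le hg), Finset.sum_mul]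
    refine Finset.sum_congr rfl fun l hl => ?_
    rw [Finset.mem_range] at hl
    have : x ^ N = x ^ l * x ^ (N - l) := by rw [← pow_add]; congr 1; omega
    rw [this, ← hxz, Algebra.smul_def, mul_pow]; ring
  rw [this]
  exact sum_mem fun l _ => mul_mem (mul_mem (hC _) (pow_mem (add_mem (mul_mem (hC _) hX) (one_mem _)) _)) (pow_mem hX _)

theorem v_integral (hc : IsCov f z y) (hx : x = (z - algebraMap k L z0)⁻¹) (hκ : ∀ j, (f.coeff j).natDegree ≤ κ)
    (i : ι) : (evz k x).IsIntegralElem (x ^ κ * y i) := by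
  set F := f.map (evz k z) with hF
  have hFm : F.Monic := by
    rw [hF, hc.fac]; exact monic_prod_of_monic _ _ fun i _ => monic_X_sub_C _
  have hp : (F.scaleRoots (x ^ κ)) ∈ lifts (evz k x) := by
    rw [lifts_iff_coeff_lifts]
    intro n
    rw [coeff_scaleRoots, hF, Polynomial.coeff_map]
    rcases lt_or_ge n F.natDegree with h | h
    · obtain ⟨e, he⟩ : ∃ e, F.natDegree - n = e + 1 := ⟨F.natDegree - n - 1, by omega⟩
      rw [← hF, he, ← pow_mul]
      have : evz k z (f.coeff n) * x ^ (κ * (e+1)) ∈ (evz k x).range :=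
        evz_mul_pow hc hx _ _ ((hκ n).trans (by nlinarith))
      exact this
    · rw [← hF, Nat.sub_eq_zero_of_le h, pow_zero, mul_one, ← Polynomial.coeff_map, ← hF]
      rcases h.lt_or_eq with h | h
      · rw [coeff_eq_zero_of_natDegree_lt h]; exact zero_mem (evz k x).range
      · rw [← h]
        change F.leadingCoeff ∈ (evz k x).range
        rw [hFm.leadingCoeff]; exact one_mem (evz k x).range
  obtain ⟨p, hp1, _, hp2⟩ := lifts_and_natDegree_eq_and_monic hp
    ((monic_scaleRoots_iff _).2 hFm)
  refine ⟨p, hp2, ?_⟩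
  rw [← eval_map, hp1]
  have h0 : Polynomial.eval₂ (RingHom.id L) (y i) F = 0 := by
    rw [eval₂_id, hF, hc.fac, eval_prod]
    exact Finset.prod_eq_zero (Finset.mem_univ i) (by simp)
  have := scaleRoots_eval₂_eq_zero (RingHom.id L) h0 (s := x ^ κ)
  simpa [eval₂_id] using this

open Classical in
/-- the discriminant-like element -/
noncomputable def disc (v : ι → L) : L := ∏ p ∈ (Finset.univ.image v).offDiag, (p.1 - p.2)

theorem disc_ne (v : ι → L) : disc v ≠ 0 := by
  classical
  rw [disc, Finset.prod_ne_zero_iff]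
  intro p hp; rw [Finset.mem_offDiag] at hp; exact sub_ne_zero.2 hp.2.2

theorem E_mem_O1 (hc : IsCov f z y) (hE : IsE k z E) (hx : x = (z - algebraMap k L z0)⁻¹)
    (hκ : ∀ j, (f.coeff j).natDegree ≤ κ) (hv : ∀ i, v i = x ^ κ * y i) {a : L} (ha : a ∈ O0 k x v) :
    rescale (disc v ^ 2) (E a) ∈ psub (O0 k x v).toSubring := by
  classical
  have hxO : x ∈ O0 k x v := z_mem_O0 x v
  have hvO : ∀ i, v i ∈ O0 k x v := y_mem_O0 x v
  have hδ : disc v ∈ O0 k x v := by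
    refine prod_mem fun p hp => ?_
    rw [Finset.mem_offDiag] at hp
    obtain ⟨i, _, hi⟩ := Finset.mem_image.1 hp.1
    obtain ⟨j, _, hj⟩ := Finset.mem_image.1 hp.2.1
    rw [← hi, ← hj]; exact sub_mem (hvO i) (hvO j)
  have hEx : E x ∈ psub (O0 k x v).toSubring := by
    have hx0 := x_ne hc hx
    have h1 : (1 + PowerSeries.C x * PowerSeries.X) * (PowerSeries.C x⁻¹ * E x) = 1 := by
      have h2 : E x * (PowerSeries.C x⁻¹ + PowerSeries.X) = 1 := by
        have : x⁻¹ = z - algebraMap k L z0 := by rw [hx, inv_inv]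
        rw [this, ← hE.sub, ← this, ← map_mul, mul_inv_cancel₀ hx0, map_one]
      have h3 : PowerSeries.C x * PowerSeries.C x⁻¹ = (1 : PowerSeries L) := by
        rw [← map_mul, mul_inv_cancel₀ hx0, map_one]
      linear_combination h2 + PowerSeries.X * E x * h3
    have h2 := psub_inv (O := (O0 k x v).toSubring)
      (add_mem (one_mem _) (mul_mem (C_mem_psub hxO) X_mem_psub)) h1 (by simp)
    have h3 : E x = PowerSeries.C x * (PowerSeries.C x⁻¹ * E x) := by
      rw [← mul_assoc, ← map_mul, mul_inv_cancel₀ hx0, map_one, one_mul]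
    rw [h3]; exact mul_mem (C_mem_psub hxO) h2
  refine O0_induction (p := fun a => rescale (disc v ^ 2) (E a) ∈ psub (O0 k x v).toSubring)
    ?_ ?_ ?_ ?_ ?_ ha
  · intro c; rw [hE.const, rescale_C']; exact C_mem_psub ((O0 k x v).algebraMap_mem c)
  · exact rescale_mem_psub hEx (pow_mem hδ 2)
  · intro i
    set d := ∏ a ∈ (orb hc (v i)).filter (· ≠ v i), (v i - a) with hd
    have hintg : (evz k x).IsIntegralElem (v i) := by rw [hv]; exact v_integral hc hx hκ i
    have h1 := den_app hc hE (x_tr hc hx) (x_adj hx) hintg (O0 k x v) hEx (hvO i) d hd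
    have hxz : x ∈ k⟮z⟯ := x_adj hx ▸ mem_adjoin_simple_self k x
    have hsub : ((orb hc (v i)).filter (· ≠ v i)).image (fun a => (v i, a)) ⊆ (Finset.univ.image v).offDiag := by
      intro p hp
      obtain ⟨a, ha, rfl⟩ := Finset.mem_image.1 hp
      rw [Finset.mem_filter] at ha
      obtain ⟨h, rfl⟩ := (mem_orb hc).1 ha.1
      rw [Finset.mem_offDiag]
      refine ⟨Finset.mem_image_of_mem _ (Finset.mem_univ _), ?_, ha.2.symm⟩
      obtain ⟨j, hj⟩ := hc.perm h i
      refine Finset.mem_image.2 ⟨j, Finset.mem_univ _, ?_⟩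
      rw [hv, hv, map_mul, map_pow, hj, show h x = x from h.commutes ⟨x, hxz⟩]
    have hdd : ∃ e ∈ O0 k x v, disc v = e * d := by
      refine ⟨∏ p ∈ (Finset.univ.image v).offDiag \ ((orb hc (v i)).filter (· ≠ v i)).image (fun a => (v i, a)),
        (p.1 - p.2), ?_, ?_⟩
      · refine prod_mem fun p hp => ?_
        rw [Finset.mem_sdiff, Finset.mem_offDiag] at hp
        obtain ⟨i, _, hi⟩ := Finset.mem_image.1 hp.1.1
        obtain ⟨j, _, hj⟩ := Finset.mem_image.1 hp.1.2.1
        rw [← hi, ← hj]; exact sub_mem (hvO i) (hvO j)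
      · rw [disc, ← Finset.prod_sdiff hsub, Finset.prod_image (fun a _ b _ h => (Prod.mk.inj h).2)]
    obtain ⟨e, he, hde⟩ := hdd
    intro n
    have h2 := h1 n
    rw [coeff_rescale] at h2 ⊢
    rw [hde, mul_pow, mul_pow, mul_assoc]
    exact mul_mem (pow_mem (pow_mem he 2) n) h2
  · intro a _ b _ h1 h2; rw [map_add, map_add]; exact add_mem h1 h2
  · intro a _ b _ h1 h2; rw [map_mul, map_mul]; exact mul_mem h1 h2

end chart
end CDM

namespace CDM

variable {k L ι : Type} [Field k] [Field L] [Algebra k L] [Fintype ι]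
variable {f : k[X][X]} {z : L} {y : ι → L}

theorem sep_pts {O : Subalgebra k L} (T : Finset (O →ₐ[k] k)) (P : O →ₐ[k] k) (hP : P ∉ T) :
    ∃ a : O, P a = 1 ∧ ∀ Q ∈ T, Q a = 0 := by
  classical
  have h1 : ∀ Q : O →ₐ[k] k, Q ∈ T → ∃ a : O, P a = 1 ∧ Q a = 0 := by
    intro Q hQ
    have hne : P ≠ Q := by rintro rfl; exact hP hQ
    obtain ⟨b, hb⟩ := DFunLike.ne_iff.1 hne
    refine ⟨algebraMap k O (P b - Q b)⁻¹ * (b - algebraMap k O (Q b)), ?_, ?_⟩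
    · rw [map_mul, map_sub, AlgHom.commutes, AlgHom.commutes]
      exact inv_mul_cancel₀ (sub_ne_zero.2 hb)
    · rw [map_mul, map_sub, AlgHom.commutes, AlgHom.commutes]
      simp
  choose! s hs using h1
  refine ⟨∏ Q ∈ T, s Q, ?_, ?_⟩
  · rw [map_prod]; exact Finset.prod_eq_one fun Q hQ => (hs Q hQ).1
  · intro Q hQ; rw [map_prod]; exact Finset.prod_eq_zero hQ (hs Q hQ).2

/-- restriction of scalars of a Galois automorphism -/
noncomputable def hres (h : L ≃ₐ[k⟮z⟯] L) : L →ₐ[k] L := (h : L →ₐ[k⟮z⟯] L).restrictScalars k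

theorem hres_apply (h : L ≃ₐ[k⟮z⟯] L) (a : L) : hres h a = h a := rfl

theorem h_z (h : L ≃ₐ[k⟮z⟯] L) : h z = z :=
  h.commutes ⟨z, mem_adjoin_simple_self k z⟩

theorem hres_O0 (hc : IsCov f z y) (h : L ≃ₐ[k⟮z⟯] L) : ∀ a ∈ O0 k z y, hres h a ∈ O0 k z y := by
  intro a ha
  refine O0_induction (p := fun a => hres h a ∈ O0 k z y) ?_ ?_ ?_ ?_ ?_ ha
  · intro c; rw [AlgHom.commutes]; exact Subalgebra.algebraMap_mem _ _
  · rw [hres_apply, h_z]; exact z_mem_O0 z y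
  · intro i; obtain ⟨j, hj⟩ := hc.perm h i; rw [hres_apply, hj]; exact y_mem_O0 z y j
  · intro a _ b _ h1 h2; rw [map_add]; exact add_mem h1 h2
  · intro a _ b _ h1 h2; rw [map_mul]; exact mul_mem h1 h2

theorem O0_integral (hy : ∀ i, (evz k z).IsIntegralElem (y i)) {a : L} (ha : a ∈ O0 k z y) :
    (evz k z).IsIntegralElem a := by
  refine O0_induction (p := fun a => (evz k z).IsIntegralElem a) ?_ ?_ hy ?_ ?_ ha
  · intro c
    have := (evz k z).isIntegralElem_map (x := Polynomial.C c)
    simpa using this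
  · have := (evz k z).isIntegralElem_map (x := Polynomial.X)
    simpa using this
  · intro a _ b _ h1 h2; exact RingHom.IsIntegralElem.add _ h1 h2
  · intro a _ b _ h1 h2; exact RingHom.IsIntegralElem.mul _ h1 h2

theorem pt_trans (hc : IsCov f z y) (P P' : O0 k z y →ₐ[k] k) (hz : rv P z = rv P' z) :
    ∃ h : L ≃ₐ[k⟮z⟯] L, P' = pcomp P (hres h) (hres_O0 hc h) := by
  classical
  have := hc.fin
  have := hc.gal
  by_contra hcon
  push Not at hcon
  obtain ⟨a, ha1, ha2⟩ := sep_pts (Finset.univ.image fun h : L ≃ₐ[k⟮z⟯] L => pcomp P (hres h) (hres_O0 hc h)) P'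
    (by simp only [Finset.mem_image, Finset.mem_univ, true_and, not_exists]; exact fun h e => hcon h e.symm)
  set b : L := 1 - a with hb
  have hbO : b ∈ O0 k z y := sub_mem (one_mem _) a.2
  have hhb : ∀ h : L ≃ₐ[k⟮z⟯] L, h b ∈ O0 k z y := fun h => hres_O0 hc h b hbO
  set n : L := ∏ h : L ≃ₐ[k⟮z⟯] L, h b with hn
  have hnfix : n ∈ k⟮z⟯ := by
    have h1 : n ∈ Set.range (algebraMap k⟮z⟯ L) := by
      refine (IsGalois.mem_range_algebraMap_iff_fixed n).2 fun g => ?_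
      rw [hn, map_prod]
      exact Fintype.prod_equiv (Equiv.mulLeft g) _ _ fun h => rfl
    obtain ⟨c, hc'⟩ := h1
    rw [← hc']; exact c.2
  have hnO : n ∈ O0 k z y := prod_mem fun h _ => hhb h
  obtain ⟨g, hg⟩ := mem_range_of_integral hc.tr hnfix (O0_integral hc.y_integral hnO)
  have e1 : rv P' n = 0 := by
    rw [hn, rv_prod _ fun h _ => mem_V_of_mem (hhb h)]
    refine Finset.prod_eq_zero (Finset.mem_univ 1) ?_
    have : (⟨b, hbO⟩ : O0 k z y) = 1 - a := by ext; rfl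
    change rv P' b = 0
    rw [rv_of_mem hbO, this, map_sub, map_one, ha1, sub_self]
  have e2 : rv P n = 1 := by
    rw [hn, rv_prod _ fun h _ => mem_V_of_mem (hhb h)]
    refine Finset.prod_eq_one fun h _ => ?_
    have h1 := ha2 _ (Finset.mem_image_of_mem _ (Finset.mem_univ h))
    have h2 := (pcomp_spec (P := P) (hres_O0 hc h) (mem_V_of_mem hbO)).2
    change rv P (hres h b) = 1
    rw [h2, rv_of_mem hbO]
    have : (⟨b, hbO⟩ : O0 k z y) = 1 - a := by ext; rfl
    rw [this, map_sub, map_one, h1, sub_zero]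
  rw [← hg, (evz_mem_V g).2] at e1 e2
  rw [hz, e1] at e2
  exact zero_ne_one e2

theorem pt_ext {P P' : O0 k z y →ₐ[k] k} (hz : rv P z = rv P' z) (hy : ∀ i, rv P (y i) = rv P' (y i)) : P = P' := by
  have : ∀ a (ha : a ∈ O0 k z y), rv P a = rv P' a := by
    intro a ha
    refine O0_induction (p := fun a => rv P a = rv P' a) ?_ hz hy ?_ ?_ ha
    · intro c; rw [rv_alg, rv_alg]
    · intro a ha b hb h1 h2; rw [rv_add (mem_V_of_mem ha) (mem_V_of_mem hb), rv_add (mem_V_of_mem ha) (mem_V_of_mem hb), h1, h2]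
    · intro a ha b hb h1 h2; rw [rv_mul (mem_V_of_mem ha) (mem_V_of_mem hb), rv_mul (mem_V_of_mem ha) (mem_V_of_mem hb), h1, h2]
  ext a
  have := this a a.2
  rwa [rv_of_mem a.2, rv_of_mem a.2] at this

/-- points above `z0` -/
def Pt (k : Type) {L ι : Type} [Field k] [Field L] [Algebra k L] (z : L) (y : ι → L) (z0 : k) : Type :=
  {P : O0 k z y →ₐ[k] k // rv P z = z0}

theorem rv_hres (hc : IsCov f z y) (P : O0 k z y →ₐ[k] k) (h : L ≃ₐ[k⟮z⟯] L) :
    rv (pcomp P (hres h) (hres_O0 hc h)) z = rv P z := by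
  rw [← (pcomp_spec (P := P) (hres_O0 hc h) (mem_V_of_mem (z_mem_O0 z y))).2, hres_apply, h_z]

theorem pt_finite (hc : IsCov f z y) (z0 : k) : Finite (Pt k z y z0) ∧
    Nat.card (Pt k z y z0) ≤ Module.finrank k⟮z⟯ L := by
  classical
  have := hc.fin
  have := hc.gal
  rcases isEmpty_or_nonempty (Pt k z y z0) with hE | ⟨⟨P, hP⟩⟩
  · exact ⟨inferInstance, by rw [Nat.card_of_isEmpty]; exact Nat.zero_le _⟩
  · have hs : Function.Surjective (fun h : L ≃ₐ[k⟮z⟯] L =>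
        (⟨pcomp P (hres h) (hres_O0 hc h), (rv_hres hc P h).trans hP⟩ : Pt k z y z0)) := by
      rintro ⟨P', hP'⟩
      obtain ⟨h, hh⟩ := pt_trans hc P P' (hP.trans hP'.symm)
      exact ⟨h, Subtype.ext hh.symm⟩
    refine ⟨Finite.of_surjective _ hs, ?_⟩
    refine (Nat.card_le_card_of_surjective _ hs).trans ?_
    rw [← IsGalois.card_aut_eq_finrank]

theorem pt_exists [IsAlgClosed k] (hc : IsCov f z y) (z0 : k) : Nonempty (Pt k z y z0) := by
  classical
  set s : O0 k z y := ⟨z, z_mem_O0 z y⟩ - algebraMap k _ z0 with hs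
  have hsL : (s : L) = z - algebraMap k L z0 := rfl
  have hs0 : (s : L) ≠ 0 := by
    intro h
    rw [hsL, sub_eq_zero] at h
    apply hc.tr; rw [h]; exact isAlgebraic_algebraMap _
  have hnu : ¬ IsUnit s := by
    intro hu
    obtain ⟨b, hb⟩ := hu.exists_right_inv
    have hb' : (s : L) * b = 1 := by have := congrArg Subtype.val hb; simpa using this
    have hbinv : (b : L) = (s : L)⁻¹ := eq_inv_of_mul_eq_one_right hb'
    have hbk : (b : L) ∈ k⟮z⟯ := by
      rw [hbinv, hsL]
      exact inv_mem (sub_mem (mem_adjoin_simple_self k z) (IntermediateField.algebraMap_mem _ _))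
    obtain ⟨g, hg⟩ := mem_range_of_integral hc.tr hbk (O0_integral hc.y_integral b.2)
    have h2 : evz k z ((Polynomial.X - Polynomial.C z0) * g) = evz k z 1 := by
      rw [map_mul, hg, map_one, ← hb', hsL]; simp
    have hinj : Function.Injective (evz k z) := transcendental_iff_injective.1 hc.tr
    have h3 := hinj h2
    have h4 := congrArg (eval z0) h3
    simp at h4
  obtain ⟨M, hM, hsM⟩ := exists_max_ideal_of_mem_nonunits hnu
  have hfg : Algebra.FiniteType k (O0 k z y) := by
    rw [← Subalgebra.fg_iff_finiteType]
    refine ⟨insert z (Finset.univ.image y), ?_⟩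
    simp [O0]
  let _ : Field (O0 k z y ⧸ M) := Ideal.Quotient.field M
  have hft : Algebra.FiniteType k (O0 k z y ⧸ M) :=
    Algebra.FiniteType.of_surjective (Ideal.Quotient.mkₐ k M) (Ideal.Quotient.mkₐ_surjective k M)
  have hfin : Module.Finite k (O0 k z y ⧸ M) := finite_of_finite_type_of_isJacobsonRing k _
  have hbij := IsAlgClosed.algebraMap_bijective_of_isIntegral (k := k) (K := O0 k z y ⧸ M)
  let e : k ≃ₐ[k] (O0 k z y ⧸ M) := AlgEquiv.ofBijective (Algebra.ofId k _) hbij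
  let P : O0 k z y →ₐ[k] k := (e.symm : _ →ₐ[k] k).comp (Ideal.Quotient.mkₐ k M)
  refine ⟨P, ?_⟩
  have h1 : P s = 0 := by
    change e.symm (Ideal.Quotient.mk M s) = 0
    rw [Ideal.Quotient.eq_zero_iff_mem.2 hsM, map_zero]
  rw [hs, map_sub, AlgHom.commutes, sub_eq_zero] at h1
  rw [rv_of_mem (z_mem_O0 z y)]; exact h1

end CDM

namespace CDM

variable {k L ι : Type} [Field k] [Field L] [Algebra k L] [Fintype ι]

/-- data of the second chart -/
structure Chart (f : k[X][X]) (z : L) (y : ι → L) (κ : ℕ) (z0 : k) (x : L) (v : ι → L) : Prop where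
  hc : IsCov f z y
  hκ : ∀ j, (f.coeff j).natDegree ≤ κ
  good : ∀ P : O0 k z y →ₐ[k] k, rv P z = z0 → Good P
  hx : x = (z - algebraMap k L z0)⁻¹
  hv : ∀ i, v i = x ^ κ * y i

variable {f : k[X][X]} {z : L} {y : ι → L} {κ : ℕ} {z0 : k} {x : L} {v : ι → L}

theorem Chart.t_eq (_ : Chart f z y κ z0 x v) : x⁻¹ = z - algebraMap k L z0 := by
  rw [‹Chart f z y κ z0 x v›.hx, inv_inv]

theorem Chart.x0 (h : Chart f z y κ z0 x v) : x ≠ 0 := x_ne h.hc h.hx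

theorem Chart.tV (h : Chart f z y κ z0 x v) (P : O0 k z y →ₐ[k] k) : x⁻¹ ∈ V P := by
  rw [h.t_eq]; exact sub_mem (mem_V_of_mem (z_mem_O0 z y)) ((V P).algebraMap_mem _)

theorem Chart.rt (h : Chart f z y κ z0 x v) (P : O0 k z y →ₐ[k] k) : rv P x⁻¹ = rv P z - z0 := by
  rw [h.t_eq, rv_sub (mem_V_of_mem (z_mem_O0 z y)) ((V P).algebraMap_mem _), rv_alg]

theorem Chart.div (h : Chart f z y κ z0 x v) (P : Pt k z y z0) {a : L} (ha : a ∈ V P.1)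
    (h0 : rv P.1 a = 0) : a * x ∈ V P.1 := by
  have := div_t_mem h.hc (h.good P.1 P.2) ha h0
  rw [P.2, ← h.hx] at this; exact this

/-- Riemann-Roch type space -/
def LL (k : Type) {L ι : Type} [Field k] [Field L] [Algebra k L] (z : L) (y : ι → L) (z0 : k) (x : L) (v : ι → L)
    (N : Pt k z y z0 → ℕ) : Submodule k L where
  carrier := {a | a ∈ O0 k x v ∧ ∀ P : Pt k z y z0, x⁻¹ ^ N P * a ∈ V P.1}
  zero_mem' := ⟨zero_mem _, fun P => by rw [mul_zero]; exact zero_mem _⟩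
  add_mem' := by
    rintro a b ⟨h1, h2⟩ ⟨h3, h4⟩
    exact ⟨add_mem h1 h3, fun P => by rw [mul_add]; exact add_mem (h2 P) (h4 P)⟩
  smul_mem' := by
    rintro c a ⟨h1, h2⟩
    exact ⟨Subalgebra.smul_mem _ h1 c, fun P => by rw [mul_smul_comm]; exact Subalgebra.smul_mem _ (h2 P) c⟩

theorem Chart.mono (h : Chart f z y κ z0 x v) {N N' : Pt k z y z0 → ℕ} (hN : ∀ P, N P ≤ N' P) :
    LL k z y z0 x v N ≤ LL k z y z0 x v N' := by
  rintro a ⟨h1, h2⟩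
  refine ⟨h1, fun P => ?_⟩
  have : x⁻¹ ^ N' P * a = x⁻¹ ^ (N' P - N P) * (x⁻¹ ^ N P * a) := by
    rw [← mul_assoc, ← pow_add, Nat.sub_add_cancel (hN P)]
  rw [this]; exact mul_mem (pow_mem (h.tV _) _) (h2 P)

theorem LL_mul {N N' : Pt k z y z0 → ℕ} {a b : L} (ha : a ∈ LL k z y z0 x v N) (hb : b ∈ LL k z y z0 x v N') :
    a * b ∈ LL k z y z0 x v (N + N') := by
  refine ⟨mul_mem ha.1 hb.1, fun P => ?_⟩
  have : x⁻¹ ^ (N + N') P * (a * b) = (x⁻¹ ^ N P * a) * (x⁻¹ ^ N' P * b) := by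
    rw [Pi.add_apply, pow_add]; ring
  rw [this]; exact mul_mem (ha.2 P) (hb.2 P)

theorem LL_one : (1 : L) ∈ LL k z y z0 x v 0 :=
  ⟨one_mem _, fun P => by simp⟩

theorem LL_pow {N : Pt k z y z0 → ℕ} {a : L} (ha : a ∈ LL k z y z0 x v N) (n : ℕ) :
    a ^ n ∈ LL k z y z0 x v (n • N) := by
  induction n with
  | zero => simpa using LL_one
  | succ n ih => rw [pow_succ, succ_nsmul]; exact LL_mul ih ha

theorem evx_const (h : Chart f z y κ z0 x v) (P : Pt k z y z0) (g : k[X]) (hg : evz k x g ∈ V P.1) :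
    g.natDegree = 0 := by
  by_contra hd
  have hg0 : g ≠ 0 := by rintro rfl; simp at hd
  have hx0 := h.x0
  let _ := invertibleOfNonzero hx0
  have h1 := eval₂_reverse_mul_pow (algebraMap k L) x g
  have h2 : evz k x⁻¹ g.reverse = x⁻¹ ^ g.natDegree * evz k x g := by
    change _ = _ * Polynomial.eval₂ (algebraMap k L) x g
    rw [← h1, invOf_eq_inv, mul_comm, mul_assoc, ← mul_pow, mul_inv_cancel₀ hx0, one_pow, mul_one]
    rfl
  have h3 : rv P.1 (x⁻¹ ^ g.natDegree * evz k x g) = 0 := by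
    rw [rv_mul (pow_mem (h.tV _) _) hg, rv_pow (h.tV _), h.rt, P.2, sub_self, zero_pow hd, zero_mul]
  have h4 : rv P.1 (evz k x⁻¹ g.reverse) = g.leadingCoeff := by
    have e : aeval (⟨x⁻¹, h.tV P.1⟩ : V P.1) g.reverse = evz k x⁻¹ g.reverse := by
      exact (aeval_algHom_apply (V P.1).val ⟨x⁻¹, h.tV P.1⟩ g.reverse).symm
    have e2 := aeval_algHom_apply (res P.1) ⟨x⁻¹, h.tV P.1⟩ g.reverse
    rw [← e]
    change res P.1 (aeval _ _) = _
    rw [← e2]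
    have e3 : res P.1 ⟨x⁻¹, h.tV P.1⟩ = 0 := by change rv P.1 x⁻¹ = 0; rw [h.rt, P.2, sub_self]
    rw [e3, ← coeff_zero_reverse, coeff_zero_eq_aeval_zero]
  rw [← h2, h4] at h3
  exact hg0 (leadingCoeff_eq_zero.1 h3)

theorem alg_const [IsAlgClosed k] {a : L} (ha : IsAlgebraic k a) : ∃ c : k, a = algebraMap k L c := by
  have h1 := minpoly.irreducible ha.isIntegral
  have h2 := IsAlgClosed.degree_eq_one_of_irreducible k h1
  obtain ⟨c, hc⟩ := minpoly.mem_range_of_degree_eq_one k a h2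
  exact ⟨c, hc.symm⟩

theorem LL_zero [IsAlgClosed k] (h : Chart f z y κ z0 x v) {a : L} (ha : a ∈ LL k z y z0 x v 0) :
    ∃ c : k, a = algebraMap k L c := by
  classical
  obtain ⟨P⟩ := pt_exists h.hc z0
  have hintg : (evz k x).IsIntegralElem a := O0_integral (fun i => by
    rw [h.hv]; exact v_integral h.hc h.hx h.hκ i) ha.1
  obtain ⟨m, hm⟩ := orbit_poly h.hc (x_tr h.hc h.hx) (x_adj h.hx) hintg
  have haV : ∀ b ∈ orb h.hc a, b ∈ V P.1 := by
    intro b hb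
    obtain ⟨s, rfl⟩ := (mem_orb h.hc).1 hb
    have h1 := ha.2 ⟨pcomp P.1 (hres s) (hres_O0 h.hc s), (rv_hres h.hc P.1 s).trans P.2⟩
    change x⁻¹ ^ 0 * a ∈ _ at h1
    rw [pow_zero, one_mul] at h1
    exact (pcomp_spec (P := P.1) (hres_O0 h.hc s) h1).1
  have hco : ∀ n, (m.coeff n).natDegree = 0 := by
    intro n
    apply evx_const h P
    rw [← Polynomial.coeff_map, hm]
    exact coeff_prod_mem (V P.1).toSubring _ haV n
  obtain ⟨m0, hm0⟩ : ∃ m0 : k[X], m = m0.map Polynomial.C := by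
    refine ⟨m.map (evalRingHom 0), ?_⟩
    ext1 n
    rw [Polynomial.coeff_map, Polynomial.coeff_map]
    conv_lhs => rw [eq_C_of_natDegree_eq_zero (hco n)]
    rw [coe_evalRingHom, coeff_zero_eq_eval_zero]
  rw [hm0, Polynomial.map_map] at hm
  have e : (evz k x).comp Polynomial.C = algebraMap k L := by ext c; simp
  rw [e] at hm
  apply alg_const
  refine ⟨m0, ?_, ?_⟩
  · rintro rfl
    rw [Polynomial.map_zero] at hm
    have h1 : (∏ a ∈ orb h.hc a, (Polynomial.X - Polynomial.C a)).Monic :=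
      monic_prod_of_monic _ _ fun i _ => monic_X_sub_C _
    rw [← hm] at h1
    exact h1.ne_zero rfl
  · rw [← eval_map_algebraMap, hm, eval_prod]
    exact Finset.prod_eq_zero (self_mem_orb h.hc a) (by simp)

/-- codimension one step -/
theorem finrank_step {M : Type} [AddCommGroup M] [Module k M] (S T : Submodule k M) (φ : T →ₗ[k] k)
    (hφ : ∀ a : T, φ a = 0 → (a : M) ∈ S) [FiniteDimensional k S] :
    FiniteDimensional k T ∧ Module.finrank k T ≤ Module.finrank k S + 1 := by
  let ψ : LinearMap.ker φ →ₗ[k] S := (T.subtype.comp (LinearMap.ker φ).subtype).codRestrict S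
    (fun a => hφ _ a.2)
  have hψ : Function.Injective ψ := by
    intro a b hab
    have := congrArg Subtype.val hab
    exact Subtype.ext (Subtype.ext this)
  have h1 : FiniteDimensional k (LinearMap.ker φ) := FiniteDimensional.of_injective ψ hψ
  have h2 : FiniteDimensional k T := by
    have : Module.Finite k (T ⧸ LinearMap.ker φ) := Module.Finite.equiv φ.quotKerEquivRange.symm
    exact Module.Finite.of_submodule_quotient (LinearMap.ker φ)
  refine ⟨h2, ?_⟩
  rw [← LinearMap.finrank_range_add_finrank_ker φ]
  have h3 := LinearMap.finrank_le_finrank_of_injective hψ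
  have h4 := Submodule.finrank_le (LinearMap.range φ)
  rw [Module.finrank_self] at h4
  omega

open Classical in
theorem LL_step (h : Chart f z y κ z0 x v) (N : Pt k z y z0 → ℕ) (P : Pt k z y z0)
    [FiniteDimensional k (LL k z y z0 x v N)] :
    FiniteDimensional k (LL k z y z0 x v (N + Pi.single P 1)) ∧
    Module.finrank k (LL k z y z0 x v (N + Pi.single P 1)) ≤ Module.finrank k (LL k z y z0 x v N) + 1 := by
  have hm : ∀ a : LL k z y z0 x v (N + Pi.single P 1), x⁻¹ ^ (N P + 1) * (a : L) ∈ V P.1 := fun a => by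
    have := a.2.2 P
    simpa using this
  let φ : LL k z y z0 x v (N + Pi.single P 1) →ₗ[k] k :=
    { toFun := fun a => rv P.1 (x⁻¹ ^ (N P + 1) * (a : L))
      map_add' := fun a b => by
        rw [← rv_add (hm a) (hm b), ← mul_add]; rfl
      map_smul' := fun c a => by
        rw [RingHom.id_apply, smul_eq_mul, ← rv_smul c (hm a), ← mul_smul_comm]; rfl }
  refine finrank_step _ _ φ ?_
  intro a ha
  refine ⟨a.2.1, fun Q => ?_⟩
  by_cases hQ : Q = P
  · subst hQ
    have h1 := h.div Q (hm a) ha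
    have : x⁻¹ ^ (N Q + 1) * (a : L) * x = x⁻¹ ^ N Q * a := by
      have := h.x0
      rw [pow_succ]; field_simp
    rwa [this] at h1
  · have := a.2.2 Q
    simpa [Pi.single_apply, hQ] using this

theorem LL_add (h : Chart f z y κ z0 x v) (N N' : Pt k z y z0 → ℕ) [Fintype (Pt k z y z0)]
    [FiniteDimensional k (LL k z y z0 x v N)] :
    FiniteDimensional k (LL k z y z0 x v (N + N')) ∧
    Module.finrank k (LL k z y z0 x v (N + N')) ≤ Module.finrank k (LL k z y z0 x v N) + ∑ P, N' P := by
  classical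
  generalize hs : ∑ P, N' P = s
  induction s generalizing N' with
  | zero =>
    have : N' = 0 := by
      ext P; exact Finset.sum_eq_zero_iff.1 hs P (Finset.mem_univ P)
    rw [this, add_zero]; exact ⟨inferInstance, le_rfl⟩
  | succ s ih =>
    obtain ⟨P, hP⟩ : ∃ P, N' P ≠ 0 := by
      by_contra hcon
      push Not at hcon
      rw [Finset.sum_eq_zero fun P _ => hcon P] at hs; omega
    set N'' : Pt k z y z0 → ℕ := fun Q => N' Q - (Pi.single P 1 : Pt k z y z0 → ℕ) Q with hN''
    have e : N' = N'' + Pi.single P 1 := by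
      ext Q
      by_cases hQ : Q = P
      · subst hQ; simp [hN'']; omega
      · simp [hN'', Pi.single_apply, hQ]
    have hsum : ∑ P, N'' P = s := by
      rw [e] at hs
      simp only [Pi.add_apply, Finset.sum_add_distrib, Finset.sum_pi_single', Finset.mem_univ, if_true] at hs
      have : ∑ Q, (Pi.single P 1 : Pt k z y z0 → ℕ) Q = 1 := by
        simp [Pi.single_apply]
      omega
    obtain ⟨h1, h2⟩ := ih N'' hsum
    rw [e, ← add_assoc]
    obtain ⟨h3, h4⟩ := LL_step h (N + N'') P
    exact ⟨h3, by omega⟩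

theorem LL_zero_fin [IsAlgClosed k] (h : Chart f z y κ z0 x v) : FiniteDimensional k (LL k z y z0 x v 0) ∧
    Module.finrank k (LL k z y z0 x v 0) ≤ 1 := by
  have h1 : LL k z y z0 x v 0 ≤ Submodule.span k {(1 : L)} := by
    intro a ha
    obtain ⟨c, rfl⟩ := LL_zero h ha
    rw [Submodule.mem_span_singleton]
    exact ⟨c, by rw [Algebra.smul_def, mul_one]⟩
  have : FiniteDimensional k (LL k z y z0 x v 0) := Submodule.finiteDimensional_of_le h1
  exact ⟨this, (Submodule.finrank_mono h1).trans ((finrank_span_le_card _).trans (by simp))⟩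

theorem LL_fin [IsAlgClosed k] (h : Chart f z y κ z0 x v) (N : Pt k z y z0 → ℕ) [Fintype (Pt k z y z0)] :
    FiniteDimensional k (LL k z y z0 x v N) ∧
    Module.finrank k (LL k z y z0 x v N) ≤ 1 + ∑ P, N P := by
  obtain ⟨h1, h2⟩ := LL_zero_fin h
  obtain ⟨h3, h4⟩ := LL_add h 0 N
  rw [zero_add] at h3 h4
  exact ⟨h3, by omega⟩

end CDM

namespace CDM

variable {k L ι : Type} [Field k] [Field L] [Algebra k L] [Fintype ι]
variable {f : k[X][X]} {z : L} {y : ι → L} {κ : ℕ} {z0 : k} {x : L} {v : ι → L}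

theorem pow_indep {A : Type} [Field A] [Algebra k A] {w : A} (hw : Transcendental k w) :
    LinearIndependent k (fun n : ℕ => w ^ n) := by
  have h1 := (basisMonomials k).linearIndependent
  have hinj : Function.Injective (aeval w : k[X] →ₐ[k] A) := transcendental_iff_injective.1 hw
  have h2 := h1.map' (aeval w : k[X] →ₐ[k] A).toLinearMap (LinearMap.ker_eq_bot.2 hinj)
  have e : (fun n : ℕ => w ^ n) = ⇑(aeval w : k[X] →ₐ[k] A).toLinearMap ∘ ⇑(basisMonomials k) := by
    ext n
    simp [← C_mul_X_pow_eq_monomial]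
  rw [e]; exact h2

/-- monomials with bounded exponents -/
def mons (w : ι → L) : Set L := {a | ∃ α : ι → ℕ, (∀ i, α i < card ι) ∧ a = ∏ i, w i ^ α i}

theorem span_mons (hc : IsCov f z y) : Submodule.span k⟮z⟯ (mons y) = ⊤ := by
  classical
  set S := Submodule.span k⟮z⟯ (mons y) with hS
  have h1 : (1 : L) ∈ S := Submodule.subset_span ⟨0, fun i => Fintype.card_pos_iff.2 ⟨i⟩, by simp⟩
  obtain ⟨F, hF, hF2⟩ := hc.splitting
  have hinj : Function.Injective (algebraMap k⟮z⟯ L) := (algebraMap k⟮z⟯ L).injective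
  have hFm : F.Monic := by
    apply monic_of_injective hinj
    rw [hF]; exact monic_prod_of_monic _ _ fun i _ => monic_X_sub_C _
  have hFd : F.natDegree = card ι := by
    rw [← natDegree_map_eq_of_injective hinj, hF, natDegree_prod_of_monic _ _ fun i _ => monic_X_sub_C _]
    simp
  have hrel : ∀ i, y i ^ card ι = ∑ l ∈ Finset.range (card ι), (- F.coeff l) • y i ^ l := by
    intro i
    have h2 : aeval (y i) F = 0 := by
      rw [← eval_map_algebraMap, hF, eval_prod]
      exact Finset.prod_eq_zero (Finset.mem_univ i) (by simp)
    rw [aeval_eq_sum_range, hFd, Finset.sum_range_succ, ← hFd, hFm.coeff_natDegree, one_smul, hFd] at h2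
    rw [eq_neg_of_add_eq_zero_right h2, ← Finset.sum_neg_distrib]
    exact Finset.sum_congr rfl fun l _ => by rw [neg_smul]
  have hmul : ∀ i, ∀ a ∈ S, y i * a ∈ S := by
    intro i a ha
    induction ha using Submodule.span_induction with
    | mem a ha =>
      obtain ⟨α, hα, rfl⟩ := ha
      have e0 : ∀ l, y i ^ l * ∏ j ∈ Finset.univ.erase i, y j ^ α j = ∏ j, y j ^ (Function.update α i l) j := by
        intro l
        rw [← Finset.mul_prod_erase _ _ (Finset.mem_univ i), Function.update_self]
        congr 1
        refine Finset.prod_congr rfl fun j hj => ?_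
        rw [Function.update_of_ne (Finset.ne_of_mem_erase hj)]
      have hmem : ∀ l < card ι, y i ^ l * ∏ j ∈ Finset.univ.erase i, y j ^ α j ∈ S := by
        intro l hl
        refine Submodule.subset_span ⟨Function.update α i l, ?_, e0 l⟩
        intro j
        by_cases hj : j = i
        · subst hj; rwa [Function.update_self]
        · rw [Function.update_of_ne hj]; exact hα j
      have e1 : y i * ∏ j, y j ^ α j = y i ^ (α i + 1) * ∏ j ∈ Finset.univ.erase i, y j ^ α j := by
        rw [← Finset.mul_prod_erase _ _ (Finset.mem_univ i)]; ring
      rw [e1]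
      rcases (Nat.succ_le_of_lt (hα i)).lt_or_eq with h | h
      · exact hmem _ h
      · rw [← Nat.succ_eq_add_one, h, hrel, Finset.sum_mul]
        refine Submodule.sum_mem _ fun l hl => ?_
        rw [smul_mul_assoc]
        exact Submodule.smul_mem _ _ (hmem l (Finset.mem_range.1 hl))
    | zero => rw [mul_zero]; exact zero_mem _
    | add a b _ _ h1 h2 => rw [mul_add]; exact add_mem h1 h2
    | smul c a _ h1 => rw [mul_smul_comm]; exact Submodule.smul_mem _ _ h1
  have hadj : Algebra.adjoin k⟮z⟯ (Set.range y) = ⊤ := by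
    rw [← hF2.adjoin_rootSet]
    congr 1
    ext a
    rw [mem_rootSet]
    constructor
    · rintro ⟨i, rfl⟩
      refine ⟨hFm.ne_zero, ?_⟩
      rw [← eval_map_algebraMap, hF, eval_prod]
      exact Finset.prod_eq_zero (Finset.mem_univ i) (by simp)
    · rintro ⟨_, h⟩
      rw [← eval_map_algebraMap, hF, eval_prod, Finset.prod_eq_zero_iff] at h
      obtain ⟨i, _, hi⟩ := h
      refine ⟨i, ?_⟩
      simp only [eval_sub, eval_X, eval_C, sub_eq_zero] at hi
      exact hi.symm
  rw [eq_top_iff]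
  intro a htop
  clear htop
  have ha : a ∈ Algebra.adjoin k⟮z⟯ (Set.range y) := by rw [hadj]; trivial
  have key : ∀ b ∈ S, a * b ∈ S := by
    induction ha using Algebra.adjoin_induction with
    | mem a ha => obtain ⟨i, rfl⟩ := ha; exact hmul i
    | algebraMap r => intro b hb; rw [← Algebra.smul_def]; exact Submodule.smul_mem _ _ hb
    | add a c _ _ h1 h2 => intro b hb; rw [add_mul]; exact add_mem (h1 b hb) (h2 b hb)
    | mul a c _ _ h1 h2 => intro b hb; rw [mul_assoc]; exact h1 _ (h2 b hb)
  have := key 1 h1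
  rwa [mul_one] at this

theorem span_mons_v (h : Chart f z y κ z0 x v) : Submodule.span k⟮z⟯ (mons v) = ⊤ := by
  rw [eq_top_iff, ← span_mons h.hc, Submodule.span_le]
  rintro _ ⟨α, hα, rfl⟩
  have hxz : x ∈ k⟮z⟯ := x_adj h.hx ▸ mem_adjoin_simple_self k x
  have hx0 := h.x0
  have e : ∏ i, y i ^ α i = ((⟨x, hxz⟩ : k⟮z⟯)⁻¹ ^ (κ * ∑ i, α i)) • ∏ i, v i ^ α i := by
    rw [Algebra.smul_def, map_pow, map_inv₀]
    change _ = x⁻¹ ^ _ * _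
    simp only [h.hv, mul_pow, Finset.prod_mul_distrib, ← pow_mul]
    rw [Finset.prod_pow_eq_pow_sum, ← Finset.mul_sum, ← mul_assoc, ← mul_pow, inv_mul_cancel₀ hx0, one_pow, one_mul]
  rw [e]
  exact Submodule.smul_mem _ _ (Submodule.subset_span ⟨α, hα, rfl⟩)

theorem mem_LL_mons (h : Chart f z y κ z0 x v) {a : L} (ha : a ∈ mons v) (j n : ℕ)
    (hn : j + κ * (card ι * card ι) ≤ n) :
    x ^ j * a ∈ LL k z y z0 x v (fun _ => n) := by
  obtain ⟨α, hα, rfl⟩ := ha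
  refine ⟨mul_mem (pow_mem (z_mem_O0 x v) _) (prod_mem fun i _ => pow_mem (y_mem_O0 x v i) _), fun P => ?_⟩
  have hs : ∑ i, α i ≤ card ι * card ι := by
    refine (Finset.sum_le_card_nsmul _ _ _ fun i _ => (hα i).le).trans ?_
    simp
  have hx0 := h.x0
  have e : x⁻¹ ^ n * (x ^ j * ∏ i, v i ^ α i) = x⁻¹ ^ (n - (j + κ * ∑ i, α i)) * ∏ i, y i ^ α i := by
    simp only [h.hv, mul_pow, Finset.prod_mul_distrib, ← pow_mul]
    rw [Finset.prod_pow_eq_pow_sum, ← Finset.mul_sum]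
    have : n = (n - (j + κ * ∑ i, α i)) + (j + κ * ∑ i, α i) :=
      (Nat.sub_add_cancel ((Nat.add_le_add_left (Nat.mul_le_mul_left κ hs) j).trans hn)).symm
    conv_lhs => rw [this, pow_add, pow_add]
    have e1 : x⁻¹ ^ j * x ^ j = 1 := by rw [← mul_pow, inv_mul_cancel₀ hx0, one_pow]
    have e2 : x⁻¹ ^ (κ * ∑ i, α i) * x ^ (κ * ∑ i, α i) = 1 := by rw [← mul_pow, inv_mul_cancel₀ hx0, one_pow]
    linear_combination (x⁻¹ ^ (n - (j + κ * ∑ i, α i)) * ∏ i, y i ^ α i) * (x⁻¹ ^ (κ * ∑ i, α i) * x ^ (κ * ∑ i, α i)) * e1 +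
     (x⁻¹ ^ (n - (j + κ * ∑ i, α i)) * ∏ i, y i ^ α i) * e2
  rw [e]
  exact mul_mem (pow_mem (h.tV _) _) (prod_mem fun i _ => pow_mem (mem_V_of_mem (y_mem_O0 z y i)) _)

theorem LL_lower [IsAlgClosed k] (h : Chart f z y κ z0 x v) [Fintype (Pt k z y z0)] (n : ℕ) :
    Module.finrank k⟮z⟯ L * n ≤ Module.finrank k (LL k z y z0 x v (fun _ => n)) +
      Module.finrank k⟮z⟯ L * (κ * (card ι * card ι)) := by
  classical
  set c := κ * (card ι * card ι) with hcdef
  rcases lt_or_ge n c with hn | hn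
  · exact (Nat.mul_le_mul_left _ hn.le).trans (Nat.le_add_left _ _)
  have hfin := h.hc.fin
  obtain ⟨b, hb1, hb2, hb3⟩ := exists_linearIndependent k⟮z⟯ (mons v)
  rw [span_mons_v h] at hb2
  have hbfin : Finite b := LinearIndependent.finite_of_isNoetherian hb3
  let _ : Fintype b := Fintype.ofFinite b
  have hcard : card b = Module.finrank k⟮z⟯ L := by
    have B := Module.Basis.mk hb3 (by rw [Subtype.range_coe, hb2])
    exact (Module.finrank_eq_card_basis B).symm
  have hxz : x ∈ k⟮z⟯ := x_adj h.hx ▸ mem_adjoin_simple_self k x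
  have htr : Transcendental k (⟨x, hxz⟩ : k⟮z⟯) := by
    rw [← transcendental_algebraMap_iff (A := L) (algebraMap k⟮z⟯ L).injective]
    exact x_tr h.hc h.hx
  have hpi := (pow_indep htr).comp (fun j : Fin (n - c + 1) => (j : ℕ)) Fin.val_injective
  have hli := _root_.linearIndependent_smul hpi hb3
  have hmem : ∀ p : Fin (n - c + 1) × b, ((⟨x, hxz⟩ : k⟮z⟯) ^ (p.1 : ℕ)) • (p.2 : L) ∈ LL k z y z0 x v (fun _ => n) := by
    intro p
    rw [Algebra.smul_def, map_pow]
    exact mem_LL_mons h (hb1 p.2.2) _ _ (by have := p.1.2; omega)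
  obtain ⟨hf, -⟩ := LL_fin h (fun _ => n)
  have hli2 : LinearIndependent k (fun p : Fin (n - c + 1) × b => (⟨_, hmem p⟩ : LL k z y z0 x v (fun _ => n))) := by
    apply LinearIndependent.of_comp (LL k z y z0 x v (fun _ => n)).subtype
    exact hli
  have := hli2.fintype_card_le_finrank
  rw [Fintype.card_prod, Fintype.card_fin, hcard] at this
  calc Module.finrank k⟮z⟯ L * n ≤ (n - c + 1) * Module.finrank k⟮z⟯ L + Module.finrank k⟮z⟯ L * c := by
        rw [mul_comm (n - c + 1), ← mul_add]; exact Nat.mul_le_mul_left _ (by omega)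
    _ ≤ _ := Nat.add_le_add_right this _

open Classical in
theorem LL_lower_pt [IsAlgClosed k] (h : Chart f z y κ z0 x v) [Fintype (Pt k z y z0)] (n : ℕ) (P : Pt k z y z0) :
    n ≤ Module.finrank k (LL k z y z0 x v (Pi.single P n)) +
      Module.finrank k⟮z⟯ L * (κ * (card ι * card ι)) := by
  obtain ⟨hf, -⟩ := LL_fin h (Pi.single P n)
  obtain ⟨_, h2⟩ := LL_add h (Pi.single P n) (fun Q => if Q = P then 0 else n)
  have e : (Pi.single P n + fun Q => if Q = P then 0 else n) = (fun _ => n : Pt k z y z0 → ℕ) := by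
    ext Q; by_cases hQ : Q = P <;> simp [Pi.single_apply, hQ]
  rw [e] at h2
  have h3 := LL_lower h n
  have h4 : ∑ Q : Pt k z y z0, (if Q = P then 0 else n) = (card (Pt k z y z0) - 1) * n := by
    rw [← Finset.add_sum_erase _ _ (Finset.mem_univ P), if_pos rfl, zero_add,
      Finset.sum_congr rfl (g := fun _ => n) (fun Q hQ => if_neg (Finset.ne_of_mem_erase hQ))]
    simp
  rw [h4] at h2
  have h5 := (pt_finite h.hc z0).2
  rw [Nat.card_eq_fintype_card] at h5
  have h6 : 1 ≤ card (Pt k z y z0) := Fintype.card_pos_iff.2 ⟨P⟩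
  obtain ⟨d, hd⟩ : ∃ d, Module.finrank k⟮z⟯ L = d + 1 := ⟨Module.finrank k⟮z⟯ L - 1, by omega⟩
  have h7 : (card (Pt k z y z0) - 1) * n ≤ d * n := Nat.mul_le_mul_right _ (by omega)
  rw [hd] at h3 ⊢
  have h8 : (d + 1) * n = d * n + n := by ring
  omega

end CDM

namespace CDM

variable {k L ι : Type} [Field k] [Field L] [Algebra k L] [Fintype ι]
variable {f : k[X][X]} {z : L} {y : ι → L} {κ : ℕ} {z0 : k} {x : L} {v : ι → L}
variable {E : L →+* PowerSeries L}

theorem O1_V (h : Chart f z y κ z0 x v) {P : O0 k z y →ₐ[k] k} (hP : rv P z ≠ z0) :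
    O0 k x v ≤ V P := by
  intro a ha
  have hx : x ∈ V P := by
    rw [← inv_inv x]
    refine inv_mem_V (h.tV P) ?_
    rw [h.rt]; exact sub_ne_zero.2 hP
  refine O0_induction (p := fun a => a ∈ V P) (V P).algebraMap_mem hx ?_ ?_ ?_ ha
  · intro i; rw [h.hv]; exact mul_mem (pow_mem hx _) (mem_V_of_mem (y_mem_O0 z y i))
  · intro a _ b _ h1 h2; exact add_mem h1 h2
  · intro a _ b _ h1 h2; exact mul_mem h1 h2

/-- residue of the Taylor series -/
noncomputable def rs (E : L →+* PowerSeries L) (P : O0 k z y →ₐ[k] k) (a : L) : PowerSeries k :=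
  PowerSeries.mk fun n => rv P (PowerSeries.coeff n (E a))

theorem coeff_rs (P : O0 k z y →ₐ[k] k) (a : L) (n : ℕ) :
    PowerSeries.coeff n (rs E P a) = rv P (PowerSeries.coeff n (E a)) := coeff_mk _ _

section rs
variable {P : O0 k z y →ₐ[k] k}

theorem rs_add (hc : IsCov f z y) (hE : IsE k z E) (hP : Good P) {a b : L} (ha : a ∈ V P) (hb : b ∈ V P) : rs E P (a + b) = rs E P a + rs E P b := by
  ext n
  rw [map_add, coeff_rs, coeff_rs, coeff_rs, map_add, map_add, rv_add (E_mem_V hc hE hP ha n) (E_mem_V hc hE hP hb n)]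

theorem rs_mul (hc : IsCov f z y) (hE : IsE k z E) (hP : Good P) {a b : L} (ha : a ∈ V P) (hb : b ∈ V P) : rs E P (a * b) = rs E P a * rs E P b := by
  ext n
  rw [coeff_rs, map_mul, PowerSeries.coeff_mul, PowerSeries.coeff_mul, rv_sum]
  · refine Finset.sum_congr rfl fun p _ => ?_
    rw [rv_mul (E_mem_V hc hE hP ha _) (E_mem_V hc hE hP hb _), coeff_rs, coeff_rs]
  · intro p _
    exact mul_mem (E_mem_V hc hE hP ha _) (E_mem_V hc hE hP hb _)

theorem rs_alg (hE : IsE k z E) (c : k) : rs E P (algebraMap k L c) = PowerSeries.C c := by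
  ext n
  rw [coeff_rs, hE.const, PowerSeries.coeff_C, PowerSeries.coeff_C]
  split_ifs
  · exact rv_alg c
  · exact rv_zero

theorem rs_one (hE : IsE k z E) : rs E P 1 = 1 := by
  have := rs_alg hE (P := P) 1
  simpa using this

theorem rs_smul (hc : IsCov f z y) (hE : IsE k z E) (hP : Good P) (c : k) {a : L} (ha : a ∈ V P) : rs E P (c • a) = c • rs E P a := by
  rw [Algebra.smul_def, rs_mul hc hE hP ((V P).algebraMap_mem c) ha, rs_alg hE, PowerSeries.smul_eq_C_mul]

theorem rs_pow (hc : IsCov f z y) (hE : IsE k z E) (hP : Good P) {a : L} (ha : a ∈ V P) (n : ℕ) : rs E P (a ^ n) = rs E P a ^ n := by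
  induction n with
  | zero => simpa using rs_one hE
  | succ n ih => rw [pow_succ, pow_succ, rs_mul hc hE hP (pow_mem ha n) ha, ih]

theorem rs_const (hE : IsE k z E) (a : L) : PowerSeries.constantCoeff (rs E P a) = rv P a := by
  rw [← coeff_zero_eq_constantCoeff_apply, coeff_rs, coeff_zero_eq_constantCoeff_apply, hE.id]

theorem rs_t (hE : IsE k z E) (c : k) : rs E P (z - algebraMap k L c) = PowerSeries.C (rv P z - c) + PowerSeries.X := by
  ext n
  rw [coeff_rs, hE.sub, map_add, map_add, PowerSeries.coeff_C, PowerSeries.coeff_C, PowerSeries.coeff_X]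
  have hzV := mem_V_of_mem (P := P) (z_mem_O0 z y)
  by_cases h0 : n = 0
  · subst h0
    simp [rv_sub hzV ((V P).algebraMap_mem c), rv_alg]
  · by_cases h1 : n = 1
    · subst h1; simp [rv_one]
    · simp [h0, h1, rv_zero, PowerSeries.coeff_X]
end rs

theorem rs_x_sub (h : Chart f z y κ z0 x v) (hE : IsE k z E) {P : O0 k z y →ₐ[k] k} (hP : Good P) (hz : rv P z ≠ z0) :
    ∃ u : PowerSeries k, PowerSeries.constantCoeff u ≠ 0 ∧
      rs E P (x - algebraMap k L (rv P x)) = u * PowerSeries.X := by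
  have hxV : x ∈ V P := O1_V h hz (z_mem_O0 x v)
  have hx0 := h.x0
  have htx : rv P x * (rv P z - z0) = 1 := by
    rw [← h.rt P, ← rv_mul hxV (h.tV P), mul_inv_cancel₀ hx0, rv_one]
  have hrx : rv P x ≠ 0 := by intro h0; rw [h0, zero_mul] at htx; exact zero_ne_one htx
  set c := algebraMap k L (rv P x) with hcdef
  have hcV : c ∈ V P := (V P).algebraMap_mem _
  have htV : z - algebraMap k L (rv P z) ∈ V P := sub_mem (mem_V_of_mem (z_mem_O0 z y)) ((V P).algebraMap_mem _)
  have e : x - c = - c * x * (z - algebraMap k L (rv P z)) := by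
    have e1 : x * (z - algebraMap k L z0) = 1 := by rw [← h.t_eq, mul_inv_cancel₀ hx0]
    have e2 : c * (algebraMap k L (rv P z) - algebraMap k L z0) = 1 := by
      rw [hcdef, ← map_sub, ← map_mul, htx, map_one]
    linear_combination c * e1 - x * e2
  refine ⟨rs E P (-c * x), ?_, ?_⟩
  · rw [rs_const hE, rv_mul (neg_mem hcV) hxV, rv_neg hcV, hcdef, rv_alg]
    exact mul_ne_zero (neg_ne_zero.2 hrx) hrx
  · rw [e, rs_mul h.hc hE hP (mul_mem (neg_mem hcV) hxV) htV, rs_t hE, sub_self, map_zero, zero_add]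

/-- point on the second chart -/
noncomputable def P1 (h : Chart f z y κ z0 x v) (P : O0 k z y →ₐ[k] k) (hP : rv P z ≠ z0) : O0 k x v →ₐ[k] k :=
  (res P).comp (Subalgebra.inclusion (O1_V h hP))

theorem P1_inj (h : Chart f z y κ z0 x v) {P Q : O0 k z y →ₐ[k] k} (hP : rv P z ≠ z0) (hQ : rv Q z ≠ z0)
    (e : P1 h P hP = P1 h Q hQ) : P = Q := by
  have e1 : ∀ a ∈ O0 k x v, rv P a = rv Q a := fun a ha => DFunLike.congr_fun e ⟨a, ha⟩
  have hx0 := h.x0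
  have htx : ∀ P : O0 k z y →ₐ[k] k, rv P z ≠ z0 → rv P x * (rv P z - z0) = 1 := by
    intro P hP
    rw [← h.rt P, ← rv_mul (O1_V h hP (z_mem_O0 x v)) (h.tV P), mul_inv_cancel₀ hx0, rv_one]
  have hz : rv P z = rv Q z := by
    have h1 := htx P hP
    have h2 := htx Q hQ
    rw [e1 x (z_mem_O0 x v)] at h1
    have h3 : rv Q x ≠ 0 := by intro h0; rw [h0, zero_mul] at h2; exact zero_ne_one h2
    have := mul_left_cancel₀ h3 (h1.trans h2.symm)
    linear_combination this
  refine pt_ext hz fun i => ?_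
  have h4 : ∀ P : O0 k z y →ₐ[k] k, rv P z ≠ z0 → rv P (y i) = (rv P z - z0) ^ κ * rv P (v i) := by
    intro P hP
    rw [← h.rt P, ← rv_pow (h.tV P), ← rv_mul (pow_mem (h.tV P) _) (O1_V h hP (y_mem_O0 x v i)), h.hv, ← mul_assoc,
      ← mul_pow, inv_mul_cancel₀ hx0, one_pow, one_mul]
  rw [h4 P hP, h4 Q hQ, hz, e1 _ (y_mem_O0 x v i)]

theorem O1_LL (h : Chart f z y κ z0 x v) {a : L} (ha : a ∈ O0 k x v) : ∃ n : ℕ, a ∈ LL k z y z0 x v (fun _ => n) := by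
  have hx0 := h.x0
  refine O0_induction (p := fun a => ∃ n : ℕ, a ∈ LL k z y z0 x v (fun _ => n)) ?_ ?_ ?_ ?_ ?_ ha
  · intro c; exact ⟨0, Subalgebra.algebraMap_mem _ _, fun P => by rw [pow_zero, one_mul]; exact Subalgebra.algebraMap_mem _ _⟩
  · exact ⟨1, z_mem_O0 x v, fun P => by rw [pow_one, inv_mul_cancel₀ hx0]; exact one_mem _⟩
  · intro i
    refine ⟨κ, y_mem_O0 x v i, fun P => ?_⟩
    rw [h.hv, ← mul_assoc, ← mul_pow, inv_mul_cancel₀ hx0, one_pow, one_mul]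
    exact mem_V_of_mem (y_mem_O0 z y i)
  · rintro a _ b _ ⟨n, h1⟩ ⟨m, h2⟩
    exact ⟨max n m, add_mem (h.mono (fun _ => le_max_left _ _) h1) (h.mono (fun _ => le_max_right _ _) h2)⟩
  · rintro a _ b _ ⟨n, h1⟩ ⟨m, h2⟩
    exact ⟨n + m, LL_mul h1 h2⟩

/-- evaluation of the Taylor coefficients -/
noncomputable def Psi (h : Chart f z y κ z0 x v) (hE : IsE k z E) {σ : Type} (p : σ → O0 k z y →ₐ[k] k)
    (hg : ∀ s, Good (p s)) (hz : ∀ s, rv (p s) z ≠ z0) (M : ℕ) :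
    Subalgebra.toSubmodule (O0 k x v) →ₗ[k] (σ → Fin M → k) where
  toFun a s i := PowerSeries.coeff (i : ℕ) (rs E (p s) (a : L))
  map_add' a b := by
    ext s i
    have := rs_add h.hc hE (hg s) (O1_V h (hz s) a.2) (O1_V h (hz s) b.2)
    change PowerSeries.coeff (i : ℕ) (rs E (p s) ((a : L) + b)) = _
    rw [this, map_add]; rfl
  map_smul' c a := by
    ext s i
    have := rs_smul h.hc hE (hg s) c (O1_V h (hz s) a.2)
    change PowerSeries.coeff (i : ℕ) (rs E (p s) (c • (a : L))) = _
    rw [this, map_smul]; rfl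

theorem Psi_surj (h : Chart f z y κ z0 x v) (hE : IsE k z E) {σ : Type} [Fintype σ] (p : σ → O0 k z y →ₐ[k] k)
    (hp : Function.Injective p)
    (hg : ∀ s, Good (p s)) (hz : ∀ s, rv (p s) z ≠ z0) (M : ℕ) :
    Function.Surjective (Psi h hE p hg hz M) := by
  classical
  rw [← LinearMap.range_eq_top]
  set R := LinearMap.range (Psi h hE p hg hz M) with hR
  have key : ∀ n : ℕ, ∀ i : Fin M, M ≤ i + n + 1 → ∀ s, (Pi.single s (Pi.single i 1) : σ → Fin M → k) ∈ R := by
    intro n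
    induction n using Nat.strong_induction_on with
    | _ n ih =>
    intro i hi s
    obtain ⟨e, he1, he2⟩ := sep_pts ((Finset.univ.erase s).image fun s' => P1 h (p s') (hz s')) (P1 h (p s) (hz s))
      (by
        rw [Finset.mem_image]
        rintro ⟨s', hs', e⟩
        exact Finset.ne_of_mem_erase hs' (hp (P1_inj h _ _ e)))
    set w : L := (e : L) ^ M * (x - algebraMap k L (rv (p s) x)) ^ (i : ℕ) with hw
    have hxc : x - algebraMap k L (rv (p s) x) ∈ O0 k x v := sub_mem (z_mem_O0 x v) (Subalgebra.algebraMap_mem _ _)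
    have hwO : w ∈ O0 k x v := mul_mem (pow_mem e.2 _) (pow_mem hxc _)
    have hrsw : ∀ s', rs E (p s') w = rs E (p s') e ^ M * rs E (p s') (x - algebraMap k L (rv (p s) x)) ^ (i : ℕ) := by
      intro s'
      have h1 := O1_V h (hz s') e.2
      have h2 := O1_V h (hz s') hxc
      rw [hw, rs_mul h.hc hE (hg s') (pow_mem h1 _) (pow_mem h2 _), rs_pow h.hc hE (hg s') h1, rs_pow h.hc hE (hg s') h2]
    obtain ⟨u, hu0, hu⟩ := rs_x_sub h hE (hg s) (hz s)
    set B := rs E (p s) e ^ M * u ^ (i : ℕ) with hB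
    have hBw : rs E (p s) w = B * PowerSeries.X ^ (i : ℕ) := by rw [hrsw, hu, hB]; ring
    have hB0 : PowerSeries.constantCoeff B ≠ 0 := by
      rw [hB, map_mul, map_pow, map_pow, rs_const hE]
      have : rv (p s) (e : L) = 1 := he1
      rw [this, one_pow, one_mul]; exact pow_ne_zero _ hu0
    have hPsi : Psi h hE p hg hz M ⟨w, hwO⟩ = ∑ i' : Fin M, PowerSeries.coeff (i' : ℕ) (B * PowerSeries.X ^ (i : ℕ)) •
        (Pi.single s (Pi.single i' 1) : σ → Fin M → k) := by
      ext s' j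
      rw [Finset.sum_apply, Finset.sum_apply]
      change PowerSeries.coeff (j : ℕ) (rs E (p s') w) = _
      by_cases hs : s' = s
      · subst hs
        rw [hBw, Finset.sum_eq_single j]
        · simp
        · intro j' _ hj; simp [hj.symm]
        · simp
      · have h3 : PowerSeries.X ∣ rs E (p s') (e : L) := by
          rw [PowerSeries.X_dvd_iff, rs_const hE]
          exact he2 _ (Finset.mem_image_of_mem _ (Finset.mem_erase.2 ⟨hs, Finset.mem_univ _⟩))
        have h4 : PowerSeries.X ^ M ∣ rs E (p s') w := by
          rw [hrsw]; exact Dvd.dvd.mul_right (pow_dvd_pow_of_dvd h3 M) _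
        rw [PowerSeries.X_pow_dvd_iff.1 h4 j j.2]
        symm
        refine Finset.sum_eq_zero fun i' _ => ?_
        simp [hs]
    have hmem : (∑ i' : Fin M, PowerSeries.coeff (i' : ℕ) (B * PowerSeries.X ^ (i : ℕ)) •
        (Pi.single s (Pi.single i' 1) : σ → Fin M → k)) ∈ R := by rw [← hPsi]; exact ⟨_, rfl⟩
    rw [← Finset.add_sum_erase _ _ (Finset.mem_univ i)] at hmem
    have hrest : (∑ i' ∈ Finset.univ.erase i, PowerSeries.coeff (i' : ℕ) (B * PowerSeries.X ^ (i : ℕ)) •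
        (Pi.single s (Pi.single i' 1) : σ → Fin M → k)) ∈ R := by
      refine Submodule.sum_mem _ fun i' hi' => ?_
      have hne := Finset.ne_of_mem_erase hi'
      have hne' : (i' : ℕ) ≠ i := fun h => hne (Fin.ext h)
      rcases lt_or_ge (i' : ℕ) i with hlt | hge
      · rw [PowerSeries.coeff_mul_X_pow', if_neg (by omega), zero_smul]; exact zero_mem _
      · apply Submodule.smul_mem
        have h5 := i.2
        have h6 := i'.2
        exact ih (M - i' - 1) (by omega) i' (by omega) s
    have h7 := (Submodule.add_mem_iff_left _ hrest).1 hmem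
    rw [PowerSeries.coeff_mul_X_pow', if_pos le_rfl, Nat.sub_self, coeff_zero_eq_constantCoeff_apply] at h7
    exact (Submodule.smul_mem_iff _ hB0).1 h7
  rw [eq_top_iff]
  intro g _
  have : g = ∑ s, ∑ i, g s i • (Pi.single s (Pi.single i 1) : σ → Fin M → k) := by
    ext s i
    simp only [Finset.sum_apply, Pi.smul_apply, smul_eq_mul]
    rw [Finset.sum_eq_single s, Finset.sum_eq_single i]
    · simp
    · intro j _ hj; simp [hj.symm]
    · simp
    · intro s' _ hs; simp [hs.symm]
    · simp
  rw [this]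
  refine Submodule.sum_mem _ fun s _ => Submodule.sum_mem _ fun i _ => Submodule.smul_mem _ _ ?_
  exact key M i (by omega) s

theorem count [IsAlgClosed k] (h : Chart f z y κ z0 x v) (hE : IsE k z E) [Fintype (Pt k z y z0)]
    {σ : Type} [Fintype σ] (p : σ → O0 k z y →ₐ[k] k) (hp : Function.Injective p)
    (hg : ∀ s, Good (p s)) (hz : ∀ s, rv (p s) z ≠ z0) (M : ℕ) (N0 : Pt k z y z0 → ℕ) (a : L)
    (ha0 : a ≠ 0) (ha : a ∈ LL k z y z0 x v N0)
    (hv : ∀ s, ∀ i < M, rv (p s) (PowerSeries.coeff i (E a)) = 0) :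
    M * card σ ≤ ∑ P, N0 P := by
  classical
  have hs := Psi_surj h hE p hp hg hz M
  choose g hgs using hs
  -- a common pole bound for preimages of the basis
  have hn : ∀ si : σ × Fin M, ∃ n : ℕ, ((g (Pi.single si.1 (Pi.single si.2 1))) : L) ∈ LL k z y z0 x v (fun _ => n) :=
    fun si => O1_LL h (g _).2
  choose n hn using hn
  set n0 := ∑ si, n si with hn0
  have hle : ∀ si, n si ≤ n0 := fun si => Finset.single_le_sum (f := n) (fun _ _ => Nat.zero_le _) (Finset.mem_univ si)
  set N : Pt k z y z0 → ℕ := fun _ => n0 with hN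
  let inc : LL k z y z0 x v (N + N0) →ₗ[k] Subalgebra.toSubmodule (O0 k x v) :=
    Submodule.inclusion (fun b hb => hb.1)
  let ψ := (Psi h hE p hg hz M).comp inc
  have hψs : Function.Surjective ψ := by
    rw [← LinearMap.range_eq_top, eq_top_iff]
    intro b _
    have : b = ∑ s, ∑ i, b s i • (Pi.single s (Pi.single i 1) : σ → Fin M → k) := by
      ext s i
      simp only [Finset.sum_apply, Pi.smul_apply, smul_eq_mul]
      rw [Finset.sum_eq_single s, Finset.sum_eq_single i]
      · simp
      · intro j _ hj; simp [hj.symm]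
      · simp
      · intro s' _ hs; simp [hs.symm]
      · simp
    rw [this]
    refine Submodule.sum_mem _ fun s _ => Submodule.sum_mem _ fun i _ => Submodule.smul_mem _ _ ?_
    refine ⟨⟨g (Pi.single s (Pi.single i 1)), h.mono (fun P => ?_) (hn (s, i))⟩, ?_⟩
    · exact (hle (s, i)).trans (Nat.le_add_right _ _)
    · exact hgs _
  obtain ⟨hf1, -⟩ := LL_fin h N
  obtain ⟨hf2, hle2⟩ := LL_add h N N0
  have hker : Module.finrank k (LL k z y z0 x v N) ≤ Module.finrank k (LinearMap.ker ψ) := by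
    have hmem : ∀ b : LL k z y z0 x v N, a * (b : L) ∈ LL k z y z0 x v (N + N0) := fun b => by
      rw [add_comm]; exact LL_mul ha b.2
    let μ : LL k z y z0 x v N →ₗ[k] LL k z y z0 x v (N + N0) :=
      ((LinearMap.mulLeft k a).comp (LL k z y z0 x v N).subtype).codRestrict _ hmem
    have hμ : ∀ b, μ b ∈ LinearMap.ker ψ := by
      intro b
      rw [LinearMap.mem_ker]
      ext s i
      change PowerSeries.coeff (i : ℕ) (rs E (p s) (a * (b : L))) = 0
      rw [rs_mul h.hc hE (hg s) (O1_V h (hz s) ha.1) (O1_V h (hz s) b.2.1)]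
      have : PowerSeries.X ^ M ∣ rs E (p s) a := by
        rw [PowerSeries.X_pow_dvd_iff]
        intro m hm; rw [coeff_rs]; exact hv s m hm
      exact PowerSeries.X_pow_dvd_iff.1 (this.mul_right _) _ i.2
    refine LinearMap.finrank_le_finrank_of_injective (f := μ.codRestrict _ hμ) ?_
    intro b c hbc
    have h1 : a * (b : L) = a * c := congrArg (fun w => ((w : LL k z y z0 x v (N + N0)) : L)) (congrArg Subtype.val hbc)
    exact Subtype.ext (mul_left_cancel₀ ha0 h1)
  have hrn := LinearMap.finrank_range_add_finrank_ker ψ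
  rw [LinearMap.range_eq_top.2 hψs, finrank_top] at hrn
  have hdim : Module.finrank k (σ → Fin M → k) = M * card σ := by
    rw [Module.finrank_pi_fintype]; simp [mul_comm]
  omega

end CDM

namespace CDM

variable {k L ι : Type} [Field k] [Field L] [Algebra k L] [Fintype ι]
variable {f : k[X][X]} {z : L} {y : ι → L} {κ : ℕ} {z0 : k} {x : L} {v : ι → L}
variable {E : L →+* PowerSeries L}

theorem LL_prod {J : Type} (s : Finset J) (a : J → L) (N : Pt k z y z0 → ℕ) (ha : ∀ j ∈ s, a j ∈ LL k z y z0 x v N) :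
    ∏ j ∈ s, a j ∈ LL k z y z0 x v (s.card • N) := by
  classical
  induction s using Finset.induction_on with
  | empty => simpa using LL_one
  | insert j s hj ih =>
    rw [Finset.prod_insert hj, Finset.card_insert_of_notMem hj, succ_nsmul']
    exact LL_mul (ha j (by simp)) (ih fun i hi => ha i (by simp [hi]))

theorem disc_LL (h : Chart f z y κ z0 x v) : disc v ∈ LL k z y z0 x v (fun _ => κ * (card ι * card ι)) := by
  classical
  have hv : ∀ i, v i ∈ LL k z y z0 x v (fun _ => κ) := by
    intro i
    refine ⟨y_mem_O0 x v i, fun P => ?_⟩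
    rw [h.hv, ← mul_assoc, ← mul_pow, inv_mul_cancel₀ h.x0, one_pow, one_mul]
    exact mem_V_of_mem (y_mem_O0 z y i)
  have h1 : disc v ∈ LL k z y z0 x v ((Finset.univ.image v).offDiag.card • (fun _ => κ)) := by
    apply LL_prod
    intro p hp
    rw [Finset.mem_offDiag] at hp
    obtain ⟨i, _, hi⟩ := Finset.mem_image.1 hp.1
    obtain ⟨j, _, hj⟩ := Finset.mem_image.1 hp.2.1
    rw [← hi, ← hj]; exact sub_mem (hv i) (hv j)
  refine h.mono (fun P => ?_) h1
  have h2 : (Finset.univ.image v).offDiag.card ≤ card ι * card ι := by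
    rw [Finset.offDiag_card]
    have : (Finset.univ.image v).card ≤ card ι := Finset.card_image_le
    exact (Nat.sub_le _ _).trans (Nat.mul_le_mul this this)
  rw [Pi.smul_apply, smul_eq_mul, mul_comm]
  exact Nat.mul_le_mul_left _ h2

theorem coeff_LL (h : Chart f z y κ z0 x v) (hE : IsE k z E) {N : Pt k z y z0 → ℕ} {a : L} (ha : a ∈ LL k z y z0 x v N)
    (i : ℕ) : (disc v ^ 2) ^ i * PowerSeries.coeff i (E a) ∈
      LL k z y z0 x v (N + fun _ => i * (1 + 2 * (κ * (card ι * card ι)))) := by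
  constructor
  · have := E_mem_O1 h.hc hE h.hx h.hκ h.hv ha.1 i
    rwa [coeff_rescale] at this
  · intro P
    have h1 := E_pole h.hc hE (h.good P.1 P.2) (a := a) (t := x⁻¹) (by rw [P.2, h.t_eq]) (ha.2 P) i
    have h2 := (LL_pow (LL_pow (disc_LL h) 2) i).2 P
    set c := κ * (card ι * card ι)
    simp only [Pi.smul_apply, smul_eq_mul] at h2
    have e : x⁻¹ ^ (N + fun _ => i * (1 + 2 * c) : Pt k z y z0 → ℕ) P * ((disc v ^ 2) ^ i * PowerSeries.coeff i (E a)) =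
      (x⁻¹ ^ (i * (2 * c)) * (disc v ^ 2) ^ i) * (x⁻¹ ^ (N P + i) * PowerSeries.coeff i (E a)) := by
      have : (N + fun _ => i * (1 + 2 * c) : Pt k z y z0 → ℕ) P = i * (2 * c) + (N P + i) := by
        simp only [Pi.add_apply]; ring
      rw [this, pow_add]; ring
    rw [e]; exact mul_mem h2 h1

open Classical in
theorem exists_J [IsAlgClosed k] (h : Chart f z y κ z0 x v) [Fintype (Pt k z y z0)] (P0 : Pt k z y z0) (A : ℕ) :
    ∃ (J : Finset ℕ) (a : ℕ → L), (∀ j ∈ J, j ≤ A) ∧ (∀ j ∈ J, a j ∈ LL k z y z0 x v (Pi.single P0 j)) ∧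
      (∀ j ∈ J, rv P0.1 (x⁻¹ ^ j * a j) ≠ 0) ∧ Module.finrank k (LL k z y z0 x v (Pi.single P0 A)) ≤ J.card := by
  induction A with
  | zero =>
    refine ⟨{0}, fun _ => 1, by simp, ?_, ?_, ?_⟩
    · intro j hj; rw [Finset.mem_singleton.1 hj, Pi.single_zero]; exact LL_one
    · intro j hj; rw [Finset.mem_singleton.1 hj]; simp [rv_one]
    · rw [Pi.single_zero]; exact (LL_zero_fin h).2
  | succ A ih =>
    obtain ⟨J, a, h1, h2, h3, h4⟩ := ih
    have hs : (Pi.single P0 (A+1) : Pt k z y z0 → ℕ) = Pi.single P0 A + Pi.single P0 1 := by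
      rw [← Pi.single_add]
    by_cases hex : ∃ b ∈ LL k z y z0 x v (Pi.single P0 (A+1)), rv P0.1 (x⁻¹ ^ (A+1) * b) ≠ 0
    · obtain ⟨b, hb, hb0⟩ := hex
      have hnm : A + 1 ∉ J := fun hm => by have := h1 _ hm; omega
      refine ⟨insert (A+1) J, fun j => if j = A + 1 then b else a j, ?_, ?_, ?_, ?_⟩
      · intro j hj
        rcases Finset.mem_insert.1 hj with rfl | hj
        · exact le_rfl
        · exact (h1 j hj).trans (Nat.le_succ _)
      · intro j hj
        by_cases hjA : j = A + 1
        · subst hjA; simpa using hb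
        · simp only [hjA, if_false]; exact h2 j ((Finset.mem_insert.1 hj).resolve_left hjA)
      · intro j hj
        by_cases hjA : j = A + 1
        · subst hjA; simpa using hb0
        · simp only [hjA, if_false]; exact h3 j ((Finset.mem_insert.1 hj).resolve_left hjA)
      · rw [Finset.card_insert_of_notMem hnm, hs]
        obtain ⟨hf, -⟩ := LL_fin h (Pi.single P0 A)
        exact (LL_step h (Pi.single P0 A) P0).2.trans (Nat.add_le_add_right h4 1)
    · push Not at hex
      refine ⟨J, a, fun j hj => (h1 j hj).trans (Nat.le_succ _), h2, h3, le_trans ?_ h4⟩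
      obtain ⟨hf, -⟩ := LL_fin h (Pi.single P0 A)
      apply Submodule.finrank_mono
      intro b hb
      refine ⟨hb.1, fun Q => ?_⟩
      by_cases hQ : Q = P0
      · subst hQ
        have hbV := hb.2 Q
        rw [Pi.single_eq_same] at hbV
        have h5 := h.div Q hbV (hex b hb)
        have : x⁻¹ ^ (A + 1) * b * x = x⁻¹ ^ A * b := by
          have := h.x0
          rw [pow_succ]; field_simp
        rw [Pi.single_eq_same]; rwa [this] at h5
      · have := hb.2 Q
        rw [Pi.single_eq_of_ne hQ] at this ⊢; exact this

/-- exact pole order -/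
theorem exists_order [IsAlgClosed k] (h : Chart f z y κ z0 x v) [DecidableEq (Pt k z y z0)] (P0 : Pt k z y z0) {B : ℕ} {b : L}
    (hb : b ∈ LL k z y z0 x v (Pi.single P0 B)) (hb0 : b ≠ 0) :
    ∃ m, b ∈ LL k z y z0 x v (Pi.single P0 m) ∧ rv P0.1 (x⁻¹ ^ m * b) ≠ 0 := by
  classical
  have hex : ∃ m, b ∈ LL k z y z0 x v (Pi.single P0 m) := ⟨B, hb⟩
  refine ⟨Nat.find hex, Nat.find_spec hex, ?_⟩
  set m := Nat.find hex with hm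
  have hbm : b ∈ LL k z y z0 x v (Pi.single P0 m) := Nat.find_spec hex
  intro h0
  rcases Nat.eq_zero_or_pos m with hm0 | hm0
  · rw [hm0] at hbm h0
    rw [Pi.single_zero] at hbm
    obtain ⟨c, rfl⟩ := LL_zero h hbm
    rw [pow_zero, one_mul, rv_alg] at h0
    exact hb0 (by rw [h0, map_zero])
  · obtain ⟨A, hA⟩ : ∃ A, m = A + 1 := ⟨m - 1, by omega⟩
    refine Nat.find_min hex (m := A) (by omega) ?_
    rw [hA] at hbm h0
    refine ⟨hbm.1, fun Q => ?_⟩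
    by_cases hQ : Q = P0
    · subst hQ
      have hbV := hbm.2 Q
      rw [Pi.single_eq_same] at hbV
      have h5 := h.div Q hbV h0
      have : x⁻¹ ^ (A + 1) * b * x = x⁻¹ ^ A * b := by
        have := h.x0
        rw [pow_succ]; field_simp
      rw [Pi.single_eq_same]; rwa [this] at h5
    · have := hbm.2 Q
      rw [Pi.single_eq_of_ne hQ] at this ⊢; exact this

/-- Frobenius data -/
structure Frob (z : L) (y : ι → L) (z0 : k) (p e : ℕ) (τ : L →+* L) (φ : L →ₐ[k] L) : Prop where
  prime : p.Prime
  ch : CharP k p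
  τz : τ z = z
  τy : ∀ i, ∃ j, τ (y i) = y j
  τs : ∀ j, ∃ i, τ (y i) = y j
  φe : ∀ a, φ a = τ a ^ (p ^ e)
  z0q : z0 ^ (p ^ e) = z0

variable {p e : ℕ} {τ : L →+* L} {φ : L →ₐ[k] L}

theorem Frob.chL (F : Frob z y z0 p e τ φ) : CharP L p := by
  have := F.ch
  exact charP_of_injective_algebraMap (algebraMap k L).injective p

theorem Frob.pow_inj (F : Frob z y z0 p e τ φ) {a b : L} (h : a ^ (p ^ e) = b ^ (p ^ e)) : a = b := by
  have := F.chL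
  have := Fact.mk F.prime
  have : ExpChar L p := ExpChar.prime F.prime
  exact (iterateFrobenius_inj L p e) (by simpa [iterateFrobenius_def] using h)

theorem Frob.τc [IsAlgClosed k] (F : Frob z y z0 p e τ φ) (c : k) : ∃ c' : k, τ (algebraMap k L c) = algebraMap k L c' := by
  obtain ⟨c', hc'⟩ := IsAlgClosed.exists_pow_nat_eq c (pow_pos F.prime.pos e)
  refine ⟨c', F.pow_inj ?_⟩
  rw [← F.φe, AlgHom.commutes, ← map_pow, hc']

theorem Frob.τz0 (F : Frob z y z0 p e τ φ) : τ (algebraMap k L z0) = algebraMap k L z0 := by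
  apply F.pow_inj
  rw [← F.φe, AlgHom.commutes, ← map_pow, F.z0q]

theorem Frob.τx (F : Frob z y z0 p e τ φ) (h : Chart f z y κ z0 x v) : τ x = x := by
  rw [h.hx, map_inv₀, map_sub, F.τz, F.τz0]

theorem Frob.τO0 [IsAlgClosed k] (F : Frob z y z0 p e τ φ) {a : L} (ha : a ∈ O0 k z y) : τ a ∈ O0 k z y := by
  refine O0_induction (p := fun a => τ a ∈ O0 k z y) ?_ ?_ ?_ ?_ ?_ ha
  · intro c; obtain ⟨c', hc'⟩ := F.τc c; rw [hc']; exact Subalgebra.algebraMap_mem _ _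
  · rw [F.τz]; exact z_mem_O0 z y
  · intro i; obtain ⟨j, hj⟩ := F.τy i; rw [hj]; exact y_mem_O0 z y j
  · intro a _ b _ h1 h2; rw [map_add]; exact add_mem h1 h2
  · intro a _ b _ h1 h2; rw [map_mul]; exact mul_mem h1 h2

theorem Frob.φO0 [IsAlgClosed k] (F : Frob z y z0 p e τ φ) : ∀ a ∈ O0 k z y, φ a ∈ O0 k z y := by
  intro a ha; rw [F.φe]; exact pow_mem (F.τO0 ha) _

theorem Frob.φO1 [IsAlgClosed k] (F : Frob z y z0 p e τ φ) (h : Chart f z y κ z0 x v) {a : L} (ha : a ∈ O0 k x v) :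
    φ a ∈ O0 k x v := by
  refine O0_induction (p := fun a => φ a ∈ O0 k x v) ?_ ?_ ?_ ?_ ?_ ha
  · intro c; rw [AlgHom.commutes]; exact Subalgebra.algebraMap_mem _ _
  · rw [F.φe, F.τx h]; exact pow_mem (z_mem_O0 x v) _
  · intro i
    obtain ⟨j, hj⟩ := F.τy i
    rw [F.φe, h.hv, map_mul, map_pow, F.τx h, hj, ← h.hv]; exact pow_mem (y_mem_O0 x v j) _
  · intro a _ b _ h1 h2; rw [map_add]; exact add_mem h1 h2
  · intro a _ b _ h1 h2; rw [map_mul]; exact mul_mem h1 h2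

/-- pull back of points by `φ` -/
noncomputable def Frob.pt [IsAlgClosed k] (F : Frob z y z0 p e τ φ) (P : Pt k z y z0) : Pt k z y z0 :=
  ⟨pcomp P.1 φ F.φO0, by
    have hz := mem_V_of_mem (P := pcomp P.1 φ F.φO0) (z_mem_O0 z y)
    rw [← (pcomp_spec (P := P.1) F.φO0 hz).2, F.φe, F.τz, rv_pow (mem_V_of_mem (z_mem_O0 z y)), P.2, F.z0q]⟩

theorem Frob.pt_inj [IsAlgClosed k] (F : Frob z y z0 p e τ φ) : Function.Injective F.pt := by
  intro P Q hPQ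
  have hPQ' : pcomp P.1 φ F.φO0 = pcomp Q.1 φ F.φO0 := congrArg Subtype.val hPQ
  have := F.ch
  have := Fact.mk F.prime
  have : ExpChar k p := ExpChar.prime F.prime
  refine Subtype.ext (pt_ext (P.2.trans Q.2.symm) fun j => ?_)
  obtain ⟨i, hi⟩ := F.τs j
  have h1 : ∀ P : Pt k z y z0, rv P.1 (y j) ^ p ^ e = rv (pcomp P.1 φ F.φO0) (y i) := by
    intro P
    have hy := mem_V_of_mem (P := pcomp P.1 φ F.φO0) (y_mem_O0 z y i)
    rw [← (pcomp_spec (P := P.1) F.φO0 hy).2, F.φe, hi, rv_pow (mem_V_of_mem (y_mem_O0 z y j))]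
  have h2 := (h1 P).trans ((congrArg (fun R => rv R (y i)) hPQ').trans (h1 Q).symm)
  exact (iterateFrobenius_inj k p e) (by simpa [iterateFrobenius_def] using h2)

theorem Frob.φLL [IsAlgClosed k] [DecidableEq (Pt k z y z0)] (F : Frob z y z0 p e τ φ) (h : Chart f z y κ z0 x v) (P0 : Pt k z y z0) {B : ℕ} {b : L}
    (hb : b ∈ LL k z y z0 x v (Pi.single (F.pt P0) B)) : φ b ∈ LL k z y z0 x v (Pi.single P0 (p ^ e * B)) := by
  refine ⟨F.φO1 h hb.1, fun Q => ?_⟩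
  by_cases hQ : Q = P0
  · subst hQ
    have h1 := hb.2 (F.pt Q)
    rw [Pi.single_eq_same] at h1 ⊢
    have h2 := (pcomp_spec (P := Q.1) F.φO0 h1).1
    rwa [map_mul, map_pow, F.φe x⁻¹, map_inv₀ τ, F.τx h, ← pow_mul] at h2
  · have h1 := hb.2 (F.pt Q)
    rw [Pi.single_eq_of_ne (fun e => hQ (F.pt_inj e)), pow_zero, one_mul] at h1
    rw [Pi.single_eq_of_ne hQ, pow_zero, one_mul]
    exact (pcomp_spec (P := Q.1) F.φO0 h1).1

theorem Frob.φrv [IsAlgClosed k] [DecidableEq (Pt k z y z0)] (F : Frob z y z0 p e τ φ) (h : Chart f z y κ z0 x v) (P0 : Pt k z y z0) {B : ℕ} {b : L}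
    (hb : b ∈ LL k z y z0 x v (Pi.single (F.pt P0) B)) :
    rv P0.1 (x⁻¹ ^ (p ^ e * B) * φ b) = rv (F.pt P0).1 (x⁻¹ ^ B * b) := by
  have h1 := hb.2 (F.pt P0)
  rw [Pi.single_eq_same] at h1
  have h2 := (pcomp_spec (P := P0.1) F.φO0 h1).2
  rwa [map_mul, map_pow, F.φe x⁻¹, map_inv₀ τ, F.τx h, ← pow_mul] at h2

theorem Frob.E_φ (F : Frob z y z0 p e τ φ) (hE : IsE k z E) (b : L) :
    ∃ A : PowerSeries L, E (φ b) = PowerSeries.C (φ b) + PowerSeries.X ^ (p ^ e) * A := by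
  have := F.chL
  have := Fact.mk F.prime
  have : CharP (PowerSeries L) p := charP_of_injective_ringHom (PowerSeries.C_injective (R := L)) p
  obtain ⟨A, hA⟩ : PowerSeries.X ∣ E (τ b) - PowerSeries.C (τ b) := by rw [PowerSeries.X_dvd_iff]; simp [hE.id]
  refine ⟨A ^ p ^ e, ?_⟩
  have : E (τ b) = PowerSeries.C (τ b) + PowerSeries.X * A := by rw [← hA]; ring
  rw [F.φe, map_pow, this, add_pow_char_pow, map_pow, mul_pow]

theorem Frob.coeff_φ (F : Frob z y z0 p e τ φ) (hE : IsE k z E) (a b : L) (i : ℕ) (hi : i < p ^ e) :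
    PowerSeries.coeff i (E (a * φ b)) = PowerSeries.coeff i (E a) * φ b := by
  obtain ⟨A, hA⟩ := F.E_φ hE b
  rw [map_mul, hA, mul_add, map_add, PowerSeries.coeff_mul_C]
  have : PowerSeries.coeff i (E a * (PowerSeries.X ^ p ^ e * A)) = 0 := by
    refine PowerSeries.X_pow_dvd_iff.1 ?_ i hi
    exact ⟨E a * A, by ring⟩
  rw [this, add_zero]

end CDM

namespace CDM
variable {k L ι : Type} [Field k] [Field L] [Algebra k L] [Fintype ι]
variable {f : k[X][X]} {z : L} {y : ι → L} {κ : ℕ} {z0 : k} {x : L} {v : ι → L}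
variable {E : L →+* PowerSeries L}
variable {p e : ℕ} {τ : L →+* L} {φ : L →ₐ[k] L}

open Classical in
theorem exists_h [IsAlgClosed k] (h : Chart f z y κ z0 x v) (hE : IsE k z E) [Fintype (Pt k z y z0)]
    (P0 P1 : Pt k z y z0) (J : Finset ℕ) (a : ℕ → L) (A B M : ℕ)
    (ha : ∀ j ∈ J, a j ∈ LL k z y z0 x v (Pi.single P0 A))
    (hnum : ∑ i ∈ Finset.range M, (1 + A + B + card (Pt k z y z0) *
        (i * (1 + 2 * (κ * (card ι * card ι))))) <
      J.card * Module.finrank k (LL k z y z0 x v (Pi.single P1 B))) :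
    ∃ b : ℕ → L, (∀ j ∈ J, b j ∈ LL k z y z0 x v (Pi.single P1 B)) ∧ (∃ j ∈ J, b j ≠ 0) ∧
      ∀ i < M, ∑ j ∈ J, PowerSeries.coeff i (E (a j)) * b j = 0 := by
  set c1 := 1 + 2 * (κ * (card ι * card ι)) with hc1
  let N : ℕ → Pt k z y z0 → ℕ := fun i => (Pi.single P0 A + fun _ => i * c1) + Pi.single P1 B
  have hfB := (LL_fin h (Pi.single P1 B)).1
  have hfN := fun i => (LL_fin h (N i)).1
  let c : ℕ → ℕ → L := fun i j => (disc v ^ 2) ^ i * PowerSeries.coeff i (E (a j))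
  let G : ℕ → ((J → LL k z y z0 x v (Pi.single P1 B)) →ₗ[k] L) := fun i =>
    ∑ j : J, (LinearMap.mulLeft k (c i j)) ∘ₗ (Submodule.subtype _) ∘ₗ (LinearMap.proj j)
  have hG : ∀ i b, G i b = ∑ j : J, c i j * (b j : L) := by
    intro i b; simp [G, LinearMap.sum_apply]
  have hGm : ∀ i b, G i b ∈ LL k z y z0 x v (N i) := by
    intro i b
    rw [hG]
    exact Submodule.sum_mem _ fun j _ => LL_mul (coeff_LL h hE (ha j j.2) i) (b j).2
  let T : (J → LL k z y z0 x v (Pi.single P1 B)) →ₗ[k] (∀ i : Fin M, LL k z y z0 x v (N i)) :=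
    LinearMap.pi fun i => LinearMap.codRestrict _ (G i) (hGm i)
  have hlt : Module.finrank k (∀ i : Fin M, LL k z y z0 x v (N i)) <
      Module.finrank k (J → LL k z y z0 x v (Pi.single P1 B)) := by
    rw [Module.finrank_pi_fintype, Module.finrank_pi_fintype]
    simp only [Finset.sum_const, Finset.card_univ, Fintype.card_coe, smul_eq_mul]
    refine lt_of_le_of_lt ?_ hnum
    rw [← Fin.sum_univ_eq_sum_range (fun i => 1 + A + B + card (Pt k z y z0) * (i * c1))]
    refine Finset.sum_le_sum fun i _ => ((LL_fin h (N i)).2).trans (le_of_eq ?_)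
    simp only [N, Pi.add_apply, Finset.sum_add_distrib, Finset.sum_pi_single', Finset.sum_const, Finset.card_univ, smul_eq_mul]
    simp [Pi.single_apply]
    ring
  have hk := LinearMap.ker_ne_bot_of_finrank_lt (f := T) hlt
  obtain ⟨b, hb, hb0⟩ := Submodule.exists_mem_ne_zero_of_ne_bot hk
  refine ⟨fun j => if hj : j ∈ J then b ⟨j, hj⟩ else 0, ?_, ?_, ?_⟩
  · intro j hj; simp only [hj, dif_pos]; exact (b ⟨j, hj⟩).2
  · by_contra hcon
    push Not at hcon
    apply hb0
    funext j
    have := hcon j.1 j.2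
    simp only [j.2, dif_pos] at this
    exact Subtype.ext this
  · intro i hi
    have h1 : G i b = 0 := by
      have := congrFun (LinearMap.mem_ker.1 hb) ⟨i, hi⟩
      exact congrArg Subtype.val this
    rw [hG] at h1
    have h2 : (disc v ^ 2) ^ i * ∑ j : J, PowerSeries.coeff i (E (a j)) * (b j : L) = 0 := by
      rw [Finset.mul_sum, ← h1]
      exact Finset.sum_congr rfl fun j _ => by simp only [c]; ring
    have h3 := (mul_eq_zero.1 h2).resolve_left (pow_ne_zero _ (pow_ne_zero _ (disc_ne v)))
    rw [← Finset.sum_coe_sort, ← h3]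
    exact Finset.sum_congr rfl fun j _ => by simp

open Classical in
theorem sum_ne_zero' [IsAlgClosed k] (h : Chart f z y κ z0 x v) (F : Frob z y z0 p e τ φ)
    (P0 : Pt k z y z0) (J : Finset ℕ) (a b : ℕ → L) (B : ℕ) (hJ : ∀ j ∈ J, j < p ^ e)
    (ha : ∀ j ∈ J, a j ∈ LL k z y z0 x v (Pi.single P0 j)) (ha0 : ∀ j ∈ J, rv P0.1 (x⁻¹ ^ j * a j) ≠ 0)
    (hb : ∀ j ∈ J, b j ∈ LL k z y z0 x v (Pi.single (F.pt P0) B)) (hb0 : ∃ j ∈ J, b j ≠ 0) :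
    ∑ j ∈ J, a j * φ (b j) ≠ 0 := by
  have hm : ∀ j, ∃ m, (j ∈ J → b j ≠ 0 → b j ∈ LL k z y z0 x v (Pi.single (F.pt P0) m) ∧ rv (F.pt P0).1 (x⁻¹ ^ m * b j) ≠ 0) := by
    intro j
    by_cases hj : j ∈ J
    · by_cases hj0 : b j = 0
      · exact ⟨0, fun _ h => absurd hj0 h⟩
      · obtain ⟨m, hm⟩ := exists_order h (F.pt P0) (hb j hj) hj0
        exact ⟨m, fun _ _ => hm⟩
    · exact ⟨0, fun h => absurd h hj⟩
  choose m hm using hm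
  let n : ℕ → ℕ := fun j => j + p ^ e * m j
  obtain ⟨js, hjs, hmax⟩ := Finset.exists_max_image (J.filter (fun j => b j ≠ 0)) n (by
    obtain ⟨j, hj, h0⟩ := hb0; exact ⟨j, by simp [hj, h0]⟩)
  rw [Finset.mem_filter] at hjs
  have hV : ∀ j ∈ J, b j ≠ 0 → x⁻¹ ^ n j * (a j * φ (b j)) ∈ V P0.1 ∧ rv P0.1 (x⁻¹ ^ n j * (a j * φ (b j))) ≠ 0 := by
    intro j hj hj0
    have e1 : x⁻¹ ^ n j * (a j * φ (b j)) = (x⁻¹ ^ j * a j) * (x⁻¹ ^ (p ^ e * m j) * φ (b j)) := by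
      simp only [n, pow_add]; ring
    have h1 := (ha j hj).2 P0
    have h2 := (F.φLL h P0 (hm j hj hj0).1).2 P0
    rw [Pi.single_eq_same] at h1 h2
    rw [e1, rv_mul h1 h2, F.φrv h P0 (hm j hj hj0).1]
    exact ⟨mul_mem h1 h2, mul_ne_zero (ha0 j hj) (hm j hj hj0).2⟩
  have hlt : ∀ j ∈ J, b j ≠ 0 → j ≠ js → n j < n js := by
    intro j hj hj0 hne
    refine lt_of_le_of_ne (hmax j (by simp [hj, hj0])) fun heq => hne ?_
    have := congrArg (· % p ^ e) heq
    simpa [n, Nat.add_mul_mod_self_left, Nat.mod_eq_of_lt (hJ j hj), Nat.mod_eq_of_lt (hJ js hjs.1)] using this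
  intro hcon
  have key : ∀ j ∈ J, x⁻¹ ^ n js * (a j * φ (b j)) ∈ V P0.1 ∧ (j ≠ js → rv P0.1 (x⁻¹ ^ n js * (a j * φ (b j))) = 0) := by
    intro j hj
    by_cases hj0 : b j = 0
    · simp [hj0, rv_zero]
    by_cases hne : j = js
    · subst hne; exact ⟨(hV j hj hj0).1, fun h => absurd rfl h⟩
    have hl := hlt j hj hj0 hne
    have e1 : x⁻¹ ^ n js * (a j * φ (b j)) = x⁻¹ ^ (n js - n j) * (x⁻¹ ^ n j * (a j * φ (b j))) := by
      rw [← mul_assoc (x⁻¹ ^ (n js - n j)), ← pow_add, Nat.sub_add_cancel hl.le]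
    have hp := pow_mem (h.tV P0.1) (n js - n j)
    rw [e1]
    refine ⟨mul_mem hp (hV j hj hj0).1, fun _ => ?_⟩
    rw [rv_mul hp (hV j hj hj0).1, rv_pow (h.tV P0.1), h.rt, P0.2, sub_self, zero_pow (by omega), zero_mul]
  have h1 : rv P0.1 (∑ j ∈ J, x⁻¹ ^ n js * (a j * φ (b j))) = 0 := by
    rw [← Finset.mul_sum, hcon, mul_zero, rv_zero]
  rw [rv_sum J (fun j hj => (key j hj).1), Finset.sum_eq_single js (fun j hj hne => (key j hj).2 hne)
    (fun hn => absurd hjs.1 hn)] at h1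
  exact (hV js hjs.1 hjs.2).2 h1

theorem stepanov_num (q M c c1 d b : ℕ) (hM1 : M * M ≤ q)
    (hb : b = c + d * c1 + 3) (hC : b + (1 + c) * (d * c1 + 4) + 1 ≤ M) :
    ∑ i ∈ Finset.range M, (1 + (q - 1) + (M + b) + d * (i * c1)) < (q - 1 - c) * (M + b - c) := by
  have h1 : ∑ i ∈ Finset.range M, (1 + (q - 1) + (M + b) + d * (i * c1)) ≤ ∑ i ∈ Finset.range M, (1 + (q - 1) + (M + b) + d * (M * c1)) := by
    refine Finset.sum_le_sum fun i hi => ?_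
    have := (Finset.mem_range.1 hi).le
    gcongr
  refine h1.trans_lt ?_
  rw [Finset.sum_const, Finset.card_range, smul_eq_mul]
  have hMpos : 1 ≤ M := by omega
  have hc : c + 1 ≤ M := by omega
  have hq : c + 1 ≤ q := by nlinarith
  obtain ⟨r, rfl⟩ := Nat.exists_eq_add_of_le hq
  have e1 : c + 1 + r - 1 - c = r := by omega
  have e2 : M + b - c = M + d * c1 + 3 := by omega
  have e3 : 1 + (c + 1 + r - 1) = c + 1 + r := by omega
  rw [e1, e2, e3]
  subst hb
  obtain ⟨s, hs⟩ : ∃ s, s = d * c1 := ⟨_, rfl⟩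
  have e4 : d * (M * c1) = M * s := by rw [hs]; ring
  rw [e4, ← hs]
  rw [← hs] at hC
  zify at hM1 hC hc hMpos ⊢
  have h5 : (0:ℤ) ≤ s := by positivity
  have h6 : (0:ℤ) ≤ c := by positivity
  have h7 : (M:ℤ) * (c + s + 3 + (1 + c) * (s + 4) + 1) ≤ M * M := mul_le_mul_of_nonneg_left hC (by positivity)
  have h8 : (s:ℤ) * (M * M) ≤ s * (c + 1 + r) := mul_le_mul_of_nonneg_left hM1 h5
  nlinarith [mul_nonneg h5 h6, mul_nonneg h6 (sub_nonneg.2 hMpos), mul_nonneg h5 (sub_nonneg.2 hMpos), mul_nonneg (mul_nonneg h5 h6) (sub_nonneg.2 hMpos)]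

set_option maxHeartbeats 1000000 in
theorem stepanov (D κ : ℕ) : ∃ C : ℕ, ∀ {k L ι : Type} [Field k] [Field L] [Algebra k L] [Fintype ι] [IsAlgClosed k]
    {f : k[X][X]} {z : L} {y : ι → L} {z0 : k} {x : L} {v : ι → L} {p e : ℕ} {τ : L →+* L} {φ : L →ₐ[k] L}
    (_ : card ι = D) (_ : Chart f z y κ z0 x v) (F : Frob z y z0 p e τ φ) (_ : C ≤ p ^ e)
    {σ : Type} [Fintype σ] (pp : σ → O0 k z y →ₐ[k] k) (_ : Function.Injective pp) (_ : ∀ s, Good (pp s))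
    (_ : ∀ s, rv (pp s) z ≠ z0) (_ : ∀ s, pcomp (pp s) φ F.φO0 = pp s),
    card σ ≤ p ^ e + C * Nat.sqrt (p ^ e) := by
  classical
  obtain ⟨d0, hd0⟩ : ∃ d0, d0 = D ^ D := ⟨_, rfl⟩
  obtain ⟨c, hc⟩ : ∃ c, c = d0 * (κ * (D * D)) := ⟨_, rfl⟩
  obtain ⟨c1, hc1⟩ : ∃ c1, c1 = 1 + 2 * (κ * (D * D)) := ⟨_, rfl⟩
  obtain ⟨b, hb⟩ : ∃ b, b = c + d0 * c1 + 3 := ⟨_, rfl⟩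
  obtain ⟨C0, hC0⟩ : ∃ C0, C0 = b + (1 + c) * (d0 * c1 + 4) + 1 := ⟨_, rfl⟩
  refine ⟨C0 * C0 + 4 * (b + 1), ?_⟩
  intro k L ι _ _ _ _ _ f z y z0 x v p e τ φ hD h F hq σ _ pp hinj hgood hz0 hfix
  subst hD
  obtain ⟨E, hE1, hE2, hE3⟩ := exists_E h.hc
  have hE : IsE k z E := ⟨hE1, hE2, hE3⟩
  have := (pt_finite h.hc z0).1
  let _ := Fintype.ofFinite (Pt k z y z0)
  have hcard : card (Pt k z y z0) ≤ d0 := by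
    rw [← Nat.card_eq_fintype_card, hd0]
    exact (pt_finite h.hc z0).2.trans h.hc.finrank_le
  have hfr : Module.finrank k⟮z⟯ L ≤ d0 := hd0 ▸ h.hc.finrank_le
  obtain ⟨P0⟩ := pt_exists h.hc z0
  obtain ⟨q, hqq⟩ : ∃ q, q = p ^ e := ⟨_, rfl⟩
  obtain ⟨M, hM⟩ : ∃ M, M = Nat.sqrt q := ⟨_, rfl⟩
  have hMM : M * M ≤ q := hM ▸ Nat.sqrt_le q
  have hMM' : q < (M + 1) * (M + 1) := hM ▸ Nat.lt_succ_sqrt q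
  have hMC : C0 ≤ M := by
    rw [hM, Nat.le_sqrt, hqq]; omega
  have hnum := stepanov_num q M c c1 d0 b hMM hb (hC0 ▸ hMC)
  obtain ⟨J, a, hJ, ha, ha0, hJc⟩ := exists_J h P0 (q - 1)
  have hq1 : 1 ≤ q := by rw [hqq]; exact Nat.one_le_pow _ _ F.prime.pos
  have hMle : M ≤ q := by nlinarith
  have hsrc : (q - 1 - c) * (M + b - c) ≤ J.card * Module.finrank k (LL k z y z0 x v (Pi.single (F.pt P0) (M + b))) := by
    have hh : Module.finrank k⟮z⟯ L * (κ * (card ι * card ι)) ≤ c := by rw [hc]; gcongr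
    have h1 := LL_lower_pt h (q - 1) P0
    have h2 := LL_lower_pt h (M + b) (F.pt P0)
    refine Nat.mul_le_mul ?_ ?_
    · have h1' : q - 1 ≤ J.card + c := h1.trans (by gcongr)
      omega
    · have h2' := h2.trans (Nat.add_le_add_left hh _)
      exact Nat.sub_le_iff_le_add.2 h2'
  obtain ⟨bb, hbb, hbb0, hsol⟩ := exists_h h hE P0 (F.pt P0) J a (q - 1) (M + b) M (fun j hj => by
      refine h.mono (fun P => ?_) (ha j hj)
      by_cases hP : P = P0
      · subst hP; simp [hJ j hj]
      · simp [hP]) (by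
      refine lt_of_le_of_lt ?_ (hnum.trans_le hsrc)
      refine Finset.sum_le_sum fun i _ => ?_
      rw [hc1]; gcongr)
  have hJ' : ∀ j ∈ J, j < p ^ e := fun j hj => by have := hJ j hj; omega
  have hne := sum_ne_zero' h F P0 J a bb (M + b) hJ' ha ha0 hbb hbb0
  have hmem : ∑ j ∈ J, a j * φ (bb j) ∈ LL k z y z0 x v (Pi.single P0 (q - 1 + q * (M + b))) := by
    refine Submodule.sum_mem _ fun j hj => ?_
    have h1 := LL_mul (ha j hj) (F.φLL h P0 (hbb j hj))
    refine h.mono (fun P => ?_) h1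
    by_cases hP : P = P0
    · subst hP; simpa [← hqq] using hJ j hj
    · simp [hP]
  have hcount := count h hE pp hinj hgood hz0 M _ _ hne hmem (by
    intro s i hi
    have hg := hgood s
    have hV1 : ∀ j ∈ J, a j ∈ V (pp s) := fun j hj => O1_V h (hz0 s) (ha j hj).1
    have hV2 : ∀ j ∈ J, bb j ∈ V (pp s) := fun j hj => O1_V h (hz0 s) (hbb j hj).1
    have hV3 : ∀ j ∈ J, PowerSeries.coeff i (E (a j)) ∈ V (pp s) := fun j hj => E_mem_V h.hc hE hg (hV1 j hj) i
    have hV4 : ∀ j ∈ J, φ (bb j) ∈ V (pp s) ∧ rv (pp s) (φ (bb j)) = rv (pp s) (bb j) := fun j hj => by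
      have := pcomp_spec (P := pp s) F.φO0 (a := bb j) (by rw [hfix s]; exact hV2 j hj)
      rwa [hfix s] at this
    rw [map_sum, map_sum, Finset.sum_congr rfl (fun j _ => F.coeff_φ hE (a j) (bb j) i (by omega)),
      rv_sum J (fun j hj => mul_mem (hV3 j hj) (hV4 j hj).1),
      Finset.sum_congr rfl (fun j hj => by
        rw [rv_mul (hV3 j hj) (hV4 j hj).1, (hV4 j hj).2, ← rv_mul (hV3 j hj) (hV2 j hj)]),
      ← rv_sum J (fun j hj => mul_mem (hV3 j hj) (hV2 j hj)), hsol i hi, rv_zero])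
  simp only [Finset.sum_pi_single', Pi.single_apply, Finset.sum_ite_eq', Finset.mem_univ, if_true] at hcount
  rw [← hqq, ← hM]
  have hMpos : 0 < M := by omega
  refine le_of_mul_le_mul_left ?_ hMpos
  refine hcount.trans ?_
  have h9 : q ≤ 4 * (M * M) := by nlinarith
  have h10 : q - 1 ≤ q := Nat.sub_le _ _
  have h11 := Nat.mul_le_mul_right (b + 1) h9
  calc q - 1 + q * (M + b) ≤ q * M + q * (b + 1) := by nlinarith
    _ ≤ q * M + 4 * (M * M) * (b + 1) := by gcongr
    _ ≤ q * M + 4 * (M * M) * (b + 1) + C0 * C0 * M * M := Nat.le_add_right _ _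
    _ = _ := by ring

end CDM

namespace CDM
variable {k L ι : Type} [Field k] [Field L] [Algebra k L] [Fintype ι]
variable {f : k[X][X]} {z : L} {y : ι → L}

open IntermediateField.algebraAdjoinAdjoin in
/-- extension of a field endomorphism of the constants -/
theorem exists_tau (hc : IsCov f z y) (σ : k →+* k) (hσ : f.map (mapRingHom σ) = f) :
    ∃ τ : L →+* L, (∀ c, τ (algebraMap k L c) = algebraMap k L (σ c)) ∧ τ z = z := by
  obtain ⟨F, hF, hsp⟩ := hc.splitting
  let e := algEquivOfTranscendental k z hc.tr
  have he : ∀ p, ((e p : Algebra.adjoin k {z}) : L) = aeval z p := fun p => by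
      simp [e, algEquivOfTranscendental]
  let g0 : k[X] →+* L := (evz k z).comp (mapRingHom σ)
  let g1 : Algebra.adjoin k {z} →+* L := g0.comp e.symm.toRingEquiv.toRingHom
  have hg1e : ∀ p, g1 (e p) = g0 p := fun p => by
      change g0 (e.symm (e p)) = _
      rw [e.symm_apply_apply]
  have hinj : Function.Injective (evz k z) := transcendental_iff_injective.1 hc.tr
  have hg0 : Function.Injective g0 := hinj.comp (Polynomial.map_injective σ σ.injective)
  have hinv : ∀ s : nonZeroDivisors (Algebra.adjoin k {z}), IsUnit (g1 s) := by
    intro s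
    obtain ⟨p, hp⟩ := e.surjective s
    rw [← hp, hg1e, isUnit_iff_ne_zero]
    intro h
    rw [← map_zero g0] at h
    have := hg0 h
    rw [this, map_zero] at hp
    exact nonZeroDivisors.ne_zero s.2 hp.symm
  let g2 : k⟮z⟯ →+* L := IsLocalization.lift (M := nonZeroDivisors (Algebra.adjoin k {z})) hinv
  let r : k[X] →+* k⟮z⟯ := (evz k z).codRestrict _ (evz_mem_adjoin z)
  have hr : (algebraMap k⟮z⟯ L).comp r = evz k z := by ext <;> rfl
  have hg2 : ∀ p, g2 (r p) = g0 p := by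
    intro p
    have h1 : r p = algebraMap (Algebra.adjoin k {z}) k⟮z⟯ (e p) := Subtype.ext (he p).symm
    rw [h1, IsLocalization.lift_eq, hg1e]
  have hFr : F = f.map r := by
    apply Polynomial.map_injective _ (algebraMap k⟮z⟯ L).injective
    rw [hF, Polynomial.map_map, hr, hc.fac]
  have hFg : F.map g2 = ∏ i, (Polynomial.X - Polynomial.C (y i)) := by
    have : g2.comp r = g0 := RingHom.ext hg2
    rw [hFr, Polynomial.map_map, this, ← Polynomial.map_map, hσ, hc.fac]
  obtain ⟨τ, hτ⟩ : ∃ τ : L →+* L, ∀ a : k⟮z⟯, τ a = g2 a := by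
    let i0 : Algebra k⟮z⟯ L := inferInstance
    let inst : Algebra k⟮z⟯ L := g2.toAlgebra
    let τ : @AlgHom k⟮z⟯ L L _ _ _ i0 inst := @IsSplittingField.lift L k⟮z⟯ L _ _ _ i0 inst F hsp (by
      change (F.map g2).Splits
      rw [hFg]
      exact Splits.prod fun i _ => Splits.X_sub_C _)
    exact ⟨@AlgHom.toRingHom _ _ _ _ _ _ i0 inst τ, fun a => @AlgHom.commutes _ _ _ _ _ _ i0 inst τ a⟩
  refine ⟨τ, fun c => ?_, ?_⟩
  · have := hg2 (Polynomial.C c)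
    rw [← hτ] at this
    have e2 : ((r (Polynomial.C c) : k⟮z⟯) : L) = algebraMap k L c := by simp [r, evz]
    rw [e2] at this
    rw [this]; simp [g0, evz]
  · have := hg2 Polynomial.X
    rw [← hτ] at this
    have e2 : ((r (Polynomial.X) : k⟮z⟯) : L) = z := by simp [r, evz]
    rw [e2] at this
    rw [this]; simp [g0, evz]

theorem exists_perm_of_map_eq {L ι : Type} [Fintype ι] (a b : ι → L) (h : Multiset.map a Finset.univ.val = Multiset.map b Finset.univ.val) :
    ∃ g : Equiv.Perm ι, ∀ i, a (g i) = b i := by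
  classical
  have h1 : ∀ c : L, card {i // b i = c} = card {i // a i = c} := by
    intro c
    have := congrArg (Multiset.count c) h
    rw [Multiset.count_map, Multiset.count_map] at this
    rw [Fintype.card_subtype, Fintype.card_subtype]
    simp only [Finset.card, Finset.filter_val]
    simpa [eq_comm] using this.symm
  let e : ∀ c, {i // b i = c} ≃ {i // a i = c} := fun c => Fintype.equivOfCardEq (h1 c)
  let g : ι ≃ ι := (Equiv.sigmaFiberEquiv b).symm.trans ((Equiv.sigmaCongrRight e).trans (Equiv.sigmaFiberEquiv a))
  exact ⟨g, fun i => (e (b i) ⟨i, rfl⟩).2⟩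

/-- such an endomorphism permutes the roots -/
theorem tau_perm (hc : IsCov f z y) (σ : k →+* k) (hσ : f.map (mapRingHom σ) = f)
    {τ : L →+* L} (h1 : ∀ c, τ (algebraMap k L c) = algebraMap k L (σ c)) (h2 : τ z = z) :
    ∃ g : Equiv.Perm ι, ∀ i, τ (y (g i)) = y i := by
  classical
  have e1 : τ.comp (evz k z) = (evz k z).comp (mapRingHom σ) := by
    ext c
    · simp [evz, h1]
    · simp [evz, h2]
  have e2 : ∏ i, (Polynomial.X - Polynomial.C (τ (y i))) = ∏ i, (Polynomial.X - Polynomial.C (y i)) := by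
    have h3 := congrArg (Polynomial.map τ) hc.fac
    rw [Polynomial.map_map, e1, ← Polynomial.map_map, hσ, hc.fac] at h3
    rw [h3]; simp [Polynomial.map_prod]
  have e3 : Multiset.map (fun i => τ (y i)) Finset.univ.val = Multiset.map y Finset.univ.val := by
    have h4 := congrArg roots e2
    have r1 : ∀ w : ι → L, (∏ i, (Polynomial.X - Polynomial.C (w i))).roots = Multiset.map w Finset.univ.val := by
      intro w
      have := roots_multiset_prod_X_sub_C (Multiset.map w Finset.univ.val)
      rw [Multiset.map_map] at this
      exact this
    rwa [r1, r1] at h4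
  obtain ⟨g, hg⟩ := exists_perm_of_map_eq (fun i => τ (y i)) y e3
  exact ⟨g, hg⟩

end CDM

namespace CDM
variable {k L ι : Type} [Field k] [Field L] [Algebra k L] [Fintype ι]
variable {f : k[X][X]} {z : L} {y : ι → L}

/-- twisted endomorphisms -/
structure Tw (σ : k →+* k) (z : L) (τ : L →+* L) : Prop where
  c : ∀ c, τ (algebraMap k L c) = algebraMap k L (σ c)
  z : τ z = z

/-- permutations induced by Frobenius lifts -/
def Gam (σ : k →+* k) (z : L) (y : ι → L) : Set (Equiv.Perm ι) :=
  {g | ∃ τ : L →+* L, Tw σ z τ ∧ ∀ i, τ (y (g i)) = y i}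

theorem exists_phi {p e : ℕ} [hp : Fact p.Prime] [CharP k p] {σ : k →+* k} (hσ : ∀ c, σ c ^ p ^ e = c) {τ : L →+* L}
    (hτ : Tw σ z τ) : ∃ φ : L →ₐ[k] L, ∀ a, φ a = τ a ^ p ^ e := by
  have : CharP L p := charP_of_injective_algebraMap (algebraMap k L).injective p
  exact ⟨{ (iterateFrobenius L p e).comp τ with
    commutes' := fun c => by
      change τ (algebraMap k L c) ^ p ^ e = _
      rw [hτ.c, ← map_pow, hσ] }, fun a => rfl⟩

theorem Tw.surj (hc : IsCov f z y) {σ : k →+* k} (hs : Function.Surjective σ) (hσ : f.map (mapRingHom σ) = f) {τ : L →+* L}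
    (hτ : Tw σ z τ) : Function.Surjective τ := by
  let R : IntermediateField k L := { τ.fieldRange with
    algebraMap_mem' := fun c => by
      obtain ⟨c', rfl⟩ := hs c
      exact ⟨algebraMap k L c', hτ.c c'⟩ }
  have hR : R = ⊤ := by
    rw [eq_top_iff, ← hc.gen, adjoin_le_iff]
    obtain ⟨g, hg⟩ := tau_perm hc σ hσ hτ.c hτ.z
    rintro a (rfl | ⟨i, rfl⟩)
    · exact ⟨_, hτ.z⟩
    · exact ⟨_, hg i⟩
  intro a
  have : a ∈ R := by rw [hR]; trivial
  exact this

theorem fixes_adjoin {h : L →+* L} (h1 : ∀ c, h (algebraMap k L c) = algebraMap k L c) (h2 : h z = z) (a : k⟮z⟯) : h a = a := by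
  let R : IntermediateField k L := { h.eqLocusField (RingHom.id L) with
    algebraMap_mem' := fun c => h1 c }
  have hR : k⟮z⟯ ≤ R := by
    rw [adjoin_simple_le_iff]; exact h2
  exact hR a.2

theorem Tw.exists_h (hc : IsCov f z y) {σ : k →+* k} (hs : Function.Surjective σ) (hσ : f.map (mapRingHom σ) = f) {τ τ' : L →+* L}
    (hτ : Tw σ z τ) (hτ' : Tw σ z τ') : ∃ h : L ≃ₐ[k⟮z⟯] L, ∀ a, τ (h a) = τ' a := by
  have := hc.fin
  let e : L ≃+* L := RingEquiv.ofBijective τ ⟨τ.injective, hτ.surj hc hs hσ⟩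
  let h0 : L →+* L := e.symm.toRingHom.comp τ'
  have he : ∀ a, τ (h0 a) = τ' a := fun a => e.apply_symm_apply (τ' a)
  let h1 : L →ₐ[k⟮z⟯] L := { h0 with
    commutes' := fun a => fixes_adjoin (k := k) (z := z) (h := h0)
      (fun c => τ.injective (by rw [he, hτ.c, hτ'.c])) (τ.injective (by rw [he, hτ.z, hτ'.z])) a }
  refine ⟨AlgEquiv.ofBijective h1 (Algebra.IsAlgebraic.algHom_bijective h1), he⟩

theorem Tw.comp {σ : k →+* k} {τ : L →+* L} (hτ : Tw σ z τ) (h : L ≃ₐ[k⟮z⟯] L) :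
    Tw σ z (τ.comp (h : L →+* L)) where
  c := fun c => by
    have : h (algebraMap k L c) = algebraMap k L c := h.commutes (algebraMap k k⟮z⟯ c)
    change τ (h _) = _
    rw [this, hτ.c]
  z := by change τ (h z) = z; rw [h_z, hτ.z]

/-- for a good point, H acts simply transitively -/
theorem pt_card [IsAlgClosed k] (hc : IsCov f z y) (z0 : k) (hg : ∀ P : O0 k z y →ₐ[k] k, rv P z = z0 → Good P) :
    Nat.card (Pt k z y z0) = Nat.card (L ≃ₐ[k⟮z⟯] L) := by
  obtain ⟨P⟩ := pt_exists hc z0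
  refine (Nat.card_congr (Equiv.ofBijective (fun h => (⟨pcomp P.1 (hres h) (hres_O0 hc h), by
    rw [rv_hres hc, P.2]⟩ : Pt k z y z0)) ⟨?_, ?_⟩)).symm
  · intro h h' e
    have e1 : pcomp P.1 (hres h) (hres_O0 hc h) = pcomp P.1 (hres h') (hres_O0 hc h') := congrArg Subtype.val e
    refine hc.ext fun i => ?_
    obtain ⟨a, ha⟩ := hc.perm h i
    obtain ⟨b, hb⟩ := hc.perm h' i
    have h1 := (pcomp_spec (P := P.1) (hres_O0 hc h) (mem_V_of_mem (y_mem_O0 z y i))).2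
    have h2 := (pcomp_spec (P := P.1) (hres_O0 hc h') (mem_V_of_mem (y_mem_O0 z y i))).2
    rw [← e1, ← h1, hres_apply, hres_apply, ha, hb] at h2
    rw [ha, hb]
    by_contra hne
    exact hg P.1 P.2 _ _ (fun e => hne e) h2.symm
  · intro P'
    obtain ⟨h, hh⟩ := pt_trans hc P.1 P'.1 (by rw [P.2, P'.2])
    exact ⟨h, Subtype.ext hh.symm⟩

theorem cheb_num {H : Type} [Fintype H] (N : H → ℝ) (q s κ C1 : ℝ) (hs : 1 ≤ s) (hκ : 0 ≤ κ) (hC1 : 0 ≤ C1)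
    (hW : ∀ h, N h ≤ q + C1 * s) (hsum : (card H : ℝ) * (q - κ) ≤ ∑ h, N h) (h : H) :
    |N h - q| ≤ card H * (κ + C1) * s := by
  classical
  have hn : (1 : ℝ) ≤ card H := by exact_mod_cast Fintype.card_pos_iff.2 ⟨h⟩
  have h1 : ∑ h' ∈ Finset.univ.erase h, N h' ≤ (card H - 1 : ℝ) * (q + C1 * s) := by
    refine (Finset.sum_le_sum fun i _ => hW i).trans (le_of_eq ?_)
    rw [Finset.sum_const, Finset.card_erase_of_mem (Finset.mem_univ h), Finset.card_univ, nsmul_eq_mul,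
      Nat.cast_sub (Fintype.card_pos_iff.2 ⟨h⟩)]
    simp
  have h2 := Finset.add_sum_erase Finset.univ N (Finset.mem_univ h)
  have h3 := hW h
  have h4 : 0 ≤ κ * s := by positivity
  have h5 : 0 ≤ C1 * s := by positivity
  have h6 : κ ≤ κ * s := by nlinarith
  rw [abs_le]
  constructor
  · nlinarith
  · nlinarith

end CDM

namespace CDM

/-- upper bound for one Frobenius class, including points over `z0` -/
theorem N_bound (D κ : ℕ) : ∃ C : ℕ, ∀ {k L ι K : Type} [Field k] [Field L] [Algebra k L] [Fintype ι] [IsAlgClosed k]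
    [Field K] [Fintype K] [Algebra K k] {f : k[X][X]} {z : L} {y : ι → L} {p e : ℕ} {σ : k →+* k} {τ : L →+* L} {φ : L →ₐ[k] L}
    (_ : card ι = D) (hc : IsCov f z y) (_ : ∀ j, (f.coeff j).natDegree ≤ κ)
    (_ : p.Prime) (_ : CharP k p) (_ : card K = p ^ e)
    (_ : f.map (mapRingHom σ) = f) (_ : Tw σ z τ) (_ : ∀ a, φ a = τ a ^ p ^ e)
    (bad : Finset K) (_ : bad.card ≤ κ)
    (_ : ∀ z1 : K, z1 ∉ bad → ∀ P : O0 k z y →ₐ[k] k, rv P z = algebraMap K k z1 → Good P)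
    (_ : C ≤ card K)
    {S : Type} [Fintype S] (pp : S → O0 k z y →ₐ[k] k) (_ : Function.Injective pp)
    (_ : ∀ s, ∃ z1, z1 ∉ bad ∧ rv (pp s) z = algebraMap K k z1)
    (_ : ∀ s, ∀ i, rv (pp s) (φ (y i)) = rv (pp s) (y i)),
    card S ≤ card K + C * Nat.sqrt (card K) := by
  obtain ⟨C, hC⟩ := stepanov D κ
  refine ⟨C + D ^ D + κ + 1, ?_⟩
  intro k L ι K _ _ _ _ _ _ _ _ f z y p e σ τ φ hD hc hκ hp hch hcard hσ hτ hφ bad hbad hgood hCq S _ pp hinj hK hfix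
  classical
  obtain ⟨z0, hz0⟩ : ∃ z0 : K, z0 ∉ bad := by
    by_contra hcon
    push Not at hcon
    have : card K ≤ bad.card := by
      rw [← Finset.card_univ]; exact Finset.card_le_card fun a _ => hcon a
    omega
  obtain ⟨g, hg⟩ := tau_perm hc σ hσ hτ.c hτ.z
  have hKq : ∀ a : K, (algebraMap K k a) ^ p ^ e = algebraMap K k a := fun a => by
    rw [← hcard, ← map_pow, FiniteField.pow_card]
  have F : Frob z y (algebraMap K k z0) p e τ φ :=
    { prime := hp, ch := hch, τz := hτ.z, τy := fun i => ⟨g.symm i, by simpa using hg (g.symm i)⟩,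
      τs := fun j => ⟨g j, hg j⟩, φe := hφ, z0q := hKq z0 }
  have h : Chart f z y κ (algebraMap K k z0) (z - algebraMap k L (algebraMap K k z0))⁻¹
      (fun i => (z - algebraMap k L (algebraMap K k z0))⁻¹ ^ κ * y i) :=
    ⟨hc, hκ, hgood z0 hz0, rfl, fun _ => rfl⟩
  have hfixP : ∀ s, pcomp (pp s) φ F.φO0 = pp s := by
    intro s
    apply pt_ext
    · rw [← (pcomp_spec (P := pp s) F.φO0 (mem_V_of_mem (z_mem_O0 z y))).2, hφ, hτ.z,
        rv_pow (mem_V_of_mem (z_mem_O0 z y))]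
      obtain ⟨z1, -, h1⟩ := hK s
      rw [h1, hKq]
    · intro i
      rw [← (pcomp_spec (P := pp s) F.φO0 (mem_V_of_mem (y_mem_O0 z y i))).2, hfix]
  have h1 := hC hD h F (by omega) (σ := {s : S // rv (pp s) z ≠ algebraMap K k z0}) (fun s => pp s.1)
    (hinj.comp Subtype.val_injective) (fun s => by
      obtain ⟨z1, h1, h2⟩ := hK s.1
      exact hgood z1 h1 _ h2) (fun s => s.2) (fun s => hfixP s.1)
  have h2 : card {s : S // rv (pp s) z = algebraMap K k z0} ≤ D ^ D := by
    have hf := (pt_finite hc (algebraMap K k z0)).1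
    have h3 := (pt_finite hc (algebraMap K k z0)).2
    have h4 := h3.trans hc.finrank_le
    rw [hD] at h4
    rw [← Nat.card_eq_fintype_card]
    let F1 : {s : S // rv (pp s) z = algebraMap K k z0} → Pt k z y (algebraMap K k z0) := fun s => ⟨pp s.1, s.2⟩
    have hF1 : Function.Injective F1 := fun s s' e => Subtype.ext (hinj (congrArg Subtype.val e))
    exact (Nat.card_le_card_of_injective F1 hF1).trans h4
  have h3 := Fintype.card_subtype_compl (fun s : S => rv (pp s) z = algebraMap K k z0)
  have h5 : 1 ≤ Nat.sqrt (card K) := by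
    rw [Nat.le_sqrt]; have := Fintype.card_pos (α := K); omega
  rw [← hcard] at h1
  have h6 : card S ≤ card K + C * Nat.sqrt (card K) + D ^ D := by
    have : card {s : S // rv (pp s) z ≠ algebraMap K k z0} = card S - card {s : S // rv (pp s) z = algebraMap K k z0} := h3
    omega
  nlinarith

end CDM

namespace CDM

section gam
variable {k L ι : Type} [Field k] [Field L] [Algebra k L] [Fintype ι]
variable {f : k[X][X]} {z : L} {y : ι → L}

theorem gam_card (hc : IsCov f z y) {σ : k →+* k} (hs : Function.Surjective σ) (hσ : f.map (mapRingHom σ) = f)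
    {τ : L →+* L} (hτ : Tw σ z τ) : ∃ m : ℕ, 0 < m ∧ m ≤ Nat.card (Equiv.Perm ι) ∧
      ∀ (t : Equiv.Perm ι → Prop) (T : (L ≃ₐ[k⟮z⟯] L) → Prop),
        (∀ h g, (∀ i, τ (h (y (g i))) = y i) → (t g ↔ T h)) →
        Nat.card {g // g ∈ Gam σ z y ∧ t g} = m * Nat.card {h // T h} := by
  classical
  have := hc.fin
  have := hc.gal
  let _ : Fintype (L ≃ₐ[k⟮z⟯] L) := Fintype.ofFinite _
  refine ⟨(Finset.univ.filter (fun s : Equiv.Perm ι => ∀ i, y (s i) = y i)).card,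
    Finset.card_pos.2 ⟨1, by simp⟩, ?_, ?_⟩
  · rw [Nat.card_eq_fintype_card, ← Finset.card_univ]; exact Finset.card_le_card (Finset.filter_subset _ _)
  intro t T htT
  rw [Nat.card_eq_fintype_card, Nat.card_eq_fintype_card, Fintype.card_subtype, Fintype.card_subtype]
  have e1 : (Finset.univ.filter (fun g => g ∈ Gam σ z y ∧ t g)) = (Finset.univ.filter T).biUnion
      (fun h => Finset.univ.filter (fun g : Equiv.Perm ι => ∀ i, τ (h (y (g i))) = y i)) := by
    ext g
    simp only [Finset.mem_filter, Finset.mem_univ, true_and, Finset.mem_biUnion]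
    constructor
    · rintro ⟨⟨τ', h1, h2⟩, h3⟩
      obtain ⟨h, hh⟩ := hτ.exists_h hc hs hσ h1
      have : ∀ i, τ (h (y (g i))) = y i := fun i => by rw [hh, h2]
      exact ⟨h, (htT h g this).1 h3, this⟩
    · rintro ⟨h, h1, h2⟩
      exact ⟨⟨_, hτ.comp h, h2⟩, (htT h g h2).2 h1⟩
  rw [e1, Finset.card_biUnion, Finset.sum_const_nat (m := (Finset.univ.filter (fun s : Equiv.Perm ι => ∀ i, y (s i) = y i)).card), mul_comm]
  · intro h _
    obtain ⟨gh, hgh⟩ := tau_perm hc σ hσ (hτ.comp h).c (hτ.comp h).z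
    refine Finset.card_bij' (fun g _ => g * gh⁻¹) (fun s _ => s * gh) ?_ ?_ ?_ ?_
    · intro g hg
      simp only [Finset.mem_filter, Finset.mem_univ, true_and] at hg ⊢
      intro i
      have h1 := hgh (gh⁻¹ i)
      have h2 := hg (gh⁻¹ i)
      have h3 := (τ.comp (h : L →+* L)).injective (h2.trans h1.symm)
      simpa using h3
    · intro s hg
      simp only [Finset.mem_filter, Finset.mem_univ, true_and] at hg ⊢
      intro i
      rw [Equiv.Perm.mul_apply, hg]
      exact hgh i
    · intro g _; simp
    · intro g _; simp
  · intro h _ h' _ hne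
    rw [Function.onFun, Finset.disjoint_left]
    intro g hg hg'
    simp only [Finset.mem_filter, Finset.mem_univ, true_and] at hg hg'
    apply hne
    apply hc.ext
    intro i
    have h1 := hg (g⁻¹ i)
    have h2 := hg' (g⁻¹ i)
    have := τ.injective (h1.trans h2.symm)
    simpa using this
end gam

theorem hh_unique {k L ι K : Type} [Field k] [Field L] [Algebra k L] [Fintype ι] [IsAlgClosed k]
    [Field K] [Fintype K] [Algebra K k] {f : k[X][X]} {z : L} {y : ι → L} {p e : ℕ} {σ : k →+* k} {τ : L →+* L}
    (hc : IsCov f z y) (hp : p.Prime) (hch : CharP k p) (hcard : card K = p ^ e)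
    (hσq : ∀ c, σ c ^ p ^ e = c) (hσ : f.map (mapRingHom σ) = f) (hτ : Tw σ z τ)
    {z1 : K} {P : O0 k z y →ₐ[k] k} (hP : rv P z = algebraMap K k z1) (hg : Good P) :
    ∃! h : L ≃ₐ[k⟮z⟯] L, ∀ i, rv P (τ (h (y i)) ^ p ^ e) = rv P (y i) := by
  have := Fact.mk hp
  have hKq : ∀ a : K, (algebraMap K k a) ^ p ^ e = algebraMap K k a := fun a => by
    rw [← hcard, ← map_pow, FiniteField.pow_card]
  obtain ⟨φ, hφ⟩ := exists_phi hσq hτ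
  obtain ⟨g, hgg⟩ := tau_perm hc σ hσ hτ.c hτ.z
  have F : Frob z y (algebraMap K k z1) p e τ φ :=
    { prime := hp, ch := hch, τz := hτ.z, τy := fun i => ⟨g.symm i, by simpa using hgg (g.symm i)⟩,
      τs := fun j => ⟨g j, hgg j⟩, φe := hφ, z0q := hKq z1 }
  have hz : rv (pcomp P φ F.φO0) z = rv P z := by
    rw [← (pcomp_spec (P := P) F.φO0 (mem_V_of_mem (z_mem_O0 z y))).2, hφ, hτ.z,
        rv_pow (mem_V_of_mem (z_mem_O0 z y)), hP, hKq]
  obtain ⟨h, hh⟩ := pt_trans hc (pcomp P φ F.φO0) P hz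
  refine ⟨h, ?_, ?_⟩
  · intro i
    have h1 := (pcomp_spec (P := pcomp P φ F.φO0) (hres_O0 hc h) (mem_V_of_mem (y_mem_O0 z y i))).2
    rw [← hh, ← (pcomp_spec (P := P) F.φO0 (mem_V_of_mem (hres_O0 hc h _ (y_mem_O0 z y i)))).2, hφ, hres_apply] at h1
    exact h1
  · intro h' hh'
    have hh1 : ∀ i, rv P (τ (h (y i)) ^ p ^ e) = rv P (y i) := by
      intro i
      have h1 := (pcomp_spec (P := pcomp P φ F.φO0) (hres_O0 hc h) (mem_V_of_mem (y_mem_O0 z y i))).2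
      rw [← hh, ← (pcomp_spec (P := P) F.φO0 (mem_V_of_mem (hres_O0 hc h _ (y_mem_O0 z y i)))).2, hφ, hres_apply] at h1
      exact h1
    refine hc.ext fun i => τ.injective ?_
    obtain ⟨g1, hg1⟩ := tau_perm hc σ hσ (hτ.comp h).c (hτ.comp h).z
    obtain ⟨g2, hg2⟩ := tau_perm hc σ hσ (hτ.comp h').c (hτ.comp h').z
    have e1 : τ (h (y i)) = y (g1⁻¹ i) := by simpa using hg1 (g1⁻¹ i)
    have e2 : τ (h' (y i)) = y (g2⁻¹ i) := by simpa using hg2 (g2⁻¹ i)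
    have e3 := (hh' i).trans (hh1 i).symm
    rw [e1, e2, rv_pow (mem_V_of_mem (y_mem_O0 z y _)), rv_pow (mem_V_of_mem (y_mem_O0 z y _))] at e3
    have e4 := (iterateFrobenius_inj k p e) (by simpa [iterateFrobenius_def] using e3)
    rw [e1, e2]
    by_contra hne
    exact hg _ _ hne e4

end CDM

namespace CDM

set_option maxHeartbeats 1000000 in
theorem cheb (D κ : ℕ) : ∃ C : ℕ, ∀ {k L ι K : Type} [Field k] [Field L] [Algebra k L] [Fintype ι] [IsAlgClosed k]
    [Field K] [Fintype K] [Algebra K k] {f : k[X][X]} {z : L} {y : ι → L} {σ : k →+* k}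
    (_ : card ι = D) (_ : IsCov f z y) (_ : ∀ j, (f.coeff j).natDegree ≤ κ)
    (_ : ∀ c, σ c ^ card K = c)
    (_ : f.map (mapRingHom σ) = f)
    (bad : Finset K) (_ : bad.card ≤ κ)
    (_ : ∀ z1 : K, z1 ∉ bad → ∀ P : O0 k z y →ₐ[k] k, rv P z = algebraMap K k z1 → Good P)
    (_ : C ≤ card K) (Ψ : K → Prop) (t : Equiv.Perm ι → Prop)
    (_ : ∀ z1 : K, z1 ∉ bad → ∀ P : O0 k z y →ₐ[k] k, rv P z = algebraMap K k z1 → ∀ g ∈ Gam σ z y,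
      (∀ i, rv P (y i) ^ card K = rv P (y (g i))) → (Ψ z1 ↔ t g)),
    (∀ z1 : K, z1 ∉ bad → ∃ g ∈ Gam σ z y, (Ψ z1 ↔ t g)) ∧ 0 < Nat.card {g // g ∈ Gam σ z y} ∧
    |(Nat.card {g // g ∈ Gam σ z y} : ℝ) * Nat.card {z1 : K // z1 ∉ bad ∧ Ψ z1} -
      Nat.card {g // g ∈ Gam σ z y ∧ t g} * card K| ≤ C * √(card K) := by
  obtain ⟨C1, hC1⟩ := N_bound D κ
  obtain ⟨n0, hn0⟩ : ∃ n0, n0 = D ^ D := ⟨_, rfl⟩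
  obtain ⟨C2, hC2⟩ : ∃ C2, C2 = n0 * (κ + C1) := ⟨_, rfl⟩
  refine ⟨C1 + 2 * (C2 + 1) * (C2 + 1) + D.factorial * (n0 * C2), ?_⟩
  intro k L ι K _ _ _ _ _ _ _ _ f z y σ hD hc hκ hσq hσ bad hbad hgood hCq Ψ t htest
  classical
  obtain ⟨p, hpK⟩ := CharP.exists K
  obtain ⟨e, hp, hcard⟩ := FiniteField.card K p
  have hpf := Fact.mk hp
  have hch : CharP k p := charP_of_injective_algebraMap (algebraMap K k).injective p
  obtain ⟨e, he⟩ : ∃ e' : ℕ, e' = (e : ℕ) := ⟨_, rfl⟩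
  rw [← he] at hcard
  obtain ⟨τ, hτ1, hτ2⟩ := exists_tau hc σ hσ
  have hτ : Tw σ z τ := ⟨hτ1, hτ2⟩
  have hσq' : ∀ c, σ c ^ p ^ e = c := fun c => by rw [← hcard, hσq]
  have hsurj : Function.Surjective σ := fun c => ⟨c ^ card K, by rw [map_pow, hσq]⟩
  have := hc.fin
  have := hc.gal
  let _ : Fintype (L ≃ₐ[k⟮z⟯] L) := Fintype.ofFinite _
  have hnH : card (L ≃ₐ[k⟮z⟯] L) ≤ n0 := by
    rw [← Nat.card_eq_fintype_card, IsGalois.card_aut_eq_finrank, hn0, ← hD]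
    exact hc.finrank_le
  have hfin : ∀ z1 : K, Finite (Pt k z y (algebraMap K k z1)) := fun z1 => (pt_finite hc _).1
  let _ : ∀ z1 : {z1 : K // z1 ∉ bad}, Fintype (Pt k z y (algebraMap K k z1.1)) := fun z1 => @Fintype.ofFinite _ (hfin z1.1)
  let GP := Σ z1 : {z1 : K // z1 ∉ bad}, Pt k z y (algebraMap K k z1.1)
  let _ : Fintype GP := inferInstanceAs (Fintype (Σ z1 : {z1 : K // z1 ∉ bad}, Pt k z y (algebraMap K k z1.1)))
  have hGPg : ∀ s : GP, Good s.2.1 := fun s => hgood s.1.1 s.1.2 s.2.1 s.2.2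
  have hex := fun s : GP => hh_unique hc hp hch hcard hσq' hσ hτ s.2.2 (hGPg s)
  choose hh hh1 hh2 using hex
  choose φ hφ using fun h : L ≃ₐ[k⟮z⟯] L => exists_phi hσq' (hτ.comp h)
  let N : (L ≃ₐ[k⟮z⟯] L) → ℕ := fun h => card {s : GP // hh s = h}
  obtain ⟨q, hq⟩ : ∃ q, q = card K := ⟨_, rfl⟩
  have hqpos : 0 < q := hq ▸ Fintype.card_pos
  have hN : ∀ h, N h ≤ q + C1 * Nat.sqrt q := by
    intro h
    rw [hq]
    refine hC1 hD hc hκ hp hch hcard hσ (hτ.comp h) (hφ h) bad hbad hgood (by omega)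
      (S := {s : GP // hh s = h}) (fun s => s.1.2.1) ?_ ?_ ?_
    · rintro ⟨⟨⟨a, ha⟩, ⟨P, hP⟩⟩, h1⟩ ⟨⟨⟨b, hb⟩, ⟨Q, hQ⟩⟩, h2⟩ e
      change P = Q at e
      subst e
      have : a = b := (algebraMap K k).injective (hP.symm.trans hQ)
      subst this
      rfl
    · intro s; exact ⟨s.1.1.1, s.1.1.2, s.1.2.2⟩
    · rintro ⟨s, rfl⟩ i
      rw [hφ]; exact hh1 s i
  have hptc : ∀ z1 : {z1 : K // z1 ∉ bad}, card (Pt k z y (algebraMap K k z1.1)) = card (L ≃ₐ[k⟮z⟯] L) := by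
    intro z1
    rw [← Nat.card_eq_fintype_card, ← Nat.card_eq_fintype_card, pt_card hc _ (hgood z1.1 z1.2)]
  have hsumN : ∑ h, N h = card GP := by
    rw [← Fintype.card_congr (Equiv.sigmaFiberEquiv hh), Fintype.card_sigma]
  have hGP : card GP = card (L ≃ₐ[k⟮z⟯] L) * (q - bad.card) := by
    have : card GP = ∑ z1 : {z1 : K // z1 ∉ bad}, card (Pt k z y (algebraMap K k z1.1)) := Fintype.card_sigma
    rw [this, Finset.sum_congr rfl (fun z1 _ => hptc z1), Finset.sum_const, Finset.card_univ, smul_eq_mul, mul_comm]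
    congr 1
    rw [Fintype.card_subtype_compl, hq]; simp
  have hsq : (1 : ℝ) ≤ √q := by rw [Real.one_le_sqrt]; exact_mod_cast hqpos
  have hNr : ∀ h, |(N h : ℝ) - q| ≤ C2 * √q := by
    intro h
    have hnum := cheb_num (fun h => (N h : ℝ)) (q : ℝ) (√q) κ C1 hsq (by positivity) (by positivity) (fun h => by
      have h1 : (N h : ℝ) ≤ q + C1 * Nat.sqrt q := by exact_mod_cast hN h
      refine h1.trans ?_
      gcongr
      exact Real.nat_sqrt_le_real_sqrt) (by
      rw [← Nat.cast_sum, hsumN, hGP, Nat.cast_mul]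
      gcongr
      rw [sub_le_iff_le_add]
      norm_cast
      omega) h
    refine hnum.trans ?_
    rw [hC2]
    push_cast
    gcongr
  have hNpos : ∀ h, ∃ s : GP, hh s = h := by
    intro h
    by_contra hcon
    have h0 : N h = 0 := by
      rw [Fintype.card_eq_zero_iff]; exact ⟨fun s => hcon ⟨s.1, s.2⟩⟩
    have h1 := hNr h
    rw [h0, Nat.cast_zero, zero_sub, abs_neg, abs_of_nonneg (by positivity)] at h1
    have h2 : (q : ℝ) = √q * √q := (Real.mul_self_sqrt (by positivity)).symm
    have h3 : √q ≤ C2 := by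
      have : √q * √q ≤ C2 * √q := h2 ▸ h1
      exact le_of_mul_le_mul_right this (by linarith)
    have h4 : (q : ℝ) ≤ C2 * C2 := by rw [h2]; gcongr
    have h5 : q ≤ C2 * C2 := by exact_mod_cast h4
    have h6 : C2 * C2 < 2 * (C2 + 1) * (C2 + 1) := by nlinarith
    rw [← hq] at hCq
    omega
  let T : (L ≃ₐ[k⟮z⟯] L) → Prop := fun h => ∃ g : Equiv.Perm ι, (∀ i, τ (h (y (g i))) = y i) ∧ t g
  have htg : ∀ s : GP, ∀ g : Equiv.Perm ι, (∀ i, τ (hh s (y (g i))) = y i) → (Ψ s.1.1 ↔ t g) := by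
    intro s g hg
    refine htest s.1.1 s.1.2 s.2.1 s.2.2 g ⟨_, hτ.comp (hh s), hg⟩ fun i => ?_
    have h1 := hh1 s (g i)
    rw [hg, rv_pow (mem_V_of_mem (y_mem_O0 z y i)), ← hcard] at h1
    exact h1
  have hgex : ∀ h : L ≃ₐ[k⟮z⟯] L, ∃ g : Equiv.Perm ι, ∀ i, τ (h (y (g i))) = y i := fun h =>
    tau_perm hc σ hσ (hτ.comp h).c (hτ.comp h).z
  have hTs : ∀ s : GP, Ψ s.1.1 ↔ T (hh s) := by
    intro s
    constructor
    · intro hs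
      obtain ⟨g, hg⟩ := hgex (hh s)
      exact ⟨g, hg, (htg s g hg).1 hs⟩
    · rintro ⟨g, hg, h2⟩
      exact (htg s g hg).2 h2
  have htT : ∀ h g, (∀ i, τ (h (y (g i))) = y i) → (t g ↔ T h) := by
    intro h g hg
    obtain ⟨s, rfl⟩ := hNpos h
    rw [← htg s g hg, hTs]
  obtain ⟨m, hm0, hm1, hm⟩ := gam_card hc hsurj hσ hτ
  have g1 := hm (fun _ => True) (fun _ => True) (fun _ _ _ => Iff.rfl)
  have g2 := hm t T htT
  have g1' : Nat.card {g // g ∈ Gam σ z y} = m * card (L ≃ₐ[k⟮z⟯] L) := by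
    simpa [Nat.card_eq_fintype_card] using g1
  have hHpos : 0 < card (L ≃ₐ[k⟮z⟯] L) := Fintype.card_pos
  refine ⟨fun z1 h1 => ?_, by rw [g1']; positivity, ?_⟩
  · obtain ⟨P, hP⟩ := pt_exists hc (algebraMap K k z1)
    obtain ⟨g, hg⟩ := hgex (hh ⟨⟨z1, h1⟩, ⟨P, hP⟩⟩)
    exact ⟨g, ⟨_, hτ.comp _, hg⟩, htg ⟨⟨z1, h1⟩, ⟨P, hP⟩⟩ g hg⟩
  rw [g1', g2]
  -- the count
  have cnt : (card (L ≃ₐ[k⟮z⟯] L) : ℝ) * Nat.card {z1 : K // z1 ∉ bad ∧ Ψ z1} = ∑ h, if T h then (N h : ℝ) else 0 := by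
    have s1 : ∑ s : GP, (if Ψ s.1.1 then (1:ℝ) else 0) = ∑ h, if T h then (N h : ℝ) else 0 := by
      rw [← Finset.sum_fiberwise Finset.univ hh]
      refine Finset.sum_congr rfl fun h _ => ?_
      have : ∀ s ∈ Finset.univ.filter (fun s : GP => hh s = h), (if Ψ s.1.1 then (1:ℝ) else 0) = if T h then (1:ℝ) else 0 := by
        intro s hs
        rw [Finset.mem_filter] at hs
        simp only [hTs, hs.2]
      rw [Finset.sum_congr rfl this, Finset.sum_const]
      split_ifs <;> simp [N, Fintype.card_subtype]
    rw [← s1]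
    have s2 : ∑ s : GP, (if Ψ s.1.1 then (1:ℝ) else 0) = ∑ z1 : {z1 : K // z1 ∉ bad}, ∑ P : Pt k z y (algebraMap K k z1.1), (if Ψ z1.1 then (1:ℝ) else 0) :=
      Fintype.sum_sigma _
    rw [s2]
    simp only [Finset.sum_const, Finset.card_univ, hptc, nsmul_eq_mul]
    rw [← Finset.mul_sum]
    congr 1
    rw [Nat.card_congr (Equiv.subtypeSubtypeEquivSubtypeInter (fun z1 : K => z1 ∉ bad) Ψ).symm, Nat.card_eq_fintype_card, Fintype.card_subtype]
    simp
  have cT : (Nat.card {h // T h} : ℝ) * q = ∑ h, if T h then (q : ℝ) else 0 := by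
    rw [Nat.card_eq_fintype_card, Fintype.card_subtype, ← Finset.sum_filter, Finset.sum_const, nsmul_eq_mul]
  have key : |∑ h, (if T h then (N h : ℝ) else 0) - ∑ h, (if T h then (q : ℝ) else 0)| ≤ card (L ≃ₐ[k⟮z⟯] L) * (C2 * √q) := by
    rw [← Finset.sum_sub_distrib]
    refine (Finset.abs_sum_le_sum_abs _ _).trans ?_
    rw [← nsmul_eq_mul, ← Finset.card_univ, ← Finset.sum_const]
    refine Finset.sum_le_sum fun h _ => ?_
    split_ifs
    · exact hNr h
    · simp; positivity
  rw [← cnt, ← cT] at key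
  rw [← hq]
  have hmD : (m : ℝ) ≤ D.factorial := by
    have : Nat.card (Equiv.Perm ι) = D.factorial := by rw [Nat.card_eq_fintype_card, Fintype.card_perm, hD]
    exact_mod_cast this ▸ hm1
  calc |((m * card (L ≃ₐ[k⟮z⟯] L) : ℕ) : ℝ) * Nat.card {z1 : K // z1 ∉ bad ∧ Ψ z1} - ((m * Nat.card {h // T h} : ℕ) : ℝ) * q|
      = m * |(card (L ≃ₐ[k⟮z⟯] L) : ℝ) * Nat.card {z1 : K // z1 ∉ bad ∧ Ψ z1} - Nat.card {h // T h} * q| := by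
        have e1 : ((m * card (L ≃ₐ[k⟮z⟯] L) : ℕ) : ℝ) * Nat.card {z1 : K // z1 ∉ bad ∧ Ψ z1} - ((m * Nat.card {h // T h} : ℕ) : ℝ) * q = (m : ℝ) * ((card (L ≃ₐ[k⟮z⟯] L) : ℝ) * Nat.card {z1 : K // z1 ∉ bad ∧ Ψ z1} - Nat.card {h // T h} * q) := by
          push_cast; ring
        rw [e1, abs_mul, abs_of_nonneg (Nat.cast_nonneg (α := ℝ) m)]
    _ ≤ D.factorial * (n0 * (C2 * √q)) := by
        gcongr
        refine key.trans ?_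
        gcongr
    _ = ((D.factorial * (n0 * C2) : ℕ) : ℝ) * √q := by push_cast; ring
    _ ≤ _ := by
        gcongr
        omega

end CDM
end

section
open Polynomial IntermediateField
open Fintype (card)
open MvPolynomial (rename eval₂Hom optionEquivLeft optionEquivRight coe_eval₂Hom esymm eval₂Hom_X')

namespace CDM

/-- uniform integral equation -/
theorem int_poly {A : Type} [CommRing A] {ι : Type} (f : A[X]) (hf : f.Monic) (p : MvPolynomial ι A) :
    ∃ Θ : A[X], Θ.Monic ∧ ∀ {B : Type} [CommRing B] (φ : A →+* B) (y : ι → B),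
      (∀ i, f.eval₂ φ (y i) = 0) → Θ.eval₂ φ (MvPolynomial.eval₂ φ y p) = 0 := by
  let I : Ideal (MvPolynomial ι A) := Ideal.span (Set.range fun i => aeval (MvPolynomial.X i) f)
  let U := MvPolynomial ι A ⧸ I
  have hX : ∀ i, IsIntegral A (Ideal.Quotient.mk I (MvPolynomial.X i) : U) := by
    intro i
    refine ⟨f, hf, ?_⟩
    have : aeval (Ideal.Quotient.mkₐ A I (MvPolynomial.X i)) f = 0 := by
      rw [aeval_algHom_apply]
      exact Ideal.Quotient.eq_zero_iff_mem.2 (Ideal.subset_span ⟨i, rfl⟩)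
    exact this
  have hp : ∀ p : MvPolynomial ι A, IsIntegral A (Ideal.Quotient.mk I p : U) := by
    intro p
    induction p using MvPolynomial.induction_on with
    | C a => exact isIntegral_algebraMap (R := A) (A := U) (x := a)
    | add p q h1 h2 => rw [map_add]; exact h1.add h2
    | mul_X p i h => rw [map_mul]; exact h.mul (hX i)
  obtain ⟨Θ, h1, h2⟩ := hp p
  refine ⟨Θ, h1, fun {B} _ φ y hy => ?_⟩
  let ψ : U →+* B := Ideal.Quotient.lift I (eval₂Hom φ y) (by
    intro a ha
    have : I ≤ RingHom.ker (eval₂Hom φ y) := by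
      rw [Ideal.span_le]
      rintro _ ⟨i, rfl⟩
      rw [SetLike.mem_coe, RingHom.mem_ker]
      beta_reduce
      rw [aeval_def, hom_eval₂]
      rw [← hy i]
      congr 1
      · ext a; simp
      · simp
    exact this ha)
  have h3 := congrArg ψ h2
  rw [hom_eval₂, map_zero] at h3
  rw [← h3]
  have : ψ.comp (algebraMap A U) = φ := by
    ext a
    change ψ (Ideal.Quotient.mk I (MvPolynomial.C a)) = _
    exact (Ideal.Quotient.lift_mk I _ _).trans (by simp)
  rw [this]
  congr 1

/-- symmetric function theorem -/
theorem sym_poly {A ι : Type} [CommRing A] [Fintype ι] (f : A[X]) (p : MvPolynomial ι A)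
    (hp : p.IsSymmetric) : ∃ a : A, ∀ {B : Type} [CommRing B] [Nontrivial B] (φ : A →+* B) (y : ι → B),
      f.map φ = ∏ i, (X - C (y i)) → MvPolynomial.eval₂ φ y p = φ a := by
  classical
  obtain ⟨P, hP⟩ := MvPolynomial.esymmAlgHom_surjective (σ := ι) (R := A) (n := card ι) le_rfl ⟨p, hp⟩
  have hP' : MvPolynomial.aeval (fun i : Fin (card ι) => esymm ι A (i + 1)) P = p := by
    rw [← MvPolynomial.esymmAlgHom_apply, hP]
  refine ⟨MvPolynomial.eval (fun i : Fin (card ι) => (-1) ^ (i.1 + 1) * f.coeff (card ι - (i + 1))) P, ?_⟩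
  intro B _ _ φ y hy
  have key : ∀ i : Fin (card ι), MvPolynomial.eval₂ φ y (esymm ι A (i + 1)) =
      φ ((-1) ^ (i.1 + 1) * f.coeff (card ι - (i + 1))) := by
    intro i
    have h1 : MvPolynomial.eval₂ φ y (esymm ι A (i + 1)) = (Finset.univ.val.map y).esymm (i + 1) := by
      rw [← MvPolynomial.aeval_esymm_eq_multiset_esymm ι B]
      rw [← MvPolynomial.map_esymm (σ := ι) (n := i.1+1) (f := φ), MvPolynomial.aeval_def, MvPolynomial.eval₂_map]
      congr 1
    have h2 := congrArg (fun g => coeff g (card ι - (i + 1))) hy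
    simp only [coeff_map] at h2
    have h3 : ∏ j, (X - C (y j)) = ((Finset.univ.val.map y).map fun x => X - C x).prod := by
      rw [Multiset.map_map]; rfl
    rw [h3, Multiset.prod_X_sub_C_coeff _ (by simp)] at h2
    have h4 : Multiset.card (Finset.univ.val.map y) - (card ι - (i + 1)) = i + 1 := by
      rw [Multiset.card_map]; change card ι - _ = _; omega
    rw [h4] at h2
    rw [map_mul, h2, h1, map_pow, map_neg, map_one, ← mul_assoc, ← mul_pow]; simp
  rw [← hP', MvPolynomial.aeval_def]
  change eval₂Hom φ y (MvPolynomial.eval₂ _ _ P) = _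
  rw [MvPolynomial.eval₂_comp_left, ← MvPolynomial.eval₂_id, MvPolynomial.eval₂_comp_left φ]
  have e : (fun i : Fin (card ι) => (eval₂Hom φ y) (esymm ι A (i + 1))) =
     φ ∘ fun i : Fin (card ι) => (-1) ^ (i.1 + 1) * f.coeff (card ι - (i + 1)) := funext key
  rw [show (⇑(eval₂Hom φ y) ∘ fun i : Fin (card ι) => (esymm ι A (i + 1))) = _ from e]
  congr 1
  ext a; simp

end CDM

namespace CDM

/-- uniform families of subsets of `K^V` -/
abbrev Fam (V : Type) := ∀ (K : Type) [Field K] [Fintype K], (V → K) → Prop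

abbrev AC (K : Type) [Field K] := AlgebraicClosure K

noncomputable def wb {V K : Type} [Field K] (w : V → K) : V → AC K := fun v => algebraMap K (AC K) (w v)

noncomputable def wev {V K : Type} [Field K] (w : V → K) : MvPolynomial V ℤ →+* AC K :=
  eval₂Hom (Int.castRingHom _) (wb w)

def Rt {V K : Type} [Field K] (f : (MvPolynomial V ℤ)[X]) (w : V → K) : Set (AC K) := {x | f.eval₂ (wev w) x = 0}

noncomputable def tev {V σ K : Type} [Field K] (w : V → K) (x : σ → AC K) : MvPolynomial (V ⊕ σ) ℤ →+* AC K :=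
  eval₂Hom (Int.castRingHom _) (Sum.elim (wb w) x)

structure IsoW {V : Type} (f : (MvPolynomial V ℤ)[X]) (T : Set (MvPolynomial (V ⊕ ℕ) ℤ))
    {K : Type} [Field K] [Fintype K] (w : V → K) (r : ℕ) {K' : Type} [Field K'] [Fintype K'] (w' : V → K') (r' : ℕ)
    (b : AC K → AC K') : Prop where
  bij : Set.BijOn b (Rt f w) (Rt f w')
  frob : ∀ x ∈ Rt f w, b (x ^ card K ^ r) = b x ^ card K' ^ r'
  test : ∀ p ∈ T, ∀ x : ℕ → AC K, (∀ i, x i ∈ Rt f w) → (tev w x p = 0 ↔ tev w' (fun i => b (x i)) p = 0)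

def NiceD {V : Type} (C M : ℕ) (f : (MvPolynomial V ℤ)[X]) (T : Set (MvPolynomial (V ⊕ ℕ) ℤ)) (ψ : Fam V) : Prop :=
  ∀ {K : Type} [Field K] [Fintype K] {K' : Type} [Field K'] [Fintype K'] (w : V → K) (w' : V → K') (r r' : ℕ)
    (b : AC K → AC K'), C ≤ card K → C ≤ card K' → r.Coprime M → r'.Coprime M →
    IsoW f T w r w' r' b → (ψ K w ↔ ψ K' w')

def Nice {V : Type} (ψ : Fam V) : Prop := ∃ (C M : ℕ) (f : (MvPolynomial V ℤ)[X]) (T : Set (MvPolynomial (V ⊕ ℕ) ℤ)),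
  M ≠ 0 ∧ f.Monic ∧ T.Finite ∧ NiceD C M f T ψ

section
variable {V K : Type} [Field K] [Fintype K]

theorem pow_mem_Rt (f : (MvPolynomial V ℤ)[X]) (w : V → K) (r : ℕ) {x : AC K} (hx : x ∈ Rt f w) :
    x ^ card K ^ r ∈ Rt f w := by
  obtain ⟨p, hpK⟩ := CharP.exists K
  obtain ⟨e, hp, hcard⟩ := FiniteField.card K p
  have hpf := Fact.mk hp
  have hch : CharP (AC K) p := charP_of_injective_algebraMap (algebraMap K (AC K)).injective p
  have hE : ExpChar (AC K) p := ExpChar.prime hp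
  have h1 : (iterateFrobenius (AC K) p (e * r)).comp (wev w) = wev w := by
    apply MvPolynomial.ringHom_ext
    · intro n; simp [wev]
    · intro v
      simp only [wev, RingHom.comp_apply, eval₂Hom_X', wb, iterateFrobenius_def]
      rw [← map_pow, pow_mul, ← hcard]
      congr 1
      rw [FiniteField.pow_card_pow]
  have h2 := congrArg (iterateFrobenius (AC K) p (e * r)) hx
  rw [map_zero, hom_eval₂, h1, iterateFrobenius_def, pow_mul, ← hcard] at h2
  exact h2

theorem Rt_finite (f : (MvPolynomial V ℤ)[X]) (hf : f.Monic) (w : V → K) : (Rt f w).Finite := by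
  have h := (f.map (wev w)).rootSet_finite (AC K)
  refine h.subset ?_
  intro x hx
  rw [mem_rootSet]
  refine ⟨(hf.map _).ne_zero, ?_⟩
  have hx' : f.eval₂ (wev w) x = 0 := hx
  simpa [aeval_def, eval₂_map] using hx'

theorem Rt_mul (f g : (MvPolynomial V ℤ)[X]) (w : V → K) : Rt (f * g) w = Rt f w ∪ Rt g w := by
  ext x; simp [Rt, eval₂_mul]

end

theorem IsoW.symm {V : Type} {f : (MvPolynomial V ℤ)[X]} {T : Set (MvPolynomial (V ⊕ ℕ) ℤ)}
    {K : Type} [Field K] [Fintype K] {w : V → K} {r : ℕ} {K' : Type} [Field K'] [Fintype K'] {w' : V → K'} {r' : ℕ}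
    {b : AC K → AC K'} (h : IsoW f T w r w' r' b) : IsoW f T w' r' w r (Function.invFunOn b (Rt f w)) := by
  have hinv := h.bij.invOn_invFunOn
  have hmap : Set.MapsTo (Function.invFunOn b (Rt f w)) (Rt f w') (Rt f w) := h.bij.surjOn.mapsTo_invFunOn
  refine ⟨h.bij.symm hinv.symm, ?_, ?_⟩
  · intro x hx
    apply h.bij.injOn (hmap (pow_mem_Rt f w' r' hx)) (pow_mem_Rt f w r (hmap hx))
    rw [hinv.2 (pow_mem_Rt f w' r' hx), h.frob _ (hmap hx), hinv.2 hx]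
  · intro p hp x hx
    rw [h.test p hp _ (fun i => hmap (hx i))]
    simp only [hinv.2 (hx _)]

/-- one direction suffices -/
theorem NiceD.of_imp {V : Type} {C M : ℕ} {f : (MvPolynomial V ℤ)[X]} {T : Set (MvPolynomial (V ⊕ ℕ) ℤ)} {ψ : Fam V}
    (h : ∀ {K : Type} [Field K] [Fintype K] {K' : Type} [Field K'] [Fintype K'] (w : V → K) (w' : V → K') (r r' : ℕ)
    (b : AC K → AC K'), C ≤ card K → C ≤ card K' → r.Coprime M → r'.Coprime M →
    IsoW f T w r w' r' b → ψ K w → ψ K' w') : NiceD C M f T ψ :=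
  fun w w' r r' b h1 h2 h3 h4 h5 => ⟨h w w' r r' b h1 h2 h3 h4 h5, h w' w r' r _ h2 h1 h4 h3 h5.symm⟩

section
variable {V : Type} {f g : (MvPolynomial V ℤ)[X]} {T T' : Set (MvPolynomial (V ⊕ ℕ) ℤ)}
    {K : Type} [Field K] [Fintype K] {w : V → K} {r : ℕ} {K' : Type} [Field K'] [Fintype K'] {w' : V → K'} {r' : ℕ}
    {b : AC K → AC K'}

/-- the test polynomial saying that the `i`-th variable is a root of `g` -/
noncomputable def rootTest (g : (MvPolynomial V ℤ)[X]) : MvPolynomial (V ⊕ ℕ) ℤ :=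
  g.eval₂ (rename Sum.inl).toRingHom (MvPolynomial.X (Sum.inr 0))

theorem tev_rename {K : Type} [Field K] (w : V → K) (x : ℕ → AC K) (a : MvPolynomial V ℤ) :
    tev w x (rename Sum.inl a) = wev w a := by
  simp only [tev, wev, coe_eval₂Hom, MvPolynomial.eval₂_rename]
  congr 1

theorem tev_rootTest (w : V → K) (x : ℕ → AC K) (g : (MvPolynomial V ℤ)[X]) :
    tev w x (rootTest g) = 0 ↔ x 0 ∈ Rt g w := by
  rw [rootTest, hom_eval₂]
  have : (tev w x).comp ((rename Sum.inl).toRingHom) = wev w := by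
    exact RingHom.ext fun a => tev_rename w x a
  rw [this]
  simp [Rt, tev]

theorem IsoW.sub (h : IsoW f T w r w' r' b) (hg : g ∣ f) (ht : rootTest g ∈ T) (hT : T' ⊆ T) : IsoW g T' w r w' r' b := by
  obtain ⟨g', rfl⟩ := hg
  have hsub : Rt g w ⊆ Rt (g * g') w := by rw [Rt_mul]; exact Set.subset_union_left
  have hsub' : Rt g w' ⊆ Rt (g * g') w' := by rw [Rt_mul]; exact Set.subset_union_left
  have key : ∀ x ∈ Rt (g * g') w, (x ∈ Rt g w ↔ b x ∈ Rt g w') := by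
    intro x hx
    have := h.test _ ht (fun _ => x) (fun _ => hx)
    rwa [tev_rootTest, tev_rootTest] at this
  refine ⟨⟨fun x hx => (key x (hsub hx)).1 hx, h.bij.injOn.mono hsub, ?_⟩, fun x hx => h.frob x (hsub hx), fun p hp x hx =>
    h.test p (hT hp) x fun i => hsub (hx i)⟩
  intro x hx
  obtain ⟨u, hu, rfl⟩ := h.bij.surjOn (hsub' hx)
  exact ⟨u, (key u hu).2 hx, rfl⟩

end

theorem Nat.Coprime_of_mul {r M N : ℕ} (h : r.Coprime (M * N)) : r.Coprime M ∧ r.Coprime N :=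
  Nat.coprime_mul_iff_right.1 h

section
variable {V : Type}

theorem NiceD.mono {C M C' M' : ℕ} {f f' : (MvPolynomial V ℤ)[X]} {T T' : Set (MvPolynomial (V ⊕ ℕ) ℤ)} {ψ : Fam V}
    (h : NiceD C M f T ψ) (hC : C ≤ C') (hM : M ∣ M') (hf : f ∣ f') (hT : T ⊆ T') (ht : rootTest f ∈ T') :
    NiceD C' M' f' T' ψ := fun w w' r r' b h1 h2 h3 h4 h5 =>
  h w w' r r' b (hC.trans h1) (hC.trans h2) (h3.coprime_dvd_right hM) (h4.coprime_dvd_right hM) (h5.sub hf ht hT)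

/-- finitely many nice families have common data -/
theorem nice_common {ι : Type} [Finite ι] {ψ : ι → Fam V} (h : ∀ i, Nice (ψ i)) :
    ∃ (C M : ℕ) (f : (MvPolynomial V ℤ)[X]) (T : Set (MvPolynomial (V ⊕ ℕ) ℤ)),
      M ≠ 0 ∧ f.Monic ∧ T.Finite ∧ ∀ i, NiceD C M f T (ψ i) := by
  have := Fintype.ofFinite ι
  choose C M f T h1 h2 h3 h4 using h
  refine ⟨∑ i, C i, ∏ i, M i, ∏ i, f i, (⋃ i, T i) ∪ ⋃ i, {rootTest (f i)}, Finset.prod_ne_zero_iff.2 fun i _ => h1 i,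
    monic_prod_of_monic _ _ fun i _ => h2 i,
    (Set.finite_iUnion h3).union (Set.finite_iUnion fun i => Set.finite_singleton _), fun i => ?_⟩
  exact NiceD.mono (h4 i) (Finset.single_le_sum (f := C) (fun _ _ => Nat.zero_le _) (Finset.mem_univ i))
    (Finset.dvd_prod_of_mem _ (Finset.mem_univ i)) (Finset.dvd_prod_of_mem _ (Finset.mem_univ i))
    (fun x hx => Or.inl (Set.mem_iUnion.2 ⟨i, hx⟩)) (Or.inr (Set.mem_iUnion.2 ⟨i, rfl⟩))

/-- boolean combinations -/
theorem Nice.comb {ι : Type} [Finite ι] {ψ : ι → Fam V} (h : ∀ i, Nice (ψ i)) (φ : Fam V) (C0 : ℕ)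
    (hφ : ∀ {K : Type} [Field K] [Fintype K] {K' : Type} [Field K'] [Fintype K'] (w : V → K) (w' : V → K'),
      C0 ≤ card K → C0 ≤ card K' →
      (∀ i, ψ i K w ↔ ψ i K' w') → φ K w → φ K' w') : Nice φ := by
  obtain ⟨C, M, f, T, h1, h2, h3, h4⟩ := nice_common h
  refine ⟨C + C0, M, f, T, h1, h2, h3, NiceD.of_imp fun w w' r r' b g1 g2 g3 g4 g5 => ?_⟩
  exact hφ w w' (by omega) (by omega) fun i => h4 i w w' r r' b (by omega) (by omega) g3 g4 g5

theorem Nice.not {ψ : Fam V} (h : Nice ψ) : Nice (fun K _ _ w => ¬ ψ K w) :=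
  Nice.comb (ι := Unit) (fun _ => h) _ 0 (fun w w' _ _ h => by simp [h ()])

theorem Nice.and {ψ φ : Fam V} (h : Nice ψ) (h' : Nice φ) : Nice (fun K _ _ w => ψ K w ∧ φ K w) :=
  Nice.comb (ι := Bool) (ψ := fun b => if b then ψ else φ) (fun b => by cases b <;> simpa) _ 0 (fun w w' _ _ h => by
    have h1 := h true; have h2 := h false; simp at h1 h2; simp [h1, h2])

theorem Nice.or {ψ φ : Fam V} (h : Nice ψ) (h' : Nice φ) : Nice (fun K _ _ w => ψ K w ∨ φ K w) :=
  Nice.comb (ι := Bool) (ψ := fun b => if b then ψ else φ) (fun b => by cases b <;> simpa) _ 0 (fun w w' _ _ h => by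
    have h1 := h true; have h2 := h false; simp at h1 h2; simp [h1, h2])

theorem Nice.imp {ψ φ : Fam V} (h : Nice ψ) (h' : Nice φ) : Nice (fun K _ _ w => ψ K w → φ K w) :=
  Nice.comb (ι := Bool) (ψ := fun b => if b then ψ else φ) (fun b => by cases b <;> simpa) _ 0 (fun w w' _ _ h => by
    have h1 := h true; have h2 := h false; simp at h1 h2; simp [h1, h2])

theorem Nice.congr {ψ φ : Fam V} (h : Nice ψ) (C0 : ℕ) (hh : ∀ (K : Type) [Field K] [Fintype K] (w : V → K), C0 ≤ card K → (ψ K w ↔ φ K w)) : Nice φ :=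
  Nice.comb (ι := Unit) (fun _ => h) _ C0 (fun w w' h1 h2 h => by rw [← hh _ w h1, ← hh _ w' h2, h ()]; exact id)

theorem Nice.exists {ι : Type} [Finite ι] {ψ : ι → Fam V} (h : ∀ i, Nice (ψ i)) : Nice (fun K _ _ w => ∃ i, ψ i K w) :=
  Nice.comb h _ 0 (fun w w' _ _ h => by simp [h])

theorem Nice.forall {ι : Type} [Finite ι] {ψ : ι → Fam V} (h : ∀ i, Nice (ψ i)) : Nice (fun K _ _ w => ∀ i, ψ i K w) :=
  Nice.comb h _ 0 (fun w w' _ _ h => by simp [h])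

theorem Nice.true : Nice (fun _ _ _ (_ : V → _) => True) := ⟨0, 1, 1, ∅, one_ne_zero, monic_one, Set.finite_empty, fun _ _ _ _ _ _ _ _ _ _ => Iff.rfl⟩
theorem Nice.false : Nice (fun _ _ _ (_ : V → _) => False) := ⟨0, 1, 1, ∅, one_ne_zero, monic_one, Set.finite_empty, fun _ _ _ _ _ _ _ _ _ _ => Iff.rfl⟩

theorem zero_mem_Rt_X {K : Type} [Field K] (w : V → K) : (0 : AC K) ∈ Rt X w := by simp [Rt]

theorem wev_eq {K : Type} [Field K] (w : V → K) (a : MvPolynomial V ℤ) : wev w a = algebraMap K (AC K) (MvPolynomial.aeval w a) := by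
  induction a using MvPolynomial.induction_on with
  | C a => simp [wev]
  | add p q h1 h2 => simp [h1, h2]
  | mul_X p i h => rw [map_mul, h, map_mul, map_mul]; simp [wev, wb]

theorem wev_eq_zero {K : Type} [Field K] (w : V → K) (a : MvPolynomial V ℤ) : wev w a = 0 ↔ MvPolynomial.aeval w a = 0 := by
  rw [wev_eq]; exact map_eq_zero _

/-- polynomial atoms -/
theorem Nice.atom (a : MvPolynomial V ℤ) : Nice (fun _ _ _ (w : V → _) => MvPolynomial.aeval w a = 0) := by
  refine ⟨0, 1, X, {rename Sum.inl a}, one_ne_zero, monic_X, Set.finite_singleton _, fun w w' r r' b _ _ _ _ h => ?_⟩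
  have := h.test _ rfl (fun _ => 0) (fun _ => zero_mem_Rt_X w)
  rwa [tev_rename, tev_rename, wev_eq_zero, wev_eq_zero] at this

/-- polynomial substitution -/
theorem Nice.subst {V' : Type} {ψ : Fam V} (h : Nice ψ) (u : V → MvPolynomial V' ℤ) :
    Nice (fun K _ _ w => ψ K (fun v => MvPolynomial.aeval w (u v))) := by
  obtain ⟨C, M, f, T, h1, h2, h3, h4⟩ := h
  let s : MvPolynomial V ℤ →+* MvPolynomial V' ℤ := (MvPolynomial.aeval u).toRingHom
  let S : MvPolynomial (V ⊕ ℕ) ℤ →+* MvPolynomial (V' ⊕ ℕ) ℤ :=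
    (MvPolynomial.aeval (Sum.elim (fun v => rename Sum.inl (u v)) (fun i => MvPolynomial.X (Sum.inr i)))).toRingHom
  have e1 : ∀ {K : Type} [Field K] (w : V' → K), Rt (f.map s) w = Rt f (fun v => MvPolynomial.aeval w (u v)) := by
    intro K _ w
    ext x
    simp only [Rt, eval₂_map, Set.mem_ofPred_eq]
    have : (wev w).comp s = wev (fun v => MvPolynomial.aeval w (u v)) := by
      apply MvPolynomial.ringHom_ext
      · intro n; simp
      · intro v
        rw [RingHom.comp_apply, wev_eq, wev_eq]; simp [s]
    rw [this]
  have e2 : ∀ {K : Type} [Field K] (w : V' → K) (x : ℕ → AC K) p, tev w x (S p) = tev (fun v => MvPolynomial.aeval w (u v)) x p := by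
    intro K _ w x p
    have : (tev w x).comp S = tev (fun v => MvPolynomial.aeval w (u v)) x := by
      apply MvPolynomial.ringHom_ext
      · intro n; simp
      · rintro (v | i)
        · simp only [RingHom.comp_apply, S, AlgHom.toRingHom_eq_coe, RingHom.coe_coe, MvPolynomial.aeval_X, Sum.elim_inl]
          rw [tev_rename, wev_eq]; simp [tev, wb]
        · simp [S, tev]
    rw [← this]; rfl
  refine ⟨C, M, f.map s, S '' T, h1, h2.map _, h3.image _, fun w w' r r' b g1 g2 g3 g4 g5 => ?_⟩
  refine h4 _ _ r r' b g1 g2 g3 g4 ⟨?_, ?_, ?_⟩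
  · rw [← e1, ← e1]; exact g5.bij
  · rw [← e1]; exact g5.frob
  · intro p hp x hx
    rw [← e1] at hx
    have := g5.test _ ⟨p, hp, rfl⟩ x hx
    rwa [e2, e2] at this

end
end CDM

namespace CDM

def oc {V K : Type} (u : K) (w : V → K) : Option V → K := fun o => o.elim u w

section
variable {K : Type} [Field K] [Fintype K]

theorem alg_pow_card (u : K) (r : ℕ) : (algebraMap K (AC K) u) ^ card K ^ r = algebraMap K (AC K) u := by
  rw [← map_pow, FiniteField.pow_card_pow]

theorem mem_range_of_pow_card (y : AC K) (h : y ^ card K = y) : ∃ u : K, algebraMap K (AC K) u = y := by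
  classical
  have hne : (X ^ card K - X : (AC K)[X]) ≠ 0 := FiniteField.X_pow_card_sub_X_ne_zero _ Fintype.one_lt_card
  by_contra hcon
  push Not at hcon
  have h1 : (insert y (Finset.univ.image (algebraMap K (AC K)))) ⊆ (X ^ card K - X : (AC K)[X]).roots.toFinset := by
    intro x hx
    rw [Multiset.mem_toFinset, mem_roots hne]
    rcases Finset.mem_insert.1 hx with rfl | hx
    · simp [h]
    · obtain ⟨u, -, rfl⟩ := Finset.mem_image.1 hx
      have := alg_pow_card u 1
      rw [pow_one] at this
      simp [this]
  have h2 := (Finset.card_le_card h1).trans ((Multiset.toFinset_card_le _).trans (card_roots' _))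
  rw [Finset.card_insert_of_notMem (by simpa using hcon), Finset.card_image_of_injective _ (algebraMap K (AC K)).injective,
    FiniteField.X_pow_card_sub_X_natDegree_eq _ Fintype.one_lt_card, Finset.card_univ] at h2
  omega

theorem iter_pow (y : AC K) (n : ℕ) : (fun x : AC K => x ^ card K)^[n] y = y ^ card K ^ n := by
  induction n with
  | zero => simp
  | succ n ih => rw [Function.iterate_succ_apply', ih, ← pow_mul, pow_succ]

theorem frob_fix {S : Set (AC K)} (hS : S.Finite) {d : ℕ} (hd : S.ncard ≤ d) (hcl : ∀ x ∈ S, x ^ card K ∈ S)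
    {y : AC K} (hy : y ∈ S) {r : ℕ} (hr : r.Coprime d.factorial) (h : y ^ card K ^ r = y) :
    ∃ u : K, algebraMap K (AC K) u = y := by
  apply mem_range_of_pow_card
  set F : AC K → AC K := fun x => x ^ card K with hF
  have hmem : ∀ n, F^[n] y ∈ S := by
    intro n
    induction n with
    | zero => exact hy
    | succ n ih => rw [Function.iterate_succ_apply']; exact hcl _ ih
  have h1 : Function.IsPeriodicPt F r y := by
    rw [Function.IsPeriodicPt, Function.IsFixedPt, hF, iter_pow, h]
  have hinj : Function.Injective F := by
    obtain ⟨p, hpK⟩ := CharP.exists K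
    obtain ⟨e, hp, hcard⟩ := FiniteField.card K p
    have hpf := Fact.mk hp
    have hch : CharP (AC K) p := charP_of_injective_algebraMap (algebraMap K (AC K)).injective p
    have hE : ExpChar (AC K) p := ExpChar.prime hp
    intro a b hab
    simp only [hF, hcard] at hab
    rw [← iterateFrobenius_def, ← iterateFrobenius_def] at hab
    exact (iterateFrobenius (AC K) p e).injective hab
  have h2 : Function.minimalPeriod F y ∣ r := h1.minimalPeriod_dvd
  have h3 : Function.minimalPeriod F y ∣ d.factorial := by
    -- a period ≤ d exists by pigeonhole
    rcases Nat.eq_zero_or_pos d with hd0 | hd0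
    · subst hd0
      rw [Nat.le_zero, Set.ncard_eq_zero hS] at hd
      rw [hd] at hy; exact hy.elim
    have : ∃ a ∈ Finset.range (d + 1), ∃ b ∈ Finset.range (d + 1), a ≠ b ∧ F^[a] y = F^[b] y := by
      apply Finset.exists_ne_map_eq_of_card_lt_of_maps_to (t := hS.toFinset)
      · rw [← Set.ncard_eq_toFinset_card S hS, Finset.card_range]; omega
      · intro n _; simpa using hmem n
    obtain ⟨a, ha, b, hb, hab, he⟩ := this
    wlog hlt : a < b generalizing a b
    · exact this b hb a ha hab.symm he.symm (by omega)
    have h4 : Function.IsPeriodicPt F (b - a) y := by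
      apply (hinj.iterate a)
      rw [← Function.iterate_add_apply, show a + (b - a) = b by omega, he]
    refine h4.minimalPeriod_dvd.trans (Nat.dvd_factorial (by omega) ?_)
    have := Finset.mem_range.1 hb; omega
  have h5 : Function.minimalPeriod F y = 1 := by
    have := Nat.dvd_gcd h2 h3
    rw [hr] at this
    exact Nat.dvd_one.1 this
  exact Function.minimalPeriod_eq_one_iff_isFixedPt.1 h5

theorem Rt_ncard {V : Type} (f : (MvPolynomial V ℤ)[X]) (hf : f.Monic) (w : V → K) : (Rt f w).ncard ≤ f.natDegree := by
  classical
  have h0 : f.map (wev w) ≠ 0 := (hf.map _).ne_zero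
  have : Rt f w = ((f.map (wev w)).roots.toFinset : Set (AC K)) := by
    ext x; simp [Rt, eval_map]
    exact fun _ => h0
  rw [this, Set.ncard_coe_finset]
  exact (Multiset.toFinset_card_le _).trans ((card_roots' _).trans natDegree_map_le)

end

/-- a common integral equation for roots of `f` over roots of `b` -/
theorem tower_poly {V : Type} (b : (MvPolynomial V ℤ)[X]) (hb : b.Monic) (f : (MvPolynomial (Option V) ℤ)[X]) (hf : f.Monic) :
    ∃ G : (MvPolynomial V ℤ)[X], G.Monic ∧ ∀ {K : Type} [Field K] (w : V → K) (u : K) (y : AC K),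
      algebraMap K (AC K) u ∈ Rt b w → y ∈ Rt f (oc u w) → y ∈ Rt G w := by
  let B := AdjoinRoot b
  let φ : MvPolynomial (Option V) ℤ →+* B := eval₂Hom (Int.castRingHom _)
    (fun o => o.elim (AdjoinRoot.root b) (fun v => AdjoinRoot.of b (MvPolynomial.X v)))
  let U := AdjoinRoot (f.map φ)
  have h1 : IsIntegral B (AdjoinRoot.root (f.map φ)) := AdjoinRoot.isIntegral_root' (hf.map φ)
  have : Algebra.IsIntegral (MvPolynomial V ℤ) B := by
    have := hb.finite_adjoinRoot
    infer_instance
  have h2 : IsIntegral (MvPolynomial V ℤ) (AdjoinRoot.root (f.map φ)) := isIntegral_trans _ h1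
  obtain ⟨G, hG, hG2⟩ := h2
  refine ⟨G, hG, ?_⟩
  intro K _ w u y hu hy
  let e1 : B →+* AC K := AdjoinRoot.lift (wev w) (algebraMap K (AC K) u) hu
  have e1r : e1 (AdjoinRoot.root b) = algebraMap K (AC K) u := AdjoinRoot.lift_root hu
  have e1o : ∀ a, e1 (AdjoinRoot.of b a) = wev w a := fun a => AdjoinRoot.lift_of hu
  have he1 : e1.comp φ = wev (oc u w) := by
    apply MvPolynomial.ringHom_ext
    · intro n; simp
    · intro o
      cases o with
      | none => simp [φ, e1r]; simp [wev, wb, oc]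
      | some v => simp [φ, e1o]; simp [wev, wb, oc]
  have hy2 : (f.map φ).eval₂ e1 y = 0 := by rw [eval₂_map, he1]; exact hy
  let e2 : U →+* AC K := AdjoinRoot.lift e1 y hy2
  have e2r : e2 (AdjoinRoot.root _) = y := AdjoinRoot.lift_root hy2
  have e2o : ∀ a, e2 (AdjoinRoot.of _ a) = e1 a := fun a => AdjoinRoot.lift_of hy2
  have h3 := congrArg e2 hG2
  rw [hom_eval₂, map_zero] at h3
  have h4 : e2.comp (algebraMap (MvPolynomial V ℤ) U) = wev w := by
    ext a
    · simp
    · rw [RingHom.comp_apply, IsScalarTower.algebraMap_apply (MvPolynomial V ℤ) B U, AdjoinRoot.algebraMap_eq, AdjoinRoot.algebraMap_eq]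
      rw [e2o, e1o]
  rw [h4, e2r] at h3
  exact h3

/-- translation of tests -/
noncomputable def trT {V : Type} : MvPolynomial (Option V ⊕ ℕ) ℤ →+* MvPolynomial (V ⊕ ℕ) ℤ :=
  eval₂Hom (Int.castRingHom _) (Sum.elim (fun o => o.elim (MvPolynomial.X (Sum.inr 0)) (fun v => MvPolynomial.X (Sum.inl v)))
    (fun i => MvPolynomial.X (Sum.inr (i + 1))))

theorem tev_trT {V K : Type} [Field K] (w : V → K) (u : K) (x : ℕ → AC K) (hx : x 0 = algebraMap K (AC K) u)
    (p : MvPolynomial (Option V ⊕ ℕ) ℤ) : tev w x (trT p) = tev (oc u w) (fun i => x (i + 1)) p := by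
  have : (tev w x).comp trT = tev (oc u w) (fun i => x (i + 1)) := by
    apply MvPolynomial.ringHom_ext
    · intro n; simp
    · rintro (o | i)
      · cases o with
        | none => simp [trT, tev, wb, oc, hx]
        | some v => simp [trT, tev, wb, oc]
      · simp [trT, tev]
  rw [← this]; rfl

theorem Nice.fp_monic {V : Type} {ψ : Fam (Option V)} (h : Nice ψ) (b : (MvPolynomial V ℤ)[X]) (hb : b.Monic) :
    Nice (fun K _ _ w => ∃ u : K, algebraMap K (AC K) u ∈ Rt b w ∧ ψ K (oc u w)) := by
  obtain ⟨C, M, f, T, h1, h2, h3, h4⟩ := h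
  obtain ⟨G, hG, hG2⟩ := tower_poly b hb f h2
  refine ⟨C, M * b.natDegree.factorial, b * G, insert (rootTest b) (trT '' (insert (rootTest f) T)),
    mul_ne_zero h1 (Nat.factorial_ne_zero _), hb.mul hG, ((h3.insert _).image _).insert _, NiceD.of_imp (ψ := fun K _ _ w => ∃ u : K, algebraMap K (AC K) u ∈ Rt b w ∧ ψ K (oc u w))
    fun {K} _ _ {K'} _ _ w w' r r' β c1 c2 c3 c4 hiso => ?_⟩
  rintro ⟨u, hu, hψ⟩
  have hbR := hiso.sub (g := b) (T' := ∅) (dvd_mul_right _ _) (Set.mem_insert _ _) (Set.empty_subset _)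
  obtain ⟨u', hu'⟩ : ∃ u' : K', algebraMap K' (AC K') u' = β (algebraMap K (AC K) u) := by
    refine frob_fix (S := Rt b w') (Rt_finite b hb w') (Rt_ncard b hb w')
      (fun x hx => by simpa using pow_mem_Rt b w' 1 hx) (hbR.bij.mapsTo hu) (Nat.Coprime_of_mul c4).2 ?_
    rw [← hbR.frob _ hu, alg_pow_card]
  have hub : algebraMap K' (AC K') u' ∈ Rt b w' := hu' ▸ hbR.bij.mapsTo hu
  refine ⟨u', hub, ?_⟩
  refine (h4 (oc u w) (oc u' w') r r' β c1 c2 (Nat.Coprime_of_mul c3).1 (Nat.Coprime_of_mul c4).1 ?_).1 hψ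
  have hs1 : Rt b w ⊆ Rt (b * G) w := by rw [Rt_mul]; exact Set.subset_union_left
  have hs2 : Rt f (oc u w) ⊆ Rt (b * G) w := by
    rw [Rt_mul]; exact fun y hy => Or.inr (hG2 w u y hu hy)
  have hs2' : Rt f (oc u' w') ⊆ Rt (b * G) w' := by
    rw [Rt_mul]; exact fun y hy => Or.inr (hG2 w' u' y hub hy)
  have ht : ∀ p ∈ insert (rootTest f) T, ∀ x : ℕ → AC K, (∀ i, x i ∈ Rt (b * G) w) →
      (tev (oc u w) x p = 0 ↔ tev (oc u' w') (fun i => β (x i)) p = 0) := by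
    intro p hp x hx
    have := hiso.test (trT p) (Set.mem_insert_of_mem _ ⟨p, hp, rfl⟩)
      (fun n => Nat.casesOn n (algebraMap K (AC K) u) x) (by rintro (_ | i); exacts [hs1 hu, hx i])
    rwa [tev_trT w u _ rfl, tev_trT w' u' _ hu'.symm] at this
  have hk : ∀ x ∈ Rt (b * G) w, (x ∈ Rt f (oc u w) ↔ β x ∈ Rt f (oc u' w')) := by
    intro x hx
    have := ht _ (Set.mem_insert _ _) (fun _ => x) (fun _ => hx)
    rwa [tev_rootTest, tev_rootTest] at this
  refine ⟨⟨fun x hx => (hk x (hs2 hx)).1 hx, hiso.bij.injOn.mono hs2, fun x hx => ?_⟩, fun x hx => hiso.frob x (hs2 hx),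
    fun p hp x hx => ht p (Set.mem_insert_of_mem _ hp) x fun i => hs2 (hx i)⟩
  obtain ⟨v, hv, rfl⟩ := hiso.bij.surjOn (hs2' hx)
  exact ⟨v, (hk v hv).2 hx, rfl⟩

end CDM

namespace CDM

/-- clearing denominators -/
theorem clr {σ τ : Type} (a : MvPolynomial τ ℤ) (N : ℕ) (u : σ → MvPolynomial τ ℤ) (p : MvPolynomial σ ℤ) :
    ∃ (m : ℕ) (q : MvPolynomial τ ℤ), ∀ {B : Type} [CommRing B] (ε : MvPolynomial σ ℤ →+* B) (ε' : MvPolynomial τ ℤ →+* B),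
      (∀ v, ε' a ^ N * ε (MvPolynomial.X v) = ε' (u v)) → ε' q = ε' a ^ m * ε p := by
  induction p using MvPolynomial.induction_on with
  | C c => exact ⟨0, MvPolynomial.C c, fun ε ε' h => by simp⟩
  | add p q h1 h2 =>
    obtain ⟨m1, q1, h1⟩ := h1
    obtain ⟨m2, q2, h2⟩ := h2
    refine ⟨m1 + m2, a ^ m2 * q1 + a ^ m1 * q2, fun ε ε' h => ?_⟩
    rw [map_add, map_mul, map_mul, h1 ε ε' h, h2 ε ε' h, map_pow, map_pow, map_add]; ring
  | mul_X p v h1 =>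
    obtain ⟨m1, q1, h1⟩ := h1
    refine ⟨m1 + N, q1 * u v, fun ε ε' h => ?_⟩
    rw [map_mul, h1 ε ε' h, ← h v, map_mul]; ring

/-- scaled polynomial -/
noncomputable def scl {A : Type} [CommRing A] (d : ℕ) (c : ℕ → A) (α : A) : A[X] :=
  X ^ d + ∑ i ∈ Finset.range d, C (α ^ (d - 1 - i) * c i) * X ^ i

theorem scl_monic {A : Type} [CommRing A] (d : ℕ) (c : ℕ → A) (α : A) : (scl d c α).Monic := by
  apply monic_X_pow_add
  refine (degree_sum_le _ _).trans_lt ?_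
  rw [Finset.sup_lt_iff (by exact WithBot.bot_lt_coe d)]
  intro i hi
  exact (degree_C_mul_X_pow_le _ _).trans_lt (by exact_mod_cast Finset.mem_range.1 hi)

theorem scl_eval {A k : Type} [CommRing A] [Field k] (d : ℕ) (c : ℕ → A) (α : A) (φ : A →+* k) (hα : φ α ≠ 0) (y : k) :
    (scl d c α).eval₂ φ (φ α * y) = 0 ↔ φ α * y ^ d + ∑ i ∈ Finset.range d, φ (c i) * y ^ i = 0 := by
  rcases Nat.eq_zero_or_pos d with rfl | hd
  · simp [scl, hα]
  have : (scl d c α).eval₂ φ (φ α * y) = φ α ^ (d - 1) * (φ α * y ^ d + ∑ i ∈ Finset.range d, φ (c i) * y ^ i) := by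
    rw [scl, eval₂_add, eval₂_X_pow, eval₂_finsetSum, mul_add, Finset.mul_sum]
    congr 1
    · rw [mul_pow]
      obtain ⟨e, rfl⟩ := Nat.exists_eq_succ_of_ne_zero hd.ne'
      simp [pow_succ]; ring
    · apply Finset.sum_congr rfl
      intro i hi
      have hi := Finset.mem_range.1 hi
      obtain ⟨e, rfl⟩ := Nat.exists_eq_add_of_lt hi
      rw [eval₂_mul, eval₂_C, eval₂_X_pow, map_mul, map_pow]
      rw [show i + e + 1 - 1 - i = e by omega, show i + e + 1 - 1 = i + e by omega]; ring
  rw [this, mul_eq_zero, or_iff_right (pow_ne_zero _ hα)]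

theorem Nice.inv {V : Type} {ψ : Fam (Option V)} (h : Nice ψ) (a : MvPolynomial V ℤ) :
    Nice (fun K _ _ w => MvPolynomial.aeval w a ≠ 0 ∧ ψ K (oc (MvPolynomial.aeval w a)⁻¹ w)) := by
  obtain ⟨Cc, M, f, T, h1, h2, h3, h4⟩ := h
  set d := f.natDegree with hd
  have hcl := fun i => clr a 1 (fun o : Option V => o.elim (1 : MvPolynomial V ℤ) (fun v => a * MvPolynomial.X v)) (f.coeff i)
  choose m q hq using hcl
  set N := ∑ i ∈ Finset.range d, m i with hN
  have hmN : ∀ i ∈ Finset.range d, m i ≤ N := fun i hi => Finset.single_le_sum (f := m) (fun _ _ => Nat.zero_le _) hi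
  set F := scl d (fun i => a ^ (N - m i) * q i) (a ^ N) with hF
  set ai : MvPolynomial (V ⊕ ℕ) ℤ := rename Sum.inl a with hai
  have hcl2 := fun p => clr ai (N + 1) (Sum.elim (fun o : Option V => o.elim (ai ^ N) (fun v => ai ^ (N + 1) * MvPolynomial.X (Sum.inl v)))
    (fun i : ℕ => ai * MvPolynomial.X (Sum.inr i))) p
  choose m2 q2 hq2 using hcl2
  have hv : ∀ {K : Type} [Field K] (w : V → K), MvPolynomial.aeval w a ≠ 0 → ∀ o : Option V,
      wev w a * wb (oc (MvPolynomial.aeval w a)⁻¹ w) o = wev w (o.elim (1 : MvPolynomial V ℤ) (fun v => a * MvPolynomial.X v)) := by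
    intro K _ w hw o
    cases o with
    | none =>
      simp only [wb, oc, wev_eq, Option.elim_none, map_one]
      rw [← map_mul, mul_inv_cancel₀ hw, map_one]
    | some v => simp [wb, oc, wev_eq]
  have key1 : ∀ {K : Type} [Field K] (w : V → K), MvPolynomial.aeval w a ≠ 0 → ∀ y,
      (y ∈ Rt f (oc (MvPolynomial.aeval w a)⁻¹ w) ↔ wev w a ^ N * y ∈ Rt F w) := by
    intro K _ w hw y
    have hw0 : wev w a ≠ 0 := by rwa [Ne, wev_eq_zero]
    have := scl_eval d (fun i => a ^ (N - m i) * q i) (a ^ N) (wev w) (by simpa using pow_ne_zero _ hw0) y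
    rw [map_pow] at this
    refine Iff.trans ?_ this.symm
    have e1 : ∀ i ∈ Finset.range d, wev w (a ^ (N - m i) * q i) * y ^ i =
        wev w a ^ N * (wev (oc (MvPolynomial.aeval w a)⁻¹ w) (f.coeff i) * y ^ i) := by
      intro i hi
      rw [map_mul, hq i (wev (oc (MvPolynomial.aeval w a)⁻¹ w)) (wev w), map_pow, ← mul_assoc, ← pow_add, Nat.sub_add_cancel (hmN i hi), mul_assoc]
      intro o
      rw [pow_one, ← hv w hw]
      simp [wev]
    rw [Finset.sum_congr rfl e1, ← Finset.mul_sum, ← mul_add, mul_eq_zero, or_iff_right (pow_ne_zero _ hw0)]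
    have : y ^ d + ∑ i ∈ Finset.range d, (wev (oc (MvPolynomial.aeval w a)⁻¹ w)) (f.coeff i) * y ^ i =
        f.eval₂ (wev (oc (MvPolynomial.aeval w a)⁻¹ w)) y := by
      rw [eval₂_eq_sum_range, Finset.sum_range_succ, ← hd, add_comm]
      congr 1
      rw [hd, h2.coeff_natDegree]; simp
    rw [this]; rfl
  have key2 : ∀ {K : Type} [Field K] (w : V → K), MvPolynomial.aeval w a ≠ 0 → ∀ p (x : ℕ → AC K),
      (tev (oc (MvPolynomial.aeval w a)⁻¹ w) x p = 0 ↔ tev w (fun i => wev w a ^ N * x i) (q2 p) = 0) := by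
    intro K _ w hw p x
    have hw0 : wev w a ≠ 0 := by rwa [Ne, wev_eq_zero]
    have hai2 : tev w (fun i => wev w a ^ N * x i) ai = wev w a := tev_rename _ _ _
    rw [hq2 p (tev (oc (MvPolynomial.aeval w a)⁻¹ w) x) (tev w (fun i => wev w a ^ N * x i)), hai2, mul_eq_zero,
      or_iff_right (pow_ne_zero _ hw0)]
    rintro (o | i)
    · have := hv w hw o
      cases o with
      | none =>
        rw [hai2]
        simp only [Sum.elim_inl, Option.elim_none, map_pow, hai2]
        simp only [Option.elim_none, map_one] at this
        simp only [tev, coe_eval₂Hom, MvPolynomial.eval₂_X, Sum.elim_inl]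
        rw [pow_succ, mul_assoc, this, mul_one]
      | some v =>
        rw [hai2]
        simp only [Sum.elim_inl, Option.elim_some, map_mul, map_pow, hai2]
        simp [tev, wb, oc]
    · rw [hai2]
      simp only [Sum.elim_inr, map_mul, hai2]
      simp [tev]; ring
  refine ⟨Cc, M, X * F, insert ai (insert (rootTest F) (q2 '' T)), h1, monic_X.mul (scl_monic _ _ _), ((h3.image _).insert _).insert _,
    NiceD.of_imp (ψ := fun K _ _ w => MvPolynomial.aeval w a ≠ 0 ∧ ψ K (oc (MvPolynomial.aeval w a)⁻¹ w))
    fun {K} _ _ {K'} _ _ w w' r r' β c1 c2 c3 c4 hiso => ?_⟩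
  rintro ⟨hw, hψ⟩
  have hw' : MvPolynomial.aeval w' a ≠ 0 := by
    have := hiso.test ai (Set.mem_insert _ _) (fun _ => 0) (fun _ => by rw [Rt_mul]; exact Or.inl (zero_mem_Rt_X w))
    rw [hai, tev_rename, tev_rename, wev_eq_zero, wev_eq_zero] at this
    rwa [Ne, ← this]
  have hw0 : wev w a ^ N ≠ 0 := pow_ne_zero _ (by rwa [Ne, wev_eq_zero])
  have hw0' : wev w' a ^ N ≠ 0 := pow_ne_zero _ (by rwa [Ne, wev_eq_zero])
  refine ⟨hw', ?_⟩
  have hI := hiso.sub (g := F) (T' := q2 '' T) (dvd_mul_left _ _) (Set.mem_insert_of_mem _ (Set.mem_insert _ _))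
    (fun x hx => Set.mem_insert_of_mem _ (Set.mem_insert_of_mem _ hx))
  refine (h4 _ _ r r' (fun y => (wev w' a ^ N)⁻¹ * β (wev w a ^ N * y)) c1 c2 c3 c4 ⟨⟨?_, ?_, ?_⟩, ?_, ?_⟩).1 hψ
  · intro y hy
    rw [key1 w hw] at hy
    rw [key1 w' hw', mul_inv_cancel_left₀ hw0']
    exact hI.bij.mapsTo hy
  · intro y hy y2 hy2 he
    rw [key1 w hw] at hy hy2
    exact mul_left_cancel₀ hw0 (hI.bij.injOn hy hy2 (mul_left_cancel₀ (inv_ne_zero hw0') he))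
  · intro y hy
    rw [key1 w' hw'] at hy
    obtain ⟨x, hx, he⟩ := hI.bij.surjOn hy
    refine ⟨(wev w a ^ N)⁻¹ * x, ?_, ?_⟩
    · rw [key1 w hw, mul_inv_cancel_left₀ hw0]; exact hx
    · change _ * β _ = _
      rw [mul_inv_cancel_left₀ hw0, he, inv_mul_cancel_left₀ hw0']
  · intro y hy
    rw [key1 w hw] at hy
    have := hI.frob _ hy
    rw [mul_pow, ← this, mul_pow]
    congr 1
    · rw [wev_eq, ← map_pow, ← map_inv₀, alg_pow_card]
    · congr 2
      rw [wev_eq, ← map_pow, alg_pow_card]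
  · intro p hp x hx
    rw [key2 w hw, key2 w' hw']
    have := hI.test (q2 p) ⟨p, hp, rfl⟩ _ (fun i => (key1 w hw _).1 (hx i))
    rw [this]
    simp only [mul_inv_cancel_left₀ hw0']

/-- general fixed point elimination -/
theorem Nice.fp {V : Type} {ψ : Fam (Option V)} (h : Nice ψ) (b : (MvPolynomial V ℤ)[X]) :
    Nice (fun K _ _ w => b.map (wev w) ≠ 0 ∧ ∃ u : K, algebraMap K (AC K) u ∈ Rt b w ∧ ψ K (oc u w)) := by
  have h2 := h.subst (fun o : Option V => o.elim (MvPolynomial.X none * MvPolynomial.X (some none))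
    (fun v => (MvPolynomial.X (some (some v)) : MvPolynomial (Option (Option V)) ℤ)))
  have h3 := fun i : Fin (b.natDegree + 1) => h2.inv (rename some (b.coeff i))
  have h4 := fun i => (h3 i).fp_monic (scl i (fun j => b.coeff j) (b.coeff i)) (scl_monic _ _ _)
  have h5 := fun i : Fin (b.natDegree + 1) => Nice.forall (fun j : {j : Fin (b.natDegree + 1) // i < j} => Nice.atom (b.coeff j))
  have h6 := Nice.exists fun i => (h5 i).and (h4 i)
  refine h6.congr 0 fun K _ _ w _ => ?_
  have e0 : ∀ u : K, ∀ i : Fin (b.natDegree + 1), MvPolynomial.aeval (oc u w) (rename some (b.coeff i)) = MvPolynomial.aeval w (b.coeff i) := by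
    intro u i
    rw [MvPolynomial.aeval_rename]; rfl
  have e1 : ∀ u c : K, (fun v : Option V => MvPolynomial.aeval (oc c (oc u w)) (v.elim (MvPolynomial.X none * MvPolynomial.X (some none))
    (fun v => (MvPolynomial.X (some (some v)) : MvPolynomial (Option (Option V)) ℤ)))) = oc (c * u) w := by
    intro u c
    funext v
    cases v <;> simp [oc]
  have e2 : ∀ i : Fin (b.natDegree + 1), (∀ j : {j : Fin (b.natDegree + 1) // i < j}, MvPolynomial.aeval w (b.coeff j) = 0) →
      MvPolynomial.aeval w (b.coeff i) ≠ 0 → ∀ u : AC K,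
      (u ∈ Rt b w ↔ wev w (b.coeff i) * u ∈ Rt (scl i (fun j => b.coeff j) (b.coeff i)) w) := by
    intro i hi hi0 u
    have := scl_eval i (fun j => b.coeff j) (b.coeff i) (wev w) (by rwa [Ne, wev_eq_zero]) u
    refine Iff.trans ?_ this.symm
    have : b.eval₂ (wev w) u = wev w (b.coeff i) * u ^ (i : ℕ) + ∑ j ∈ Finset.range i, wev w (b.coeff j) * u ^ j := by
      rw [eval₂_eq_sum_range, add_comm (_ * _), ← Finset.sum_range_succ (fun j => wev w (b.coeff j) * u ^ j)]
      symm
      apply Finset.sum_subset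
      · exact Finset.range_subset_range.2 (by omega)
      · intro j hj hj2
        have hj := Finset.mem_range.1 hj
        have hj2 : ¬ j < i + 1 := fun h => hj2 (Finset.mem_range.2 h)
        have := hi ⟨⟨j, hj⟩, by rw [Fin.lt_def]; simp; omega⟩
        rw [(wev_eq_zero w _).2 this, zero_mul]
    rw [← this]; rfl
  simp only [e0, e1]
  constructor
  · rintro ⟨i, hi, u, hu, hi0, hψ⟩
    refine ⟨?_, (MvPolynomial.aeval w (b.coeff i))⁻¹ * u, ?_, hψ⟩
    · intro h0
      have := congrArg (fun p => p.coeff i) h0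
      rw [coeff_map, coeff_zero, wev_eq_zero] at this
      exact hi0 this
    · rw [e2 i hi hi0, wev_eq, ← map_mul, mul_inv_cancel_left₀ hi0]; exact hu
  · rintro ⟨hb, u, hu, hψ⟩
    set b' := b.map (wev w)
    have hdeg : b'.natDegree < b.natDegree + 1 := Nat.lt_succ_of_le natDegree_map_le
    have hlead : MvPolynomial.aeval w (b.coeff b'.natDegree) ≠ 0 := by
      rw [Ne, ← wev_eq_zero, ← coeff_map]
      exact leadingCoeff_ne_zero.2 hb
    have hz : ∀ j : {j : Fin (b.natDegree + 1) // (⟨b'.natDegree, hdeg⟩ : Fin (b.natDegree + 1)) < j}, MvPolynomial.aeval w (b.coeff j) = 0 := by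
      rintro ⟨j, hj⟩
      rw [← wev_eq_zero, ← coeff_map]
      exact coeff_eq_zero_of_natDegree_lt hj
    refine ⟨⟨b'.natDegree, hdeg⟩, hz, MvPolynomial.aeval w (b.coeff b'.natDegree) * u, ?_, hlead, ?_⟩
    · rw [map_mul, ← wev_eq]
      exact (e2 ⟨b'.natDegree, hdeg⟩ hz hlead _).1 hu
    · rwa [inv_mul_cancel_left₀ hlead]

end CDM

namespace CDM

/-- enumeration form of niceness -/
def EnumD {V ι J : Type} [Fintype ι] (C M : ℕ) (f : (MvPolynomial V ℤ)[X]) (p : J → MvPolynomial (V ⊕ ι) ℤ) (ψ : Fam V) : Prop :=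
  ∀ {K : Type} [Field K] [Fintype K] {K' : Type} [Field K'] [Fintype K'] (w : V → K) (w' : V → K') (r r' : ℕ)
    (η : ι → AC K) (η' : ι → AC K') (g : Equiv.Perm ι), C ≤ card K → C ≤ card K' → r.Coprime M → r'.Coprime M →
    f.map (wev w) = ∏ i, (X - Polynomial.C (η i)) → f.map (wev w') = ∏ i, (X - Polynomial.C (η' i)) →
    (∀ i, η i ^ card K ^ r = η (g i)) → (∀ i, η' i ^ card K' ^ r' = η' (g i)) →
    (∀ j, tev w η (p j) = 0 ↔ tev w' η' (p j) = 0) → (ψ K w ↔ ψ K' w')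

theorem Rt_of_prod {V ι K : Type} [Fintype ι] [Field K] {f : (MvPolynomial V ℤ)[X]} {w : V → K} {η : ι → AC K}
    (h : f.map (wev w) = ∏ i, (X - C (η i))) (x : AC K) : x ∈ Rt f w ↔ ∃ i, x = η i := by
  have : x ∈ Rt f w ↔ (f.map (wev w)).eval x = 0 := by rw [eval_map]; rfl
  rw [this, h, eval_prod, Finset.prod_eq_zero_iff]
  simp [sub_eq_zero]

theorem tev_rename_map {V σ τ K : Type} [Field K] (w : V → K) (x : τ → AC K) (s : σ → τ) (p : MvPolynomial (V ⊕ σ) ℤ) :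
    tev w x (rename (Sum.map id s) p) = tev w (fun i => x (s i)) p := by
  simp only [tev, coe_eval₂Hom, MvPolynomial.eval₂_rename]
  congr 1
  funext i
  cases i <;> rfl

theorem tev_congr {V K : Type} [Field K] (w : V → K) (x y : ℕ → AC K) (p : MvPolynomial (V ⊕ ℕ) ℤ)
    (h : ∀ i, Sum.inr i ∈ p.vars → x i = y i) : tev w x p = tev w y p := by
  refine MvPolynomial.eval₂Hom_congr' rfl ?_ rfl
  rintro (v | i) h1 _
  · rfl
  · exact h i h1

theorem Nice.enum {V : Type} {ψ : Fam V} (h : Nice ψ) : ∃ (C M : ℕ) (f : (MvPolynomial V ℤ)[X]) (J : Type) (_ : Fintype J)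
    (p : J → MvPolynomial (V ⊕ Fin f.natDegree) ℤ), M ≠ 0 ∧ f.Monic ∧ (∀ i, ∃ j, p j = MvPolynomial.X (Sum.inr i)) ∧
      (∀ i i', ∃ j, p j = MvPolynomial.X (Sum.inr i) - MvPolynomial.X (Sum.inr i')) ∧ EnumD C M f p ψ := by
  classical
  obtain ⟨C, M, f, T, h1, h2, h3, h4⟩ := h
  have hn : ∃ n, ∀ p ∈ T, ∀ i : ℕ, Sum.inr i ∈ p.vars → i < n + 1 := by
    have hfin : (⋃ p ∈ T, {i : ℕ | (Sum.inr i : V ⊕ ℕ) ∈ p.vars}).Finite := by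
      refine h3.biUnion fun p _ => ?_
      exact (p.vars.finite_toSet.preimage Sum.inr_injective.injOn).subset (fun i hi => hi)
    obtain ⟨n, hn⟩ := hfin.bddAbove
    exact ⟨n, fun p hp i hi => Nat.lt_succ_of_le (hn (Set.mem_biUnion hp hi))⟩
  obtain ⟨n, hn⟩ := hn
  have := h3.fintype
  let ι := Fin f.natDegree
  refine ⟨C, M, f, (T × (Fin (n + 1) → ι)) ⊕ ((ι × ι) ⊕ ι), inferInstance,
    Sum.elim (fun a => rename (Sum.map id fun i => a.2 (Fin.ofNat (n + 1) i)) a.1.1)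
      (Sum.elim (fun a => MvPolynomial.X (Sum.inr a.1) - MvPolynomial.X (Sum.inr a.2)) (fun i => MvPolynomial.X (Sum.inr i))),
    h1, h2, fun i => ⟨Sum.inr (Sum.inr i), rfl⟩, fun i i' => ⟨Sum.inr (Sum.inl (i, i')), rfl⟩, ?_⟩
  intro K _ _ K' _ _ w w' r r' η η' g c1 c2 c3 c4 e1 e2 f1 f2 ht
  have heq : ∀ i i', η i = η i' ↔ η' i = η' i' := by
    intro i i'
    have := ht (Sum.inr (Sum.inl (i, i')))
    simpa [tev, sub_eq_zero] using this
  have hex : ∀ x : AC K, ∃ y : AC K', ∀ i, x = η i → y = η' i := by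
    intro x
    by_cases hx : ∃ i, x = η i
    · obtain ⟨i, rfl⟩ := hx
      exact ⟨η' i, fun i' hi' => (heq i i').1 hi'⟩
    · exact ⟨0, fun i hi => (hx ⟨i, hi⟩).elim⟩
  choose b hb using hex
  have hb' : ∀ i, b (η i) = η' i := fun i => hb _ i rfl
  refine h4 w w' r r' b c1 c2 c3 c4 ⟨⟨?_, ?_, ?_⟩, ?_, ?_⟩
  · intro x hx
    obtain ⟨i, rfl⟩ := (Rt_of_prod e1 x).1 hx
    rw [hb']; exact (Rt_of_prod e2 _).2 ⟨i, rfl⟩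
  · intro x hx x' hx' hxx
    obtain ⟨i, rfl⟩ := (Rt_of_prod e1 x).1 hx
    obtain ⟨i', rfl⟩ := (Rt_of_prod e1 x').1 hx'
    rw [hb', hb'] at hxx
    exact (heq _ _).2 hxx
  · intro x hx
    obtain ⟨i, rfl⟩ := (Rt_of_prod e2 x).1 hx
    exact ⟨η i, (Rt_of_prod e1 _).2 ⟨i, rfl⟩, hb' i⟩
  · intro x hx
    obtain ⟨i, rfl⟩ := (Rt_of_prod e1 x).1 hx
    rw [f1, hb', hb', f2]
  · intro q hq x hx
    choose s hs using fun i => (Rt_of_prod e1 (x i)).1 (hx i)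
    have := ht (Sum.inl (⟨q, hq⟩, fun i => s i))
    simp only [Sum.elim_inl] at this
    rw [tev_rename_map, tev_rename_map] at this
    have e : ∀ i, (Sum.inr i : V ⊕ ℕ) ∈ q.vars → ((Fin.ofNat (n + 1) i : Fin (n + 1)) : ℕ) = i := by
      intro i hi
      rw [Fin.val_ofNat, Nat.mod_eq_of_lt (hn q hq i hi)]
    rw [tev_congr w x (fun i => η (s (Fin.ofNat (n + 1) i))) q (fun i hi => by rw [e i hi, hs]),
      tev_congr w' (fun i => b (x i)) (fun i => η' (s (Fin.ofNat (n + 1) i))) q (fun i hi => by rw [e i hi, hs, hb'])]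
    exact this

end CDM

namespace CDM

/-- polynomials in one main variable over a multivariate polynomial ring -/
abbrev P2 (O k : Type) [CommRing k] := (MvPolynomial O k)[X]

section
variable {O k k' : Type} [CommRing k] [CommRing k']

noncomputable def cf (α : ℕ × (O →₀ ℕ)) (Q : P2 O k) : k := (Q.coeff α.1).coeff α.2

noncomputable def Mp (φ : k →+* k') : P2 O k →+* P2 O k' := mapRingHom (MvPolynomial.map φ)

theorem cf_Mp (φ : k →+* k') (α : ℕ × (O →₀ ℕ)) (Q : P2 O k) : cf α (Mp φ Q) = φ (cf α Q) := by
  simp [cf, Mp, MvPolynomial.coeff_map]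

theorem cf_ext {P Q : P2 O k} (h : ∀ α, cf α P = cf α Q) : P = Q := by
  ext i m
  exact h (i, m)

theorem cf_sub (α : ℕ × (O →₀ ℕ)) (P Q : P2 O k) : cf α (P - Q) = cf α P - cf α Q := by simp [cf]

theorem cf_finite (P : P2 O k) : (Set.range fun α => cf α P).Finite := by
  classical
  have : (Set.range fun α => cf α P) ⊆ insert 0 (⋃ i ∈ P.support, (fun m => (P.coeff i).coeff m) '' (P.coeff i).support) := by
    rintro _ ⟨⟨i, m⟩, rfl⟩
    by_cases h : cf (i, m) P = 0
    · left; exact h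
    · right
      have h1 : (P.coeff i).coeff m ≠ 0 := h
      simp only [Set.mem_iUnion]
      refine ⟨i, ?_, m, ?_, rfl⟩
      · rw [mem_support_iff]; intro h2; rw [h2] at h1; simp at h1
      · simpa using h1
  refine Set.Finite.subset (Set.Finite.insert _ ?_) this
  refine Set.Finite.biUnion (Finset.finite_toSet _) fun i _ => Set.Finite.image _ (Finset.finite_toSet _)

theorem Mp_monic {φ : k →+* k'} {Q : P2 O k} (h : Q.Monic) : (Mp φ Q).Monic := h.map _

/-- the generic polynomial with coefficients `x` -/
noncomputable def gen (I : Finset (ℕ × (O →₀ ℕ))) (x : ℕ × (O →₀ ℕ) → k) : P2 O k :=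
  ∑ α ∈ I, monomial α.1 (MvPolynomial.monomial α.2 (x α))

theorem cf_gen (I : Finset (ℕ × (O →₀ ℕ))) (x : ℕ × (O →₀ ℕ) → k) (hx : ∀ α, α ∉ I → x α = 0) (α) : cf α (gen I x) = x α := by
  classical
  have h1 : ∀ β : ℕ × (O →₀ ℕ), cf α (monomial β.1 (MvPolynomial.monomial β.2 (x β))) = if β = α then x β else 0 := by
    rintro ⟨i, m⟩
    obtain ⟨i', m'⟩ := α
    simp only [cf, coeff_monomial, Prod.mk.injEq]
    by_cases hi : i = i'
    · simp [hi, MvPolynomial.coeff_monomial]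
    · simp [hi]
  have h2 : cf α (gen I x) = ∑ β ∈ I, cf α (monomial β.1 (MvPolynomial.monomial β.2 (x β))) := by
    simp [cf, gen, MvPolynomial.coeff_sum]
  rw [h2, Finset.sum_congr rfl fun β _ => h1 β, Finset.sum_ite_eq']
  split_ifs with h
  · rfl
  · exact (hx _ h).symm

theorem gen_cf (I : Finset (ℕ × (O →₀ ℕ))) (Q : P2 O k) (h : ∀ α, cf α Q ≠ 0 → α ∈ I) : gen I (fun α => cf α Q) = Q :=
  cf_ext fun α => cf_gen I _ (fun α hα => by by_contra h2; exact hα (h α h2)) α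

theorem Mp_gen (φ : k →+* k') (I : Finset (ℕ × (O →₀ ℕ))) (x : ℕ × (O →₀ ℕ) → k) : Mp φ (gen I x) = gen I (fun α => φ (x α)) := by
  simp [gen, Mp, MvPolynomial.map_monomial]

theorem P2_deg [Finite O] {A : Type} [CommRing A] (R : P2 O A) (hR : R.Monic) : ∃ I : Finset (ℕ × (O →₀ ℕ)),
    ∀ {k : Type} [Field k] (φ : A →+* k) (Q Q1 : P2 O k), Q * Q1 = Mp φ R → ∀ α, cf α Q ≠ 0 → α ∈ I := by
  classical
  have := Fintype.ofFinite O
  let R' := (optionEquivLeft A O).symm R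
  let N := R'.totalDegree
  refine ⟨(Finset.Iic (Finsupp.equivFunOnFinite.symm fun _ : Option O => N)).image fun m => (m none, m.some), ?_⟩
  intro k _ φ Q Q1 h α hα
  let e := optionEquivLeft k O
  have hn : e (MvPolynomial.map φ R') = Mp φ R := by
    have h1 : ((e : MvPolynomial (Option O) k →+* P2 O k).comp (MvPolynomial.map φ)) =
        (Mp φ).comp (optionEquivLeft A O : MvPolynomial (Option O) A →+* P2 O A) := by
      apply MvPolynomial.ringHom_ext
      · intro r; simp [e, Mp]
      · rintro (_ | i) <;> simp [e, Mp]
    have h2 := RingHom.congr_fun h1 R'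
    simpa [R'] using h2
  have hmul : e.symm Q * e.symm Q1 = MvPolynomial.map φ R' := by
    rw [← map_mul, h, ← hn, AlgEquiv.symm_apply_apply]
  have hne : MvPolynomial.map φ R' ≠ 0 := by
    intro h0
    rw [h0, map_zero] at hn
    exact (Mp_monic hR).ne_zero hn.symm
  have hQ0 : e.symm Q ≠ 0 := fun h0 => hne (by rw [← hmul, h0, zero_mul])
  have hQ1 : e.symm Q1 ≠ 0 := fun h0 => hne (by rw [← hmul, h0, mul_zero])
  have hdeg : (e.symm Q).totalDegree ≤ N := by
    have := MvPolynomial.totalDegree_mul_of_isDomain hQ0 hQ1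
    rw [hmul] at this
    have h3 : (MvPolynomial.map φ R').totalDegree ≤ N := Finset.sup_mono (MvPolynomial.support_map_subset φ R')
    omega
  obtain ⟨i, m⟩ := α
  have hm : MvPolynomial.coeff (m.optionElim i) (e.symm Q) ≠ 0 := by
    rw [← MvPolynomial.optionEquivLeft_coeff_some_coeff_none]
    simpa [e, cf] using hα
  rw [Finset.mem_image]
  refine ⟨m.optionElim i, ?_, by simp⟩
  rw [Finset.mem_Iic]
  intro o
  have h4 := MvPolynomial.le_totalDegree (MvPolynomial.mem_support_iff.2 hm)
  have h5 : (m.optionElim i) o ≤ (m.optionElim i).sum fun _ e => e := by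
    by_cases ho : o ∈ (m.optionElim i).support
    · exact Finset.single_le_sum (f := fun o => (m.optionElim i) o) (fun _ _ => Nat.zero_le _) ho
    · rw [Finsupp.notMem_support_iff] at ho; rw [ho]; exact Nat.zero_le _
  exact h5.trans (h4.trans hdeg)

attribute [local instance] MvPolynomial.algebraMvPolynomial in
theorem P2_univ [Finite O] {A : Type} [CommRing A] (R : P2 O A) (hR : R.Monic) : ∃ G : A[X], G.Monic ∧
    ∀ {k : Type} [Field k] (φ : A →+* k) (Q : P2 O k), Q.Monic → Q ∣ Mp φ R → ∀ α, G.eval₂ φ (cf α Q) = 0 := by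
  classical
  obtain ⟨I, hI⟩ := P2_deg R hR
  have key : ∀ n : ℕ, ∀ α ∈ I, ∃ Θ : A[X], Θ.Monic ∧ ∀ {k : Type} [Field k] (φ : A →+* k) (Q : P2 O k), Q.Monic →
      Q.natDegree = n → Q ∣ Mp φ R → Θ.eval₂ φ (cf α Q) = 0 := by
    intro n
    let Ix := ℕ × (O →₀ ℕ)
    let B := MvPolynomial (Ix ⊕ Ix) A
    let x : Ix → B := fun α => if α ∈ I then MvPolynomial.X (Sum.inl α) else 0
    let x1 : Ix → B := fun α => if α ∈ I then MvPolynomial.X (Sum.inr α) else 0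
    let S1 : Set B := Set.range fun α => cf α (gen I x * gen I x1 - Mp (algebraMap A B) R)
    let S2 : Set B := {b | ∃ α : Ix, n ≤ α.1 ∧ b = cf α (gen I x - Polynomial.X ^ n)}
    let In : Ideal B := Ideal.span (S1 ∪ S2)
    let U := B ⧸ In
    let mk : B →+* U := Ideal.Quotient.mk In
    let QU : P2 O U := Mp mk (gen I x)
    have hz1 : ∀ α, mk (cf α (gen I x * gen I x1 - Mp (algebraMap A B) R)) = 0 := fun α =>
      Ideal.Quotient.eq_zero_iff_mem.2 (Ideal.subset_span (Or.inl ⟨α, rfl⟩))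
    have hz2 : ∀ α : Ix, n ≤ α.1 → mk (cf α (gen I x - Polynomial.X ^ n)) = 0 := fun α h =>
      Ideal.Quotient.eq_zero_iff_mem.2 (Ideal.subset_span (Or.inr ⟨α, h, rfl⟩))
    have hco : ∀ i, n ≤ i → QU.coeff i = (Polynomial.X ^ n : P2 O U).coeff i := by
      intro i hi
      ext m
      have h1 := hz2 (i, m) hi
      rw [← cf_Mp, map_sub, cf_sub, sub_eq_zero, map_pow] at h1
      have h2 : Mp mk (Polynomial.X : P2 O B) = Polynomial.X := by simp [Mp]
      rw [h2] at h1
      exact h1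
    have hmon : QU.Monic := by
      refine monic_of_natDegree_le_of_coeff_eq_one n ?_ ?_
      · rw [natDegree_le_iff_coeff_eq_zero]
        intro i hi
        rw [hco i hi.le, coeff_X_pow, if_neg (by omega)]
      · rw [hco n le_rfl, coeff_X_pow, if_pos rfl]
    have hdvd : QU ∣ R.map (algebraMap (MvPolynomial O A) (MvPolynomial O U)) := by
      refine ⟨Mp mk (gen I x1), ?_⟩
      rw [← map_mul]
      have h1 : Mp mk (gen I x * gen I x1) = Mp mk (Mp (algebraMap A B) R) := by
        rw [← sub_eq_zero, ← map_sub]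
        refine cf_ext fun α => ?_
        rw [cf_Mp, hz1]; simp [cf]
      rw [h1]
      refine cf_ext fun α => ?_
      rw [cf_Mp, cf_Mp]
      have : cf α (R.map (algebraMap (MvPolynomial O A) (MvPolynomial O U))) = algebraMap A U (cf α R) := by
        rw [cf, coeff_map]
        exact MvPolynomial.coeff_map _ _ _
      rw [this]
      rfl
    have hintg : ∀ α : Ix, IsIntegral A (cf α QU) := fun α =>
      MvPolynomial.isIntegral_iff_isIntegral_coeff.1 (isIntegral_coeff_of_dvd R QU hR hmon hdvd α.1) α.2
    intro α hα
    obtain ⟨Θ, h1, h2⟩ := hintg α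
    refine ⟨Θ, h1, ?_⟩
    intro k _ φ Q hQ hn hQd
    obtain ⟨Q1, hQ1⟩ := hQd
    have g1 : gen I (fun α => cf α Q) = Q := gen_cf I Q (hI φ Q Q1 hQ1.symm)
    have g2 : gen I (fun α => cf α Q1) = Q1 := gen_cf I Q1 (hI φ Q1 Q (by rw [mul_comm, hQ1]))
    let E : B →+* k := eval₂Hom φ (Sum.elim (fun α => cf α Q) (fun α => cf α Q1))
    have hE1 : ∀ α, E (MvPolynomial.X (Sum.inl α)) = cf α Q := fun α => eval₂Hom_X' _ _ _
    have hE2 : ∀ α, E (MvPolynomial.X (Sum.inr α)) = cf α Q1 := fun α => eval₂Hom_X' _ _ _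
    have hEC : ∀ a, E (MvPolynomial.C a) = φ a := fun a => MvPolynomial.eval₂Hom_C _ _ _
    have e1 : Mp E (gen I x) = Q := by
      rw [Mp_gen]
      conv_rhs => rw [← g1]
      unfold gen
      refine Finset.sum_congr rfl fun β hβ => ?_
      simp only [x, if_pos hβ, hE1]
    have e2 : Mp E (gen I x1) = Q1 := by
      rw [Mp_gen]
      conv_rhs => rw [← g2]
      unfold gen
      refine Finset.sum_congr rfl fun β hβ => ?_
      simp only [x1, if_pos hβ, hE2]
    have e3 : Mp E (Mp (algebraMap A B) R) = Mp φ R := by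
      refine cf_ext fun β => ?_
      rw [cf_Mp, cf_Mp, cf_Mp]
      exact hEC _
    have e4 : ∀ b ∈ In, E b = 0 := by
      intro b hb
      have : In ≤ RingHom.ker E := by
        rw [Ideal.span_le]
        rintro _ (⟨β, rfl⟩ | ⟨β, hβ, rfl⟩)
        · change E _ = 0
          simp only
          rw [← cf_Mp, map_sub, map_mul, e1, e2, e3, hQ1, sub_self]; simp [cf]
        · change E _ = 0
          rw [← cf_Mp, map_sub, map_pow, e1]
          have h2 : Mp E (Polynomial.X : P2 O B) = Polynomial.X := by simp [Mp]
          rw [h2, cf_sub, sub_eq_zero]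
          unfold cf
          congr 1
          rw [coeff_X_pow]
          split_ifs with h
          · rw [h, ← hn]; exact hQ
          · exact coeff_eq_zero_of_natDegree_lt (by omega)
      exact this hb
    let Eb : U →+* k := Ideal.Quotient.lift In E e4
    have e5 : Eb (cf α QU) = cf α Q := by
      rw [← cf_Mp]
      congr 1
      rw [← e1]
      refine cf_ext fun β => ?_
      rw [cf_Mp, cf_Mp, cf_Mp]
      rfl
    have e6 : Eb.comp (algebraMap A U) = φ := by
      ext a
      have : Eb (mk (MvPolynomial.C a)) = φ a := by
        have : Eb (mk (MvPolynomial.C a)) = E (MvPolynomial.C a) := rfl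
        rw [this]; exact hEC a
      exact this
    have h3 := congrArg Eb h2
    rw [hom_eval₂, e5, e6, map_zero] at h3
    exact h3
  choose Θ hΘ1 hΘ2 using key
  refine ⟨Polynomial.X * ∏ n ∈ Finset.range (R.natDegree + 1), ∏ α ∈ I.attach, Θ n α.1 α.2, ?_, ?_⟩
  · refine Polynomial.monic_X.mul (monic_prod_of_monic _ _ fun n _ => monic_prod_of_monic _ _ fun α _ => hΘ1 _ _ _)
  · intro k _ φ Q hQ hQd α
    rw [eval₂_mul, eval₂_X]
    by_cases hα : cf α Q = 0
    · rw [hα, zero_mul]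
    · obtain ⟨Q1, hQ1⟩ := id hQd
      have hαI := hI φ Q Q1 hQ1.symm α hα
      have hnd : Q.natDegree ≤ R.natDegree := by
        refine (natDegree_le_of_dvd hQd (Mp_monic hR).ne_zero).trans ?_
        exact natDegree_map_le
      rw [eval₂_finset_prod, Finset.prod_eq_zero (Finset.mem_range.2 (Nat.lt_succ_of_le hnd)), mul_zero]
      rw [eval₂_finset_prod]
      exact Finset.prod_eq_zero (Finset.mem_attach _ ⟨α, hαI⟩) (hΘ2 _ α hαI φ Q hQ rfl hQd)

end
end CDM

namespace CDM

section
variable {k L ι J : Type} [Field k] [Field L] [Algebra k L] [Fintype ι] [Fintype J] {f : k[X][X]} {z : L} {y : ι → L}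

noncomputable def ell {R : Type} [CommRing R] (a : J → R) : MvPolynomial J R := ∑ j, MvPolynomial.C (a j) * MvPolynomial.X j

theorem coeff_ell {R : Type} [CommRing R] (a : J → R) (j : J) : (ell a).coeff (Finsupp.single j 1) = a j := by
  classical
  simp [ell, MvPolynomial.coeff_sum, MvPolynomial.coeff_C_mul, MvPolynomial.coeff_X, Finsupp.single_left_inj]

theorem ell_inj {R : Type} [CommRing R] {a b : J → R} (h : ell a = ell b) : a = b := by
  funext j
  rw [← coeff_ell a, h, coeff_ell]

theorem map_ell {R S : Type} [CommRing R] [CommRing S] (φ : R →+* S) (a : J → R) :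
    MvPolynomial.map φ (ell a) = ell (fun j => φ (a j)) := by
  simp [ell]

theorem rename_ell {R : Type} [CommRing R] (e : Equiv.Perm J) (a : J → R) :
    rename e (ell a) = ell (fun j => a (e.symm j)) := by
  simp only [ell, map_sum, map_mul, MvPolynomial.rename_C, MvPolynomial.rename_X]
  exact Fintype.sum_equiv e _ _ (fun j => by simp)

noncomputable def ev0 (k : Type) (J : Type) {L : Type} [Field k] [Field L] [Algebra k L] (z : L) :
    MvPolynomial (Option J) k →+* MvPolynomial J L :=
  (MvPolynomial.map (evz k z)).comp (optionEquivRight k J : MvPolynomial (Option J) k →+* MvPolynomial J k[X])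

noncomputable def ev (k : Type) (J : Type) {L : Type} [Field k] [Field L] [Algebra k L] (z : L) :
    P2 (Option J) k →+* (MvPolynomial J L)[X] := mapRingHom (ev0 k J z)

theorem ev0_C (c : k) : ev0 k J z (MvPolynomial.C c) = MvPolynomial.C (algebraMap k L c) := by
  simp [ev0, MvPolynomial.optionEquivRight_C]

theorem ev0_none : ev0 k J z (MvPolynomial.X none) = MvPolynomial.C z := by
  simp [ev0, MvPolynomial.optionEquivRight_X_none]

theorem ev0_some (j : J) : ev0 k J z (MvPolynomial.X (some j)) = MvPolynomial.X j := by
  simp [ev0, MvPolynomial.optionEquivRight_X_some]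

theorem ev0_inj (hz : Transcendental k z) : Function.Injective (ev0 k J z) := by
  have h1 : Function.Injective (evz k z) := transcendental_iff_injective.1 hz
  exact (MvPolynomial.map_injective _ h1).comp (optionEquivRight k J).injective

theorem ev_inj (hz : Transcendental k z) : Function.Injective (ev k J z) := Polynomial.map_injective _ (ev0_inj hz)

theorem mem_range_ev0 (P : MvPolynomial J L) (h : ∀ m, P.coeff m ∈ (evz k z).range) : ∃ q, ev0 k J z q = P := by
  have h1 : P ∈ Set.range (MvPolynomial.map (σ := J) (evz k z)) := by
    rw [MvPolynomial.mem_range_map_iff_coeffs_subset]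
    intro c hc
    obtain ⟨m, _, rfl⟩ := MvPolynomial.mem_coeffs_iff.1 hc
    exact h m
  obtain ⟨q, hq⟩ := h1
  refine ⟨(optionEquivRight k J).symm q, ?_⟩
  change MvPolynomial.map (evz k z) (optionEquivRight k J ((optionEquivRight k J).symm q)) = P
  rw [AlgEquiv.apply_symm_apply, hq]

noncomputable def Ren (e : Equiv.Perm J) : P2 (Option J) k →+* P2 (Option J) k :=
  mapRingHom (rename (Option.map e)).toRingHom

theorem ev_Ren (e : Equiv.Perm J) (Q : P2 (Option J) k) :
    ev k J z (Ren e Q) = (ev k J z Q).map (rename e).toRingHom := by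
  simp only [ev, Ren, coe_mapRingHom, Polynomial.map_map]
  congr 1
  apply MvPolynomial.ringHom_ext
  · intro c; simp [ev0_C]
  · rintro (_ | j) <;> simp [ev0_none, ev0_some]

theorem ev_Mp {σ : k →+* k} {τ : L →+* L} (hτ : Tw σ z τ) (Q : P2 (Option J) k) :
    ev k J z (Mp σ Q) = (ev k J z Q).map (MvPolynomial.map τ) := by
  simp only [ev, Mp, coe_mapRingHom, Polynomial.map_map]
  congr 1
  apply MvPolynomial.ringHom_ext
  · intro c; simp [ev0_C, hτ.c]
  · rintro (_ | j) <;> simp [ev0_none, ev0_some, hτ.z]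

theorem Tw.ofAut (h : L ≃ₐ[k⟮z⟯] L) : Tw (RingHom.id k) z (h : L →+* L) where
  c := fun c => h.commutes (algebraMap k k⟮z⟯ c)
  z := h.commutes (⟨z, mem_adjoin_simple_self k z⟩ : k⟮z⟯)

variable [Fintype (L ≃ₐ[k⟮z⟯] L)]

noncomputable def pr (k : Type) {L : Type} [Field k] [Field L] [Algebra k L] (z : L) [Fintype (L ≃ₐ[k⟮z⟯] L)] (a : J → L) :
    (MvPolynomial J L)[X] := ∏ h : L ≃ₐ[k⟮z⟯] L, (X - C (ell fun j => h (a j)))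

theorem pr_monic (a : J → L) : (pr k z a).Monic := monic_prod_of_monic _ _ fun _ _ => monic_X_sub_C _

theorem pr_natDegree (a : J → L) : (pr k z a).natDegree = card (L ≃ₐ[k⟮z⟯] L) := by
  rw [pr, natDegree_prod_of_monic _ _ fun _ _ => monic_X_sub_C _]
  simp

theorem pr_smul (a : J → L) (h : L ≃ₐ[k⟮z⟯] L) : pr k z (fun j => h (a j)) = pr k z a :=
  Fintype.prod_equiv (Equiv.mulRight h) _ _ fun g => rfl

theorem pr_rename (e : Equiv.Perm J) (a : J → L) :
    (pr k z a).map (rename e).toRingHom = pr k z (fun j => a (e.symm j)) := by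
  rw [pr, Polynomial.map_prod]
  refine Finset.prod_congr rfl fun h _ => ?_
  simp [rename_ell]

theorem pr_map (hc : IsCov f z y) {σ : k →+* k} (hs : Function.Surjective σ) (hσ : f.map (mapRingHom σ) = f)
    {τ : L →+* L} (hτ : Tw σ z τ) (a : J → L) : (pr k z a).map (MvPolynomial.map τ) = pr k z (fun j => τ (a j)) := by
  have h1 : ∀ h : L ≃ₐ[k⟮z⟯] L, ∃ h' : L ≃ₐ[k⟮z⟯] L, ∀ a, τ (h' a) = h (τ a) := by
    intro h
    refine hτ.exists_h hc hs hσ (τ' := (h : L →+* L).comp τ) ⟨fun c => ?_, ?_⟩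
    · rw [RingHom.comp_apply, hτ.c]; exact (Tw.ofAut h).c _
    · rw [RingHom.comp_apply, hτ.z]; exact (Tw.ofAut h).z
  choose g hg using h1
  have hinj : Function.Injective g := by
    intro h h' e
    apply AlgEquiv.ext
    intro a
    obtain ⟨b, rfl⟩ := hτ.surj hc hs hσ a
    rw [← hg, ← hg, e]
  have hbij : Function.Bijective g := (Fintype.bijective_iff_injective_and_card g).2 ⟨hinj, rfl⟩
  rw [pr, Polynomial.map_prod, ← hbij.prod_comp, pr]
  refine Finset.prod_congr rfl fun h _ => ?_
  simp [map_ell, hg]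

theorem dvd_pr {a b : J → L} : (X - C (ell b)) ∣ pr k z a ↔ ∃ h : L ≃ₐ[k⟮z⟯] L, ∀ j, b j = h (a j) := by
  rw [dvd_iff_isRoot, IsRoot, pr, eval_prod, Finset.prod_eq_zero_iff]
  constructor
  · rintro ⟨h, _, h1⟩
    refine ⟨h, fun j => ?_⟩
    rw [eval_sub, eval_X, eval_C, sub_eq_zero] at h1
    exact congrFun (ell_inj h1) j
  · rintro ⟨h, h1⟩
    refine ⟨h, Finset.mem_univ _, ?_⟩
    rw [eval_sub, eval_X, eval_C, sub_eq_zero]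
    congr 1; funext j; exact h1 j

theorem self_dvd_pr (a : J → L) : (X - C (ell a)) ∣ pr k z a := dvd_pr.2 ⟨1, fun _ => rfl⟩

theorem pr_dvd {a : J → L} (ha : ∀ h : L ≃ₐ[k⟮z⟯] L, (∀ j, h (a j) = a j) → h = 1) (Q : P2 (Option J) k) (hQ : ev k J z Q ≠ 0)
    (hd : (X - C (ell a)) ∣ ev k J z Q) : pr k z a ∣ ev k J z Q := by
  classical
  have hinj : Function.Injective fun h : L ≃ₐ[k⟮z⟯] L => ell fun j => h (a j) := by
    intro h h' e
    have e1 := ell_inj e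
    have e2 : h'⁻¹ * h = 1 := ha _ fun j => by
      change h'.symm (h (a j)) = a j
      rw [AlgEquiv.symm_apply_eq]; exact congrFun e1 j
    exact (inv_mul_eq_one.1 e2).symm
  have h1 : pr k z a = (((Finset.univ.val : Multiset (L ≃ₐ[k⟮z⟯] L)).map fun h => ell fun j => h (a j)).map fun b => X - C b).prod := by
    rw [Multiset.map_map]; rfl
  rw [h1, Multiset.prod_X_sub_C_dvd_iff_le_roots hQ, Multiset.le_iff_subset (Multiset.Nodup.map hinj Finset.univ.nodup)]
  intro b hb
  obtain ⟨h, _, rfl⟩ := Multiset.mem_map.1 hb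
  rw [mem_roots hQ, ← dvd_iff_isRoot]
  have h2 := ev_Mp (Tw.ofAut h) Q
  have h3 : Mp (RingHom.id k) Q = Q := cf_ext fun α => by rw [cf_Mp]; rfl
  rw [h3] at h2
  rw [h2]
  have h4 := Polynomial.map_dvd (MvPolynomial.map (σ := J) (h : L →+* L)) hd
  simpa [map_ell] using h4

theorem Q_exists (hc : IsCov f z y) (a : J → L) (ha : ∀ j, (evz k z).IsIntegralElem (a j)) :
    ∃ Q : P2 (Option J) k, ev k J z Q = pr k z a := by
  have hfin := hc.fin
  have hgal := hc.gal
  suffices h : pr k z a ∈ lifts (ev0 k J z) from (mem_lifts _).1 h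
  rw [lifts_iff_coeff_lifts]
  intro n
  apply mem_range_ev0
  intro m
  apply mem_range_of_integral hc.tr
  · have : ((pr k z a).coeff n).coeff m ∈ Set.range (algebraMap k⟮z⟯ L) := by
      rw [IsGalois.mem_range_algebraMap_iff_fixed]
      intro h
      have h1 : (pr k z a).map (MvPolynomial.map (h : L →+* L)) = pr k z a := by
        rw [pr_map hc (σ := RingHom.id k) (fun c => ⟨c, rfl⟩) (by simp) (Tw.ofAut h)]
        exact pr_smul a h
      have h2 := congrArg (fun p => (p.coeff n).coeff m) h1
      simp only [coeff_map, MvPolynomial.coeff_map] at h2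
      exact h2
    obtain ⟨c, hc⟩ := this
    rw [← hc]; exact c.2
  · let _ : Algebra k[X] L := (evz k z).toAlgebra
    let S := (integralClosure k[X] L).toSubring
    have hS : ∀ (h : L ≃ₐ[k⟮z⟯] L) j, h (a j) ∈ S := fun h j =>
      integral_conj (mem_adjoin_simple_self k z) (ha j) h
    have h1 : pr k z a = (∏ h : L ≃ₐ[k⟮z⟯] L, (X - C (ell fun j => (⟨h (a j), hS h j⟩ : S)))).map (MvPolynomial.map S.subtype) := by
      rw [Polynomial.map_prod, pr]
      refine Finset.prod_congr rfl fun h _ => ?_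
      simp [map_ell]
    rw [h1, coeff_map, MvPolynomial.coeff_map]
    exact Subtype.property _

theorem exists_factor {R S : Type} [CommRing R] [IsDomain R] [Fintype S] (a : S → R) (P : R[X]) (hP : P.Monic) (h0 : 0 < P.natDegree)
    (hd : P ∣ ∏ s, (X - C (a s))) : ∃ s, (X - C (a s)) ∣ P := by
  obtain ⟨P1, h1⟩ := hd
  have hm : (∏ s, (X - C (a s))).Monic := monic_prod_of_monic _ _ fun _ _ => monic_X_sub_C _
  have hP1 : P1.Monic := hP.of_mul_monic_left (h1 ▸ hm)
  have hr : (∏ s, (X - C (a s))).roots.card = P.natDegree + P1.natDegree := by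
    have e : ∏ s, (X - C (a s)) = ((Finset.univ.val.map a).map fun b => X - C b).prod := by rw [Multiset.map_map]; rfl
    rw [← hP.natDegree_mul hP1, ← h1, e, roots_multiset_prod_X_sub_C, natDegree_multiset_prod_X_sub_C_eq_card]
  rw [h1, roots_mul (h1 ▸ hm.ne_zero), Multiset.card_add] at hr
  have h2 := card_roots' P
  have h3 := card_roots' P1
  have h4 : 0 < P.roots.card := by omega
  obtain ⟨c, hc⟩ := Multiset.card_pos_iff_exists_mem.1 h4
  have hc1 := (mem_roots hP.ne_zero).1 hc
  have hc2 : (∏ s, (X - C (a s))).eval c = 0 := by rw [h1, eval_mul, hc1, zero_mul]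
  rw [eval_prod, Finset.prod_eq_zero_iff] at hc2
  obtain ⟨s, _, hs⟩ := hc2
  refine ⟨s, ?_⟩
  rw [dvd_iff_isRoot]
  rw [eval_sub, eval_X, eval_C, sub_eq_zero] at hs
  rw [← hs]; exact hc1

end
end CDM

namespace CDM

section
variable {V ι J0 : Type} [Fintype ι] [DecidableEq ι] [Fintype J0]

abbrev JJ (ι J0 : Type) := Option (Equiv.Perm ι × J0)

def actP (g : Equiv.Perm ι) : Equiv.Perm (JJ ι J0) := Equiv.optionCongr (Equiv.prodCongr (Equiv.mulLeft g) (Equiv.refl J0))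

theorem actP_some (g s : Equiv.Perm ι) (j : J0) : actP g (some (s, j)) = some (g * s, j) := rfl
theorem actP_none (g : Equiv.Perm ι) : actP (J0 := J0) g none = none := rfl

theorem actP_mul (g h : Equiv.Perm ι) (x : JJ ι J0) : actP (g * h) x = actP g (actP h x) := by
  rcases x with _ | ⟨s, j⟩
  · rfl
  · simp [actP_some, mul_assoc]

theorem actP_symm (g : Equiv.Perm ι) (x : JJ ι J0) : (actP g).symm x = actP g⁻¹ x := by
  rw [Equiv.symm_apply_eq, ← actP_mul, mul_inv_cancel]
  rcases x with _ | ⟨s, j⟩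
  · rfl
  · simp [actP_some]

section
variable {R : Type} [CommRing R]

/-- evaluation with the first group of variables given by a ring homomorphism -/
noncomputable def pe (φ : MvPolynomial V ℤ →+* R) (y : ι → R) : MvPolynomial (V ⊕ ι) ℤ →+* R :=
  eval₂Hom (Int.castRingHom R) (Sum.elim (fun v => φ (MvPolynomial.X v)) y)

theorem pe_inr (φ : MvPolynomial V ℤ →+* R) (y : ι → R) (i : ι) : pe φ y (MvPolynomial.X (Sum.inr i)) = y i := by simp [pe]

theorem pe_comp {S : Type} [CommRing S] (φ : MvPolynomial V ℤ →+* R) (y : ι → R) (h : R →+* S) (P : MvPolynomial (V ⊕ ι) ℤ) :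
    h (pe φ y P) = pe (h.comp φ) (fun i => h (y i)) P := by
  rw [← RingHom.comp_apply]
  congr 1
  apply MvPolynomial.ringHom_ext
  · intro n; simp [pe]
  · rintro (v | i) <;> simp [pe]

theorem pe_mem (φ : MvPolynomial V ℤ →+* R) (y : ι → R) (S : Subring R) (h1 : ∀ v, φ (MvPolynomial.X v) ∈ S) (h2 : ∀ i, y i ∈ S)
    (P : MvPolynomial (V ⊕ ι) ℤ) : pe φ y P ∈ S := by
  let P' : S := eval₂Hom (Int.castRingHom S) (Sum.elim (fun v => ⟨_, h1 v⟩) fun i => ⟨_, h2 i⟩) P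
  have : pe φ y P = S.subtype P' := by
    change _ = (S.subtype.comp _) P
    congr 1
    apply MvPolynomial.ringHom_ext
    · intro n; simp [pe]
    · rintro (v | i) <;> simp [pe]
  rw [this]; exact P'.2

noncomputable def av (p : J0 → MvPolynomial (V ⊕ ι) ℤ) (φ : MvPolynomial V ℤ →+* R) (y : ι → R) : JJ ι J0 → R
  | none => 0
  | some (s, j) => pe φ (fun i => y (s i)) (p j)

theorem av_act (p : J0 → MvPolynomial (V ⊕ ι) ℤ) (φ : MvPolynomial V ℤ →+* R) (y : ι → R) (g : Equiv.Perm ι) (x : JJ ι J0) :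
    av p φ (fun i => y (g i)) x = av p φ y (actP g x) := by
  rcases x with _ | ⟨s, j⟩ <;> rfl

theorem av_comp {S : Type} [CommRing S] (p : J0 → MvPolynomial (V ⊕ ι) ℤ) (φ : MvPolynomial V ℤ →+* R) (y : ι → R) (h : R →+* S) (x : JJ ι J0) :
    h (av p φ y x) = av p (h.comp φ) (fun i => h (y i)) x := by
  rcases x with _ | ⟨s, j⟩
  · exact map_zero _
  · exact pe_comp _ _ _ _

end

theorem fix_monic {R : Type} [CommRing R] (R0 : R[X]) (N : ℕ) : ∃ R1 : R[X], R1.Monic ∧ ∀ {S : Type} [CommRing S] [Nontrivial S] (ρ : R →+* S),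
    (R0.map ρ).Monic → (R0.map ρ).natDegree = N → R1.map ρ = R0.map ρ := by
  refine ⟨X ^ N + ∑ i ∈ Finset.range N, C (R0.coeff i) * X ^ i, ?_, ?_⟩
  · apply monic_X_pow_add
    exact degree_sum_fin_lt (n := N) (fun i => R0.coeff i) |> fun h => by
      rwa [Finset.sum_range]
  · intro S _ _ ρ h1 h2
    conv_rhs => rw [h1.as_sum, h2]
    simp [Polynomial.map_sum]

/-- `MvPolynomial (Option V) ℤ → P2 (Option J) (MvPolynomial V ℤ)` -/
noncomputable def psi0 (V J : Type) : MvPolynomial (Option V) ℤ →+* P2 (Option J) (MvPolynomial V ℤ) :=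
  eval₂Hom (Int.castRingHom _) (fun v => v.elim (C (MvPolynomial.X none)) fun v => C (MvPolynomial.C (MvPolynomial.X v)))

noncomputable def lz {k L : Type} [Field k] [Field L] [Algebra k L] (ω : MvPolynomial V ℤ →+* k) (z : L) : MvPolynomial (Option V) ℤ →+* L :=
  eval₂Hom (Int.castRingHom _) (fun v => v.elim z fun v => algebraMap k L (ω (MvPolynomial.X v)))

noncomputable def wz {k : Type} [Field k] (ω : MvPolynomial V ℤ →+* k) : MvPolynomial (Option V) ℤ →+* k[X] :=
  eval₂Hom (Int.castRingHom _) (fun v => v.elim X fun v => C (ω (MvPolynomial.X v)))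

theorem evz_wz {k L : Type} [Field k] [Field L] [Algebra k L] (ω : MvPolynomial V ℤ →+* k) (z : L) :
    (evz k z).comp (wz ω) = lz ω z := by
  apply MvPolynomial.ringHom_ext
  · intro n; simp [wz, lz]
  · rintro (_ | v) <;> simp [wz, lz, evz]

theorem ev_psi0 {k L J : Type} [Fintype J] [Field k] [Field L] [Algebra k L] (ω : MvPolynomial V ℤ →+* k) (z : L) :
    ((ev k J z).comp (Mp ω)).comp (psi0 V J) = ((C : MvPolynomial J L →+* _).comp (MvPolynomial.C : L →+* MvPolynomial J L)).comp (lz ω z) := by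
  apply MvPolynomial.ringHom_ext
  · intro n; simp [psi0, lz]
  · rintro (_ | v) <;> simp [psi0, lz, ev, Mp, ev0_none, ev0_C]

/-- the generic product attached to all reorderings of the roots -/
theorem sym_prod {B : Type} [CommRing B] (p : J0 → MvPolynomial (Option V ⊕ ι) ℤ) (ψ : MvPolynomial (Option V) ℤ →+* B) (x0 : B) (xs : JJ ι J0 → B)
    (f : (MvPolynomial (Option V) ℤ)[X]) : ∃ R0 : B, ∀ {S : Type} [CommRing S] [Nontrivial S] (φ : B →+* S) (y : ι → S),
      (f.map ψ).map φ = ∏ i, (X - C (y i)) →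
      φ R0 = ∏ s : Equiv.Perm ι, (φ x0 - ∑ j, φ (xs j) * av p (φ.comp ψ) (fun i => y (s i)) j) := by
  let p0 : MvPolynomial ι B := ∏ s : Equiv.Perm ι, (MvPolynomial.C x0 - ∑ j : JJ ι J0, MvPolynomial.C (xs j) *
    av p ((MvPolynomial.C : B →+* MvPolynomial ι B).comp ψ) (fun i => MvPolynomial.X (s i)) j)
  have hsym : p0.IsSymmetric := by
    intro g
    change (rename g : MvPolynomial ι B →ₐ[B] MvPolynomial ι B).toRingHom p0 = p0
    simp only [p0, map_prod, map_sub, map_sum, map_mul, av_comp]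
    refine Fintype.prod_equiv (Equiv.mulLeft g) _ _ fun s => ?_
    have e : (rename g : MvPolynomial ι B →ₐ[B] MvPolynomial ι B).toRingHom.comp ((MvPolynomial.C : B →+* MvPolynomial ι B).comp ψ) =
        ((MvPolynomial.C : B →+* MvPolynomial ι B).comp ψ) := by
      apply RingHom.ext; intro x; simp
    rw [e]
    simp
  obtain ⟨R0, hR0⟩ := sym_poly (f.map ψ) p0 hsym
  refine ⟨R0, fun φ y hf => ?_⟩
  rw [← hR0 φ y hf]
  change eval₂Hom _ _ p0 = _
  simp only [p0, map_prod, map_sub, map_sum, map_mul, av_comp]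
  refine Finset.prod_congr rfl fun s _ => ?_
  have e : (eval₂Hom φ y).comp ((MvPolynomial.C : B →+* MvPolynomial ι B).comp ψ) = φ.comp ψ := by
    apply RingHom.ext; intro x; simp
  rw [e]
  simp

theorem R_exists (f : (MvPolynomial (Option V) ℤ)[X]) (p : J0 → MvPolynomial (Option V ⊕ ι) ℤ) :
    ∃ R : P2 (Option (JJ ι J0)) (MvPolynomial V ℤ), R.Monic ∧ ∀ {k L : Type} [Field k] [Field L] [Algebra k L]
      (ω : MvPolynomial V ℤ →+* k) (z : L) (y : ι → L), f.map (lz ω z) = ∏ i, (X - C (y i)) →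
      ev k (JJ ι J0) z (Mp ω R) = ∏ s : Equiv.Perm ι, (X - C (ell (av p (lz ω z) fun i => y (s i)))) := by
  obtain ⟨R0, hR0⟩ := sym_prod p (psi0 V (JJ ι J0)) X (fun j => C (MvPolynomial.X (some j))) f
  obtain ⟨R, hR, hR1⟩ := fix_monic R0 (card (Equiv.Perm ι))
  refine ⟨R, hR, ?_⟩
  intro k L _ _ _ ω z y hf
  have h1 := hR0 ((ev k (JJ ι J0) z).comp (Mp ω)) (fun i => C (MvPolynomial.C (y i))) (by
    rw [Polynomial.map_map, ev_psi0, ← Polynomial.map_map, hf, Polynomial.map_prod]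
    simp)
  have h2 : ev k (JJ ι J0) z (Mp ω R0) = ∏ s : Equiv.Perm ι, (X - C (ell (av p (lz ω z) fun i => y (s i)))) := by
    rw [← RingHom.comp_apply, h1]
    refine Finset.prod_congr rfl fun s _ => ?_
    rw [ev_psi0]
    congr 1
    · simp [ev, Mp]
    · simp only [ell, map_sum, map_mul]
      refine Finset.sum_congr rfl fun j _ => ?_
      have e2 := av_comp p (lz ω z) (fun i => y (s i)) ((C : MvPolynomial (JJ ι J0) L →+* _).comp (MvPolynomial.C : L →+* MvPolynomial (JJ ι J0) L)) j
      simp only [RingHom.comp_apply] at e2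
      rw [← e2, mul_comm]
      simp [ev, Mp, ev0_some]
  let ρ := (ev0 k (JJ ι J0) z).comp (MvPolynomial.map (σ := Option (JJ ι J0)) ω)
  have hρ : ∀ P, ev k (JJ ι J0) z (Mp ω P) = P.map ρ := fun P => by
    simp [ev, Mp, ρ, Polynomial.map_map]
  have hm : (∏ s : Equiv.Perm ι, (X - C (ell (av p (lz ω z) fun i => y (s i))))).Monic :=
    monic_prod_of_monic _ _ fun _ _ => monic_X_sub_C _
  rw [hρ, hR1 ρ, ← hρ, h2]
  · rw [← hρ, h2]; exact hm
  · rw [← hρ, h2, natDegree_prod_of_monic _ _ fun _ _ => monic_X_sub_C _]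
    simp

end
end CDM

namespace CDM

section
variable {V ι J0 : Type} [Fintype ι] [DecidableEq ι] [Fintype J0] {k L : Type} [Field k] [Field L] [Algebra k L]
  {f : (MvPolynomial (Option V) ℤ)[X]} {p : J0 → MvPolynomial (Option V ⊕ ι) ℤ} {ω : MvPolynomial V ℤ →+* k} {z : L} {y : ι → L}

theorem IsCov.comp_perm {ι : Type} [Fintype ι] {f : k[X][X]} {y : ι → L} (hc : IsCov f z y) (s : Equiv.Perm ι) : IsCov f z (fun i => y (s i)) where
  tr := hc.tr
  fac := by rw [hc.fac]; exact (Equiv.prod_comp s (fun i => X - C (y i))).symm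
  gen := by
    have : Set.range (fun i => y (s i)) = Set.range y := s.surjective.range_comp y
    rw [this]; exact hc.gen
  sep := fun i => hc.sep (s i)

theorem cov_fac (hc : IsCov (f.map (wz ω)) z y) : f.map (lz ω z) = ∏ i, (X - C (y i)) := by
  rw [← hc.fac, Polynomial.map_map, evz_wz]

theorem wz_fix {σ : k →+* k} (hσ : ∀ v, σ (ω (MvPolynomial.X v)) = ω (MvPolynomial.X v)) : (mapRingHom σ).comp (wz ω) = wz ω := by
  apply MvPolynomial.ringHom_ext
  · intro n; simp [wz]
  · rintro (_ | v) <;> simp [wz, hσ]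

theorem lz_fix {σ : k →+* k} (hσ : ∀ v, σ (ω (MvPolynomial.X v)) = ω (MvPolynomial.X v)) {τ : L →+* L} (hτ : Tw σ z τ) : τ.comp (lz ω z) = lz ω z := by
  apply MvPolynomial.ringHom_ext
  · intro n; simp [lz]
  · rintro (_ | v) <;> simp [lz, hσ, hτ.z, hτ.c]

theorem av_tau {σ : k →+* k} (hσ : ∀ v, σ (ω (MvPolynomial.X v)) = ω (MvPolynomial.X v)) {τ : L →+* L} (hτ : Tw σ z τ) (x : JJ ι J0) :
    τ (av p (lz ω z) y x) = av p (lz ω z) (fun i => τ (y i)) x := by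
  rw [av_comp, lz_fix hσ hτ]

theorem av_X {R : Type} [CommRing R] (hp : ∀ i, ∃ j, p j = MvPolynomial.X (Sum.inr i)) (φ : MvPolynomial (Option V) ℤ →+* R) (i : ι) :
    ∃ j : JJ ι J0, ∀ y : ι → R, av p φ y j = y i := by
  obtain ⟨j, hj⟩ := hp i
  exact ⟨some (1, j), fun y => by change pe _ _ (p j) = _; rw [hj, pe_inr]; rfl⟩

theorem av_faithful (hc : IsCov (f.map (wz ω)) z y) (hp : ∀ i, ∃ j, p j = MvPolynomial.X (Sum.inr i)) (h : L ≃ₐ[k⟮z⟯] L)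
    (hh : ∀ j, h (av p (lz ω z) y j) = av p (lz ω z) y j) : h = 1 := by
  apply hc.ext
  intro i
  obtain ⟨j, hj⟩ := av_X hp (lz ω z) i
  rw [← hj y, hh]; rfl

theorem av_integral (hc : IsCov (f.map (wz ω)) z y) (j : JJ ι J0) : (evz k z).IsIntegralElem (av p (lz ω z) y j) := by
  let _ : Algebra k[X] L := (evz k z).toAlgebra
  have h1 : ∀ g : k[X], (evz k z) g ∈ (integralClosure k[X] L) := fun g => (isIntegral_algebraMap (R := k[X]) (A := L) (x := g))
  rcases j with _ | ⟨s, j⟩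
  · have := h1 0
    rw [map_zero] at this
    exact this
  · refine pe_mem (lz ω z) _ (integralClosure k[X] L).toSubring ?_ ?_ (p j)
    · intro v
      have := h1 (wz ω (MvPolynomial.X v))
      rw [← RingHom.comp_apply, evz_wz] at this
      exact this
    · intro i; exact hc.y_integral (s i)

variable [Fintype (L ≃ₐ[k⟮z⟯] L)]

/-- `Q` is the minimal factor attached to `y` -/
def IsQ (p : J0 → MvPolynomial (Option V ⊕ ι) ℤ) (ω : MvPolynomial V ℤ →+* k) (z : L) [Fintype (L ≃ₐ[k⟮z⟯] L)] (y : ι → L) (Q : P2 (Option (JJ ι J0)) k) : Prop :=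
  ev k (JJ ι J0) z Q = pr k z (av p (lz ω z) y)

theorem isQ_exists (hc : IsCov (f.map (wz ω)) z y) : ∃ Q, IsQ p ω z y Q := Q_exists hc _ (av_integral hc)

variable {Q : P2 (Option (JJ ι J0)) k}

theorem IsQ.monic (hc : IsCov (f.map (wz ω)) z y) (hQ : IsQ p ω z y Q) : Q.Monic := by
  apply monic_of_injective (ev0_inj hc.tr)
  have : Q.map (ev0 k (JJ ι J0) z) = pr k z (av p (lz ω z) y) := hQ
  rw [this]; exact pr_monic _

theorem IsQ.natDegree (hc : IsCov (f.map (wz ω)) z y) (hQ : IsQ p ω z y Q) : Q.natDegree = card (L ≃ₐ[k⟮z⟯] L) := by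
  have h : Q.map (ev0 k (JJ ι J0) z) = pr k z (av p (lz ω z) y) := hQ
  rw [← pr_natDegree (z := z) (av p (lz ω z) y), ← h, natDegree_map_eq_of_injective (ev0_inj hc.tr)]

theorem pr_eq_iff {a b : JJ ι J0 → L} : pr k z a = pr k z b ↔ ∃ h : L ≃ₐ[k⟮z⟯] L, ∀ j, b j = h (a j) := by
  constructor
  · intro e
    rw [← dvd_pr, e]; exact self_dvd_pr b
  · rintro ⟨h, hh⟩
    have : b = fun j => h (a j) := funext hh
    rw [this, pr_smul]

theorem IsQ.ren (hQ : IsQ p ω z y Q) (e : Equiv.Perm (JJ ι J0)) :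
    ev k (JJ ι J0) z (Ren e Q) = pr k z (fun j => av p (lz ω z) y (e.symm j)) := by
  rw [ev_Ren, hQ, pr_rename]

theorem IsQ.pat (hc : IsCov (f.map (wz ω)) z y) (hQ : IsQ p ω z y Q) [DecidableEq (JJ ι J0)] (j : J0) :
    pe (lz ω z) y (p j) = 0 ↔ Ren (Equiv.swap (some (1, j)) none) Q = Q := by
  have key : Ren (Equiv.swap (some (1, j)) none) Q = Q ↔
      ∃ h : L ≃ₐ[k⟮z⟯] L, ∀ x, av p (lz ω z) y (Equiv.swap (some (1, j)) none x) = h (av p (lz ω z) y x) := by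
    rw [← (ev_inj hc.tr).eq_iff, hQ.ren, hQ, Equiv.symm_swap]
    exact eq_comm.trans pr_eq_iff
  rw [key]
  constructor
  · intro h
    refine ⟨1, fun x => ?_⟩
    have h0 : av p (lz ω z) y (some (1, j)) = 0 := h
    by_cases h1 : x = some (1, j)
    · rw [h1, Equiv.swap_apply_left, AlgEquiv.one_apply, h0]; rfl
    · by_cases h2 : x = none
      · rw [h2, Equiv.swap_apply_right, AlgEquiv.one_apply, h0]; rfl
      · rw [Equiv.swap_apply_of_ne_of_ne h1 h2]; rfl
  · rintro ⟨h, hh⟩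
    have h1 := hh none
    rw [Equiv.swap_apply_right] at h1
    have h2 : h (av p (lz ω z) y none) = 0 := map_zero h
    rw [h2] at h1
    exact h1

theorem IsQ.gam (hc : IsCov (f.map (wz ω)) z y) (hp : ∀ i, ∃ j, p j = MvPolynomial.X (Sum.inr i)) (hQ : IsQ p ω z y Q) {σ : k →+* k} (hs : Function.Surjective σ)
    (hσ : ∀ v, σ (ω (MvPolynomial.X v)) = ω (MvPolynomial.X v)) (g : Equiv.Perm ι) :
    g ∈ Gam σ z y ↔ Mp σ Q = Ren (actP g) Q := by
  have hσf : (f.map (wz ω)).map (mapRingHom σ) = f.map (wz ω) := by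
    rw [Polynomial.map_map, wz_fix hσ]
  have hM : ∀ {τ : L →+* L}, Tw σ z τ → ev k (JJ ι J0) z (Mp σ Q) = pr k z (fun j => av p (lz ω z) (fun i => τ (y i)) j) := by
    intro τ hτ
    rw [ev_Mp hτ, hQ, pr_map hc hs hσf hτ]
    simp only [av_tau hσ hτ]
  have hact : (fun j => av p (lz ω z) y ((actP g).symm j)) = av p (lz ω z) (fun i => y (g⁻¹ i)) := by
    funext x; rw [actP_symm, av_act]
  constructor
  · rintro ⟨τ, hτ, h⟩
    apply ev_inj hc.tr
    rw [hM hτ, hQ.ren, hact]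
    congr 1
    funext x
    congr 1
    funext i
    rw [← h (g⁻¹ i), ← Equiv.Perm.mul_apply, mul_inv_cancel, Equiv.Perm.one_apply]
  · intro h
    obtain ⟨τ, h1, h2⟩ := exists_tau hc σ hσf
    have hτ : Tw σ z τ := ⟨h1, h2⟩
    have h3 := congrArg (ev k (JJ ι J0) z) h
    rw [hM hτ, hQ.ren, hact, pr_eq_iff] at h3
    obtain ⟨e, he⟩ := h3
    refine ⟨(e : L →+* L).comp τ, ⟨fun c => ?_, ?_⟩, fun i => ?_⟩
    · rw [RingHom.comp_apply, hτ.c]; exact (Tw.ofAut e).c _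
    · rw [RingHom.comp_apply, hτ.z]; exact (Tw.ofAut e).z
    · obtain ⟨j, hj⟩ := av_X hp (lz ω z) (g i)
      have h4 := he j
      rw [hj, hj, ← Equiv.Perm.mul_apply, inv_mul_cancel, Equiv.Perm.one_apply] at h4
      exact h4.symm

theorem dvd_prod_one {ι : Type} [Fintype ι] [DecidableEq ι] {R : Type} [CommRing R] (F : Equiv.Perm ι → R) : F 1 ∣ ∏ s, F s := Finset.dvd_prod_of_mem F (Finset.mem_univ 1)

theorem IsQ.dvd (hc : IsCov (f.map (wz ω)) z y) (hp : ∀ i, ∃ j, p j = MvPolynomial.X (Sum.inr i)) (hQ : IsQ p ω z y Q)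
    {R : P2 (Option (JJ ι J0)) k} (hR : ev k (JJ ι J0) z R = ∏ s : Equiv.Perm ι, (X - C (ell (av p (lz ω z) fun i => y (s i))))) : Q ∣ R := by
  have hm : (∏ s : Equiv.Perm ι, (X - C (ell (av p (lz ω z) fun i => y (s i))))).Monic :=
    monic_prod_of_monic _ _ fun _ _ => monic_X_sub_C _
  refine (map_dvd_map (ev0 k (JJ ι J0) z) (ev0_inj hc.tr) (hQ.monic hc)).1 ?_
  have h1 : Q.map (ev0 k (JJ ι J0) z) = pr k z (av p (lz ω z) y) := hQ
  rw [h1]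
  have h2 : pr k z (av p (lz ω z) y) ∣ ev k (JJ ι J0) z R := by
    refine pr_dvd (av_faithful hc hp) R ?_ ?_
    · rw [hR]; exact hm.ne_zero
    · rw [hR]; exact dvd_prod_one (fun s : Equiv.Perm ι => X - C (ell (av p (lz ω z) fun i => y (s i))))
  exact h2

/-- every factor of `R` of positive degree is divisible by the minimal factor of some reordering -/
theorem factor_dvd (hc : IsCov (f.map (wz ω)) z y) (hp : ∀ i, ∃ j, p j = MvPolynomial.X (Sum.inr i))
    {R Q' : P2 (Option (JJ ι J0)) k} (hR : ev k (JJ ι J0) z R = ∏ s : Equiv.Perm ι, (X - C (ell (av p (lz ω z) fun i => y (s i)))))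
    (hm : Q'.Monic) (h0 : 0 < Q'.natDegree) (hd : Q' ∣ R) : ∃ s : Equiv.Perm ι, pr k z (av p (lz ω z) fun i => y (s i)) ∣ ev k (JJ ι J0) z Q' := by
  have hd2 := map_dvd (ev k (JJ ι J0) z) hd
  rw [hR] at hd2
  have hm' : (ev k (JJ ι J0) z Q').Monic := hm.map _
  have hdeg : (ev k (JJ ι J0) z Q').natDegree = Q'.natDegree := hm.natDegree_map _
  obtain ⟨s, hs⟩ := exists_factor _ _ hm' (by rw [hdeg]; exact h0) hd2
  exact ⟨s, pr_dvd (av_faithful (hc.comp_perm s) hp) Q' hm'.ne_zero hs⟩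

end

section
variable {ι J0 k : Type} [CommRing k]

theorem cf_Ren {J k : Type} [Field k] (e : Equiv.Perm J) (Q : P2 (Option J) k) (i : ℕ) (m : Option J →₀ ℕ) :
    cf (i, m.mapDomain (Option.map e)) (Ren e Q) = cf (i, m) Q := by
  simp only [cf, Ren, coe_mapRingHom, coeff_map]
  exact MvPolynomial.coeff_rename_mapDomain _ (Option.map_injective e.injective) _ _

theorem eq_Ren {J k : Type} [Field k] (e : Equiv.Perm J) (Q P : P2 (Option J) k) :
    P = Ren e Q ↔ ∀ i m, cf (i, m.mapDomain (Option.map e)) P = cf (i, m) Q := by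
  constructor
  · rintro rfl i m
    exact cf_Ren e Q i m
  · intro h
    apply cf_ext
    rintro ⟨i, m⟩
    have h1 : m = (m.mapDomain (Option.map e.symm)).mapDomain (Option.map e) := by
      rw [← Finsupp.mapDomain_comp, Option.map_comp_map]
      simp
    rw [h1, h, cf_Ren]

theorem perm_pow_lemma {Idx G k : Type} [Group G] [Fintype G] [Monoid k] (c : Idx → k) (q : ℕ) (A : G → Idx → Idx) (h1 : ∀ α, A 1 α = α)
    (hm : ∀ g h α, A (g * h) α = A g (A h α)) (g0 : G) (hg0 : ∀ α, c α ^ q = c (A g0 α)) (r : ℕ) (hr : r.Coprime (card G)) (γ : G) :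
    (∀ α, c α ^ q ^ r = c (A γ α)) ↔ ∃ g, (∀ α, c α ^ q = c (A g α)) ∧ g ^ r = γ := by
  have hpow : ∀ (g : G) (n : ℕ), (∀ α, c α ^ q ^ n = c (A g α)) → ∀ m α, c α ^ q ^ (n * m) = c (A (g ^ m) α) := by
    intro g n h m
    induction m with
    | zero => intro α; simp [h1]
    | succ m ih => intro α; rw [Nat.mul_succ, pow_add, pow_mul, ih, h, pow_succ', hm]
  constructor
  · intro h
    obtain ⟨s, hs⟩ : ∃ s, r * s % card G = 1 % card G := by
      by_cases h1 : card G = 1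
      · exact ⟨0, by simp [h1, Nat.mod_one]⟩
      · obtain ⟨s, hs⟩ := Nat.exists_mul_mod_eq_one_of_coprime hr (lt_of_le_of_ne Fintype.card_pos (Ne.symm h1))
        exact ⟨s, by rw [hs.2, Nat.mod_eq_of_lt (lt_of_le_of_ne Fintype.card_pos (Ne.symm h1))]⟩
    have hN : ∀ m α, c α ^ q ^ (card G * m) = c α := by
      intro m α
      have := hpow g0 1 (by simpa using hg0) (card G * m) α
      rw [pow_mul g0, pow_card_eq_one, one_pow, h1, one_mul] at this
      exact this
    have hG : ∀ (x : G) (n : ℕ), n % card G = 1 % card G → x ^ n = x := by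
      intro x n hn
      rw [← pow_mod_card, hn, pow_mod_card, pow_one]
    refine ⟨γ ^ s, fun α => ?_, ?_⟩
    · have e := hpow γ r h s α
      rw [← e]
      by_cases hc1 : card G = 1
      · have := hN (r * s) α
        rw [hc1, one_mul] at this
        rw [this]
        have := hN 1 α
        rw [hc1, one_mul, pow_one] at this
        exact this
      · have e1 : r * s = card G * (r * s / card G) + 1 := by
          have := Nat.div_add_mod (r * s) (card G)
          rw [hs, Nat.mod_eq_of_lt (lt_of_le_of_ne Fintype.card_pos (Ne.symm hc1))] at this
          omega
        rw [e1, pow_add, pow_one, pow_mul, hN]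
    · rw [← pow_mul, mul_comm]; exact hG _ _ hs
  · rintro ⟨g, hg, rfl⟩ α
    have := hpow g 1 (by simpa using hg) r α
    rw [one_mul] at this
    exact this

end
end CDM

namespace CDM

section
variable {V O : Type} [Finite O]

theorem trans1 (R : P2 O (MvPolynomial V ℤ)) (hR : R.Monic) : ∃ (G : (MvPolynomial V ℤ)[X]) (T : Set (MvPolynomial (V ⊕ ℕ) ℤ)),
    G.Monic ∧ T.Finite ∧ ∀ {K : Type} [Field K] [Fintype K] {K' : Type} [Field K'] [Fintype K'] (w : V → K) (w' : V → K') (r r' : ℕ)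
    (b : AC K → AC K'), IsoW G T w r w' r' b → ∀ Q : P2 O (AC K), Q.Monic → Q ∣ Mp (wev w) R → (∀ α, cf α Q ∈ Rt G w) ∧
      ∃ Q' : P2 O (AC K'), Q'.Monic ∧ Q'.natDegree = Q.natDegree ∧ Q' ∣ Mp (wev w') R ∧ ∀ α, cf α Q' = b (cf α Q) := by
  classical
  obtain ⟨I, hI⟩ := P2_deg R hR
  obtain ⟨G0, hG0, hG⟩ := P2_univ R hR
  have hcount : Countable (Bool × (ℕ × (O →₀ ℕ))) := inferInstance
  obtain ⟨enc, henc⟩ := hcount.exists_injective_nat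
  let gQ : Bool → P2 O (MvPolynomial (V ⊕ ℕ) ℤ) := fun t => gen I (fun α => MvPolynomial.X (Sum.inr (enc (t, α))))
  let E := gQ true * gQ false - Mp (rename (R := ℤ) (Sum.inl : V → V ⊕ ℕ)).toRingHom R
  refine ⟨G0 * (X * (X - 1)), (Set.range fun α => cf α E) ∪ {MvPolynomial.X (Sum.inr 0), MvPolynomial.X (Sum.inr 0) - 1},
    hG0.mul (monic_X.mul (by simpa using monic_X_sub_C (1 : MvPolynomial V ℤ))), (cf_finite E).union (Set.toFinite _), ?_⟩
  intro K _ _ K' _ _ w w' r r' b h Q hQ hd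
  have m0 : (0 : AC K) ∈ Rt (G0 * (X * (X - 1))) w := by simp [Rt, eval₂_mul]
  have m1 : (1 : AC K) ∈ Rt (G0 * (X * (X - 1))) w := by simp [Rt, eval₂_mul]
  have b0 : b 0 = 0 := by
    have := (h.test (MvPolynomial.X (Sum.inr 0)) (by simp) (fun _ => 0) (fun _ => m0)).1 (by simp [tev])
    simpa [tev] using this
  have b1 : b 1 = 1 := by
    have := (h.test (MvPolynomial.X (Sum.inr 0) - 1) (by simp) (fun _ => 1) (fun _ => m1)).1 (by simp [tev])
    simpa [tev, sub_eq_zero] using this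
  have hmem : ∀ P : P2 O (AC K), P.Monic → P ∣ Mp (wev w) R → ∀ α, cf α P ∈ Rt (G0 * (X * (X - 1))) w := by
    intro P hP hPd α
    rw [Rt_mul]
    exact Or.inl (hG (wev w) P hP hPd α)
  obtain ⟨Q1, hQ1⟩ := hd
  have hQ1m : Q1.Monic := hQ.of_mul_monic_left (hQ1 ▸ Mp_monic hR)
  refine ⟨hmem Q hQ ⟨Q1, hQ1⟩, ?_⟩
  have hIQ := hI (wev w) Q Q1 hQ1.symm
  have hIQ1 := hI (wev w) Q1 Q (by rw [mul_comm, hQ1])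
  let F : Bool × (ℕ × (O →₀ ℕ)) → AC K := fun a => if a.1 then cf a.2 Q else cf a.2 Q1
  let x : ℕ → AC K := Function.extend enc F (fun _ => 0)
  have hx : ∀ a, x (enc a) = F a := fun a => henc.extend_apply F _ a
  have hxR : ∀ n, x n ∈ Rt (G0 * (X * (X - 1))) w := by
    intro n
    by_cases hn : ∃ a, enc a = n
    · obtain ⟨⟨t, α⟩, rfl⟩ := hn
      rw [hx]
      cases t
      · exact hmem Q1 hQ1m ⟨Q, by rw [mul_comm, hQ1]⟩ α
      · exact hmem Q hQ ⟨Q1, hQ1⟩ α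
    · have : x n = 0 := Function.extend_apply' _ _ _ hn
      rw [this]; exact m0
  have hE : ∀ {K : Type} [Field K] (w : V → K) (x : ℕ → AC K), Mp (tev w x) E = gen I (fun α => x (enc (true, α))) * gen I (fun α => x (enc (false, α))) - Mp (wev w) R := by
    intro K _ w x
    have e1 : Mp (tev w x) (Mp (rename (R := ℤ) (Sum.inl : V → V ⊕ ℕ)).toRingHom R) = Mp (wev w) R := by
      apply cf_ext; intro α
      rw [cf_Mp, cf_Mp, cf_Mp]
      exact tev_rename w x _
    rw [map_sub, map_mul, Mp_gen, Mp_gen, e1]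
    simp [tev]
  have hE0 : Mp (tev w x) E = 0 := by
    have e1 : (fun α => x (enc (true, α))) = fun α => cf α Q := by funext α; rw [hx]; rfl
    have e2 : (fun α => x (enc (false, α))) = fun α => cf α Q1 := by funext α; rw [hx]; rfl
    rw [hE, e1, e2, gen_cf I Q hIQ, gen_cf I Q1 hIQ1, hQ1, sub_self]
  have hE1 : Mp (tev w' fun i => b (x i)) E = 0 := by
    apply cf_ext; intro α
    rw [cf_Mp]
    have e : cf α (0 : P2 O (AC K')) = 0 := by simp [cf]
    rw [e, ← h.test _ (Or.inl ⟨α, rfl⟩) x hxR, ← cf_Mp, hE0]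
    simp [cf]
  rw [hE, sub_eq_zero] at hE1
  have e1 : (fun α => b (x (enc (true, α)))) = fun α => b (cf α Q) := by funext α; rw [hx]; rfl
  rw [e1] at hE1
  have hcf : ∀ α, cf α (gen I fun α => b (cf α Q)) = b (cf α Q) := by
    apply cf_gen
    intro α hα
    have : cf α Q = 0 := by by_contra h0; exact hα (hIQ α h0)
    rw [this, b0]
  have hlow : ∀ i, Q.natDegree < i → (gen I fun α => b (cf α Q)).coeff i = 0 := by
    intro i hi
    ext m
    have := hcf (i, m)
    rw [cf] at this
    rw [this, cf, coeff_eq_zero_of_natDegree_lt hi]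
    simpa using b0
  have hlead : (gen I fun α => b (cf α Q)).coeff Q.natDegree = 1 := by
    ext m
    have := hcf (Q.natDegree, m)
    rw [cf] at this
    have h2 : Q.coeff Q.natDegree = 1 := hQ
    rw [this, cf, h2]
    change b (MvPolynomial.coeff m 1) = MvPolynomial.coeff m 1
    rw [MvPolynomial.coeff_one, MvPolynomial.coeff_one]
    split_ifs
    · exact b1
    · exact b0
  have hdeg : (gen I fun α => b (cf α Q)).natDegree ≤ Q.natDegree := natDegree_le_iff_coeff_eq_zero.2 hlow
  have hmon := monic_of_natDegree_le_of_coeff_eq_one Q.natDegree hdeg hlead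
  refine ⟨gen I fun α => b (cf α Q), hmon, le_antisymm hdeg ?_, ⟨_, hE1.symm⟩, hcf⟩
  apply le_natDegree_of_ne_zero
  rw [hlead]; exact one_ne_zero
end

section
variable {V ι J0 : Type} [Fintype ι] [DecidableEq ι] [Fintype J0] {k L : Type} [Field k] [Field L] [Algebra k L]
  {f : (MvPolynomial (Option V) ℤ)[X]} {p : J0 → MvPolynomial (Option V ⊕ ι) ℤ} {ω : MvPolynomial V ℤ →+* k} {z : L} {y : ι → L}

theorem deg_le [Fintype (L ≃ₐ[k⟮z⟯] L)] (hc : IsCov (f.map (wz ω)) z y) (hp : ∀ i, ∃ j, p j = MvPolynomial.X (Sum.inr i))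
    {R Q' : P2 (Option (JJ ι J0)) k} (hR : ev k (JJ ι J0) z R = ∏ s : Equiv.Perm ι, (X - C (ell (av p (lz ω z) fun i => y (s i)))))
    (hm : Q'.Monic) (h0 : 0 < Q'.natDegree) (hd : Q' ∣ R) : card (L ≃ₐ[k⟮z⟯] L) ≤ Q'.natDegree ∧
      (Q'.natDegree ≤ card (L ≃ₐ[k⟮z⟯] L) → ∃ s : Equiv.Perm ι, IsQ p ω z (fun i => y (s i)) Q') := by
  obtain ⟨s, hs⟩ := factor_dvd hc hp hR hm h0 hd
  have hm' : (ev k (JJ ι J0) z Q').Monic := hm.map _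
  have hdeg : (ev k (JJ ι J0) z Q').natDegree = Q'.natDegree := hm.natDegree_map _
  have h1 := natDegree_le_of_dvd hs hm'.ne_zero
  rw [pr_natDegree, hdeg] at h1
  refine ⟨h1, fun h2 => ⟨s, ?_⟩⟩
  refine (eq_of_monic_of_dvd_of_natDegree_le (pr_monic _) hm' hs ?_)
  rw [pr_natDegree, hdeg]; exact h2

/-- the Frobenius relation on coefficients -/
theorem IsQ.gam_pow [Fintype (L ≃ₐ[k⟮z⟯] L)] (hc : IsCov (f.map (wz ω)) z y) (hp : ∀ i, ∃ j, p j = MvPolynomial.X (Sum.inr i))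
    {Q : P2 (Option (JJ ι J0)) k} (hQ : IsQ p ω z y Q)
    {σ : k →+* k} {q : ℕ} (hq : ∀ c, σ c ^ q = c)
    (hσ : ∀ v, σ (ω (MvPolynomial.X v)) = ω (MvPolynomial.X v)) (r : ℕ) (hr : r.Coprime (card (Equiv.Perm ι))) (γ : Equiv.Perm ι) :
    (∃ g ∈ Gam σ z y, g ^ r = γ) ↔ ∀ i m, cf (i, m) Q ^ q ^ r = cf (i, m.mapDomain (Option.map (actP γ))) Q := by
  have hs : Function.Surjective σ := fun c => ⟨c ^ q, by rw [map_pow, hq]⟩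
  have hg : ∀ g, g ∈ Gam σ z y ↔ ∀ i m, cf (i, m) Q ^ q = cf (i, m.mapDomain (Option.map (actP g))) Q := by
    intro g
    rw [hQ.gam hc hp hs hσ, eq_Ren]
    refine forall₂_congr fun i m => ?_
    rw [cf_Mp]
    constructor
    · intro h; rw [← h, hq]
    · intro h; rw [← h, map_pow, hq]
  have hσf : (f.map (wz ω)).map (mapRingHom σ) = f.map (wz ω) := by
    rw [Polynomial.map_map, wz_fix hσ]
  obtain ⟨τ, h1, h2⟩ := exists_tau hc σ hσf
  obtain ⟨g0, hg0⟩ := tau_perm hc σ hσf h1 h2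
  have hg0' := (hg g0).1 ⟨τ, ⟨h1, h2⟩, hg0⟩
  have key := perm_pow_lemma (fun α : ℕ × (Option (JJ ι J0) →₀ ℕ) => cf α Q) q
    (fun (g : Equiv.Perm ι) α => (α.1, α.2.mapDomain (Option.map (actP g)))) ?_ ?_ g0 (fun α => hg0' α.1 α.2) r hr γ
  · simp only [Prod.forall] at key
    rw [key]
    simp only [hg]
  · rintro ⟨i, m⟩
    have : (Option.map (actP (1 : Equiv.Perm ι)) : Option (JJ ι J0) → _) = id := by
      funext x
      rcases x with _ | _ | ⟨s, j⟩ <;> simp [actP_none, actP_some]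
    simp [this]
  · rintro g h ⟨i, m⟩
    simp only [Prod.mk.injEq, true_and]
    rw [← Finsupp.mapDomain_comp, Option.map_comp_map]
    congr 2
    funext x; exact actP_mul g h x

theorem transfer (f : (MvPolynomial (Option V) ℤ)[X]) (p : J0 → MvPolynomial (Option V ⊕ ι) ℤ) (hp : ∀ i, ∃ j, p j = MvPolynomial.X (Sum.inr i)) :
    ∃ (G : (MvPolynomial V ℤ)[X]) (T : Set (MvPolynomial (V ⊕ ℕ) ℤ)),
    G.Monic ∧ T.Finite ∧ ∀ {K : Type} [Field K] [Fintype K] {K' : Type} [Field K'] [Fintype K'] (w : V → K) (w' : V → K') (r r' : ℕ)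
    (b : AC K → AC K'), r.Coprime (card (Equiv.Perm ι)) → r'.Coprime (card (Equiv.Perm ι)) → IsoW G T w r w' r' b →
    ∀ {L L' : Type} [Field L] [Field L'] [Algebra (AC K) L] [Algebra (AC K') L'] {z : L} {z' : L'} {y : ι → L} {y' : ι → L'}
    {σ : AC K →+* AC K} {σ' : AC K' →+* AC K'}, IsCov (f.map (wz (wev w))) z y → IsCov (f.map (wz (wev w'))) z' y' →
    (∀ c, σ c ^ card K = c) → (∀ c, σ' c ^ card K' = c) →
    (∀ v, σ (wev w (MvPolynomial.X v)) = wev w (MvPolynomial.X v)) → (∀ v, σ' (wev w' (MvPolynomial.X v)) = wev w' (MvPolynomial.X v)) →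
    ∃ s : Equiv.Perm ι, (∀ j, pe (lz (wev w) z) y (p j) = 0 ↔ pe (lz (wev w') z') (fun i => y' (s i)) (p j) = 0) ∧
      ∀ γ, (∃ g ∈ Gam σ z y, g ^ r = γ) ↔ (∃ g ∈ Gam σ' z' (fun i => y' (s i)), g ^ r' = γ) := by
  classical
  obtain ⟨R, hR, hRe⟩ := R_exists f p
  obtain ⟨G, T, hG, hT, htr⟩ := trans1 R hR
  refine ⟨G, T, hG, hT, ?_⟩
  intro K _ _ K' _ _ w w' r r' b hr hr' hiso L L' _ _ _ _ z z' y y' σ σ' hc hc' hq hq' hσ hσ'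
  have := hc.fin
  have := hc'.fin
  let _ : Fintype (L ≃ₐ[(AC K)⟮z⟯] L) := Fintype.ofFinite _
  let _ : Fintype (L' ≃ₐ[(AC K')⟮z'⟯] L') := Fintype.ofFinite _
  obtain ⟨Q, hQ⟩ := isQ_exists (p := p) hc
  obtain ⟨Q2, hQ2⟩ := isQ_exists (p := p) hc'
  have hR1 := hRe (wev w) z y (cov_fac hc)
  have hR2 := hRe (wev w') z' y' (cov_fac hc')
  have pos1 : 0 < card (L ≃ₐ[(AC K)⟮z⟯] L) := Fintype.card_pos
  have pos2 : 0 < card (L' ≃ₐ[(AC K')⟮z'⟯] L') := Fintype.card_pos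
  obtain ⟨hmem, Q', hm', hd', hdvd', hcf⟩ := htr w w' r r' b hiso Q (hQ.monic hc) (hQ.dvd hc hp hR1)
  obtain ⟨_, Q3, hm3, hd3, hdvd3, _⟩ := htr w' w r' r _ hiso.symm Q2 (hQ2.monic hc') (hQ2.dvd hc' hp hR2)
  rw [hQ.natDegree hc] at hd'
  rw [hQ2.natDegree hc'] at hd3
  have l1 := deg_le hc' hp hR2 hm' (by omega) hdvd'
  have l2 := deg_le hc hp hR1 hm3 (by omega) hdvd3
  obtain ⟨s, hs⟩ := l1.2 (by have := l2.1; omega)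
  have hcs := hc'.comp_perm s
  have hinj : ∀ α β, cf α Q = cf β Q ↔ cf α Q' = cf β Q' := by
    intro α β
    rw [hcf, hcf]
    exact ⟨fun h => by rw [h], fun h => hiso.bij.injOn (hmem α) (hmem β) h⟩
  refine ⟨s, fun j => ?_, fun γ => ?_⟩
  · rw [hQ.pat hc j, hs.pat hcs j, eq_comm, eq_Ren, @eq_comm _ _ Q', eq_Ren]
    exact forall₂_congr fun i m => hinj _ _
  · rw [hQ.gam_pow hc hp hq hσ r hr, hs.gam_pow hcs hp hq' hσ' r' hr']
    refine forall₂_congr fun i m => ?_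
    rw [hcf, hcf, ← hiso.frob _ (hmem _)]
    exact ⟨fun h => by rw [h], fun h => hiso.bij.injOn (pow_mem_Rt G w r (hmem _)) (hmem _) h⟩

end
end CDM

namespace CDM

theorem exists_sigma (K : Type) [Field K] [Fintype K] : ∃ σ : AC K →+* AC K, (∀ c, σ c ^ card K = c) ∧
    ∀ u : K, σ (algebraMap K (AC K) u) = algebraMap K (AC K) u := by
  obtain ⟨p, hpK⟩ := CharP.exists K
  obtain ⟨e, hp, hcard⟩ := FiniteField.card K p
  have hpf := Fact.mk hp
  have hch : CharP (AC K) p := charP_of_injective_algebraMap (algebraMap K (AC K)).injective p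
  have hE : ExpChar (AC K) p := ExpChar.prime hp
  refine ⟨(iterateFrobeniusEquiv (AC K) p e).symm.toRingHom, fun c => ?_, fun u => ?_⟩
  · rw [hcard]
    exact (iterateFrobeniusEquiv (AC K) p e).apply_symm_apply c
  · change (iterateFrobeniusEquiv (AC K) p e).symm _ = _
    rw [RingEquiv.symm_apply_eq, iterateFrobeniusEquiv_apply, iterateFrobenius_def, ← hcard, ← map_pow, FiniteField.pow_card]

section
variable {V : Type}

theorem tev_eq_pe {ι K : Type} [Fintype ι] [DecidableEq ι] [Field K] (w : V → K) (x : ι → AC K) (q : MvPolynomial (V ⊕ ι) ℤ) : tev w x q = pe (wev w) x q := by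
  have : tev w x = pe (wev w) x := by
    apply MvPolynomial.ringHom_ext
    · intro n; simp [tev, pe]
    · rintro (v | i) <;> simp [tev, pe, wev]
  rw [this]

theorem wz_eq {k : Type} [Field k] (ω : MvPolynomial V ℤ →+* k) (θ : MvPolynomial (Option V) ℤ) :
    wz ω θ = (optionEquivLeft ℤ V θ).map ω := by
  have : wz ω = (mapRingHom ω).comp (optionEquivLeft ℤ V).toRingEquiv.toRingHom := by
    apply MvPolynomial.ringHom_ext
    · intro n; simp [wz]
    · rintro (_ | v) <;> simp [wz, MvPolynomial.optionEquivLeft_X_none, MvPolynomial.optionEquivLeft_X_some]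
  rw [this]; rfl

theorem wev_oc' {K : Type} [Field K] (w : V → K) (u : K) (θ : MvPolynomial (Option V) ℤ) :
    wev (oc u w) θ = (wz (wev w) θ).eval (algebraMap K (AC K) u) := by
  have : wev (oc u w) = (evalRingHom (algebraMap K (AC K) u)).comp (wz (wev w)) := by
    apply MvPolynomial.ringHom_ext
    · intro n; simp [wz, wev]
    · rintro (_ | v) <;> simp [wz, wev, oc, wb]
  rw [this]; rfl

section
variable {k L ι : Type} [Field k] [Field L] [Algebra k L] [Fintype ι] [DecidableEq ι]

noncomputable def lzO (ω : MvPolynomial V ℤ →+* k) (z : L) (y : ι → L) : MvPolynomial (Option V) ℤ →+* O0 k z y :=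
  eval₂Hom (Int.castRingHom _) (fun v => v.elim ⟨z, z_mem_O0 z y⟩ fun v => algebraMap k _ (ω (MvPolynomial.X v)))

def yO (k : Type) [Field k] [Algebra k L] (z : L) (y : ι → L) (i : ι) : O0 k z y := ⟨y i, y_mem_O0 z y i⟩

theorem val_lzO (ω : MvPolynomial V ℤ →+* k) (z : L) (y : ι → L) : (O0 k z y).val.toRingHom.comp (lzO ω z y) = lz ω z := by
  apply MvPolynomial.ringHom_ext
  · intro n; simp [lzO, lz]
  · rintro (_ | v)
    · simp [lzO, lz]
    · simp [lzO, lz]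

theorem val_pe (ω : MvPolynomial V ℤ →+* k) (z : L) (y : ι → L) (q : MvPolynomial (Option V ⊕ ι) ℤ) :
    ((pe (lzO ω z y) (yO k z y) q : O0 k z y) : L) = pe (lz ω z) y q := by
  have := pe_comp (lzO ω z y) (yO k z y) (O0 k z y).val.toRingHom q
  rw [val_lzO] at this
  exact this

theorem fac_O {f : (MvPolynomial (Option V) ℤ)[X]} {ω : MvPolynomial V ℤ →+* k} {z : L} {y : ι → L} (hc : IsCov (f.map (wz ω)) z y) :
    f.map (lzO ω z y) = ∏ i, (X - C (yO k z y i)) := by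
  apply Polynomial.map_injective (O0 k z y).val.toRingHom Subtype.val_injective
  rw [Polynomial.map_map, val_lzO, cov_fac hc, Polynomial.map_prod]
  refine Finset.prod_congr rfl fun i _ => ?_
  simp [yO]

end

section
variable {L ι K : Type} [Field K] [Field L] [Algebra (AC K) L] [Fintype ι] [DecidableEq ι] {f : (MvPolynomial (Option V) ℤ)[X]} {w : V → K} {z : L} {y : ι → L}
  {z1 : K} {P : O0 (AC K) z y →ₐ[AC K] AC K}

theorem P_lzO (h : rv P z = algebraMap K (AC K) z1) : P.toRingHom.comp (lzO (wev w) z y) = wev (oc z1 w) := by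
  rw [rv_of_mem (z_mem_O0 z y)] at h
  apply MvPolynomial.ringHom_ext
  · intro n; simp [lzO]
  · rintro (_ | v)
    · simp [lzO, wev, oc, wb, h]
    · simp [lzO, wev, oc, wb]

theorem pt_fac (hc : IsCov (f.map (wz (wev w))) z y) (h : rv P z = algebraMap K (AC K) z1) :
    f.map (wev (oc z1 w)) = ∏ i, (X - C (rv P (y i))) := by
  rw [← P_lzO h, ← Polynomial.map_map, fac_O hc, Polynomial.map_prod]
  refine Finset.prod_congr rfl fun i _ => ?_
  rw [rv_of_mem (y_mem_O0 z y i)]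
  simp [yO]

theorem pt_tev (h : rv P z = algebraMap K (AC K) z1) (q : MvPolynomial (Option V ⊕ ι) ℤ) :
    tev (oc z1 w) (fun i => rv P (y i)) q = P (pe (lzO (wev w) z y) (yO (AC K) z y) q) := by
  have := pe_comp (lzO (wev w) z y) (yO (AC K) z y) P.toRingHom q
  rw [P_lzO h] at this
  rw [tev_eq_pe]
  refine Eq.trans ?_ this.symm
  congr 2
  funext i
  exact rv_of_mem _

/-- the bad points in the base -/
def badU (BB : Finset ((MvPolynomial V ℤ)[X])) (w : V → K) (u : K) : Prop :=
  ∃ b ∈ BB, b.map (wev w) ≠ 0 ∧ algebraMap K (AC K) u ∈ Rt b w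

theorem badU_card [Fintype K] (BB : Finset ((MvPolynomial V ℤ)[X])) (w : V → K) :
    Nat.card {u : K // badU BB w u} ≤ ∑ b ∈ BB, b.natDegree := by
  classical
  have hsub : {u : K | badU BB w u} ⊆ ((BB.biUnion fun b => ((b.map (wev w)).roots.toFinset.preimage (algebraMap K (AC K))
      (algebraMap K (AC K)).injective.injOn) : Finset K) : Set K) := by
    rintro u ⟨b, hb, h1, h2⟩
    simp only [Finset.coe_biUnion, Set.mem_iUnion, Finset.coe_preimage, Set.mem_preimage, Finset.mem_coe, Multiset.mem_toFinset]
    refine ⟨b, hb, ?_⟩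
    rw [mem_roots h1, IsRoot.def, eval_map]
    exact h2
  have h1 := Set.ncard_le_ncard hsub (Finset.finite_toSet _)
  rw [Set.ncard_coe_finset] at h1
  refine le_trans h1 (Finset.card_biUnion_le.trans (Finset.sum_le_sum fun b _ => ?_))
  rw [Finset.card_preimage]
  exact (Finset.card_filter_le _ _).trans ((Multiset.toFinset_card_le _).trans ((card_roots' _).trans (natDegree_map_le)))

end

theorem bad_exists {ι J0 : Type} [Fintype ι] [DecidableEq ι] [Fintype J0] (f : (MvPolynomial (Option V) ℤ)[X]) (hf : f.Monic) (p : J0 → MvPolynomial (Option V ⊕ ι) ℤ) :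
    ∃ BB : Finset ((MvPolynomial V ℤ)[X]), ∀ {K L : Type} [Field K] [Field L] [Algebra (AC K) L] {w : V → K} {z : L} {y : ι → L},
      IsCov (f.map (wz (wev w))) z y → ∀ z1, ¬ badU BB w z1 → ∀ P : O0 (AC K) z y →ₐ[AC K] AC K, rv P z = algebraMap K (AC K) z1 →
      ∀ j, tev (oc z1 w) (fun i => rv P (y i)) (p j) = 0 ↔ pe (lz (wev w) z) y (p j) = 0 := by
  classical
  choose Θ hΘ1 hΘ2 using fun j => int_poly f hf (pe (MvPolynomial.C : MvPolynomial (Option V) ℤ →+* MvPolynomial ι _) MvPolynomial.X (p j))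
  refine ⟨Finset.univ.biUnion fun j => (Finset.range ((Θ j).natDegree + 1)).image fun i => optionEquivLeft ℤ V ((Θ j).coeff i), ?_⟩
  intro K L _ _ _ w z y hc z1 hz1 P hP j
  rw [pt_tev hP, ← val_pe]
  constructor
  swap
  · intro h
    rw [ZeroMemClass.coe_eq_zero] at h
    rw [h, map_zero]
  intro h
  by_contra hne
  rw [ZeroMemClass.coe_eq_zero] at hne
  set a := pe (lzO (wev w) z y) (yO (AC K) z y) (p j) with ha
  have hroot : (Θ j).eval₂ (lzO (wev w) z y) a = 0 := by
    have := hΘ2 j (lzO (wev w) z y) (yO (AC K) z y) ?_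
    · convert this using 1
      congr 1
      have := pe_comp (MvPolynomial.C : MvPolynomial (Option V) ℤ →+* MvPolynomial ι _) MvPolynomial.X
        (eval₂Hom (lzO (wev w) z y) (yO (AC K) z y)) (p j)
      rw [coe_eval₂Hom] at this
      rw [this, ha]
      congr 2
      · exact (RingHom.ext fun x => by simp).symm
      · funext i; simp
    · intro i
      rw [← eval_map, fac_O hc, eval_prod]
      exact Finset.prod_eq_zero (Finset.mem_univ i) (by simp)
  have hex : ∃ i, wz (wev w) ((Θ j).coeff i) ≠ 0 := ⟨(Θ j).natDegree, by rw [(hΘ1 j).coeff_natDegree]; simp⟩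
  have hmin := fun i hi => not_not.1 (Nat.find_min hex (m := i) hi)
  have hspec := Nat.find_spec hex
  set i0 := Nat.find hex
  have hzero : ∀ i < i0, lzO (wev w) z y ((Θ j).coeff i) = 0 := by
    intro i hi
    apply Subtype.val_injective
    have e1 := congrArg (fun φ => φ ((Θ j).coeff i)) (val_lzO (wev w) z y)
    have e2 := congrArg (fun φ => φ ((Θ j).coeff i)) (evz_wz (wev w) z)
    simp only [RingHom.comp_apply, hmin i hi, map_zero] at e1 e2
    exact e1.trans e2.symm
  obtain ⟨G, hG⟩ : X ^ i0 ∣ (Θ j).map (lzO (wev w) z y) := by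
    rw [X_pow_dvd_iff]
    intro d hd
    rw [coeff_map, hzero d hd]
  have hG0 : G.coeff 0 = lzO (wev w) z y ((Θ j).coeff i0) := by
    rw [← coeff_map, hG]
    simp [coeff_X_pow_mul']
  rw [← eval_map, hG, eval_mul, eval_pow, eval_X] at hroot
  have hGa : G.eval a = 0 := by
    rcases mul_eq_zero.1 hroot with h | h
    · exact (pow_ne_zero _ hne h).elim
    · exact h
  have hPG := congrArg P.toRingHom hGa
  rw [map_zero, ← eval₂_hom, ← eval_map] at hPG
  have h' : P.toRingHom a = 0 := h
  rw [h', ← coeff_zero_eq_eval_zero, coeff_map, hG0] at hPG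
  have e3 := congrArg (fun φ => φ ((Θ j).coeff i0)) (P_lzO (w := w) hP)
  simp only [RingHom.comp_apply] at e3
  rw [e3, wev_oc'] at hPG
  refine hz1 ⟨optionEquivLeft ℤ V ((Θ j).coeff i0), ?_, ?_, ?_⟩
  · simp only [Finset.mem_biUnion, Finset.mem_image, Finset.mem_univ, true_and, Finset.mem_range]
    refine ⟨j, i0, ?_, rfl⟩
    by_contra hlt
    rw [coeff_eq_zero_of_natDegree_lt (by omega)] at hspec
    exact hspec (map_zero _)
  · rw [← wz_eq]; exact hspec
  · rw [wz_eq, eval_map] at hPG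
    exact hPG

end
end CDM

namespace CDM

section
variable {V : Type}

def Rl {U ι J0 : Type} [Fintype ι] (f : (MvPolynomial U ℤ)[X]) (p : J0 → MvPolynomial (U ⊕ ι) ℤ) (ψ : Fam U) (C0 M : ℕ)
    (β : J0 → Prop) (γ : Equiv.Perm ι) : Prop :=
  ∃ (K1 : Type) (_ : Field K1) (_ : Fintype K1) (w1 : U → K1) (r1 : ℕ) (η1 : ι → AC K1), C0 ≤ card K1 ∧ r1.Coprime M ∧
    f.map (wev w1) = ∏ i, (X - C (η1 i)) ∧ (∀ i, η1 i ^ card K1 ^ r1 = η1 (γ i)) ∧ (∀ j, tev w1 η1 (p j) = 0 ↔ β j) ∧ ψ K1 w1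

theorem Rl_iff {U ι J0 : Type} [Fintype ι] {f : (MvPolynomial U ℤ)[X]} {p : J0 → MvPolynomial (U ⊕ ι) ℤ} {ψ : Fam U} {C0 M : ℕ}
    (hE : EnumD C0 M f p ψ) {β : J0 → Prop} {γ : Equiv.Perm ι} {K : Type} [Field K] [Fintype K] (w : U → K) (r : ℕ) (η : ι → AC K)
    (h1 : C0 ≤ card K) (h2 : r.Coprime M) (h3 : f.map (wev w) = ∏ i, (X - C (η i))) (h4 : ∀ i, η i ^ card K ^ r = η (γ i))
    (h5 : ∀ j, tev w η (p j) = 0 ↔ β j) : ψ K w ↔ Rl f p ψ C0 M β γ := by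
  constructor
  · intro h
    exact ⟨K, _, _, w, r, η, h1, h2, h3, h4, h5, h⟩
  · rintro ⟨K1, _, _, w1, r1, η1, g1, g2, g3, g4, g5, g⟩
    exact (hE w w1 r r1 η η1 γ h1 g1 h2 g2 h3 g3 h4 g4 fun j => (h5 j).trans (g5 j).symm).2 g

noncomputable def mu {ι : Type} (S : Set (Equiv.Perm ι)) (R : Equiv.Perm ι → Prop) : ℚ :=
  (Nat.card {γ // γ ∈ S ∧ R γ} : ℚ) / Nat.card {γ // γ ∈ S}

def Est (C : ℕ) (BB : Finset ((MvPolynomial V ℤ)[X])) (ψ : Fam (Option V)) (K : Type) [Field K] [Fintype K] (w : V → K) (m : ℚ) : Prop :=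
  |(Nat.card {u : K // ψ K (oc u w)} : ℝ) - m * card K| ≤ C * √(card K) ∧ (m = 0 → ∀ u, ψ K (oc u w) → badU BB w u)

theorem est1 {ι J0 : Type} [Fintype ι] [DecidableEq ι] [Fintype J0] (f : (MvPolynomial (Option V) ℤ)[X]) (hf : f.Monic)
    (p : J0 → MvPolynomial (Option V ⊕ ι) ℤ) (hp : ∀ i i', ∃ j, p j = MvPolynomial.X (Sum.inr i) - MvPolynomial.X (Sum.inr i'))
    (C0 M : ℕ) (ψ : Fam (Option V)) (hE : EnumD C0 M f p ψ) : ∃ (C : ℕ) (BB : Finset ((MvPolynomial V ℤ)[X])),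
    ∀ {K : Type} [Field K] [Fintype K] (w : V → K) (r : ℕ), C ≤ card K → r.Coprime M → r.Coprime (card (Equiv.Perm ι)) →
    ∀ {L : Type} [Field L] [Algebra (AC K) L] {z : L} {y : ι → L} {σ : AC K →+* AC K}, IsCov (f.map (wz (wev w))) z y →
    (∀ c, σ c ^ card K = c) → (∀ v, σ (wev w (MvPolynomial.X v)) = wev w (MvPolynomial.X v)) →
    Est C BB ψ K w (mu {γ | ∃ g ∈ Gam σ z y, g ^ r = γ} (Rl f p ψ C0 M fun j => pe (lz (wev w) z) y (p j) = 0)) := by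
  classical
  obtain ⟨BB, hBB⟩ := bad_exists f hf p
  obtain ⟨κ1, hκ1⟩ : ∃ κ1, κ1 = ∑ b ∈ BB, b.natDegree := ⟨_, rfl⟩
  obtain ⟨κ2, hκ2⟩ : ∃ κ2, ∀ j, (optionEquivLeft ℤ V (f.coeff j)).natDegree ≤ κ2 := by
    refine ⟨(Finset.range (f.natDegree + 1)).sup fun j => (optionEquivLeft ℤ V (f.coeff j)).natDegree, fun j => ?_⟩
    by_cases h : j < f.natDegree + 1
    · exact Finset.le_sup (f := fun j => (optionEquivLeft ℤ V (f.coeff j)).natDegree) (Finset.mem_range.2 h)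
    · rw [coeff_eq_zero_of_natDegree_lt (by omega)]; simp
  obtain ⟨C1, hC1⟩ := cheb (card ι) (κ1 + κ2)
  refine ⟨C0 + C1 + κ1, BB, ?_⟩
  intro K _ _ w r hCq hrM hrP L _ _ z y σ hc hq hσ
  have hbadc : (Finset.univ.filter fun u : K => badU BB w u).card ≤ κ1 := by
    have := badU_card BB w
    rwa [Nat.card_eq_fintype_card, Fintype.card_subtype, ← hκ1] at this
  have hη : ∀ (P : O0 (AC K) z y →ₐ[AC K] AC K) (g : Equiv.Perm ι), (∀ i, rv P (y i) ^ card K = rv P (y (g i))) →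
      ∀ (r : ℕ) i, rv P (y i) ^ card K ^ r = rv P (y ((g ^ r) i)) := by
    intro P g hg r
    induction r with
    | zero => intro i; simp
    | succ n ih => intro i; rw [pow_succ, pow_mul, ih, hg, pow_succ', Equiv.Perm.mul_apply]
  have key := hC1 (σ := σ) rfl hc (fun j => ?_) hq ?_ (Finset.univ.filter fun u : K => badU BB w u) (by omega) ?_ (by omega)
    (fun u => ψ K (oc u w)) (fun g => Rl f p ψ C0 M (fun j => pe (lz (wev w) z) y (p j) = 0) (g ^ r)) ?_
  rotate_left
  · rw [coeff_map, wz_eq]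
    exact natDegree_map_le.trans ((hκ2 j).trans (by omega))
  · rw [Polynomial.map_map, wz_fix hσ]
  · intro z1 hz1 P hP i i' hne heq
    obtain ⟨j, hj⟩ := hp i i'
    have := (hBB hc z1 (by simpa using hz1) P hP j).1 (by rw [hj, tev_eq_pe, map_sub, pe_inr, pe_inr, heq, sub_self])
    rw [hj, map_sub, pe_inr, pe_inr, sub_eq_zero] at this
    exact hne this
  · intro z1 hz1 P hP g hg hfr
    exact Rl_iff hE (oc z1 w) r (fun i => rv P (y i)) (by omega) hrM (pt_fac hc hP) (hη P g hfr r) (hBB hc z1 (by simpa using hz1) P hP)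
  obtain ⟨k1, k2, k3⟩ := key
  have hpinj : Function.Injective fun g : Equiv.Perm ι => g ^ r := by
    have : (Nat.card (Equiv.Perm ι)).Coprime r := by rw [Nat.card_eq_fintype_card]; exact hrP.symm
    exact (powCoprime this).injective
  set R := Rl f p ψ C0 M (fun j => pe (lz (wev w) z) y (p j) = 0) with hR
  have e1 : Nat.card {g // g ∈ Gam σ z y} = Nat.card {γ // γ ∈ {γ | ∃ g ∈ Gam σ z y, g ^ r = γ}} := by
    refine Nat.card_congr (Equiv.ofBijective (fun g => ⟨g.1 ^ r, g.1, g.2, rfl⟩) ⟨?_, ?_⟩)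
    · intro a b h; exact Subtype.ext (hpinj (congrArg Subtype.val h))
    · rintro ⟨_, g, hg, rfl⟩; exact ⟨⟨g, hg⟩, rfl⟩
  have e2 : Nat.card {g // g ∈ Gam σ z y ∧ R (g ^ r)} = Nat.card {γ // γ ∈ {γ | ∃ g ∈ Gam σ z y, g ^ r = γ} ∧ R γ} := by
    refine Nat.card_congr (Equiv.ofBijective (fun g => ⟨g.1 ^ r, ⟨g.1, g.2.1, rfl⟩, g.2.2⟩) ⟨?_, ?_⟩)
    · intro a b h; exact Subtype.ext (hpinj (congrArg Subtype.val h))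
    · rintro ⟨_, ⟨g, hg, rfl⟩, h⟩; exact ⟨⟨g, hg, h⟩, rfl⟩
  have hmu : mu {γ | ∃ g ∈ Gam σ z y, g ^ r = γ} R = (Nat.card {g // g ∈ Gam σ z y ∧ R (g ^ r)} : ℚ) / Nat.card {g // g ∈ Gam σ z y} := by
    rw [mu, e1, e2]
  rw [hmu]
  obtain ⟨a, ha⟩ : ∃ a, a = Nat.card {g // g ∈ Gam σ z y ∧ R (g ^ r)} := ⟨_, rfl⟩
  obtain ⟨b, hb⟩ : ∃ b, b = Nat.card {g // g ∈ Gam σ z y} := ⟨_, rfl⟩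
  rw [← ha, ← hb]
  rw [← ha, ← hb] at k3
  rw [← hb] at k2
  have hb1 : (1 : ℝ) ≤ b := by exact_mod_cast k2
  have hsq : (1 : ℝ) ≤ √(card K) := by
    rw [Real.one_le_sqrt]; exact_mod_cast Fintype.card_pos
  refine ⟨?_, ?_⟩
  · obtain ⟨N, hN⟩ : ∃ N, N = Nat.card {u : K // ψ K (oc u w)} := ⟨_, rfl⟩
    obtain ⟨N', hN'⟩ : ∃ N', N' = Nat.card {z1 : K // z1 ∉ (Finset.univ.filter fun u : K => badU BB w u) ∧ ψ K (oc z1 w)} := ⟨_, rfl⟩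
    rw [← hN'] at k3
    rw [← hN]
    have l1 : N' ≤ N := by
      rw [hN, hN']
      exact Nat.card_le_card_of_injective (fun u => (⟨u.1, u.2.2⟩ : {u : K // ψ K (oc u w)})) fun a b h => Subtype.ext (by simpa using h)
    have l2 : N ≤ N' + κ1 := by
      rw [hN, hN', Nat.card_eq_fintype_card, Nat.card_eq_fintype_card, Fintype.card_subtype, Fintype.card_subtype]
      refine le_trans (Finset.card_le_card ?_) ((Finset.card_union_le _ _).trans (Nat.add_le_add_left hbadc _))
      intro u hu
      simp only [Finset.mem_filter, Finset.mem_univ, true_and, Finset.mem_union] at hu ⊢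
      tauto
    have l1' : (N' : ℝ) ≤ N := by exact_mod_cast l1
    have l2' : (N : ℝ) ≤ N' + κ1 := by exact_mod_cast l2
    have k4 : |(N' : ℝ) - a / b * card K| ≤ C1 * √(card K) := by
      have : (N' : ℝ) - a / b * card K = (b * N' - a * card K) / b := by field_simp
      rw [this, abs_div, abs_of_pos (by linarith : (0 : ℝ) < b)]
      exact (div_le_self (abs_nonneg _) hb1).trans k3
    push_cast
    rw [abs_le] at k4 ⊢
    have hk : (κ1 : ℝ) ≤ κ1 * √(card K) := le_mul_of_one_le_right (by positivity) hsq
    have hk0 : (0 : ℝ) ≤ C0 * √(card K) := by positivity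
    have hk1 : (0 : ℝ) ≤ κ1 := by positivity
    constructor <;> nlinarith [k4.1, k4.2]
  · intro h0 u hu
    by_contra hnb
    obtain ⟨g, hg, hgt⟩ := k1 u (by simpa using hnb)
    have : 0 < a := by
      rw [ha, Nat.card_pos_iff]
      exact ⟨⟨⟨g, hg, hgt.1 hu⟩⟩, inferInstance⟩
    have h1 : (0 : ℚ) < a / b := by positivity
    exact h1.ne' h0

def HasCov {ι : Type} [Fintype ι] (f : (MvPolynomial (Option V) ℤ)[X]) {K : Type} [Field K] (w : V → K) : Prop :=
  ∃ (L : Type) (_ : Field L) (_ : Algebra (AC K) L) (z : L) (y : ι → L), IsCov (f.map (wz (wev w))) z y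

theorem core0 {ι J0 : Type} [Fintype ι] [DecidableEq ι] [Fintype J0] (f : (MvPolynomial (Option V) ℤ)[X]) (hf : f.Monic)
    (p : J0 → MvPolynomial (Option V ⊕ ι) ℤ) (hp0 : ∀ i, ∃ j, p j = MvPolynomial.X (Sum.inr i))
    (hp : ∀ i i', ∃ j, p j = MvPolynomial.X (Sum.inr i) - MvPolynomial.X (Sum.inr i'))
    (C0 M : ℕ) (hM : M ≠ 0) (ψ : Fam (Option V)) (hE : EnumD C0 M f p ψ) :
    ∃ (C M' : ℕ) (BB : Finset ((MvPolynomial V ℤ)[X])) (Mu : Finset ℚ) (G : (MvPolynomial V ℤ)[X]) (T : Set (MvPolynomial (V ⊕ ℕ) ℤ)),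
    M' ≠ 0 ∧ G.Monic ∧ T.Finite ∧ (∀ m ∈ Mu, 0 ≤ m) ∧ ∀ {K : Type} [Field K] [Fintype K] {K' : Type} [Field K'] [Fintype K'] (w : V → K) (w' : V → K') (r r' : ℕ)
    (b : AC K → AC K'), C ≤ card K → C ≤ card K' → r.Coprime M' → r'.Coprime M' → HasCov (ι := ι) f w → HasCov (ι := ι) f w' →
    IsoW G T w r w' r' b → ∃ m ∈ Mu, Est C BB ψ K w m ∧ Est C BB ψ K' w' m := by
  classical
  obtain ⟨C, BB, hest⟩ := est1 f hf p hp C0 M ψ hE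
  obtain ⟨G, T, hG, hT, htr⟩ := transfer f p hp0
  refine ⟨C, M * card (Equiv.Perm ι), BB, Finset.image₂ (fun a b : ℕ => (a : ℚ) / b) (Finset.range (card (Equiv.Perm ι) + 1)) (Finset.range (card (Equiv.Perm ι) + 1)),
    G, T, mul_ne_zero hM Fintype.card_ne_zero, hG, hT, ?_, ?_⟩
  · intro m hm
    obtain ⟨a, _, b, _, rfl⟩ := Finset.mem_image₂.1 hm
    positivity
  intro K _ _ K' _ _ w w' r r' b c1 c2 c3 c4 hcov hcov' hiso
  obtain ⟨L, _, _, z, y, hc⟩ := hcov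
  obtain ⟨L', _, _, z', y', hc'⟩ := hcov'
  obtain ⟨σ, hq, hσ⟩ := exists_sigma K
  obtain ⟨σ', hq', hσ'⟩ := exists_sigma K'
  have hσ1 : ∀ v, σ (wev w (MvPolynomial.X v)) = wev w (MvPolynomial.X v) := fun v => by simpa [wev, wb] using hσ (w v)
  have hσ1' : ∀ v, σ' (wev w' (MvPolynomial.X v)) = wev w' (MvPolynomial.X v) := fun v => by simpa [wev, wb] using hσ' (w' v)
  have r1 := Nat.Coprime.coprime_mul_right_right c3
  have r2 := Nat.Coprime.coprime_mul_left_right c3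
  have r1' := Nat.Coprime.coprime_mul_right_right c4
  have r2' := Nat.Coprime.coprime_mul_left_right c4
  obtain ⟨s, hs1, hs2⟩ := htr w w' r r' b r2 r2' hiso hc hc' hq hq' hσ1 hσ1'
  have E1 := hest w r c1 r1 r2 hc hq hσ1
  have E2 := hest w' r' c2 r1' r2' (hc'.comp_perm s) hq' hσ1'
  have hS : {γ | ∃ g ∈ Gam σ' z' (fun i => y' (s i)), g ^ r' = γ} = {γ | ∃ g ∈ Gam σ z y, g ^ r = γ} := by
    ext γ; exact (hs2 γ).symm
  have hβ : (fun j => pe (lz (wev w') z') (fun i => y' (s i)) (p j) = 0) = (fun j => pe (lz (wev w) z) y (p j) = 0) := by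
    funext j; exact propext (hs1 j).symm
  rw [hS, hβ] at E2
  refine ⟨_, ?_, E1, E2⟩
  rw [mu]
  have hle : ∀ q : Equiv.Perm ι → Prop, Nat.card {γ // q γ} < card (Equiv.Perm ι) + 1 := fun q => by
    rw [Nat.card_eq_fintype_card]
    exact Nat.lt_succ_of_le (Fintype.card_subtype_le _)
  exact Finset.mem_image₂.2 ⟨_, Finset.mem_range.2 (hle _), _, Finset.mem_range.2 (hle _), rfl⟩

end
end CDM

namespace CDM

theorem enum_roots {F ι : Type} [Field F] [Fintype ι] (P : F[X]) (h1 : P.Monic) (h2 : P.Splits) (h3 : P.natDegree = card ι) :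
    ∃ y : ι → F, P = ∏ i, (X - C (y i)) := by
  have hc : P.roots.toList.length = card ι := by rw [Multiset.length_toList, ← h2.natDegree_eq_card_roots, h3]
  let e : ι ≃ Fin P.roots.toList.length := (Fintype.equivFin ι).trans (finCongr hc.symm)
  refine ⟨fun i => P.roots.toList.get (e i), ?_⟩
  rw [Fintype.prod_equiv e _ (fun i => X - C (P.roots.toList.get i)) (fun i => rfl)]
  conv_lhs => rw [h2.eq_prod_roots_of_monic h1]
  rw [← List.prod_ofFn, ← Multiset.prod_coe]
  congr 1
  conv_lhs => rw [← Multiset.coe_toList P.roots]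
  rw [Multiset.map_coe]
  congr 1
  conv_lhs => rw [← List.ofFn_get P.roots.toList]
  rw [List.map_ofFn]
  rfl

theorem sep_pow {F Ω : Type} [Field F] [Field Ω] [Algebra F Ω] {p : ℕ} [hp : Fact p.Prime] [CharP F p] {c : Ω} {h : F[X]} (hm : h.Monic)
    (hc : aeval c h = 0) {a : ℕ} (hD : h.natDegree < p ^ (a + 1)) : IsSeparable F (c ^ p ^ a) := by
  have hintg : IsIntegral F c := ⟨h, hm, hc⟩
  obtain ⟨n, g, hg, he⟩ := exists_separable_of_irreducible p (minpoly.irreducible hintg) hp.out.ne_zero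
  have hpos := minpoly.natDegree_pos hintg
  have hle : (minpoly F c).natDegree ≤ h.natDegree := natDegree_le_of_dvd (minpoly.dvd F c hc) hm.ne_zero
  rw [← he, natDegree_expand] at hpos hle
  have hn : n < a + 1 := by
    apply (Nat.pow_lt_pow_iff_right hp.out.one_lt).1
    refine lt_of_le_of_lt ?_ (lt_of_le_of_lt hle hD)
    exact Nat.le_mul_of_pos_left _ (Nat.pos_of_mul_pos_right hpos)
  have h0 : aeval (c ^ p ^ n) g = 0 := by
    have := minpoly.aeval F c
    rwa [← he, expand_aeval] at this
  have h1 : IsSeparable F (c ^ p ^ n) := hg.of_dvd (minpoly.dvd F _ h0)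
  have h2 : c ^ p ^ n ∈ separableClosure F Ω := h1
  have h3 := pow_mem h2 (p ^ (a - n))
  rw [← pow_mul, ← pow_add] at h3
  have : n + (a - n) = a := by omega
  rw [this] at h3
  exact h3

theorem cov_exists {k ι : Type} [Field k] [IsAlgClosed k] [Fintype ι] (p : ℕ) [hp : Fact p.Prime] [CharP k p] (f : k[X][X]) (hf : f.Monic)
    (hd : f.natDegree = card ι) (a : ℕ) (ha : card ι < p ^ (a + 1)) :
    ∃ (L : Type) (_ : Field L) (_ : Algebra k L) (z : L) (y : ι → L), IsCov (f.map (expand k (p ^ a)).toRingHom) z y := by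
  set fE := f.map (expand k (p ^ a)).toRingHom with hfE
  have hfEm : fE.Monic := hf.map _
  set g := fE.map (algebraMap k[X] (RatFunc k)) with hg
  let L := SplittingField g
  let z : L := algebraMap (RatFunc k) L RatFunc.X
  have hev : (evz k z) = (algebraMap (RatFunc k) L).comp (algebraMap k[X] (RatFunc k)) := by
    apply ringHom_ext
    · intro c
      simp only [evz, RingHom.comp_apply]
      simp [IsScalarTower.algebraMap_apply k (RatFunc k) L]
    · simp [evz, z]
  have hz : Transcendental k z := by
    rw [transcendental_iff_injective]
    have : ((aeval z : k[X] →ₐ[k] L) : k[X] → L) = (algebraMap (RatFunc k) L) ∘ (algebraMap k[X] (RatFunc k)) := by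
      funext q
      exact congrArg (fun φ => φ q) hev
    rw [this]
    exact (algebraMap (RatFunc k) L).injective.comp (RatFunc.algebraMap_injective k)
  obtain ⟨y, hy⟩ := enum_roots (ι := ι) (g.map (algebraMap (RatFunc k) L)) ((hfEm.map _).map _) (SplittingField.splits g) (by
    rw [natDegree_map, hfEm.natDegree_map, hf.natDegree_map, hd])
  have hfac : fE.map (evz k z) = ∏ i, (X - C (y i)) := by rw [hev, ← Polynomial.map_map, ← hg, hy]
  refine ⟨L, inferInstance, inferInstance, z, y, hz, hfac, ?_, ?_⟩
  · rw [eq_top_iff]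
    have h1 : ∀ q : k[X], algebraMap (RatFunc k) L (algebraMap k[X] (RatFunc k) q) ∈ adjoin k (insert z (Set.range y)) := by
      intro q
      have : algebraMap (RatFunc k) L (algebraMap k[X] (RatFunc k) q) = aeval z q := (congrArg (fun φ => φ q) hev).symm
      rw [this]
      exact (algebra_adjoin_le_adjoin k _) (aeval_mem_adjoin_singleton k z |> fun h => Algebra.adjoin_mono (by simp) h)
    intro x _
    have hx : x ∈ Algebra.adjoin (RatFunc k) (g.rootSet L) := by rw [SplittingField.adjoin_rootSet]; trivial
    induction hx using Algebra.adjoin_induction with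
    | mem x hx =>
      rw [mem_rootSet'] at hx
      have h2 := hx.2
      rw [aeval_def, ← eval_map, hy, eval_prod, Finset.prod_eq_zero_iff] at h2
      obtain ⟨i, _, hi⟩ := h2
      rw [eval_sub, eval_X, eval_C, sub_eq_zero] at hi
      rw [hi]
      exact subset_adjoin _ _ (Set.mem_insert_of_mem _ ⟨i, rfl⟩)
    | algebraMap c =>
      rw [← RatFunc.num_div_denom c, map_div₀]
      exact div_mem (h1 _) (h1 _)
    | add x y _ _ hx hy => exact add_mem (hx trivial) (hy trivial)
    | mul x y _ _ hx hy => exact mul_mem (hx trivial) (hy trivial)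
  · intro i
    let Ω := AlgebraicClosure L
    let F := k⟮z⟯
    have hchF : CharP F p := charP_of_injective_algebraMap (algebraMap k F).injective p
    have hchΩ : CharP Ω p := charP_of_injective_algebraMap (algebraMap k Ω).injective p
    have hEk : ExpChar k p := ExpChar.prime hp.out
    have hEΩ : ExpChar Ω p := ExpChar.prime hp.out
    have hEΩ : ExpChar F p := ExpChar.prime hp.out
    obtain ⟨c, hc⟩ := IsAlgClosed.exists_pow_nat_eq (algebraMap L Ω (y i)) (pow_pos hp.out.pos a)
    let φ := (iterateFrobeniusEquiv k p a).symm.toRingHom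
    have hexp : ∀ q : k[X], expand k (p ^ a) q = (q.map φ) ^ p ^ a := by
      intro q
      rw [← map_iterateFrobenius_expand, map_expand, Polynomial.map_map]
      have : (iterateFrobenius k p a).comp φ = RingHom.id k := by
        ext x; exact (iterateFrobeniusEquiv k p a).apply_symm_apply x
      rw [this, Polynomial.map_id]
    let zF : F := ⟨z, mem_adjoin_simple_self k z⟩
    let eF : k[X] →+* F := (aeval zF : k[X] →ₐ[k] F).toRingHom
    have heF : (algebraMap F L).comp eF = evz k z := by
      apply ringHom_ext
      · intro x; simp [eF, evz]
      · simp [eF, evz, zF]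
    let h : F[X] := (f.map (mapRingHom φ)).map eF
    have hhm : h.Monic := (hf.map _).map _
    have hhd : h.natDegree < p ^ (a + 1) := by
      rw [(hf.map _).natDegree_map, hf.natDegree_map, hd]; exact ha
    have hroot : aeval c h = 0 := by
      have e1 : aeval (y i) (fE.map eF) = 0 := by
        rw [aeval_def, eval₂_map, heF, ← eval_map, hfac, eval_prod]
        exact Finset.prod_eq_zero (Finset.mem_univ i) (by simp)
      have e2 : aeval (algebraMap L Ω (y i)) (fE.map eF) = 0 := by
        rw [aeval_algebraMap_apply, e1, map_zero]
      rw [← hc] at e2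
      have e3 : (fE.map eF) = h.map (iterateFrobenius F p a) := by
        rw [hfE, Polynomial.map_map, Polynomial.map_map, Polynomial.map_map]
        congr 1
        apply RingHom.ext
        intro q
        simp only [RingHom.comp_apply, AlgHom.toRingHom_eq_coe, RingHom.coe_coe, hexp, iterateFrobenius_def, map_pow]
        rfl
      rw [e3, ← expand_aeval] at e2
      have e4 := map_iterateFrobenius_expand p h a
      rw [← map_expand, e4, map_pow] at e2
      exact pow_eq_zero_iff (pow_pos hp.out.pos a).ne' |>.1 e2
    have hs := sep_pow hhm hroot hhd
    rw [hc] at hs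
    exact IsSeparable.tower_bot hs

end CDM

namespace CDM

section
variable {V : Type}

/-- substitution of a power for the distinguished variable -/
def powE {K : Type} [Field K] (E : ℕ) (w : Option V → K) : Option V → K := fun o => o.elim (w none ^ E) fun v => w (some v)

theorem powE_oc {K : Type} [Field K] (E : ℕ) (u : K) (w : V → K) : powE E (oc u w) = oc (u ^ E) w := by
  funext o; cases o <;> rfl

def psE (ψ : Fam (Option V)) (E : ℕ) : Fam (Option V) := fun K _ _ w => ψ K (powE E w)

noncomputable def subE (E : ℕ) : MvPolynomial (Option V) ℤ →+* MvPolynomial (Option V) ℤ :=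
  (MvPolynomial.aeval fun o : Option V => o.elim (MvPolynomial.X none ^ E) fun v => MvPolynomial.X (some v)).toRingHom

noncomputable def subT (E : ℕ) (ι : Type) : MvPolynomial (Option V ⊕ ι) ℤ →+* MvPolynomial (Option V ⊕ ι) ℤ :=
  (MvPolynomial.aeval (Sum.elim (fun o : Option V => o.elim (MvPolynomial.X (Sum.inl none) ^ E) fun v => MvPolynomial.X (Sum.inl (some v)))
    fun i => MvPolynomial.X (Sum.inr i))).toRingHom

theorem wev_powE {K : Type} [Field K] (E : ℕ) (w : Option V → K) : (wev w).comp (subE E) = wev (powE E w) := by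
  apply MvPolynomial.ringHom_ext
  · intro n; simp [subE]
  · rintro (_ | v) <;> simp [subE, wev, wb, powE]

theorem tev_powE {K ι : Type} [Field K] (E : ℕ) (w : Option V → K) (x : ι → AC K) (q : MvPolynomial (Option V ⊕ ι) ℤ) :
    tev w x (subT E ι q) = tev (powE E w) x q := by
  rw [← RingHom.comp_apply]
  congr 1
  apply MvPolynomial.ringHom_ext
  · intro n; simp [subT]
  · rintro ((_ | v) | i) <;> simp [subT, tev, wb, powE]

theorem wz_subE {k : Type} [Field k] (E : ℕ) (ω : MvPolynomial V ℤ →+* k) : (wz ω).comp (subE E) = (expand k E).toRingHom.comp (wz ω) := by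
  apply MvPolynomial.ringHom_ext
  · intro n; simp [subE]
  · rintro (_ | v) <;> simp [subE, wz]

theorem EnumD.powE {ι J0 : Type} [Fintype ι] {C0 M : ℕ} {f : (MvPolynomial (Option V) ℤ)[X]} {p : J0 → MvPolynomial (Option V ⊕ ι) ℤ} {ψ : Fam (Option V)}
    (h : EnumD C0 M f p ψ) (E : ℕ) : EnumD C0 M (f.map (subE E)) (fun j => subT E ι (p j)) (psE ψ E) := by
  intro K _ _ K' _ _ w w' r r' η η' g c1 c2 c3 c4 e1 e2 f1 f2 ht
  rw [Polynomial.map_map, wev_powE] at e1 e2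
  simp only [tev_powE] at ht
  exact h _ _ r r' η η' g c1 c2 c3 c4 e1 e2 f1 f2 ht

theorem hasCov_E {ι : Type} [Fintype ι] (f : (MvPolynomial (Option V) ℤ)[X]) (hf : f.Monic) (hd : f.natDegree = card ι) {K : Type} [Field K]
    (w : V → K) (p a : ℕ) (hp : p.Prime) (hK : CharP K p) (ha : card ι < p ^ (a + 1)) : HasCov (ι := ι) (f.map (subE (p ^ a))) w := by
  have := Fact.mk hp
  have : CharP (AC K) p := charP_of_injective_algebraMap (algebraMap K (AC K)).injective p
  have h := cov_exists (ι := ι) p (f.map (wz (wev w))) (hf.map _) (by rw [hf.natDegree_map, hd]) a ha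
  rwa [Polynomial.map_map, ← wz_subE, ← Polynomial.map_map] at h

theorem Nice.mk' {χ φ : Fam V} (hχ : Nice χ) (C M : ℕ) (G : (MvPolynomial V ℤ)[X]) (T : Set (MvPolynomial (V ⊕ ℕ) ℤ)) (hM : M ≠ 0) (hG : G.Monic)
    (hT : T.Finite) (h : ∀ {K : Type} [Field K] [Fintype K] {K' : Type} [Field K'] [Fintype K'] (w : V → K) (w' : V → K') (r r' : ℕ)
    (b : AC K → AC K'), C ≤ card K → C ≤ card K' → r.Coprime M → r'.Coprime M →
    IsoW G T w r w' r' b → χ K w → χ K' w' → φ K w → φ K' w') : Nice (fun K _ _ w => χ K w ∧ φ K w) := by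
  obtain ⟨C1, M1, f1, T1, h1, h2, h3, h4⟩ := hχ
  refine ⟨C + C1, M * M1, G * f1, insert (rootTest G) (insert (rootTest f1) (T ∪ T1)), mul_ne_zero hM h1, hG.mul h2, ((hT.union h3).insert _).insert _,
    NiceD.of_imp (ψ := fun K _ _ w => χ K w ∧ φ K w) fun {K} _ _ {K'} _ _ w w' r r' β c1 c2 c3 c4 hiso hh => ?_⟩
  have i1 : IsoW G T w r w' r' β := hiso.sub (Dvd.intro _ rfl) (by simp) (fun x hx => by simp [hx])
  have i2 : IsoW f1 T1 w r w' r' β := hiso.sub (Dvd.intro_left _ rfl) (by simp) (fun x hx => by simp [hx])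
  have hχ' := (h4 w w' r r' β (by omega) (by omega) c3.coprime_mul_left_right c4.coprime_mul_left_right i2).1 hh.1
  exact ⟨hχ', h w w' r r' β (by omega) (by omega) c3.coprime_mul_right_right c4.coprime_mul_right_right i1 hh.1 hχ' hh.2⟩

theorem gap (Mu : Finset ℚ) (C : ℕ) : ∃ Q : ℕ, ∀ (q : ℕ) (N : ℝ), Q ≤ q → ∀ m ∈ Mu, ∀ m' ∈ Mu, |N - m * q| ≤ C * √q → |N - m' * q| ≤ C * √q → m = m' := by
  have h1 : ∀ a : ℚ × ℚ, ∃ Q : ℕ, ∀ q : ℕ, Q ≤ q → ∀ N : ℝ, |N - a.1 * q| ≤ C * √q → |N - a.2 * q| ≤ C * √q → a.1 = a.2 := by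
    rintro ⟨m, m'⟩
    by_cases hm : m = m'
    · exact ⟨0, fun q _ N _ _ => hm⟩
    have hδ : (0 : ℝ) < |(m : ℝ) - m'| := by
      rw [abs_pos, sub_ne_zero]; exact_mod_cast hm
    obtain ⟨Q, hQ⟩ := exists_nat_gt ((2 * C / |(m : ℝ) - m'|) ^ 2)
    refine ⟨Q + 1, fun q hq N ha hb => ?_⟩
    exfalso
    have hq' : (Q : ℝ) < q := by exact_mod_cast hq
    have hs : 2 * C / |(m : ℝ) - m'| < √q := Real.lt_sqrt_of_sq_lt (hQ.trans hq')
    have hs0 : 0 < √(q : ℝ) := lt_of_le_of_lt (by positivity) hs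
    rw [div_lt_iff₀ hδ] at hs
    have h3 : |((m : ℝ) - m') * q| ≤ 2 * C * √q := by
      have : ((m : ℝ) - m') * q = (N - m' * q) - (N - m * q) := by ring
      rw [this]
      refine (abs_sub _ _).trans ?_
      simp only at ha hb
      linarith
    rw [abs_mul, abs_of_nonneg (by positivity : (0 : ℝ) ≤ q)] at h3
    have h4 : √(q : ℝ) * √q = q := Real.mul_self_sqrt (by positivity)
    nlinarith [mul_lt_mul_of_pos_right hs hs0]
  choose Q hQ using h1
  refine ⟨∑ a ∈ Mu ×ˢ Mu, Q a, fun q N hq m hm m' hm' ha hb => hQ (m, m') q (le_trans ?_ hq) N ha hb⟩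
  exact Finset.single_le_sum (f := Q) (fun _ _ => Nat.zero_le _) (Finset.mem_product.2 ⟨hm, hm'⟩)

theorem Est.mono {C C' : ℕ} (h : C ≤ C') {BB : Finset ((MvPolynomial V ℤ)[X])} {ψ : Fam (Option V)} {K : Type} [Field K] [Fintype K] {w : V → K} {m : ℚ}
    (hE : Est C BB ψ K w m) : Est C' BB ψ K w m :=
  ⟨hE.1.trans (by gcongr), hE.2⟩

/-- classes of characteristics -/
def Cls (D : ℕ) (c : Option (Fin (D + 1))) : Fam V := fun K _ _ _ =>
  match c with
  | none => ∀ p : Fin (D + 1), (p : ℕ).Prime → ((p : ℕ) : K) ≠ 0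
  | some p => (p : ℕ).Prime ∧ ((p : ℕ) : K) = 0

def clE (D : ℕ) : Option (Fin (D + 1)) → ℕ
  | none => 1
  | some p => (p : ℕ) ^ D

theorem Nice.char (p : ℕ) : Nice (V := V) (fun K _ _ _ => (p : K) = 0) := by
  have := Nice.atom (V := V) (MvPolynomial.C (p : ℤ))
  simpa using this

theorem Nice.prop (P : Prop) : Nice (V := V) (fun _ _ _ _ => P) := by
  by_cases h : P
  · simpa [h] using Nice.true
  · simpa [h] using Nice.false

theorem cls_nice (D : ℕ) (c : Option (Fin (D + 1))) : Nice (Cls (V := V) D c) := by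
  cases c with
  | none =>
    exact Nice.forall fun p => (Nice.prop _).imp (Nice.char (p : ℕ)).not
  | some p => exact (Nice.prop _).and (Nice.char (p : ℕ))

theorem cls_cover (D : ℕ) {K : Type} [Field K] [Fintype K] (w : V → K) : ∃ c, Cls D c K w := by
  by_cases h : ∃ p : Fin (D + 1), (p : ℕ).Prime ∧ ((p : ℕ) : K) = 0
  · obtain ⟨p, hp⟩ := h
    exact ⟨some p, hp⟩
  · push Not at h
    exact ⟨none, h⟩

theorem cls_spec (D : ℕ) {K : Type} [Field K] [Fintype K] {w : V → K} {c} (h : Cls D c K w) : ∃ p a : ℕ, p.Prime ∧ CharP K p ∧ clE D c = p ^ a ∧ D < p ^ (a + 1) := by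
  cases c with
  | none =>
    obtain ⟨p, hpK⟩ := CharP.exists K
    obtain ⟨e, hp, hcard⟩ := FiniteField.card K p
    refine ⟨p, 0, hp, hpK, rfl, ?_⟩
    by_contra hlt
    rw [zero_add, pow_one] at hlt
    exact h ⟨p, by omega⟩ hp (CharP.cast_eq_zero K p)
  | some p =>
    have hp : (p : ℕ).Prime := h.1
    have hch : CharP K (p : ℕ) := by
      have := Fact.mk hp
      obtain ⟨p', hpK⟩ := CharP.exists K
      obtain ⟨e, hp', hcard⟩ := FiniteField.card K p'
      have := (CharP.cast_eq_zero_iff K p' p).1 h.2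
      rw [← (Nat.prime_dvd_prime_iff_eq hp' hp).1 this]
      exact hpK
    refine ⟨p, D, hp, hch, rfl, ?_⟩
    exact (Nat.lt_pow_self hp.one_lt).trans_le (Nat.pow_le_pow_right hp.pos (by omega))

theorem pow_bij {K : Type} [Field K] [Fintype K] {p : ℕ} (hp : p.Prime) (hK : CharP K p) (a : ℕ) : Function.Bijective fun u : K => u ^ p ^ a := by
  have hE : ExpChar K p := ExpChar.prime hp
  rw [← Finite.injective_iff_bijective]
  exact iterateFrobenius_inj K p a

theorem core1 {ψ : Fam (Option V)} (h : Nice ψ) : ∃ (I : Type) (_ : Fintype I) (B : I → Fam V) (m : I → ℚ) (E : I → ℕ)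
    (BB : I → Finset ((MvPolynomial V ℤ)[X])) (C : ℕ), (∀ i, 0 ≤ m i) ∧ (∀ i, Nice (B i)) ∧
    (∀ (K : Type) [Field K] [Fintype K] (w : V → K), C ≤ card K → ∃ i, B i K w) ∧
    (∀ i (K : Type) [Field K] [Fintype K] (w : V → K), B i K w → Est C (BB i) (psE ψ (E i)) K w (m i) ∧ Function.Bijective fun u : K => u ^ E i) := by
  classical
  obtain ⟨C0, M, f, J0, _, p, hM, hf, hp1, hp2, hE⟩ := h.enum
  obtain ⟨D, hD⟩ : ∃ D, D = f.natDegree := ⟨_, rfl⟩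
  have key := fun c : Option (Fin (D + 1)) => core0 (ι := Fin f.natDegree) (f.map (subE (clE D c))) (hf.map _) (fun j => subT (clE D c) _ (p j)) (fun i => by
      obtain ⟨j, hj⟩ := hp1 i
      exact ⟨j, by simp [hj, subT]⟩) (fun i i' => by
      obtain ⟨j, hj⟩ := hp2 i i'
      exact ⟨j, by simp [hj, subT]⟩) C0 M hM (psE ψ (clE D c)) (hE.powE _)
  choose C M' BB Mu G T hM' hG hT hMu hmain using key
  have hcov : ∀ {K : Type} [Field K] [Fintype K] (w : V → K) c, Cls D c K w → HasCov (ι := Fin f.natDegree) (f.map (subE (clE D c))) w := by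
    intro K _ _ w c hc
    obtain ⟨p, a, h1, h2, h3, h4⟩ := cls_spec D hc
    rw [h3]
    exact hasCov_E f hf (by simp) w p a h1 h2 (by simpa [← hD] using h4)
  choose Q hQ using fun c => gap (Mu c) (C c)
  refine ⟨Σ c, Mu c, inferInstance, fun i K _ _ w => Cls D i.1 K w ∧ Est (C i.1) (BB i.1) (psE ψ (clE D i.1)) K w i.2.1, fun i => i.2.1, fun i => clE D i.1,
    fun i => BB i.1, ∑ c, C c, fun i => hMu _ _ i.2.2, ?_, ?_, ?_⟩
  · intro i
    refine Nice.mk' (cls_nice D i.1) (C i.1 + Q i.1) (M' i.1) (G i.1) (T i.1) (hM' _) (hG _) (hT _) ?_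
    intro K _ _ K' _ _ w w' r r' b c1 c2 c3 c4 hiso x1 x2 hes
    obtain ⟨m, hm, E1, E2⟩ := hmain i.1 w w' r r' b (by omega) (by omega) c3 c4 (hcov w _ x1) (hcov w' _ x2) hiso
    have := hQ i.1 (card K) _ (by omega) _ i.2.2 _ hm hes.1 E1.1
    rw [this]; exact E2
  · intro K _ _ w hq
    obtain ⟨c, hc⟩ := cls_cover D w
    have hq' : C c ≤ card K := (Finset.single_le_sum (f := C) (fun _ _ => Nat.zero_le _) (Finset.mem_univ c)).trans hq
    obtain ⟨m, hm, E1, -⟩ := hmain c w w 1 1 id hq' hq' (Nat.coprime_one_left _) (Nat.coprime_one_left _) (hcov w c hc) (hcov w c hc)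
      ⟨Set.bijOn_id _, fun _ _ => rfl, fun _ _ _ _ => Iff.rfl⟩
    exact ⟨⟨c, m, hm⟩, hc, E1⟩
  · rintro ⟨c, m, hm⟩ K _ _ w ⟨h1, h2⟩
    refine ⟨h2.mono (Finset.single_le_sum (f := C) (fun _ _ => Nat.zero_le _) (Finset.mem_univ c)), ?_⟩
    obtain ⟨p, a, g1, g2, g3, g4⟩ := cls_spec D h1
    simp only [g3]
    exact pow_bij g1 g2 a

end
end CDM

namespace CDM

section
variable {V : Type}

theorem Nice.psE {ψ : Fam (Option V)} (h : Nice ψ) (E : ℕ) : Nice (psE ψ E) := by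
  refine (h.subst (fun o : Option V => o.elim (MvPolynomial.X none ^ E) fun v => (MvPolynomial.X (some v) : MvPolynomial (Option V) ℤ))).congr 0 ?_
  intro K _ _ w _
  have : (fun o : Option V => MvPolynomial.aeval w (o.elim (MvPolynomial.X none ^ E) fun v => (MvPolynomial.X (some v) : MvPolynomial (Option V) ℤ))) = powE E w := by
    funext o; cases o <;> simp [powE]
  rw [this]; rfl

/-- number of points in a fibre -/
noncomputable def cnt (ψ : Fam (Option V)) (K : Type) [Field K] [Fintype K] (w : V → K) : ℕ := Nat.card {u : K // ψ K (oc u w)}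

theorem cnt_psE (ψ : Fam (Option V)) {K : Type} [Field K] [Fintype K] (w : V → K) {E : ℕ} (hE : Function.Bijective fun u : K => u ^ E) :
    Nat.card {u : K // psE ψ E K (oc u w)} = cnt ψ K w := by
  refine Nat.card_congr ((Equiv.ofBijective _ hE).subtypeEquiv fun u => ?_)
  change ψ K (powE E (oc u w)) ↔ _
  rw [powE_oc]; rfl

theorem ex_psE (ψ : Fam (Option V)) {K : Type} [Field K] [Fintype K] (w : V → K) {E : ℕ} (hE : Function.Bijective fun u : K => u ^ E) :
    (∃ u, psE ψ E K (oc u w)) ↔ ∃ u, ψ K (oc u w) := by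
  constructor
  · rintro ⟨u, hu⟩
    exact ⟨u ^ E, by rw [← powE_oc]; exact hu⟩
  · rintro ⟨u, hu⟩
    obtain ⟨v, rfl⟩ := hE.2 u
    refine ⟨v, ?_⟩
    change ψ K (powE E (oc v w))
    rw [powE_oc]; exact hu

theorem count1 {ψ : Fam (Option V)} (h : Nice ψ) : ∃ (I : Type) (_ : Fintype I) (B : I → Fam V) (m : I → ℚ) (C : ℕ),
    (∀ i, 0 ≤ m i) ∧ (∀ i, Nice (B i)) ∧
    (∀ (K : Type) [Field K] [Fintype K] (w : V → K), C ≤ card K → ∃ i, B i K w) ∧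
    (∀ i (K : Type) [Field K] [Fintype K] (w : V → K), B i K w → |(cnt ψ K w : ℝ) - m i * card K| ≤ C * √(card K) ∧
      (m i = 0 → cnt ψ K w ≤ C)) := by
  obtain ⟨I, _, B, m, E, BB, C, h1, h2, h3, h4⟩ := core1 h
  refine ⟨I, inferInstance, B, m, C + ∑ i, ∑ b ∈ BB i, b.natDegree, h1, h2, fun K _ _ w hq => h3 K w (by omega), fun i K _ _ w hB => ?_⟩
  obtain ⟨⟨g1, g2⟩, g3⟩ := h4 i K w hB
  rw [cnt_psE ψ w g3] at g1
  refine ⟨g1.trans (by gcongr; omega), fun h0 => ?_⟩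
  have hle : Nat.card {u : K // psE ψ (E i) K (oc u w)} ≤ Nat.card {u : K // badU (BB i) w u} :=
    Nat.card_le_card_of_injective (fun u => (⟨u.1, g2 h0 u.1 u.2⟩ : {u : K // badU (BB i) w u})) fun a b hab => Subtype.ext (by simpa using hab)
  rw [cnt_psE ψ w g3] at hle
  have h5 := badU_card (BB i) w
  have h6 := Finset.single_le_sum (f := fun i => ∑ b ∈ BB i, b.natDegree) (fun _ _ => Nat.zero_le _) (Finset.mem_univ i)
  omega

theorem Nice.ex {ψ : Fam (Option V)} (h : Nice ψ) : Nice (fun K _ _ w => ∃ u : K, ψ K (oc u w)) := by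
  obtain ⟨I, _, B, m, E, BB, C, h1, h2, h3, h4⟩ := core1 h
  have key : ∀ i, ∃ Q : ℕ, m i ≠ 0 → ∀ q : ℕ, Q ≤ q → (C : ℝ) * √q < m i * q := by
    intro i
    by_cases hm : m i = 0
    · exact ⟨0, fun h => absurd hm h⟩
    have hmp : (0 : ℝ) < m i := by exact_mod_cast lt_of_le_of_ne (h1 i) (Ne.symm hm)
    obtain ⟨Q, hQ⟩ := exists_nat_gt ((C / (m i : ℝ)) ^ 2)
    refine ⟨Q, fun _ q hq => ?_⟩
    have hq' : (Q : ℝ) ≤ q := by exact_mod_cast hq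
    have hs : C / (m i : ℝ) < √q := Real.lt_sqrt_of_sq_lt (hQ.trans_le hq')
    have hs0 : 0 < √(q : ℝ) := lt_of_le_of_lt (by positivity) hs
    rw [div_lt_iff₀ hmp] at hs
    have h4 : √(q : ℝ) * √q = q := Real.mul_self_sqrt (by positivity)
    nlinarith [mul_lt_mul_of_pos_right hs hs0]
  choose Q hQ using key
  have hN : Nice (fun K _ _ w => ∃ i, B i K w ∧ (m i ≠ 0 ∨ ∃ b : BB i, (b.1.map (wev w) ≠ 0 ∧ ∃ u : K, algebraMap K (AC K) u ∈ Rt b.1 w ∧ CDM.psE ψ (E i) K (oc u w)))) :=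
    Nice.exists fun i => (h2 i).and ((Nice.prop _).or (Nice.exists fun b => (h.psE (E i)).fp b.1))
  refine hN.congr (C + ∑ i, Q i) ?_
  intro K _ _ w hq
  constructor
  · rintro ⟨i, hB, hh⟩
    obtain ⟨⟨g1, g2⟩, g3⟩ := h4 i K w hB
    rw [← ex_psE ψ w g3]
    rcases hh with hm | ⟨b, -, u, -, hu⟩
    · have hq' : Q i ≤ card K := (Finset.single_le_sum (f := Q) (fun _ _ => Nat.zero_le _) (Finset.mem_univ i)).trans (by omega)
      have g4 := hQ i hm _ hq'
      have : 0 < Nat.card {u : K // CDM.psE ψ (E i) K (oc u w)} := by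
        rw [abs_le] at g1
        have : (0 : ℝ) < Nat.card {u : K // CDM.psE ψ (E i) K (oc u w)} := by linarith [g1.1]
        exact_mod_cast this
      rw [Nat.card_pos_iff] at this
      obtain ⟨⟨u, hu⟩⟩ := this.1
      exact ⟨u, hu⟩
    · exact ⟨u, hu⟩
  · intro hex
    obtain ⟨i, hB⟩ := h3 K w (by omega)
    obtain ⟨⟨g1, g2⟩, g3⟩ := h4 i K w hB
    refine ⟨i, hB, ?_⟩
    by_cases hm : m i = 0
    · right
      rw [← ex_psE ψ w g3] at hex
      obtain ⟨u, hu⟩ := hex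
      obtain ⟨b, hb, hb1, hb2⟩ := g2 hm u hu
      exact ⟨⟨b, hb⟩, hb1, u, hb2, hu⟩
    · exact Or.inl hm

/-- at least `j` solutions -/
theorem Nice.atLeast (j : ℕ) : ∀ {V : Type} {ψ : Fam (Option V)}, Nice ψ → Nice (fun K _ _ w => j ≤ cnt ψ K w) := by
  induction j with
  | zero => intro V ψ _; simpa using Nice.true
  | succ j ih =>
    intro V ψ h
    -- variables: none = new point, some none = old point
    let φ : Fam (Option (Option V)) := fun K _ _ w => ψ K (fun o => o.elim (w none) fun v => w (some (some v))) ∧ w none ≠ w (some none)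
    have hφ : Nice φ := by
      refine Nice.congr (((h.subst (fun o : Option V => o.elim (MvPolynomial.X none) fun v => (MvPolynomial.X (some (some v)) : MvPolynomial (Option (Option V)) ℤ)))).and
        (Nice.atom (MvPolynomial.X none - MvPolynomial.X (some none))).not) 0 ?_
      intro K _ _ w _
      have : (fun o : Option V => MvPolynomial.aeval w (o.elim (MvPolynomial.X none) fun v => (MvPolynomial.X (some (some v)) : MvPolynomial (Option (Option V)) ℤ))) =
          (fun o => o.elim (w none) fun v => w (some (some v))) := by
        funext o; cases o <;> simp
      rw [this]
      simp [φ, sub_eq_zero]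
    refine (h.and (ih hφ)).ex.congr 0 ?_
    intro K _ _ w _
    have hφu : ∀ u v : K, φ K (oc v (oc u w)) ↔ ψ K (oc v w) ∧ v ≠ u := by
      intro u v
      have : (fun o : Option V => o.elim ((oc v (oc u w)) none) fun x => (oc v (oc u w)) (some (some x))) = oc v w := by
        funext o; cases o <;> rfl
      simp only [φ, this]
      rfl
    have hcnt : ∀ u, ψ K (oc u w) → cnt φ K (oc u w) + 1 = cnt ψ K w := by
      classical
      intro u hu
      simp only [cnt, hφu, Nat.card_eq_fintype_card, Fintype.card_subtype]
      have : (Finset.univ.filter fun v : K => ψ K (oc v w) ∧ v ≠ u) = (Finset.univ.filter fun v : K => ψ K (oc v w)).erase u := by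
        ext v; simp [and_comm]
      rw [this, Finset.card_erase_add_one]
      simpa using hu
    constructor
    · rintro ⟨u, h1, h2⟩
      have := hcnt u h1
      omega
    · intro hj
      have : 0 < cnt ψ K w := by omega
      rw [cnt, Nat.card_pos_iff] at this
      obtain ⟨⟨u, hu⟩⟩ := this.1
      have := hcnt u hu
      exact ⟨u, hu, by omega⟩

end
end CDM
end

section
open Polynomial FirstOrder
open Fintype (card)
attribute [local instance] FirstOrder.Ring.compatibleRingOfRing

namespace CDM
variable {V : Type}

/-- families defined by a ring formula -/
def Df (φ : Fam V) : Prop := ∃ F : Language.ring.Formula V, ∀ (K : Type) [Field K] [Fintype K] (w : V → K), F.Realize w ↔ φ K w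

theorem Df.congr {φ ψ : Fam V} (h : Df φ) (hh : ∀ (K : Type) [Field K] [Fintype K] (w : V → K), φ K w ↔ ψ K w) : Df ψ := by
  obtain ⟨F, hF⟩ := h
  exact ⟨F, fun K _ _ w => (hF K w).trans (hh K w)⟩

theorem Df.atom (a : MvPolynomial V ℤ) : Df (fun _ _ _ w => MvPolynomial.aeval w a = 0) := by
  refine ⟨(FirstOrder.Ring.termOfFreeCommRing ((freeCommRingEquivMvPolynomialInt V).symm a)).equal 0, fun K _ _ w => ?_⟩
  rw [Language.Formula.realize_equal, FirstOrder.Ring.realize_termOfFreeCommRing, FirstOrder.Ring.realize_zero]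
  have : (FreeCommRing.lift w) = (MvPolynomial.aeval w : MvPolynomial V ℤ →ₐ[ℤ] K).toRingHom.comp (freeCommRingEquivMvPolynomialInt V).toRingHom := by
    apply FreeCommRing.hom_ext
    intro x
    simp [freeCommRingEquivMvPolynomialInt]
  rw [this]
  simp

theorem Df.not {φ : Fam V} (h : Df φ) : Df (fun K _ _ w => ¬ φ K w) := by
  obtain ⟨F, hF⟩ := h
  exact ⟨F.not, fun K _ _ w => by rw [Language.Formula.realize_not, hF]⟩

theorem Df.and {φ ψ : Fam V} (h : Df φ) (h' : Df ψ) : Df (fun K _ _ w => φ K w ∧ ψ K w) := by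
  obtain ⟨F, hF⟩ := h
  obtain ⟨G, hG⟩ := h'
  exact ⟨F ⊓ G, fun K _ _ w => by rw [Language.Formula.realize_inf, hF, hG]⟩

theorem Df.forall {ι : Type} [Finite ι] {φ : ι → Fam V} (h : ∀ i, Df (φ i)) : Df (fun K _ _ w => ∀ i, φ i K w) := by
  choose F hF using h
  exact ⟨Language.Formula.iInf F, fun K _ _ w => by simp only [Language.Formula.realize_iInf, hF]⟩

theorem Df.exists {ι : Type} [Finite ι] {φ : ι → Fam V} (h : ∀ i, Df (φ i)) : Df (fun K _ _ w => ∃ i, φ i K w) := by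
  choose F hF using h
  exact ⟨Language.Formula.iSup F, fun K _ _ w => by simp only [Language.Formula.realize_iSup, hF]⟩

theorem Df.ex {σ : Type} [Finite σ] {φ : Fam (V ⊕ σ)} (h : Df φ) : Df (fun K _ _ w => ∃ u : σ → K, φ K (Sum.elim w u)) := by
  obtain ⟨F, hF⟩ := h
  exact ⟨F.iExs σ, fun K _ _ w => by simp only [Language.Formula.realize_iExs, hF]⟩

theorem Df.prop (P : Prop) : Df (V := V) (fun _ _ _ _ => P) := by
  by_cases hP : P
  · exact (Df.atom 0).congr fun K _ _ w => by simp [hP]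
  · exact (Df.atom 1).congr fun K _ _ w => by simp [hP]

theorem term_poly (t : Language.ring.Term V) : ∃ a : MvPolynomial V ℤ, ∀ (K : Type) [Field K] [Fintype K] (w : V → K),
    t.realize w = MvPolynomial.aeval w a := by
  induction t with
  | var v => exact ⟨MvPolynomial.X v, fun K _ _ w => by simp⟩
  | func f ts ih =>
    choose a ha using ih
    cases f with
    | add => exact ⟨a 0 + a 1, fun K _ _ w => by
        rw [map_add, ← ha, ← ha]; exact FirstOrder.Ring.CompatibleRing.funMap_add _⟩
    | mul => exact ⟨a 0 * a 1, fun K _ _ w => by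
        rw [map_mul, ← ha, ← ha]; exact FirstOrder.Ring.CompatibleRing.funMap_mul _⟩
    | neg => exact ⟨- a 0, fun K _ _ w => by
        rw [map_neg, ← ha]; exact FirstOrder.Ring.CompatibleRing.funMap_neg _⟩
    | zero => exact ⟨0, fun K _ _ w => by
        rw [map_zero]; exact FirstOrder.Ring.CompatibleRing.funMap_zero _⟩
    | one => exact ⟨1, fun K _ _ w => by
        rw [map_one]; exact FirstOrder.Ring.CompatibleRing.funMap_one _⟩

theorem bf_nice {n : ℕ} (φ : Language.ring.BoundedFormula V n) :
    Nice (V := V ⊕ Fin n) (fun _ _ _ w => φ.Realize (fun v => w (Sum.inl v)) (fun i => w (Sum.inr i))) := by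
  induction φ with
  | falsum => exact Nice.false
  | equal t s =>
    obtain ⟨a, ha⟩ := term_poly t
    obtain ⟨b, hb⟩ := term_poly s
    refine (Nice.atom (a - b)).congr 0 fun K _ _ w _ => ?_
    have : w = Sum.elim (fun v => w (Sum.inl v)) (fun i => w (Sum.inr i)) := by funext x; cases x <;> rfl
    rw [map_sub, sub_eq_zero, ← ha, ← hb, this]
    rfl
  | rel R => exact R.elim
  | imp _ _ h1 h2 => exact h1.imp h2
  | @all n φ h =>
    have h1 := (h.subst (V' := Option (V ⊕ Fin n)) (Sum.elim (fun v => MvPolynomial.X (some (Sum.inl v)))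
      (Fin.snoc (α := fun _ => MvPolynomial (Option (V ⊕ Fin n)) ℤ) (fun i => MvPolynomial.X (some (Sum.inr i))) (MvPolynomial.X none)))).not.ex.not
    refine h1.congr 0 fun K _ _ w _ => ?_
    simp only [not_exists, not_not, Language.BoundedFormula.realize_all]
    refine forall_congr' fun u => ?_
    have e1 : (fun i => MvPolynomial.aeval (oc u w) (Fin.snoc (α := fun _ => MvPolynomial (Option (V ⊕ Fin n)) ℤ) (fun i : Fin n => MvPolynomial.X (some (Sum.inr i))) (MvPolynomial.X none) i : MvPolynomial (Option (V ⊕ Fin n)) ℤ))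
        = (Fin.snoc (fun i => w (Sum.inr i)) u : Fin (n + 1) → K) := by
      funext i
      refine Fin.lastCases ?_ (fun i => ?_) i <;> simp [oc]
    simp only [Sum.elim_inl, Sum.elim_inr]
    rw [e1]
    simp [oc]

theorem formula_nice (φ : Language.ring.Formula V) : Nice (fun _ _ _ w => φ.Realize w) := by
  refine ((bf_nice φ).subst (V' := V) (Sum.elim MvPolynomial.X Fin.elim0)).congr 0 fun K _ _ w _ => ?_
  simp only [Sum.elim_inl, Sum.elim_inr, MvPolynomial.aeval_X, Language.Formula.Realize]
  rw [Subsingleton.elim (fun i : Fin 0 => _) default]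
end CDM
end

section
open Polynomial IntermediateField
open Fintype (card)
open MvPolynomial (rename eval₂Hom optionEquivLeft optionEquivRight coe_eval₂Hom esymm eval₂Hom_X')

namespace CDM
section
variable {K : Type} [Field K] [Fintype K]

theorem pow_card_mul {x : AC K} {l : ℕ} (h : x ^ card K ^ l = x) {m : ℕ} (hm : l ∣ m) : x ^ card K ^ m = x := by
  obtain ⟨k, rfl⟩ := hm
  induction k with
  | zero => simp
  | succ k ih => rw [Nat.mul_succ, pow_add, pow_mul, ih, h]

theorem pow_card_minpoly (x : AC K) : x ^ card K ^ (minpoly K x).natDegree = x := by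
  have hx : IsIntegral K x := Algebra.IsIntegral.isIntegral x
  have := adjoin.finiteDimensional hx
  have : Finite K⟮x⟯ := Module.finite_of_finite K
  have := Fintype.ofFinite K⟮x⟯
  have h := FiniteField.pow_card (AdjoinSimple.gen K x)
  rw [Module.card_eq_pow_finrank (K := K), adjoin.finrank hx] at h
  simpa using congrArg (algebraMap K⟮x⟯ (AC K)) h

theorem conj_pow {x y : AC K} (h : aeval y (minpoly K x) = 0) : ∃ r, y = x ^ card K ^ r := by
  have hx : IsIntegral K x := Algebra.IsIntegral.isIntegral x
  have := adjoin.finiteDimensional hx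
  have : Finite K⟮x⟯ := Module.finite_of_finite K
  obtain ⟨σ, hσ⟩ := minpoly.exists_algEquiv_of_root' (L := AC K) hx.isAlgebraic h
  obtain ⟨p, hp⟩ := CharP.exists K
  have : Fact p.Prime := ⟨CharP.char_is_prime K p⟩
  obtain ⟨r, hr⟩ := FiniteField.exists_forall_apply_eq_pow K p K⟮x⟯ (σ.restrictNormal K⟮x⟯)
  refine ⟨r, ?_⟩
  have h1 := σ.restrictNormal_commutes K⟮x⟯ (AdjoinSimple.gen K x)
  rw [hr] at h1
  simp only [map_pow, AdjoinSimple.algebraMap_gen, Nat.card_eq_fintype_card] at h1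
  rw [← hσ, ← h1]

theorem ext_exists (K : Type) [Field K] [Fintype K] (l : ℕ) (hl : l ≠ 0) : ∃ x : AC K, (minpoly K x).natDegree = l ∧
    ∀ y : AC K, y ^ card K ^ l = y → ∃ P : K[X], P.natDegree < l ∧ aeval x P = y := by
  obtain ⟨p, hp⟩ := CharP.exists K
  have : Fact p.Prime := ⟨CharP.char_is_prime K p⟩
  have : NeZero l := ⟨hl⟩
  let E := FiniteField.Extension K p l
  let φ : E →ₐ[K] AC K := IsAlgClosed.lift
  let pb := Field.powerBasisOfFiniteOfSeparable K E
  have hd : pb.dim = l := by rw [← pb.finrank]; exact FiniteField.finrank_extension K p l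
  refine ⟨φ pb.gen, ?_, fun y hy => ?_⟩
  · rw [minpoly.algHom_eq φ φ.injective, pb.natDegree_minpoly, hd]
  · have h1 := (inferInstance : IsSplittingField K E (X ^ Nat.card K ^ l - X)).splits
    have h2 : (X ^ Nat.card K ^ l - X : K[X]) ≠ 0 :=
      FiniteField.X_pow_card_pow_sub_X_ne_zero K hl (by rw [Nat.card_eq_fintype_card]; exact Fintype.one_lt_card)
    have h3 : y ∈ φ.toRingHom.range := by
      refine h1.mem_range_of_isRoot (i := φ.toRingHom) (Polynomial.map_ne_zero h2) ?_
      simp [Nat.card_eq_fintype_card, hy]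
    obtain ⟨e, rfl⟩ := h3
    obtain ⟨P, hP, rfl⟩ := pb.exists_eq_aeval e
    exact ⟨P, hd ▸ hP, (aeval_algHom_apply φ _ _)⟩
end
end CDM

namespace CDM

/-- polynomial with given list of coefficients -/
noncomputable def gp {R : Type} [CommRing R] {n : ℕ} (s : Fin n → R) : R[X] := ∑ k, C (s k) * X ^ (k : ℕ)

theorem map_gp {R S : Type} [CommRing R] [CommRing S] {n : ℕ} (φ : R →+* S) (s : Fin n → R) : (gp s).map φ = gp (fun k => φ (s k)) := by
  simp [gp, Polynomial.map_sum]

theorem gp_coeff {R : Type} [CommRing R] {n : ℕ} (P : R[X]) (h : P.natDegree < n) : gp (fun k : Fin n => P.coeff k) = P := by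
  conv_rhs => rw [P.as_sum_range_C_mul_X_pow' h, ← Fin.sum_univ_eq_sum_range (fun k => C (P.coeff k) * X ^ k)]
  rfl

theorem gp_degree {R : Type} [CommRing R] {n : ℕ} (s : Fin n → R) : (gp s).degree < n := by
  refine (degree_sum_le _ _).trans_lt ((Finset.sup_lt_iff (WithBot.bot_lt_coe n)).2 fun k _ => ?_)
  exact (degree_C_mul_X_pow_le _ _).trans_lt (Nat.cast_lt.2 k.2)

theorem gp_natDegree {R : Type} [CommRing R] [Nontrivial R] {n : ℕ} (s : Fin n → R) : (X ^ n + gp s).natDegree = n := by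
  apply natDegree_eq_of_degree_eq_some
  rw [degree_add_eq_left_of_degree_lt, degree_X_pow]
  rw [degree_X_pow]; exact gp_degree _

theorem exists_gp {R : Type} [CommRing R] {n : ℕ} (hn : n ≠ 0) (P : R[X]) (h : P.Monic) (h' : P.natDegree = n) : ∃ s : Fin n → R, X ^ n + gp s = P := by
  refine ⟨fun k => P.eraseLead.coeff k, ?_⟩
  have h1 := P.eraseLead_natDegree_le
  rw [gp_coeff _ (by omega)]
  have h2 := P.eraseLead_add_C_mul_X_pow
  rw [h.leadingCoeff, h', C_1, one_mul] at h2
  rw [add_comm, h2]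

section
variable {U : Type} {K : Type} [Field K]

noncomputable def aw (w : U → K) : MvPolynomial U ℤ →+* K := (MvPolynomial.aeval w : MvPolynomial U ℤ →ₐ[ℤ] K).toRingHom

theorem aw_apply (w : U → K) (a : MvPolynomial U ℤ) : aw w a = MvPolynomial.aeval w a := rfl

theorem aw_X (w : U → K) (v : U) : aw w (MvPolynomial.X v) = w v := by simp [aw]

theorem wev_aw (w : U → K) : wev w = (algebraMap K (AC K)).comp (aw w) := RingHom.ext fun a => wev_eq w a

theorem aeval_aw (w : U → K) (x : AC K) (P : (MvPolynomial U ℤ)[X]) : aeval x (P.map (aw w)) = P.eval₂ (wev w) x := by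
  rw [aeval_def, eval₂_map, wev_aw]

theorem dvd_aw {w : U → K} {c : (MvPolynomial U ℤ)[X]} (hc : c.Monic) (h : Irreducible (c.map (aw w))) {x : AC K} (hx : c.eval₂ (wev w) x = 0)
    (P : (MvPolynomial U ℤ)[X]) : c.map (aw w) ∣ P.map (aw w) ↔ P.eval₂ (wev w) x = 0 := by
  rw [← aeval_aw] at hx ⊢
  rw [minpoly.eq_of_irreducible_of_monic h hx (hc.map _), minpoly.dvd_iff]

theorem frob_ev [Fintype K] (w : U → K) (x : AC K) (P : (MvPolynomial U ℤ)[X]) (r : ℕ) :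
    P.eval₂ (wev w) (x ^ card K ^ r) = (P.eval₂ (wev w) x) ^ card K ^ r := by
  simp only [← aeval_aw]
  induction r with
  | zero => simp
  | succ r ih =>
    rw [pow_succ, pow_mul, pow_mul, ← ih, ← expand_aeval, FiniteField.expand_card, map_pow]
end

section
variable {U : Type}

theorem Df.dvd (c P : (MvPolynomial U ℤ)[X]) (hc : c.Monic) : Df (fun _ _ _ w => c.map (aw w) ∣ P.map (aw w)) := by
  refine (Df.forall fun k : Fin ((P %ₘ c).natDegree + 1) => Df.atom ((P %ₘ c).coeff k)).congr fun K _ _ w => ?_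
  rw [← modByMonic_eq_zero_iff_dvd (hc.map _), ← map_modByMonic _ hc]
  constructor
  · intro h
    ext k
    rw [coeff_map, coeff_zero]
    by_cases hk : k < (P %ₘ c).natDegree + 1
    · exact h ⟨k, hk⟩
    · rw [coeff_eq_zero_of_natDegree_lt (by omega), map_zero]
  · intro h k
    rw [← aw_apply, ← coeff_map, h, coeff_zero]

theorem Df.irr (c : (MvPolynomial U ℤ)[X]) (hc : c.Monic) (h0 : c.natDegree ≠ 0) : Df (fun _ _ _ w => Irreducible (c.map (aw w))) := by
  have h1 : ∀ j : Fin (c.natDegree / 2), Df (fun K _ _ w => ¬ ∃ s : Fin (j + 1) → K,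
      (X ^ ((j : ℕ) + 1) + gp (fun k => MvPolynomial.X (Sum.inr k)) : (MvPolynomial (U ⊕ Fin (j + 1)) ℤ)[X]).map (aw (Sum.elim w s)) ∣
        (c.map (rename Sum.inl).toRingHom).map (aw (Sum.elim w s))) :=
    fun j => (Df.dvd _ _ (monic_X_pow_add (gp_degree _))).ex.not
  refine (Df.forall h1).congr fun K _ _ w => ?_
  have hd : (c.map (aw w)).natDegree = c.natDegree := hc.natDegree_map _
  rw [(hc.map (aw w)).irreducible_iff_lt_natDegree_lt (fun h => h0 (by rw [← hd, h, natDegree_one])), hd]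
  have e1 : ∀ (j : ℕ) (s : Fin j → K), (aw (Sum.elim w s)).comp (rename Sum.inl).toRingHom = aw w := by
    intro j s
    ext v <;> simp [aw]
  simp only [Polynomial.map_map, e1, Polynomial.map_add, Polynomial.map_pow, map_X, map_gp, aw_X, Sum.elim_inr]
  constructor
  · intro h q hq hq' hdv
    rw [Finset.mem_Ioc] at hq'
    obtain ⟨j, hj⟩ : ∃ j, q.natDegree = j + 1 := ⟨q.natDegree - 1, by omega⟩
    obtain ⟨s, hs⟩ := exists_gp (by omega) q hq hj
    exact h ⟨j, by omega⟩ ⟨s, hs ▸ hdv⟩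
  · rintro h j ⟨s, hs⟩
    refine h _ (monic_X_pow_add (gp_degree _)) ?_ hs
    rw [Finset.mem_Ioc, gp_natDegree]
    omega
end
end CDM

namespace CDM
section
variable {V ι J : Type} [Fintype ι] (l : ℕ)

/-- variables of the coding of the extension of degree `l` -/
abbrev CV (V ι : Type) (l : ℕ) := V ⊕ (Option (Option ι) × Fin l)

noncomputable def gU (t : Option (Option ι)) : (MvPolynomial (CV V ι l) ℤ)[X] := gp fun k => MvPolynomial.X (Sum.inr (t, k))

noncomputable def cU : (MvPolynomial (CV V ι l) ℤ)[X] := X ^ l + gU l none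

noncomputable def fU (f : (MvPolynomial V ℤ)[X]) : (MvPolynomial (CV V ι l) ℤ)[X][X] :=
  ∏ i : ι, (X - C (gU l (some (some i)))) - f.map (C.comp (rename Sum.inl).toRingHom)

noncomputable def pU : MvPolynomial (V ⊕ ι) ℤ →+* (MvPolynomial (CV V ι l) ℤ)[X] :=
  eval₂Hom (Int.castRingHom _) (Sum.elim (fun v => C (MvPolynomial.X (Sum.inl v))) fun i => gU l (some (some i)))

noncomputable def itU : ℕ → (MvPolynomial (CV V ι l) ℤ)[X]
  | 0 => X
  | n + 1 => (itU n).comp (gU l (some none))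

theorem cU_monic : (cU l : (MvPolynomial (CV V ι l) ℤ)[X]).Monic := monic_X_pow_add (gp_degree _)

theorem cU_natDegree : (cU l : (MvPolynomial (CV V ι l) ℤ)[X]).natDegree = l := gp_natDegree _

/-- the coding family -/
def Cod (f : (MvPolynomial V ℤ)[X]) (p : J → MvPolynomial (V ⊕ ι) ℤ) (γ : Equiv.Perm ι) (β : J → Prop) : Fam (CV V ι l) := fun _ _ _ w =>
  Irreducible ((cU l).map (aw w)) ∧ (cU l).map (aw w) ∣ ((cU l).comp (gU l (some none))).map (aw w) ∧
  (∀ i : Fin (l - 1), ¬ (cU l).map (aw w) ∣ (itU l (i + 1) - X).map (aw w)) ∧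
  (∀ k : Fin ((fU (ι := ι) l f).natDegree + 1), (cU l).map (aw w) ∣ ((fU l f).coeff k).map (aw w)) ∧
  (∀ i : ι, (cU l).map (aw w) ∣ ((gU l (some (some i))).comp (gU l (some none)) - gU l (some (some (γ i)))).map (aw w)) ∧
  ∀ j, ((cU l).map (aw w) ∣ (pU l (p j)).map (aw w) ↔ β j)

theorem Cod_df (hl : l ≠ 0) [Finite J] (f : (MvPolynomial V ℤ)[X]) (p : J → MvPolynomial (V ⊕ ι) ℤ) (γ : Equiv.Perm ι) (β : J → Prop) :
    Df (Cod l f p γ β) := by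
  have h := fun P : (MvPolynomial (CV V ι l) ℤ)[X] => Df.dvd (cU l) P (cU_monic l)
  refine (Df.irr (cU l) (cU_monic l) (by rwa [cU_natDegree])).and ((h _).and ((Df.forall fun i => (h _).not).and ((Df.forall fun k => h _).and
    ((Df.forall fun i => h _).and (Df.forall fun j => ?_)))))
  by_cases hj : β j
  · exact (h (pU l (p j))).congr fun K _ _ w => by simp [hj]
  · exact (h (pU l (p j))).not.congr fun K _ _ w => by simp [hj]

variable {K : Type} [Field K] (w : V → K) (u : Option (Option ι) × Fin l → K) (x : AC K)

theorem fU_ev (f : (MvPolynomial V ℤ)[X]) : (fU l f).map (eval₂RingHom (wev (Sum.elim w u)) x) =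
    ∏ i : ι, (X - C ((gU l (some (some i))).eval₂ (wev (Sum.elim w u)) x)) - f.map (wev w) := by
  have : (eval₂RingHom (wev (Sum.elim w u)) x).comp (C.comp (rename Sum.inl).toRingHom) = wev w := by
    ext v <;> simp [wev, wb]
  simp only [fU, Polynomial.map_sub, Polynomial.map_prod, map_X, map_C, Polynomial.map_map, this, coe_eval₂RingHom]

theorem pU_ev (p : MvPolynomial (V ⊕ ι) ℤ) : (pU l p).eval₂ (wev (Sum.elim w u)) x =
    tev w (fun i => (gU l (some (some i))).eval₂ (wev (Sum.elim w u)) x) p := by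
  have : (eval₂RingHom (wev (Sum.elim w u)) x).comp (pU l) = tev w (fun i => (gU l (some (some i))).eval₂ (wev (Sum.elim w u)) x) := by
    ext v
    · simp
    · rcases v with v | i <;> simp [pU, tev, wev, wb]
  exact RingHom.congr_fun this p

theorem itU_ev [Fintype K] {r : ℕ} (w : CV V ι l → K) (h : (gU l (some none)).eval₂ (wev w) x = x ^ card K ^ r) (n : ℕ) :
    (itU l n).eval₂ (wev w) x = x ^ card K ^ (r * n) := by
  induction n with
  | zero => simp [itU]
  | succ n ih => rw [itU, eval₂_comp, h, frob_ev, ih, ← pow_mul, ← pow_add, Nat.mul_succ]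

theorem Cod_sound [Fintype K] (hl : l ≠ 0) {M : ℕ} (hM : M ∣ l) {f : (MvPolynomial V ℤ)[X]} {p : J → MvPolynomial (V ⊕ ι) ℤ} {γ : Equiv.Perm ι} {β : J → Prop}
    (h : Cod l f p γ β K (Sum.elim w u)) : ∃ (r : ℕ) (η : ι → AC K), r.Coprime M ∧ f.map (wev w) = ∏ i, (X - C (η i)) ∧
      (∀ i, η i ^ card K ^ r = η (γ i)) ∧ ∀ j, tev w η (p j) = 0 ↔ β j := by
  obtain ⟨h1, h2, h3, h4, h5, h6⟩ := h
  set w' := Sum.elim w u with hw'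
  obtain ⟨x, hx⟩ := IsAlgClosed.exists_aeval_eq_zero (AC K) _ (degree_pos_of_irreducible h1).ne'
  have hmin := minpoly.eq_of_irreducible_of_monic h1 hx ((cU_monic l).map _)
  rw [aeval_aw] at hx
  have hd := dvd_aw (cU_monic l) h1 hx
  simp only [hd] at h2 h3 h4 h5 h6
  rw [eval₂_comp, ← aeval_aw, hmin] at h2
  obtain ⟨r, hr⟩ := conj_pow h2
  have hxl := pow_card_minpoly x
  rw [← hmin, (cU_monic l).natDegree_map, cU_natDegree] at hxl
  refine ⟨r, fun i => (gU l (some (some i))).eval₂ (wev w') x, ?_, ?_, fun i => ?_, fun j => ?_⟩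
  · refine Nat.Coprime.coprime_dvd_right hM ?_
    by_contra hc
    have hg0 : 0 < r.gcd l := Nat.gcd_pos_of_pos_right _ (by omega)
    have hg1 : 1 < r.gcd l := by
      have : r.gcd l ≠ 1 := hc
      omega
    have hlt : l / r.gcd l < l := Nat.div_lt_self (by omega) hg1
    have hpos : 0 < l / r.gcd l := Nat.div_pos (Nat.le_of_dvd (by omega) (Nat.gcd_dvd_right _ _)) hg0
    refine h3 ⟨l / r.gcd l - 1, by omega⟩ ?_
    simp only [Nat.sub_add_cancel hpos]
    rw [eval₂_sub, eval₂_X, itU_ev l x w' hr, sub_eq_zero]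
    refine pow_card_mul hxl ?_
    rw [← Nat.mul_div_assoc _ (Nat.gcd_dvd_right _ _), mul_comm, Nat.mul_div_assoc _ (Nat.gcd_dvd_left _ _)]
    exact Dvd.intro _ rfl
  · have : (fU l f).map (eval₂RingHom (wev w') x) = 0 := by
      ext k
      rw [coeff_map, coeff_zero]
      by_cases hk : k < (fU (ι := ι) l f).natDegree + 1
      · exact h4 ⟨k, hk⟩
      · rw [coeff_eq_zero_of_natDegree_lt (by omega), map_zero]
    rw [hw', fU_ev, sub_eq_zero] at this
    exact this.symm
  · have := h5 i
    rw [eval₂_sub, eval₂_comp, hr, frob_ev, sub_eq_zero] at this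
    exact this
  · rw [← h6, hw', pU_ev]

theorem Cod_complete [Fintype K] (hl : l ≠ 0) {f : (MvPolynomial V ℤ)[X]} {p : J → MvPolynomial (V ⊕ ι) ℤ} {γ : Equiv.Perm ι} {η : ι → AC K}
    (h1 : f.map (wev w) = ∏ i, (X - C (η i))) (h2 : ∀ i, η i ^ card K = η (γ i)) (h3 : ∀ i, η i ^ card K ^ l = η i) :
    ∃ u, Cod l f p γ (fun j => tev w η (p j) = 0) K (Sum.elim w u) := by
  obtain ⟨x, hxd, hx⟩ := ext_exists K l hl
  have hxi : IsIntegral K x := Algebra.IsIntegral.isIntegral x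
  have hxl := pow_card_minpoly x
  rw [hxd] at hxl
  obtain ⟨a, ha, ha'⟩ := hx (x ^ card K) (by rw [← pow_mul, mul_comm, pow_mul, hxl])
  choose e he he' using fun i => hx (η i) (h3 i)
  obtain ⟨c, hc⟩ := exists_gp hl _ (minpoly.monic hxi) hxd
  let u : Option (Option ι) × Fin l → K := fun t => t.1.elim (c t.2) fun s => s.elim (a.coeff t.2) fun i => (e i).coeff t.2
  have hcU : (cU l).map (aw (Sum.elim w u)) = minpoly K x := by
    simp only [cU, gU, Polynomial.map_add, Polynomial.map_pow, map_X, map_gp, aw_X, Sum.elim_inr]; exact hc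
  have haU : (gU l (some none)).eval₂ (wev (Sum.elim w u)) x = x ^ card K ^ 1 := by
    rw [← aeval_aw, pow_one, ← ha', ← gp_coeff a ha]
    simp only [gU, map_gp, aw_X, Sum.elim_inr]; rfl
  have heU : ∀ i, (gU l (some (some i))).eval₂ (wev (Sum.elim w u)) x = η i := by
    intro i
    rw [← aeval_aw, ← he', ← gp_coeff (e i) (he i)]
    simp only [gU, map_gp, aw_X, Sum.elim_inr]; rfl
  have hir : Irreducible ((cU l).map (aw (Sum.elim w u))) := hcU ▸ minpoly.irreducible hxi
  have hx0 : (cU l).eval₂ (wev (Sum.elim w u)) x = 0 := by rw [← aeval_aw, hcU, minpoly.aeval]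
  have hd := dvd_aw (cU_monic l) hir hx0
  refine ⟨u, hir, ?_, fun i => ?_, fun k => ?_, fun i => ?_, fun j => ?_⟩
  · rw [hd, eval₂_comp, haU, frob_ev, hx0, zero_pow (pow_ne_zero _ Fintype.card_ne_zero)]
  · rw [hd, eval₂_sub, eval₂_X, itU_ev l x _ haU, sub_eq_zero, one_mul]
    intro h
    have h4 : minpoly K x ∣ X ^ Nat.card K ^ ((i : ℕ) + 1) - X := minpoly.dvd _ _ (by simp [Nat.card_eq_fintype_card, h])
    have h5 := Nat.le_of_dvd (by omega) ((minpoly.irreducible hxi).natDegree_dvd_of_dvd_X_pow_card_pow_sub_X h4)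
    omega
  · rw [hd]
    have : (fU l f).map (eval₂RingHom (wev (Sum.elim w u)) x) = 0 := by
      rw [fU_ev, h1, sub_eq_zero]; simp only [heU]
    rw [← coe_eval₂RingHom, ← coeff_map, this, coeff_zero]
  · rw [hd, eval₂_sub, eval₂_comp, haU, frob_ev, heU, heU, pow_one, h2, sub_self]
  · rw [hd, pU_ev]; simp only [heU]
end

theorem perm_of_prod {F ι : Type} [Field F] [Fintype ι] (η ξ : ι → F) (h : ∏ i, (X - C (ξ i)) = ∏ i, (X - C (η i))) :
    ∃ γ : Equiv.Perm ι, ∀ i, ξ i = η (γ i) := by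
  classical
  have h1 : ∀ η : ι → F, (∏ i, (X - C (η i))).roots = Finset.univ.val.map η := fun η => by
    rw [← roots_multiset_prod_X_sub_C (Finset.univ.val.map η), Multiset.map_map]; rfl
  have h2 : ∀ y, Nonempty ({i // ξ i = y} ≃ {i // η i = y}) := fun y => by
    have h3 := congrArg (Multiset.count y) ((h1 ξ).symm.trans ((congrArg roots h).trans (h1 η)))
    rw [Multiset.count_map, Multiset.count_map] at h3
    refine ⟨Fintype.equivOfCardEq ?_⟩
    rw [Fintype.card_subtype, Fintype.card_subtype]
    simpa only [eq_comm, Finset.card_def, Finset.filter_val] using h3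
  exact ⟨Equiv.ofFiberEquiv fun y => (h2 y).some, fun i => (Equiv.ofFiberEquiv_map _ i).symm⟩

theorem Nice.df {V : Type} {ψ : Fam V} (h : Nice ψ) : ∃ (C : ℕ) (φ : Fam V), Df φ ∧
    ∀ (K : Type) [Field K] [Fintype K] (w : V → K), C ≤ card K → (φ K w ↔ ψ K w) := by
  obtain ⟨C0, M, f, J, _, p, hM, hf, -, hsep, hE⟩ := h.enum
  set l := M * f.natDegree.factorial with hldef
  have hl : l ≠ 0 := Nat.mul_ne_zero hM (Nat.factorial_ne_zero _)
  refine ⟨C0, fun K _ _ w => ∃ b : Equiv.Perm (Fin f.natDegree) × (J → Prop), Rl f p ψ C0 M b.2 b.1 ∧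
    ∃ u : Option (Option (Fin f.natDegree)) × Fin l → K, Cod l f p b.1 b.2 K (Sum.elim w u),
    Df.exists fun b => (Df.prop _).and (Cod_df l hl f p b.1 b.2).ex, fun K _ _ w hq => ⟨?_, fun hψ => ?_⟩⟩
  · rintro ⟨b, hb, u, hu⟩
    obtain ⟨r, η, g1, g2, g3, g4⟩ := Cod_sound l w u hl (Dvd.intro _ rfl) hu
    exact (Rl_iff hE w r η hq g1 g2 g3 g4).2 hb
  · obtain ⟨η, hη⟩ := enum_roots (ι := Fin f.natDegree) (f.map (wev w)) (hf.map _) (IsAlgClosed.splits _) (by simp [hf.natDegree_map])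
    have hFr : (FiniteField.frobeniusAlgHom K (AC K)).toRingHom.comp (wev w) = wev w := by
      rw [wev_aw, ← RingHom.comp_assoc]
      exact congrArg (fun g : K →+* AC K => g.comp (aw w)) (FiniteField.frobeniusAlgHom K (AC K)).comp_algebraMap
    obtain ⟨γ, hγ⟩ := perm_of_prod η (fun i => η i ^ card K) (by
      have h1 := congrArg (Polynomial.map (FiniteField.frobeniusAlgHom K (AC K)).toRingHom) hη
      rw [Polynomial.map_map, hFr, hη, Polynomial.map_prod] at h1
      rw [h1]
      simp)
    have hfix : ∀ i, η i ^ card K ^ l = η i := fun i => by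
      refine pow_card_mul (pow_card_minpoly (η i)) (Dvd.dvd.mul_left (Nat.dvd_factorial (minpoly.natDegree_pos (Algebra.IsIntegral.isIntegral _)) ?_) M)
      rw [← hf.natDegree_map (aw w)]
      refine natDegree_le_of_dvd (minpoly.dvd _ _ ?_) (hf.map _).ne_zero
      rw [aeval_aw]
      exact (Rt_of_prod hη (η i)).2 ⟨i, rfl⟩
    obtain ⟨u, hu⟩ := Cod_complete l w hl (p := p) hη hγ hfix
    exact ⟨(γ, fun j => tev w η (p j) = 0), (Rl_iff hE w 1 η hq (Nat.coprime_one_left M) hη (by simpa using hγ) fun j => Iff.rfl).1 hψ, u, hu⟩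
end CDM
end

section
open Fintype (card)

namespace CDM

/-- `N` is `m * q ^ r` up to the relative error `C / √q`, and vanishes if `m = 0` -/
def Ev (C : ℝ) (m : ℚ) (r q N : ℕ) : Prop := |(N : ℝ) - m * (q : ℝ) ^ r| ≤ C * (q : ℝ) ^ r / √q ∧ (m = 0 → N = 0)

theorem Ev.nonneg {C : ℝ} {m : ℚ} {r q N : ℕ} (hq : 1 ≤ q) (h : Ev C m r q N) : 0 ≤ C := by
  have hq' : (0 : ℝ) < q := by exact_mod_cast hq
  have h1 := (abs_nonneg _).trans h.1
  have h2 : 0 < (q : ℝ) ^ r / √q := by positivity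
  rw [mul_div_assoc] at h1
  exact nonneg_of_mul_nonneg_left h1 h2

theorem inv_sqrt_le {q : ℕ} (hq : 1 ≤ q) : 1 / √(q : ℝ) ≤ 1 := by
  have h2 : (1 : ℝ) ≤ √q := Real.one_le_sqrt.2 (by exact_mod_cast hq)
  rw [div_le_one (by positivity)]; exact h2

theorem Ev.le {C : ℝ} {m : ℚ} {r q N : ℕ} (hq : 1 ≤ q) (h : Ev C m r q N) : (N : ℝ) ≤ (m + C) * (q : ℝ) ^ r := by
  have h1 := (abs_le.1 h.1).2
  have h2 := inv_sqrt_le hq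
  have h3 : C * (q : ℝ) ^ r / √q ≤ C * (q : ℝ) ^ r := by
    rw [div_eq_mul_one_div]
    exact mul_le_of_le_one_right (mul_nonneg (h.nonneg hq) (by positivity)) h2
  linarith

theorem Ev.mul {C C' : ℝ} {m m' : ℚ} {r s q : ℕ} (hq : 1 ≤ q) (hm : 0 ≤ m) {α : Type} (T : Finset α) (g : α → ℕ)
    (hC : 0 ≤ C) (hT : Ev C' m' s q T.card) (hg : ∀ u ∈ T, Ev C m r q (g u)) : Ev ((m' + C') * C + m * C') (m * m') (r + s) q (∑ u ∈ T, g u) := by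
  have hm' : (0 : ℝ) ≤ m := by exact_mod_cast hm
  refine ⟨?_, fun h => ?_⟩
  · have h1 : |((∑ u ∈ T, g u : ℕ) : ℝ) - T.card * (m * (q : ℝ) ^ r)| ≤ T.card * (C * (q : ℝ) ^ r / √q) := by
      rw [Nat.cast_sum, ← nsmul_eq_mul, ← nsmul_eq_mul, ← Finset.sum_const, ← Finset.sum_const, ← Finset.sum_sub_distrib]
      exact (Finset.abs_sum_le_sum_abs _ _).trans (Finset.sum_le_sum fun u hu => (hg u hu).1)
    have h2 : |(T.card : ℝ) * (m * (q : ℝ) ^ r) - m * m' * (q : ℝ) ^ (r + s)| ≤ m * (q : ℝ) ^ r * (C' * (q : ℝ) ^ s / √q) := by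
      have : (T.card : ℝ) * (m * (q : ℝ) ^ r) - m * m' * (q : ℝ) ^ (r + s) = m * (q : ℝ) ^ r * (T.card - m' * (q : ℝ) ^ s) := by ring
      rw [this, abs_mul, abs_of_nonneg (by positivity)]
      exact mul_le_mul_of_nonneg_left hT.1 (by positivity)
    have h3 : T.card * (C * (q : ℝ) ^ r / √q) ≤ (m' + C') * (q : ℝ) ^ s * (C * (q : ℝ) ^ r / √q) :=
      mul_le_mul_of_nonneg_right (hT.le hq) (by positivity)
    have h4 := abs_sub_le ((∑ u ∈ T, g u : ℕ) : ℝ) (T.card * (m * (q : ℝ) ^ r)) (m * m' * (q : ℝ) ^ (r + s))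
    rw [Rat.cast_mul]
    refine (h4.trans (add_le_add (h1.trans h3) h2)).trans (le_of_eq ?_)
    ring
  · rcases mul_eq_zero.1 h with h | h
    · exact Finset.sum_eq_zero fun u hu => (hg u hu).2 h
    · rw [Finset.card_eq_zero.1 (hT.2 h), Finset.sum_empty]

theorem Ev.add_lt {C1 C2 : ℝ} {m1 m2 : ℚ} {r1 r2 q N1 N2 : ℕ} (hq : 1 ≤ q) (hm : 0 ≤ m1) (hm2 : m2 ≠ 0) (hr : r1 < r2) (h1 : Ev C1 m1 r1 q N1)
    (h2 : Ev C2 m2 r2 q N2) : Ev (m1 + C1 + C2) m2 r2 q (N1 + N2) := by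
  refine ⟨?_, fun h => absurd h hm2⟩
  have hm' : (0 : ℝ) ≤ m1 := by exact_mod_cast hm
  have hq1 : (1 : ℝ) ≤ q := by exact_mod_cast hq
  have h5 : (N1 : ℝ) ≤ (m1 + C1) * (q : ℝ) ^ r2 / √q := by
    refine (h1.le hq).trans ?_
    rw [mul_div_assoc]
    refine mul_le_mul_of_nonneg_left ?_ (add_nonneg hm' (h1.nonneg hq))
    rw [le_div_iff₀ (by positivity)]
    have h6 : √(q : ℝ) ≤ q := Real.sqrt_le_left (by positivity) |>.2 (by nlinarith)
    calc (q : ℝ) ^ r1 * √q ≤ (q : ℝ) ^ r1 * q := by gcongr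
      _ = (q : ℝ) ^ (r1 + 1) := (pow_succ _ _).symm
      _ ≤ (q : ℝ) ^ r2 := pow_le_pow_right₀ hq1 hr
  have h7 := abs_add_le (N1 : ℝ) ((N2 : ℝ) - m2 * (q : ℝ) ^ r2)
  rw [abs_of_nonneg (Nat.cast_nonneg N1 : (0 : ℝ) ≤ N1)] at h7
  have h8 : ((N1 + N2 : ℕ) : ℝ) - m2 * (q : ℝ) ^ r2 = N1 + ((N2 : ℝ) - m2 * (q : ℝ) ^ r2) := by push_cast; ring
  rw [h8]
  refine (h7.trans (add_le_add h5 h2.1)).trans (le_of_eq ?_)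
  ring

theorem Ev.add {n : ℕ} (C1 C2 : ℝ) {m1 m2 : ℚ} {r1 r2 : ℕ} (hm1 : 0 ≤ m1) (hm2 : 0 ≤ m2) (hr1 : r1 ≤ n) (hr2 : r2 ≤ n) :
    ∃ (C : ℝ) (m : ℚ) (r : ℕ), 0 ≤ m ∧ r ≤ n ∧ ∀ q N1 N2 : ℕ, 1 ≤ q → Ev C1 m1 r1 q N1 → Ev C2 m2 r2 q N2 → Ev C m r q (N1 + N2) := by
  by_cases h1 : m1 = 0
  · exact ⟨C2, m2, r2, hm2, hr2, fun q N1 N2 _ e1 e2 => by rw [e1.2 h1, zero_add]; exact e2⟩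
  by_cases h2 : m2 = 0
  · exact ⟨C1, m1, r1, hm1, hr1, fun q N1 N2 _ e1 e2 => by rw [e2.2 h2, add_zero]; exact e1⟩
  rcases lt_trichotomy r1 r2 with hr | rfl | hr
  · exact ⟨_, m2, r2, hm2, hr2, fun q N1 N2 hq e1 e2 => e1.add_lt hq hm1 h2 hr e2⟩
  · refine ⟨C1 + C2, m1 + m2, r1, add_nonneg hm1 hm2, hr1, fun q N1 N2 hq e1 e2 => ⟨?_, fun h => absurd h ?_⟩⟩
    · have h8 : ((N1 + N2 : ℕ) : ℝ) - (m1 + m2 : ℚ) * (q : ℝ) ^ r1 = ((N1 : ℝ) - m1 * (q : ℝ) ^ r1) + ((N2 : ℝ) - m2 * (q : ℝ) ^ r1) := by push_cast; ring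
      rw [h8]
      refine ((abs_add_le _ _).trans (add_le_add e1.1 e2.1)).trans (le_of_eq ?_)
      ring
    · have : 0 < m1 := lt_of_le_of_ne hm1 (Ne.symm h1)
      linarith
  · exact ⟨_, m1, r1, hm1, hr1, fun q N1 N2 hq e1 e2 => add_comm N2 N1 ▸ e2.add_lt hq hm2 h1 hr e1⟩

theorem Ev.sum {n : ℕ} {I : Type} (s : Finset I) (C : I → ℝ) (m : I → ℚ) (r : I → ℕ) (hm : ∀ i, 0 ≤ m i) (hr : ∀ i, r i ≤ n) :
    ∃ (C' : ℝ) (m' : ℚ) (r' : ℕ), 0 ≤ m' ∧ r' ≤ n ∧ ∀ (q : ℕ) (N : I → ℕ), 1 ≤ q → (∀ i, Ev (C i) (m i) (r i) q (N i)) → Ev C' m' r' q (∑ i ∈ s, N i) := by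
  classical
  induction s using Finset.induction_on with
  | empty => exact ⟨0, 0, 0, le_rfl, Nat.zero_le _, fun q N _ _ => by simp [Ev]⟩
  | insert a s ha ih =>
    obtain ⟨C', m', r', h1, h2, h3⟩ := ih
    obtain ⟨C2, m2, r2, g1, g2, g3⟩ := Ev.add (C a) C' (hm a) h1 (hr a) h2
    exact ⟨C2, m2, r2, g1, g2, fun q N hq hN => by rw [Finset.sum_insert ha]; exact g3 q _ _ hq (hN a) (h3 q N hq hN)⟩

theorem nice_disj {V I : Type} [Fintype I] {B : I → Fam V} (h : ∀ i, Nice (B i)) : ∃ B' : I → Fam V, (∀ i, Nice (B' i)) ∧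
    (∀ i (K : Type) [Field K] [Fintype K] (w : V → K), B' i K w → B i K w) ∧
    ∀ (K : Type) [Field K] [Fintype K] (w : V → K), (∃ i, B i K w) → ∃! i, B' i K w := by
  classical
  let e := Fintype.equivFin I
  refine ⟨fun i K _ _ w => B i K w ∧ ∀ j : {j // e j < e i}, ¬ B j.1 K w, fun i => (h i).and (Nice.forall fun j => (h j.1).not), fun i K _ _ w hh => hh.1, ?_⟩
  intro K _ _ w hex
  obtain ⟨i, hi⟩ := hex
  obtain ⟨k, hk, hmin⟩ := WellFounded.has_min (InvImage.wf e (wellFounded_lt (α := Fin (card I)))) {i | B i K w} ⟨i, hi⟩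
  refine ⟨k, ⟨hk, fun j hj => hmin j.1 hj j.2⟩, fun k' hk' => ?_⟩
  rcases lt_trichotomy (e k') (e k) with hlt | heq | hlt
  · exact absurd hlt (hmin k' hk'.1)
  · exact e.injective heq
  · exact absurd hk (hk'.2 ⟨k, hlt⟩)

theorem count1' {V : Type} {ψ : Fam (Option V)} (h : Nice ψ) : ∃ (I : Type) (_ : Fintype I) (B : I → Fam V) (C : ℝ) (m : I → ℚ) (s : I → ℕ) (Q : ℕ),
    (∀ i, 0 ≤ m i) ∧ (∀ i, s i ≤ 1) ∧ (∀ i, Nice (B i)) ∧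
    (∀ (K : Type) [Field K] [Fintype K] (w : V → K), Q ≤ card K → ∃ i, B i K w) ∧
    (∀ i (K : Type) [Field K] [Fintype K] (w : V → K), B i K w → Ev C (m i) (s i) (card K) (cnt ψ K w)) := by
  classical
  obtain ⟨I, _, B, m, C, h1, h2, h3, h4⟩ := count1 h
  refine ⟨I × Fin (C + 1), inferInstance, fun a K _ _ w => B a.1 K w ∧ (m a.1 ≠ 0 ∨ (a.2 : ℕ) ≤ cnt ψ K w ∧ ¬ ((a.2 : ℕ) + 1 ≤ cnt ψ K w)), C,
    fun a => if m a.1 = 0 then (a.2 : ℕ) else m a.1, fun a => if m a.1 = 0 then 0 else 1, C, fun a => ?_, fun a => ?_,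
    fun a => (h2 a.1).and ((Nice.prop _).or ((h.atLeast _).and (h.atLeast _).not)), fun K _ _ w hq => ?_, fun a K _ _ w hB => ?_⟩
  · dsimp only
    split_ifs
    · positivity
    · exact h1 _
  · dsimp only
    split_ifs <;> simp
  · obtain ⟨i, hi⟩ := h3 K w hq
    by_cases hm : m i = 0
    · exact ⟨(i, ⟨cnt ψ K w, Nat.lt_succ_of_le ((h4 i K w hi).2 hm)⟩), hi, Or.inr ⟨le_rfl, by simp⟩⟩
    · exact ⟨(i, 0), hi, Or.inl hm⟩
  · obtain ⟨hB, hc⟩ := hB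
    by_cases hm : m a.1 = 0
    · have hc' : cnt ψ K w = a.2 := by
        rcases hc with hc | hc
        · exact absurd hm hc
        · omega
      simp only [hm, if_true, hc']
      refine ⟨?_, fun h => by exact_mod_cast h⟩
      simp only [Rat.cast_natCast, pow_zero, mul_one, sub_self, abs_zero]
      positivity
    · simp only [hm, if_false]
      refine ⟨?_, fun h => absurd h hm⟩
      have := (h4 a.1 K w hB).1
      rwa [pow_one, mul_div_assoc, Real.div_sqrt]
end CDM

namespace CDM

noncomputable def cntN {V : Type} {n : ℕ} (ψ : Fam (V ⊕ Fin n)) (K : Type) [Field K] [Fintype K] (w : V → K) : ℕ :=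
  Nat.card {a : Fin n → K // ψ K (Sum.elim w a)}

/-- move the first counted variable to the parameters -/
def shiftF {V : Type} {n : ℕ} (ψ : Fam (V ⊕ Fin (n + 1))) : Fam (Option V ⊕ Fin n) := fun K _ _ v =>
  ψ K (Sum.elim (fun x => v (Sum.inl (some x))) (Fin.cons (v (Sum.inl none)) fun i => v (Sum.inr i)))

theorem Nice.shiftF {V : Type} {n : ℕ} {ψ : Fam (V ⊕ Fin (n + 1))} (h : Nice ψ) : Nice (shiftF ψ) := by
  refine (h.subst (V' := Option V ⊕ Fin n) (Sum.elim (fun x => MvPolynomial.X (Sum.inl (some x)))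
    (Fin.cons (α := fun _ => MvPolynomial (Option V ⊕ Fin n) ℤ) (MvPolynomial.X (Sum.inl none)) fun i => MvPolynomial.X (Sum.inr i)))).congr 0 fun K _ _ w _ => ?_
  unfold CDM.shiftF
  apply iff_of_eq
  congr 1
  funext v
  rcases v with v | i
  · simp
  · refine Fin.cases ?_ (fun i => ?_) i <;> simp

theorem cntN_succ {V : Type} {n : ℕ} (ψ : Fam (V ⊕ Fin (n + 1))) (K : Type) [Field K] [Fintype K] (w : V → K) :
    cntN ψ K w = ∑ u : K, cntN (shiftF ψ) K (oc u w) := by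
  classical
  unfold cntN
  rw [← Nat.card_sigma]
  refine Nat.card_congr ⟨fun a => ⟨a.1 0, fun i => a.1 i.succ, ?_⟩, fun b => ⟨Fin.cons b.1 b.2.1, b.2.2⟩, fun a => ?_, fun b => ?_⟩
  · have := a.2
    rw [← Fin.cons_self_tail a.1] at this
    exact this
  · exact Subtype.ext (Fin.cons_self_tail a.1)
  · rfl

theorem countN (n : ℕ) : ∀ {V : Type} {ψ : Fam (V ⊕ Fin n)}, Nice ψ → ∃ (I : Type) (_ : Fintype I) (B : I → Fam V) (C : I → ℝ) (m : I → ℚ) (r : I → ℕ) (Q : ℕ),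
    (∀ i, 0 ≤ m i) ∧ (∀ i, r i ≤ n) ∧ (∀ i, Nice (B i)) ∧
    (∀ (K : Type) [Field K] [Fintype K] (w : V → K), Q ≤ card K → ∃! i, B i K w) ∧
    (∀ i (K : Type) [Field K] [Fintype K] (w : V → K), B i K w → Ev (C i) (m i) (r i) (card K) (cntN ψ K w)) := by
  induction n with
  | zero =>
    intro V ψ h
    have h' : Nice (fun K _ _ w => ψ K (Sum.elim w Fin.elim0)) := (h.subst (V' := V) (Sum.elim MvPolynomial.X Fin.elim0)).congr 0 fun K _ _ w _ => by
      apply iff_of_eq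
      congr 1
      funext v
      rcases v with v | i
      · simp
      · exact i.elim0
    have hc : ∀ (K : Type) [Field K] [Fintype K] (w : V → K), (ψ K (Sum.elim w Fin.elim0) → cntN ψ K w = 1) ∧ (¬ ψ K (Sum.elim w Fin.elim0) → cntN ψ K w = 0) := by
      intro K _ _ w
      have e : ∀ a : Fin 0 → K, a = Fin.elim0 := fun a => Subsingleton.elim _ _
      refine ⟨fun hp => Nat.card_eq_one_iff_unique.2 ⟨⟨fun a b => Subtype.ext (Subsingleton.elim _ _)⟩, ⟨⟨Fin.elim0, hp⟩⟩⟩, fun hp => ?_⟩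
      have : IsEmpty {a : Fin 0 → K // ψ K (Sum.elim w a)} := ⟨fun a => hp (e a.1 ▸ a.2)⟩
      exact Nat.card_of_isEmpty
    refine ⟨Prop, inferInstance, fun P K _ _ w => (ψ K (Sum.elim w Fin.elim0) ∧ P) ∨ (¬ ψ K (Sum.elim w Fin.elim0) ∧ ¬ P), fun _ => 0, fun P => by classical exact if P then 1 else 0, fun _ => 0, 0,
      fun P => ?_, fun _ => le_rfl, fun P => (h'.and (Nice.prop P)).or (h'.not.and (Nice.prop _)), fun K _ _ w _ => ⟨ψ K (Sum.elim w Fin.elim0), by tauto, fun P hP => propext (by tauto)⟩, fun P K _ _ w hP => ?_⟩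
    · dsimp only
      split_ifs <;> simp
    · rcases hP with ⟨h1, h2⟩ | ⟨h1, h2⟩
      · simp [Ev, h2, (hc K w).1 h1]
      · simp [Ev, h2, (hc K w).2 h1]
  | succ n ih =>
    intro V ψ h
    classical
    obtain ⟨I, _, B, C, m, r, Q, h1, h2, h3, h4, h5⟩ := ih h.shiftF
    choose I' hI' B' C' m' s' Q' g1 g2 g3 g4 g5 using fun i => count1' (h3 i)
    choose C2 m2 r2 k1 k2 k3 using fun t : ∀ i, I' i => Ev.sum (n := n + 1) Finset.univ (fun i => (m' i (t i) + C' i) * |C i| + m i * C' i) (fun i => m i * m' i (t i)) (fun i => r i + s' i (t i))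
      (fun i => mul_nonneg (h1 i) (g1 i _)) (fun i => Nat.add_le_add (h2 i) (g2 i _))
    obtain ⟨D, d1, d2, d3⟩ := nice_disj (fun t : ∀ i, I' i => Nice.forall fun i => g3 i (t i))
    refine ⟨∀ i, I' i, inferInstance, fun t K _ _ w => D t K w ∧ Q ≤ card K, C2, m2, r2, Q + ∑ i, Q' i, k1, k2, ?_, ?_, ?_⟩
    · exact fun t => (d1 t).congr Q fun K _ _ w hq => by simp [hq]
    · intro K _ _ w hq
      have hQ : Q ≤ card K := by omega
      simp only [hQ, and_true]
      refine d3 K w ?_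
      have : ∀ i, ∃ t, B' i t K w := fun i => g4 i K w (by
        have := Finset.single_le_sum (f := Q') (fun _ _ => Nat.zero_le _) (Finset.mem_univ i)
        omega)
      choose t ht using this
      exact ⟨t, ht⟩
    · rintro t K _ _ w ⟨hD, hQ⟩
      have hB := d2 t K w hD
      have hq1 : 1 ≤ card K := Fintype.card_pos
      choose j hj hju using fun u : K => h4 K (oc u w) hQ
      rw [cntN_succ, ← Finset.sum_fiberwise Finset.univ j]
      refine k3 t _ _ hq1 fun i => ?_
      refine Ev.mul hq1 (h1 i) _ _ (abs_nonneg _) ?_ fun u hu => ?_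
      · have : (Finset.univ.filter fun u => j u = i).card = cnt (B i) K w := by
          unfold cnt
          rw [Nat.card_eq_fintype_card, Fintype.card_subtype]
          congr 1
          ext u
          simp only [Finset.mem_filter, Finset.mem_univ, true_and]
          exact ⟨fun hu => hu ▸ hj u, fun hu => (hju u i hu).symm⟩
        rw [this]
        exact g5 i (t i) K w (hB i)
      · have hu' : j u = i := (Finset.mem_filter.1 hu).2
        have := h5 i K (oc u w) (hu' ▸ hj u)
        rwa [abs_of_nonneg (this.nonneg hq1)]
end CDM

namespace CDM

theorem Df.card_le {V : Type} (Q : ℕ) : Df (V := V) (fun K _ _ _ => Q ≤ card K) := by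
  have h : Df (V := V) (fun K _ _ w => ∃ u : Fin Q → K, ∀ a : {a : Fin Q × Fin Q // a.1 ≠ a.2},
      ¬ MvPolynomial.aeval (Sum.elim w u) (MvPolynomial.X (Sum.inr a.1.1) - MvPolynomial.X (Sum.inr a.1.2) : MvPolynomial (V ⊕ Fin Q) ℤ) = 0) :=
    (Df.forall fun a => (Df.atom _).not).ex
  refine h.congr fun K _ _ w => ?_
  simp only [map_sub, MvPolynomial.aeval_X, Sum.elim_inr, sub_eq_zero]
  constructor
  · rintro ⟨u, hu⟩
    have := Fintype.card_le_of_injective u fun a b hab => by_contra fun hne => hu ⟨(a, b), hne⟩ hab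
    simpa using this
  · intro hq
    obtain ⟨e⟩ := Function.Embedding.nonempty_of_card_le (α := Fin Q) (β := K) (by simpa using hq)
    exact ⟨e, fun a h => a.2 (e.injective h)⟩

theorem small_bound {N q Q n : ℕ} (hq : 1 ≤ q) (hQ : q ≤ Q) (hN : N ≤ q ^ n) :
    |(N : ℝ) - (1 : ℚ) * (q : ℝ) ^ 0| ≤ (((Q ^ n + 1) * Q : ℕ) + 1 : ℚ) * (q : ℝ) ^ 0 / √q := by
  have h1 : (1 : ℝ) ≤ q := by exact_mod_cast hq
  have h2 : √(q : ℝ) ≤ Q := (Real.sqrt_le_left (by positivity) |>.2 (by nlinarith)).trans (show (q : ℝ) ≤ Q by exact_mod_cast hQ)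
  have h3 : (N : ℝ) ≤ (Q : ℝ) ^ n := by exact_mod_cast hN.trans (Nat.pow_le_pow_left hQ n)
  have h4 : |(N : ℝ) - 1| ≤ (Q : ℝ) ^ n + 1 := by
    rw [abs_le]
    have : (0 : ℝ) ≤ N := by positivity
    constructor <;> linarith
  push_cast
  rw [pow_zero, one_mul, mul_one, le_div_iff₀ (by positivity)]
  have h5 : |(N : ℝ) - 1| * √q ≤ ((Q : ℝ) ^ n + 1) * Q := mul_le_mul h4 h2 (by positivity) (by positivity)
  linarith

theorem final {V : Type} {n : ℕ} {ψ : Fam (V ⊕ Fin n)} (h : Nice ψ) : ∃ (I : Type) (_ : Fintype I) (φ : I → Fam V) (μ ε : I → ℚ) (r : I → ℕ),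
    (∀ i, Df (φ i)) ∧ (∀ i, 0 < μ i) ∧ (∀ i, 0 < ε i) ∧ (∀ i, r i ≤ n) ∧ ∀ (K : Type) [Field K] [Fintype K] (w : V → K), (∃! i, φ i K w) ∧
      ∀ i, φ i K w → (cntN ψ K w = 0 ∨ |(cntN ψ K w : ℝ) - (μ i : ℝ) * (card K : ℝ) ^ (r i)| ≤
        (ε i : ℝ) * (card K : ℝ) ^ (r i) / Real.sqrt (card K)) := by
  classical
  obtain ⟨I, _, B, C, m, r, Q, h1, h2, h3, h4, h5⟩ := countN n h
  choose Q' φ' g1 g2 using fun i => (h3 i).df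
  choose ε hε using fun i => exists_rat_gt (max (C i) 0)
  set T := Q + ∑ i, Q' i with hT
  have hφ : ∀ i (K : Type) [Field K] [Fintype K] (w : V → K), T ≤ card K → (φ' i K w ↔ B i K w) := fun i K _ _ w hq => g2 i K w (by
    have := Finset.single_le_sum (f := Q') (fun _ _ => Nat.zero_le _) (Finset.mem_univ i)
    omega)
  refine ⟨Option I, inferInstance, fun o K _ _ w => o.elim (¬ T ≤ card K) fun i => T ≤ card K ∧ φ' i K w,
    fun o => o.elim 1 fun i => if m i = 0 then 1 else m i, fun o => o.elim (((T ^ n + 1) * T : ℕ) + 1) ε, fun o => o.elim 0 r, ?_, ?_, ?_, ?_, ?_⟩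
  · rintro (_ | i)
    · exact (Df.card_le T).not
    · exact (Df.card_le T).and (g1 i)
  · rintro (_ | i)
    · exact one_pos
    · change 0 < if m i = 0 then 1 else m i
      split_ifs with hm
      · exact one_pos
      · exact lt_of_le_of_ne (h1 i) (Ne.symm hm)
  · rintro (_ | i)
    · change (0 : ℚ) < (((T ^ n + 1) * T : ℕ) : ℚ) + 1
      positivity
    · exact_mod_cast (le_max_right _ _).trans_lt (hε i)
  · rintro (_ | i)
    · exact Nat.zero_le _
    · exact h2 i
  · intro K _ _ w
    by_cases hq : T ≤ card K
    · obtain ⟨i, hi, hu⟩ := h4 K w (by omega)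
      refine ⟨⟨some i, ⟨hq, (hφ i K w hq).2 hi⟩, ?_⟩, ?_⟩
      · rintro (_ | k) hk
        · exact absurd hq hk
        · rw [hu k ((hφ k K w hq).1 hk.2)]
      · rintro (_ | k) hk
        · exact absurd hq hk
        · have hE := h5 k K w ((hφ k K w hq).1 hk.2)
          by_cases hm : m k = 0
          · exact Or.inl (hE.2 hm)
          · right
            change |(cntN ψ K w : ℝ) - ((if m k = 0 then 1 else m k : ℚ) : ℝ) * (card K : ℝ) ^ (r k)| ≤ (ε k : ℝ) * (card K : ℝ) ^ (r k) / _
            rw [if_neg hm]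
            refine hE.1.trans ?_
            have := (le_max_left _ _).trans (hε k).le
            gcongr
    · refine ⟨⟨none, hq, ?_⟩, ?_⟩
      · rintro (_ | k) hk
        · rfl
        · exact absurd hk.1 hq
      · rintro (_ | k) hk
        · right
          refine small_bound (n := n) (Nat.one_le_iff_ne_zero.2 Fintype.card_ne_zero) (by omega) ?_
          refine (Nat.card_le_card_of_injective (fun a : {a : Fin n → K // ψ K (Sum.elim w a)} => a.1) Subtype.val_injective).trans ?_
          simp [Nat.card_eq_fintype_card]
        · exact absurd hk.1 hq
end CDM
end

open FirstOrder

attribute [local instance] FirstOrder.Ring.compatibleRingOfRing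

/-- Theorem 3.7 (Chatzidakis–van den Dries–Macintyre, non-effective version): for every
formula `θ(x₁,…,xₙ,y₁,…,yₘ)` in the language of rings there is a finite family
`(θᵢ, μᵢ, εᵢ, rᵢ)` such that for every finite field `K` with `q` elements and every
`b ∈ Kᵐ`, exactly one `θᵢ` holds of `b` in `K`, and for this `i` the number `N_q(b)` of
solutions `a ∈ Kⁿ` of `θ(a, b)` is either zero or satisfies
`|N_q(b) − μᵢ q^{rᵢ}| ≤ εᵢ q^{rᵢ}/√q`. -/
theorem stmt_7 (n m : ℕ) (θ : Language.ring.Formula (Fin n ⊕ Fin m)) :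
    ∃ (I : Type) (_ : Fintype I) (θi : I → Language.ring.Formula (Fin m))
      (μ ε : I → ℚ) (r : I → ℕ),
      (∀ i, 0 < μ i) ∧ (∀ i, 0 < ε i) ∧ (∀ i, r i ≤ n) ∧
      ∀ (K : Type) [Field K] [Fintype K] (b : Fin m → K),
        (∃! i : I, (θi i).Realize b) ∧
        ∀ i : I, (θi i).Realize b →
          (Nat.card {a : Fin n → K // θ.Realize (Sum.elim a b)} = 0 ∨
            |(Nat.card {a : Fin n → K // θ.Realize (Sum.elim a b)} : ℝ) -
                (μ i : ℝ) * (Fintype.card K : ℝ) ^ (r i)| ≤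
              (ε i : ℝ) * (Fintype.card K : ℝ) ^ (r i) / Real.sqrt (Fintype.card K)) := by
  have h : CDM.Nice (V := Fin m ⊕ Fin n) (fun _ _ _ w => θ.Realize (fun v => w v.swap)) :=
    ((CDM.formula_nice θ).subst (V' := Fin m ⊕ Fin n) (fun v => MvPolynomial.X v.swap)).congr 0 fun K _ _ w _ => by
      simp only [MvPolynomial.aeval_X]
  obtain ⟨I, hI, φ, μ, ε, r, h1, h2, h3, h4, h5⟩ := CDM.final h
  choose F hF using h1
  refine ⟨I, hI, F, μ, ε, r, h2, h3, h4, fun K _ _ b => ?_⟩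
  have hc : CDM.cntN (V := Fin m) (n := n) (fun _ _ _ w => θ.Realize (fun v => w v.swap)) K b = Nat.card {a : Fin n → K // θ.Realize (Sum.elim a b)} := by
    unfold CDM.cntN
    refine Nat.card_congr (Equiv.subtypeEquivRight fun a => ?_)
    have : (fun v : Fin n ⊕ Fin m => (Sum.elim b a : Fin m ⊕ Fin n → K) v.swap) = Sum.elim a b := by
      funext v; cases v <;> rfl
    exact iff_of_eq (congrArg (fun v => θ.Realize v) this)
  have h6 := h5 K b
  rw [hc] at h6
  simpa only [hF] using h6
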